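/- There exist finite sets 𝔄₁ and 𝔄₂ of lines in ℂℙ² together with a bijection φ : 𝔄₁ → 𝔄₂ such that: (1) for every subset S ⊆ 𝔄₁, the lines of S have a common point in ℂℙ² if and only if the lines of φ(S) have a common point (so 𝔄₁ and 𝔄₂ are lattice-isomorphic); (2) the complements M(𝔄₁) and M(𝔄₂) are homotopy equivalent; and (3) M(𝔄₁) and M(𝔄₂) are not homeomorphic. -/

import Mathlib

/- The complex projective plane `ℂℙ²`, with its quotient topology, and projective
lines given as zero loci of linear forms in the homogeneous coordinates. -/

open scoped LinearAlgebra.Projectivization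
open Projectivization

noncomputable section

abbrev CP2 := ℙ ℂ (Fin 3 → ℂ)

instance : TopologicalSpace CP2 :=
  inferInstanceAs (TopologicalSpace (Quotient (projectivizationSetoid ℂ (Fin 3 → ℂ))))

/-- The projective line `{[x:y:z] | a*x + b*y + c*z = 0}`.  (The zero locus of a linear
form is well defined on any representative, so we may use the representative `p.rep`.) -/
def projLine (a b c : ℂ) : Set CP2 :=
  {p | a * p.rep 0 + b * p.rep 1 + c * p.rep 2 = 0}

/-- `L` is a projective line: the zero locus of a nonzero linear form. -/
def IsProjLine (L : Set CP2) : Prop :=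
  ∃ a b c : ℂ, ¬(a = 0 ∧ b = 0 ∧ c = 0) ∧ L = projLine a b c

section

open unitInterval

/-! ### Cocycles on paths and their gluing -/

section PathCocycle

variable {X : Type*} [TopologicalSpace X]

/-- The map `t ↦ t / 2` of the unit interval. -/
def halfL : C(I, I) :=
  ⟨fun t => ⟨t / 2, by constructor <;> linarith [t.2.1, t.2.2]⟩, by fun_prop⟩

/-- The map `t ↦ (1 + t) / 2` of the unit interval. -/
def halfR : C(I, I) :=
  ⟨fun t => ⟨(1 + t) / 2, by constructor <;> linarith [t.2.1, t.2.2]⟩, by fun_prop⟩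

@[simp] lemma halfL_zero : halfL 0 = 0 := by ext; simp [halfL]
@[simp] lemma halfR_one : halfR 1 = 1 := by ext; simp [halfR]
lemma halfL_one : halfL 1 = halfR 0 := by ext; simp [halfL, halfR]
lemma coe_halfL (t : I) : (halfL t : ℝ) = t / 2 := rfl
lemma coe_halfR (t : I) : (halfR t : ℝ) = (1 + t) / 2 := rfl

def sqBot (K : C(I × I, X)) : C(I, X) := ⟨fun t => K (t, 0), by fun_prop⟩
def sqTop (K : C(I × I, X)) : C(I, X) := ⟨fun t => K (t, 1), by fun_prop⟩
def sqLeft (K : C(I × I, X)) : C(I, X) := ⟨fun s => K (0, s), by fun_prop⟩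
def sqRight (K : C(I × I, X)) : C(I, X) := ⟨fun s => K (1, s), by fun_prop⟩

/-- A function on paths that, on paths and squares inside `S`, is multiplicative under halving a
path and takes the same value on both ways round a square. -/
structure IsCocycle {G : Type*} [Monoid G] (S : Set X) (Φ : C(I, X) → G) : Prop where
  half : ∀ γ : C(I, X), (∀ t, γ t ∈ S) → Φ γ = Φ (γ.comp halfL) * Φ (γ.comp halfR)
  sq : ∀ K : C(I × I, X), (∀ p, K p ∈ S) → Φ (sqBot K) * Φ (sqRight K) = Φ (sqLeft K) * Φ (sqTop K)

variable {G : Type*} [Monoid G]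

lemma IsCocycle.mono {S S' : Set X} {Φ : C(I, X) → G} (h : IsCocycle S' Φ) (hS : S ⊆ S') :
    IsCocycle S Φ :=
  ⟨fun γ hγ => h.half γ fun t => hS (hγ t), fun K hK => h.sq K fun p => hS (hK p)⟩

namespace Glue

/-- Iterated product over the dyadic subdivision of a path. -/
def subdiv (f : C(I, X) → G) : ℕ → C(I, X) → G
  | 0 => f
  | n + 1 => fun γ => subdiv f n (γ.comp halfL) * subdiv f n (γ.comp halfR)

variable {ι : Type*} (U : ι → Set X)

def Fine : ℕ → C(I, X) → Prop
  | 0 => fun γ => ∃ i, ∀ t, γ t ∈ U i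
  | n + 1 => fun γ => Fine n (γ.comp halfL) ∧ Fine n (γ.comp halfR)

def FineSq : ℕ → C(I × I, X) → Prop
  | 0 => fun K => ∃ i, ∀ p, K p ∈ U i
  | n + 1 => fun K => FineSq n (K.comp (halfL.prodMap halfL)) ∧
      FineSq n (K.comp (halfR.prodMap halfL)) ∧ FineSq n (K.comp (halfL.prodMap halfR)) ∧
      FineSq n (K.comp (halfR.prodMap halfR))

variable {U}

lemma Fine.succ {n : ℕ} : ∀ {γ : C(I, X)}, Fine U n γ → Fine U (n + 1) γ := by
  induction n with
  | zero =>
    rintro γ ⟨i, hi⟩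
    exact ⟨⟨i, fun t => hi _⟩, ⟨i, fun t => hi _⟩⟩
  | succ n ih =>
    intro γ h
    exact ⟨ih h.1, ih h.2⟩

lemma dist_halfL (x y : I) : dist (halfL x) (halfL y) = dist x y / 2 := by
  rw [Subtype.dist_eq, Subtype.dist_eq, Real.dist_eq, Real.dist_eq, coe_halfL, coe_halfL,
    ← sub_div, abs_div, abs_two]

lemma dist_halfR (x y : I) : dist (halfR x) (halfR y) = dist x y / 2 := by
  rw [Subtype.dist_eq, Subtype.dist_eq, Real.dist_eq, Real.dist_eq, coe_halfR, coe_halfR,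
    ← sub_div, abs_div, abs_two]
  congr 2
  ring

lemma fine_of_leb (n : ℕ) : ∀ (γ : C(I, X)) (δ : ℝ), 1 < 2 ^ n * δ →
    (∀ x, ∃ i, ∀ y, dist x y < δ → γ y ∈ U i) → Fine U n γ := by
  induction n with
  | zero =>
    intro γ δ hδ h
    obtain ⟨i, hi⟩ := h 0
    refine ⟨i, fun t => hi t (lt_of_le_of_lt ?_ (by simpa using hδ))⟩
    rw [Subtype.dist_eq, Real.dist_eq, abs_le]
    constructor <;> simp <;> linarith [t.2.1, t.2.2]
  | succ n ih =>
    intro γ δ hδ h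
    have hδ' : 1 < 2 ^ n * (2 * δ) := by rw [pow_succ] at hδ; linarith
    constructor
    · refine ih _ (2 * δ) hδ' fun x => ?_
      obtain ⟨i, hi⟩ := h (halfL x)
      exact ⟨i, fun y hy => hi _ (by rw [dist_halfL]; linarith)⟩
    · refine ih _ (2 * δ) hδ' fun x => ?_
      obtain ⟨i, hi⟩ := h (halfR x)
      exact ⟨i, fun y hy => hi _ (by rw [dist_halfR]; linarith)⟩

lemma fineSq_of_leb (n : ℕ) : ∀ (K : C(I × I, X)) (δ : ℝ), 1 < 2 ^ n * δ →
    (∀ x, ∃ i, ∀ y, dist x y < δ → K y ∈ U i) → FineSq U n K := by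
  induction n with
  | zero =>
    intro γ δ hδ h
    obtain ⟨i, hi⟩ := h 0
    refine ⟨i, fun t => hi t (lt_of_le_of_lt ?_ (by simpa using hδ))⟩
    rw [Prod.dist_eq, max_le_iff]
    constructor <;> rw [Subtype.dist_eq, Real.dist_eq, abs_le] <;> constructor <;> simp <;>
      linarith [t.1.2.1, t.1.2.2, t.2.2.1, t.2.2.2]
  | succ n ih =>
    intro γ δ hδ h
    have hδ' : 1 < 2 ^ n * (2 * δ) := by rw [pow_succ] at hδ; linarith
    have key : ∀ a b : C(I, I), (∀ x y, dist (a x) (a y) = dist x y / 2) →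
        (∀ x y, dist (b x) (b y) = dist x y / 2) → FineSq U n (γ.comp (a.prodMap b)) := by
      intro a b ha hb
      refine ih _ (2 * δ) hδ' fun x => ?_
      obtain ⟨i, hi⟩ := h (a x.1, b x.2)
      refine ⟨i, fun y hy => hi (a y.1, b y.2) ?_⟩
      rw [Prod.dist_eq, max_lt_iff] at hy ⊢
      simp only [ha, hb]
      constructor <;> linarith [hy.1, hy.2]
    exact ⟨key _ _ dist_halfL dist_halfL, key _ _ dist_halfR dist_halfL,
      key _ _ dist_halfL dist_halfR, key _ _ dist_halfR dist_halfR⟩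

lemma exists_leb {Y : Type*} [PseudoMetricSpace Y] [CompactSpace Y] (hU : ∀ i, IsOpen (U i))
    (f : C(Y, X)) (hf : ∀ y, f y ∈ ⋃ i, U i) :
    ∃ δ > 0, ∀ x, ∃ i, ∀ y, dist x y < δ → f y ∈ U i := by
  obtain ⟨δ, hδ, h⟩ := lebesgue_number_lemma_of_metric (c := fun i => f ⁻¹' U i) isCompact_univ
    (fun i => (hU i).preimage f.continuous) (fun y _ => by simpa using hf y)
  refine ⟨δ, hδ, fun x => ?_⟩
  obtain ⟨i, hi⟩ := h x trivial
  exact ⟨i, fun y hy => hi (by rwa [Metric.mem_ball, dist_comm])⟩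

lemma exists_pow {δ : ℝ} (hδ : 0 < δ) : ∃ n : ℕ, 1 < 2 ^ n * δ := by
  obtain ⟨n, hn⟩ := pow_unbounded_of_one_lt (1 / δ) (one_lt_two : (1 : ℝ) < 2)
  exact ⟨n, by rwa [div_lt_iff₀ hδ] at hn⟩

lemma exists_fine (hU : ∀ i, IsOpen (U i)) (γ : C(I, X)) (hγ : ∀ t, γ t ∈ ⋃ i, U i) :
    ∃ n, Fine U n γ := by
  obtain ⟨δ, hδ, h⟩ := exists_leb hU γ hγ
  obtain ⟨n, hn⟩ := exists_pow hδ
  exact ⟨n, fine_of_leb n γ δ hn h⟩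

lemma exists_fineSq (hU : ∀ i, IsOpen (U i)) (K : C(I × I, X)) (hK : ∀ t, K t ∈ ⋃ i, U i) :
    ∃ n, FineSq U n K := by
  obtain ⟨δ, hδ, h⟩ := exists_leb hU K hK
  obtain ⟨n, hn⟩ := exists_pow hδ
  exact ⟨n, fineSq_of_leb n K δ hn h⟩

/-- A half-additive function satisfying the square rule on the members of a cover satisfies it on
the union. -/
lemma sq_of_fineSq (Ψ : C(I, X) → G)
    (hhalf : ∀ γ : C(I, X), (∀ t, γ t ∈ ⋃ i, U i) → Ψ γ = Ψ (γ.comp halfL) * Ψ (γ.comp halfR))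
    (hsq : ∀ i, ∀ K : C(I × I, X), (∀ p, K p ∈ U i) →
      Ψ (sqBot K) * Ψ (sqRight K) = Ψ (sqLeft K) * Ψ (sqTop K)) (n : ℕ) :
    ∀ K : C(I × I, X), (∀ p, K p ∈ ⋃ i, U i) → FineSq U n K →
      Ψ (sqBot K) * Ψ (sqRight K) = Ψ (sqLeft K) * Ψ (sqTop K) := by
  induction n with
  | zero =>
    rintro K - ⟨i, hi⟩
    exact hsq i K hi
  | succ n ih =>
    rintro K hK ⟨h00, h10, h01, h11⟩
    have e00 := ih (K.comp (halfL.prodMap halfL)) (fun p => hK _) h00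
    have e10 := ih (K.comp (halfR.prodMap halfL)) (fun p => hK _) h10
    have e01 := ih (K.comp (halfL.prodMap halfR)) (fun p => hK _) h01
    have e11 := ih (K.comp (halfR.prodMap halfR)) (fun p => hK _) h11
    set K00 := K.comp (halfL.prodMap halfL) with hK00
    set K10 := K.comp (halfR.prodMap halfL) with hK10
    set K01 := K.comp (halfL.prodMap halfR) with hK01
    set K11 := K.comp (halfR.prodMap halfR) with hK11
    have b0 : (sqBot K).comp halfL = sqBot K00 := by ext t; simp [sqBot, K00]
    have b1 : (sqBot K).comp halfR = sqBot K10 := by ext t; simp [sqBot, K10]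
    have t0 : (sqTop K).comp halfL = sqTop K01 := by ext t; simp [sqTop, K01]
    have t1 : (sqTop K).comp halfR = sqTop K11 := by ext t; simp [sqTop, K11]
    have l0 : (sqLeft K).comp halfL = sqLeft K00 := by ext t; simp [sqLeft, K00]
    have l1 : (sqLeft K).comp halfR = sqLeft K01 := by ext t; simp [sqLeft, K01]
    have r0 : (sqRight K).comp halfL = sqRight K10 := by ext t; simp [sqRight, K10]
    have r1 : (sqRight K).comp halfR = sqRight K11 := by ext t; simp [sqRight, K11]
    have m1 : sqRight K00 = sqLeft K10 := by
      ext t; simp [sqRight, sqLeft, K00, K10, halfL_one]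
    have m2 : sqTop K00 = sqBot K01 := by ext t; simp [sqTop, sqBot, K00, K01, halfL_one]
    have m3 : sqRight K01 = sqLeft K11 := by ext t; simp [sqRight, sqLeft, K01, K11, halfL_one]
    have m4 : sqTop K10 = sqBot K11 := by ext t; simp [sqTop, sqBot, K10, K11, halfL_one]
    rw [hhalf (sqBot K) fun t => hK _, hhalf (sqTop K) fun t => hK _,
      hhalf (sqLeft K) fun t => hK _, hhalf (sqRight K) fun t => hK _,
      b0, b1, t0, t1, l0, l1, r0, r1]
    rw [m1, m2] at e00
    rw [m4] at e10
    rw [m3] at e01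
    calc Ψ (sqBot K00) * Ψ (sqBot K10) * (Ψ (sqRight K10) * Ψ (sqRight K11))
        = Ψ (sqBot K00) * (Ψ (sqBot K10) * Ψ (sqRight K10)) * Ψ (sqRight K11) := by
          simp only [mul_assoc]
      _ = (Ψ (sqBot K00) * Ψ (sqLeft K10)) * (Ψ (sqBot K11) * Ψ (sqRight K11)) := by
          rw [e10]; simp only [mul_assoc]
      _ = Ψ (sqLeft K00) * (Ψ (sqBot K01) * Ψ (sqLeft K11)) * Ψ (sqTop K11) := by
          rw [e00, e11]; simp only [mul_assoc]
      _ = _ := by rw [e01]; simp only [mul_assoc]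

end Glue

open Glue

/-- Cocycles on the members of an open cover that agree on common paths glue. -/
theorem IsCocycle.exists_glue {ι : Type*} {U : ι → Set X} (hU : ∀ i, IsOpen (U i))
    (Φ : ι → C(I, X) → G) (hΦ : ∀ i, IsCocycle (U i) (Φ i))
    (hag : ∀ i j γ, (∀ t, γ t ∈ U i) → (∀ t, γ t ∈ U j) → Φ i γ = Φ j γ) :
    ∃ Ψ : C(I, X) → G, IsCocycle (⋃ i, U i) Ψ ∧ ∀ i γ, (∀ t, γ t ∈ U i) → Ψ γ = Φ i γ := by
  classical
  let f : C(I, X) → G := fun γ => if h : ∃ i, ∀ t, γ t ∈ U i then Φ h.choose γ else 1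
  have hf : ∀ i γ, (∀ t, γ t ∈ U i) → f γ = Φ i γ := fun i γ h => by
    have h' : ∃ i, ∀ t, γ t ∈ U i := ⟨i, h⟩
    simp only [f, dif_pos h']
    exact hag _ _ _ h'.choose_spec h
  have hsucc : ∀ n γ, Fine U n γ → subdiv f (n + 1) γ = subdiv f n γ := by
    intro n
    induction n with
    | zero =>
      rintro γ ⟨i, hi⟩
      change f _ * f _ = f γ
      rw [hf i γ hi, hf i (γ.comp halfL) fun t => hi _, hf i (γ.comp halfR) fun t => hi _,
        (hΦ i).half γ hi]
    | succ n ih =>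
      intro γ h
      change subdiv f (n + 1) _ * subdiv f (n + 1) _ = subdiv f n _ * subdiv f n _
      rw [ih _ h.1, ih _ h.2]
  have hle : ∀ n m γ, Fine U n γ → Fine U (n + m) γ ∧ subdiv f (n + m) γ = subdiv f n γ := by
    intro n m γ h
    induction m with
    | zero => exact ⟨h, rfl⟩
    | succ m ih => exact ⟨ih.1.succ, (hsucc _ _ ih.1).trans ih.2⟩
  let Ψ : C(I, X) → G := fun γ => if h : ∃ n, Fine U n γ then subdiv f h.choose γ else 1
  have hΨ : ∀ n γ, Fine U n γ → Ψ γ = subdiv f n γ := by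
    intro n γ h
    have h' : ∃ n, Fine U n γ := ⟨n, h⟩
    simp only [Ψ, dif_pos h']
    rw [← (hle n h'.choose γ h).2, ← (hle _ n γ h'.choose_spec).2, add_comm]
  have hΨ0 : ∀ i γ, (∀ t, γ t ∈ U i) → Ψ γ = Φ i γ := fun i γ h =>
    (hΨ 0 γ ⟨i, h⟩).trans (hf i γ h)
  have hhalf : ∀ γ : C(I, X), (∀ t, γ t ∈ ⋃ i, U i) →
      Ψ γ = Ψ (γ.comp halfL) * Ψ (γ.comp halfR) := by
    intro γ hγ
    obtain ⟨n, hn⟩ := exists_fine hU γ hγ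
    rw [hΨ (n + 1) γ hn.succ, hΨ n _ hn.succ.1, hΨ n _ hn.succ.2]
    rfl
  refine ⟨Ψ, ⟨hhalf, fun K hK => ?_⟩, hΨ0⟩
  obtain ⟨n, hn⟩ := exists_fineSq hU K hK
  refine sq_of_fineSq Ψ hhalf (fun i K hK => ?_) n K hK hn
  rw [hΨ0 i (sqBot K) fun t => hK _, hΨ0 i (sqRight K) fun t => hK _,
    hΨ0 i (sqLeft K) fun t => hK _, hΨ0 i (sqTop K) fun t => hK _]
  exact (hΦ i).sq K hK

/-- Two cocycles that agree on paths inside the members of an open cover agree. -/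
theorem IsCocycle.eq_of_cover {ι : Type*} {U : ι → Set X} (hU : ∀ i, IsOpen (U i))
    {Φ Ψ : C(I, X) → G} (hΦ : IsCocycle (⋃ i, U i) Φ) (hΨ : IsCocycle (⋃ i, U i) Ψ)
    (hag : ∀ i γ, (∀ t, γ t ∈ U i) → Φ γ = Ψ γ) (γ : C(I, X)) (hγ : ∀ t, γ t ∈ ⋃ i, U i) :
    Φ γ = Ψ γ := by
  obtain ⟨n, hn⟩ := exists_fine hU γ hγ
  induction n generalizing γ with
  | zero => obtain ⟨i, hi⟩ := hn; exact hag i γ hi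
  | succ n ih =>
    rw [hΦ.half γ hγ, hΨ.half γ hγ, ih (γ.comp halfL) (fun t => hγ _) hn.1,
      ih (γ.comp halfR) (fun t => hγ _) hn.2]

end PathCocycle

/-! ### Crossed homomorphisms -/

section Crossed

variable {X : Type*} [TopologicalSpace X] {R : Type*} [CommRing R]

/-- Affine maps `x ↦ tr + lin * x` of a commutative ring, with composition as multiplication. -/
@[ext] structure Aff (R : Type*) where
  tr : R
  lin : R

instance : Monoid (Aff R) where
  mul a b := ⟨a.tr + a.lin * b.tr, a.lin * b.lin⟩
  one := ⟨0, 1⟩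
  mul_assoc a b c := by
    apply Aff.ext
    · change a.tr + a.lin * b.tr + a.lin * b.lin * c.tr = a.tr + a.lin * (b.tr + b.lin * c.tr)
      ring
    · exact mul_assoc _ _ _
  one_mul a := by
    apply Aff.ext
    · change 0 + 1 * a.tr = a.tr
      ring
    · exact one_mul _
  mul_one a := by
    apply Aff.ext
    · change a.tr + a.lin * 0 = a.tr
      ring
    · exact mul_one _

/-- `δ` is a crossed homomorphism on `S` for the character `ψ`. -/
structure IsCrossed (S : Set X) (ψ δ : C(I, X) → R) : Prop where
  half : ∀ γ : C(I, X), (∀ t, γ t ∈ S) →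
    δ γ = δ (γ.comp halfL) + ψ (γ.comp halfL) * δ (γ.comp halfR)
  sq : ∀ K : C(I × I, X), (∀ p, K p ∈ S) → δ (sqBot K) + ψ (sqBot K) * δ (sqRight K) =
    δ (sqLeft K) + ψ (sqLeft K) * δ (sqTop K)

lemma isCocycle_aff {S : Set X} {ψ δ : C(I, X) → R} (hψ : IsCocycle S ψ) :
    IsCocycle S (fun γ => (⟨δ γ, ψ γ⟩ : Aff R)) ↔ IsCrossed S ψ δ := by
  constructor
  · intro h
    exact ⟨fun γ hγ => congrArg Aff.tr (h.half γ hγ), fun K hK => congrArg Aff.tr (h.sq K hK)⟩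
  · intro h
    exact ⟨fun γ hγ => Aff.ext (h.half γ hγ) (hψ.half γ hγ),
      fun K hK => Aff.ext (h.sq K hK) (hψ.sq K hK)⟩

/-- The principal crossed homomorphism of a function on points. -/
def principal (ψ : C(I, X) → R) (m : X → R) : C(I, X) → R := fun γ => m (γ 0) - ψ γ * m (γ 1)

variable {S : Set X} {ψ δ δ' : C(I, X) → R}

lemma isCrossed_principal (hψ : IsCocycle S ψ) (m : X → R) : IsCrossed S ψ (principal ψ m) := by
  constructor
  · intro γ hγ
    simp only [principal, ContinuousMap.comp_apply, halfL_zero, halfR_one, halfL_one, hψ.half γ hγ]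
    ring
  · intro K hK
    have := hψ.sq K hK
    simp only [principal, sqBot, sqTop, sqLeft, sqRight, ContinuousMap.coe_mk] at this ⊢
    linear_combination (-m (K (1, 1))) * this

lemma IsCrossed.mono {S' : Set X} (h : IsCrossed S' ψ δ) (hS : S ⊆ S') : IsCrossed S ψ δ :=
  ⟨fun γ hγ => h.half γ fun t => hS (hγ t), fun K hK => h.sq K fun p => hS (hK p)⟩

lemma IsCrossed.add (h : IsCrossed S ψ δ) (h' : IsCrossed S ψ δ') :
    IsCrossed S ψ (fun γ => δ γ + δ' γ) :=
  ⟨fun γ hγ => by simp only [h.half γ hγ, h'.half γ hγ]; ring,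
    fun K hK => by linear_combination h.sq K hK + h'.sq K hK⟩

lemma IsCrossed.smul (h : IsCrossed S ψ δ) (c : R) : IsCrossed S ψ (fun γ => c * δ γ) :=
  ⟨fun γ hγ => by simp only [h.half γ hγ]; ring, fun K hK => by linear_combination c * h.sq K hK⟩

lemma IsCrossed.sub (h : IsCrossed S ψ δ) (h' : IsCrossed S ψ δ') :
    IsCrossed S ψ (fun γ => δ γ - δ' γ) :=
  ⟨fun γ hγ => by simp only [h.half γ hγ, h'.half γ hγ]; ring,
    fun K hK => by linear_combination h.sq K hK - h'.sq K hK⟩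

lemma IsCrossed.zero : IsCrossed S ψ (fun _ => 0) :=
  ⟨fun γ hγ => by simp, fun K hK => by simp⟩

lemma IsCrossed.sum {ι : Type*} {s : Finset ι} {D : ι → C(I, X) → R}
    (h : ∀ i ∈ s, IsCrossed S ψ (D i)) : IsCrossed S ψ (fun γ => ∑ i ∈ s, D i γ) := by
  classical
  induction s using Finset.induction_on with
  | empty => simpa using IsCrossed.zero
  | insert a s ha ih =>
    have := (h a (by simp)).add (ih fun i hi => h i (by simp [hi]))
    simpa only [Finset.sum_insert ha] using this

theorem IsCrossed.exists_glue {ι : Type*} {U : ι → Set X} (hU : ∀ i, IsOpen (U i))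
    (hψ : IsCocycle (⋃ i, U i) ψ) (D : ι → C(I, X) → R) (hD : ∀ i, IsCrossed (U i) ψ (D i))
    (hag : ∀ i j γ, (∀ t, γ t ∈ U i) → (∀ t, γ t ∈ U j) → D i γ = D j γ) :
    ∃ Δ : C(I, X) → R, IsCrossed (⋃ i, U i) ψ Δ ∧ ∀ i γ, (∀ t, γ t ∈ U i) → Δ γ = D i γ := by
  obtain ⟨Ψ, hΨ, hΨD⟩ := IsCocycle.exists_glue (G := Aff R) hU (fun i γ => ⟨D i γ, ψ γ⟩)
    (fun i => (isCocycle_aff (hψ.mono (Set.subset_iUnion U i))).2 (hD i))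
    (fun i j γ h h' => Aff.ext (hag i j γ h h') rfl)
  have hlin : ∀ γ, (∀ t, γ t ∈ ⋃ i, U i) → (Ψ γ).lin = ψ γ := by
    have h1 : IsCocycle (⋃ i, U i) (fun γ => (Ψ γ).lin) :=
      ⟨fun γ hγ => congrArg Aff.lin (hΨ.half γ hγ), fun K hK => congrArg Aff.lin (hΨ.sq K hK)⟩
    exact IsCocycle.eq_of_cover hU h1 hψ fun i γ h => congrArg Aff.lin (hΨD i γ h)
  refine ⟨fun γ => (Ψ γ).tr, ⟨fun γ hγ => ?_, fun K hK => ?_⟩,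
    fun i γ h => congrArg Aff.tr (hΨD i γ h)⟩
  · rw [← hlin (γ.comp halfL) fun t => hγ _]
    exact congrArg Aff.tr (hΨ.half γ hγ)
  · rw [← hlin (sqBot K) fun t => hK _, ← hlin (sqLeft K) fun t => hK _]
    exact congrArg Aff.tr (hΨ.sq K hK)

theorem IsCrossed.eq_of_cover {ι : Type*} {U : ι → Set X} (hU : ∀ i, IsOpen (U i))
    (h : IsCrossed (⋃ i, U i) ψ δ) (h' : IsCrossed (⋃ i, U i) ψ δ')
    (hag : ∀ i γ, (∀ t, γ t ∈ U i) → δ γ = δ' γ) (γ : C(I, X)) (hγ : ∀ t, γ t ∈ ⋃ i, U i) :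
    δ γ = δ' γ := by
  obtain ⟨n, hn⟩ := Glue.exists_fine hU γ hγ
  induction n generalizing γ with
  | zero => obtain ⟨i, hi⟩ := hn; exact hag i γ hi
  | succ n ih =>
    rw [h.half γ hγ, h'.half γ hγ, ih (γ.comp halfL) (fun t => hγ _) hn.1,
      ih (γ.comp halfR) (fun t => hγ _) hn.2]

end Crossed

/-! ### Change of angle along a path -/

section Angle

/-- Total change of the argument along a curve in `ℂ \ {0}`. -/
def ang (c : I → ℂ) : ℝ :=
  open Classical in
  if h : ∃ L : C(I, ℂ), ∀ t, Complex.exp (L t) = c t then (h.choose 1 - h.choose 0).im else 0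

lemma im_sub_eq_of_exp_eq {L L' : C(I, ℂ)} (h : ∀ t, Complex.exp (L t) = Complex.exp (L' t)) :
    L 1 - L 0 = L' 1 - L' 0 := by
  have key : ∀ t, ∃ n : ℤ, L t = L' t + n * (2 * Real.pi * Complex.I) := fun t =>
    Complex.exp_eq_exp_iff_exists_int.1 (h t)
  choose n hn using key
  have hc : Continuous fun t => ((n t : ℤ) : ℝ) := by
    have : (fun t => ((n t : ℤ) : ℝ)) = fun t => ((L t - L' t) / (2 * Real.pi * Complex.I)).re := by
      funext t
      have h2 : (2 * Real.pi * Complex.I : ℂ) ≠ 0 := by simp [Real.pi_ne_zero]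
      rw [hn t, add_sub_cancel_left, mul_div_cancel_right₀ _ h2]
      simp
    rw [this]
    fun_prop
  have hc' : Continuous n := by
    rw [Int.isClosedEmbedding_coe_real.isInducing.continuous_iff]; exact hc
  have : n 1 = n 0 := PreconnectedSpace.constant inferInstance hc'
  rw [hn 1, hn 0, this]
  ring

lemma ang_eq {c : I → ℂ} (L : C(I, ℂ)) (h : ∀ t, Complex.exp (L t) = c t) :
    ang c = (L 1 - L 0).im := by
  have h' : ∃ L : C(I, ℂ), ∀ t, Complex.exp (L t) = c t := ⟨L, h⟩
  rw [ang, dif_pos h']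
  congr 1
  exact im_sub_eq_of_exp_eq fun t => by rw [h'.choose_spec, h]

lemma exists_log_sq (K : C(I × I, ℂ)) (hK : ∀ p, K p ≠ 0) :
    ∃ L : C(I × I, ℂ), ∀ p, Complex.exp (L p) = K p := by
  let q : C(ℝ × ℝ, I × I) := ⟨fun p => (Set.projIcc 0 1 zero_le_one p.1,
    Set.projIcc 0 1 zero_le_one p.2), by
      have := continuous_projIcc (a := (0 : ℝ)) (b := 1) (h := zero_le_one)
      fun_prop⟩
  obtain ⟨L, ⟨-, hL⟩, -⟩ := Complex.isCoveringMapOn_exp.existsUnique_continuousMap_lifts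
    (K.comp q) (a₀ := (0, 0)) (Complex.exp_log (hK (q (0, 0)))) (fun x => hK _)
  refine ⟨⟨fun p => L (p.1, p.2), by fun_prop⟩, fun p => ?_⟩
  have := congrFun hL (p.1, p.2)
  simp only [Function.comp_apply, ContinuousMap.comp_apply] at this
  rw [ContinuousMap.coe_mk, this]
  congr 1
  simp [q]

lemma exists_log (c : C(I, ℂ)) (hc : ∀ p, c p ≠ 0) : ∃ L : C(I, ℂ), ∀ p, Complex.exp (L p) = c p := by
  obtain ⟨L, hL⟩ := exists_log_sq ⟨fun p => c p.1, by fun_prop⟩ fun p => hc _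
  exact ⟨⟨fun t => L (t, 0), by fun_prop⟩, fun t => hL (t, 0)⟩

lemma ang_mul (c c' : C(I, ℂ)) (hc : ∀ t, c t ≠ 0) (hc' : ∀ t, c' t ≠ 0) :
    ang (fun t => c t * c' t) = ang c + ang c' := by
  obtain ⟨L, hL⟩ := exists_log c hc
  obtain ⟨L', hL'⟩ := exists_log c' hc'
  rw [ang_eq L hL, ang_eq L' hL', ang_eq (L + L') fun t => by simp [Complex.exp_add, hL, hL']]
  simp
  ring

/-- If `A` is a continuous choice of argument along the curve then the change of angle is the
difference of `A`. -/
lemma ang_eq_of_arg (c : C(I, ℂ)) (hc : ∀ t, c t ≠ 0) (A : I → ℝ) (hA : Continuous A)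
    (h : ∀ t, c t = ‖c t‖ * Complex.exp (A t * Complex.I)) : ang c = A 1 - A 0 := by
  have hn : ∀ t, ‖c t‖ ≠ 0 := fun t => norm_ne_zero_iff.2 (hc t)
  have hl : Continuous fun t => Real.log ‖c t‖ := Continuous.log (by fun_prop) hn
  rw [ang_eq ⟨fun t => (Real.log ‖c t‖ : ℝ) + A t * Complex.I, by fun_prop⟩]
  · simp
  · intro t
    rw [ContinuousMap.coe_mk, Complex.exp_add, ← Complex.ofReal_exp,
      Real.exp_log (norm_pos_iff.2 (hc t)), ← h t]

variable {X : Type*} [TopologicalSpace X]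

/-- The change of the argument of `f` along a path. -/
def Theta (f : X → ℂ) (γ : C(I, X)) : ℝ := ang (fun t => f (γ t))

lemma isCrossed_Theta {S : Set X} {f : X → ℂ} (hf : ContinuousOn f S) (h0 : ∀ x ∈ S, f x ≠ 0) :
    IsCrossed S (fun _ => (1 : ℝ)) (Theta f) := by
  constructor
  · intro γ hγ
    obtain ⟨L, hL⟩ := exists_log ⟨fun t => f (γ t), hf.comp_continuous γ.continuous hγ⟩
      fun t => h0 _ (hγ t)
    have h1 : Theta f γ = (L 1 - L 0).im := ang_eq L hL
    have h2 : Theta f (γ.comp halfL) = ((L.comp halfL) 1 - (L.comp halfL) 0).im :=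
      ang_eq (L.comp halfL) fun t => hL _
    have h3 : Theta f (γ.comp halfR) = ((L.comp halfR) 1 - (L.comp halfR) 0).im :=
      ang_eq (L.comp halfR) fun t => hL _
    rw [h1, h2, h3]
    simp [halfL_one]
  · intro K hK
    obtain ⟨L, hL⟩ := exists_log_sq ⟨fun t => f (K t), hf.comp_continuous K.continuous hK⟩
      fun t => h0 _ (hK t)
    have h1 : Theta f (sqBot K) = ((sqBot L) 1 - (sqBot L) 0).im := ang_eq _ fun t => hL _
    have h2 : Theta f (sqTop K) = ((sqTop L) 1 - (sqTop L) 0).im := ang_eq _ fun t => hL _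
    have h3 : Theta f (sqLeft K) = ((sqLeft L) 1 - (sqLeft L) 0).im := ang_eq _ fun t => hL _
    have h4 : Theta f (sqRight K) = ((sqRight L) 1 - (sqRight L) 0).im := ang_eq _ fun t => hL _
    rw [h1, h2, h3, h4]
    simp [sqBot, sqTop, sqLeft, sqRight]

end Angle

end

section

open unitInterval

/-! ### Real linear forms on `ℂ³` -/

abbrev E3 := Fin 3 → ℂ

/-- The determinant of three vectors. -/
def det3 {R : Type*} [CommRing R] (a b c : Fin 3 → R) : R :=
  a 0 * (b 1 * c 2 - b 2 * c 1) - a 1 * (b 0 * c 2 - b 2 * c 0) + a 2 * (b 0 * c 1 - b 1 * c 0)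

/-- The complex linear form with real coefficients `a`. -/
def lf (a : Fin 3 → ℝ) : E3 →L[ℂ] ℂ := ∑ k, (a k : ℂ) • ContinuousLinearMap.proj k

lemma lf_apply (a : Fin 3 → ℝ) (x : E3) : lf a x = a 0 * x 0 + a 1 * x 1 + a 2 * x 2 := by
  simp [lf, Fin.sum_univ_three]

/-- The vector dual to `a` in the basis dual to `a, b, c`. -/
def dv (a b c : Fin 3 → ℝ) : E3 :=
  ![((b 1 * c 2 - b 2 * c 1) / det3 a b c : ℝ), ((b 2 * c 0 - b 0 * c 2) / det3 a b c : ℝ),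
    ((b 0 * c 1 - b 1 * c 0) / det3 a b c : ℝ)]

lemma lf_dv (a b c d : Fin 3 → ℝ) : lf d (dv a b c) = (det3 d b c / det3 a b c : ℝ) := by
  simp only [lf_apply, dv, Matrix.cons_val_zero, Matrix.cons_val_one, Matrix.cons_val_two,
    Matrix.head_cons, Matrix.tail_cons, ← Complex.ofReal_mul, ← Complex.ofReal_add]
  congr 1
  simp only [det3]
  ring

lemma det3_cramer (a b c d : Fin 3 → ℝ) (k : Fin 3) :
    det3 a b c * d k = det3 d b c * a k + det3 a d c * b k + det3 a b d * c k := by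
  fin_cases k <;> simp [det3] <;> ring

lemma lf_cramer {a b c : Fin 3 → ℝ} (h : det3 a b c ≠ 0) (d : Fin 3 → ℝ) (x : E3) :
    lf d x = (det3 d b c / det3 a b c : ℝ) * lf a x + (det3 a d c / det3 a b c : ℝ) * lf b x +
      (det3 a b d / det3 a b c : ℝ) * lf c x := by
  have h' : ((det3 a b c : ℝ) : ℂ) ≠ 0 := by exact_mod_cast h
  have hk : ∀ k, ((det3 a b c : ℝ) : ℂ) * d k = det3 d b c * a k + det3 a d c * b k +
      det3 a b d * c k := fun k => by exact_mod_cast det3_cramer a b c d k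
  simp only [lf_apply, Complex.ofReal_div]
  field_simp
  linear_combination x 0 * hk 0 + x 1 * hk 1 + x 2 * hk 2

lemma det3_rot {R : Type*} [CommRing R] (a b c : Fin 3 → R) : det3 b c a = det3 a b c := by
  simp only [det3]; ring

lemma det3_swap {R : Type*} [CommRing R] (a b c : Fin 3 → R) : det3 b a c = -det3 a b c := by
  simp only [det3]; ring

lemma det3_self {R : Type*} [CommRing R] (a c : Fin 3 → R) : det3 a a c = 0 := by
  simp only [det3]; ring

/-- Every vector is recovered from its three coordinates. -/
lemma eq_sum_dv {a b c : Fin 3 → ℝ} (h : det3 a b c ≠ 0) (x : E3) :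
    x = lf a x • dv a b c + lf b x • dv b c a + lf c x • dv c a b := by
  have h' : ((det3 a b c : ℝ) : ℂ) ≠ 0 := by exact_mod_cast h
  have h1 : det3 b c a = det3 a b c := det3_rot a b c
  have h2 : det3 c a b = det3 a b c := by rw [det3_rot b c a, h1]
  have hd : ((det3 a b c : ℝ) : ℂ) = a 0 * (b 1 * c 2 - b 2 * c 1) - a 1 * (b 0 * c 2 - b 2 * c 0) +
      a 2 * (b 0 * c 1 - b 1 * c 0) := by simp [det3]
  ext k
  fin_cases k <;>
  · simp only [dv, lf_apply, Fin.zero_eta, Fin.mk_one, Fin.reduceFinMk, Pi.add_apply, Pi.smul_apply,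
      smul_eq_mul, h1, h2, Matrix.cons_val_zero, Matrix.cons_val_one, Matrix.cons_val_two,
      Matrix.head_cons, Matrix.tail_cons, Complex.ofReal_div, Complex.ofReal_sub,
      Complex.ofReal_mul]
    field_simp
    rw [hd]
    ring

/-! ### Arrangements whose points have multiplicity at most three -/

/-- A real line arrangement with at most triple points, together with its set of triple points. -/
structure Arr (ι : Type*) [Fintype ι] [DecidableEq ι] where
  l : ι → Fin 3 → ℝ
  T : Finset (Finset ι)
  card_T : ∀ p ∈ T, p.card = 3
  inter : ∀ p ∈ T, ∀ q ∈ T, p ≠ q → (p ∩ q).card ≤ 1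
  det : ∀ i j k, i ≠ j → j ≠ k → i ≠ k → (det3 (l i) (l j) (l k) = 0 ↔ {i, j, k} ∈ T)
  card : 6 ≤ Fintype.card ι

namespace Arr

variable {ι : Type*} [Fintype ι] [DecidableEq ι] (A : Arr ι)

def f (i : ι) : E3 →L[ℂ] ℂ := lf (A.l i)

/-- The complement of the arrangement in `ℂ³`. -/
def M : Set E3 := {x | ∀ i, A.f i x ≠ 0}

def d (i j k : ι) : ℝ := det3 (A.l i) (A.l j) (A.l k)

lemma d_rot (i j k : ι) : A.d j k i = A.d i j k := det3_rot _ _ _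
lemma d_swap (i j k : ι) : A.d j i k = -A.d i j k := det3_swap _ _ _
lemma d_self (i k : ι) : A.d i i k = 0 := det3_self _ _
lemma d_self_right (i k : ι) : A.d i k k = 0 := by rw [← d_rot, d_self]
lemma d_self_out (i k : ι) : A.d i k i = 0 := by rw [d_rot, d_self]

def D (i j k : ι) : E3 := dv (A.l i) (A.l j) (A.l k)

lemma f_D (i j k m : ι) : A.f m (A.D i j k) = (A.d m j k / A.d i j k : ℝ) := lf_dv _ _ _ _

lemma f_cramer {a b c : ι} (h : A.d a b c ≠ 0) (m : ι) (x : E3) :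
    A.f m x = (A.d m b c / A.d a b c : ℝ) * A.f a x + (A.d a m c / A.d a b c : ℝ) * A.f b x +
      (A.d a b m / A.d a b c : ℝ) * A.f c x := lf_cramer h _ x

lemma eq_sum_D {a b c : ι} (h : A.d a b c ≠ 0) (x : E3) :
    x = A.f a x • A.D a b c + A.f b x • A.D b c a + A.f c x • A.D c a b := eq_sum_dv h x

lemma exists_K : ∃ K : ℝ, 1 ≤ K ∧ (∀ i j k i' j' k', |A.d i j k / A.d i' j' k'| ≤ K) ∧
    ∀ i j k, ‖A.D i j k‖ ≤ K := by
  let g : (ι × ι × ι) × ι × ι × ι → ℝ := fun q =>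
    |A.d q.1.1 q.1.2.1 q.1.2.2 / A.d q.2.1 q.2.2.1 q.2.2.2|
  let g' : ι × ι × ι → ℝ := fun q => ‖A.D q.1 q.2.1 q.2.2‖
  have h1 : 0 ≤ ∑ q, g q := Finset.sum_nonneg fun _ _ => abs_nonneg _
  have h2 : 0 ≤ ∑ q, g' q := Finset.sum_nonneg fun _ _ => norm_nonneg _
  refine ⟨1 + ∑ q, g q + ∑ q, g' q, by linarith, fun i j k i' j' k' => ?_, fun i j k => ?_⟩
  · have := Finset.single_le_sum (f := g) (fun _ _ => abs_nonneg _)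
      (Finset.mem_univ ((i, j, k), i', j', k'))
    change |A.d i j k / A.d i' j' k'| ≤ _ at this
    linarith
  · have := Finset.single_le_sum (f := g') (fun _ _ => norm_nonneg _) (Finset.mem_univ (i, j, k))
    change ‖A.D i j k‖ ≤ _ at this
    linarith

/-- A constant bounding all coefficients that occur. -/
def K : ℝ := A.exists_K.choose
lemma one_le_K : 1 ≤ A.K := A.exists_K.choose_spec.1
lemma ratio_le (i j k i' j' k' : ι) : |A.d i j k / A.d i' j' k'| ≤ A.K :=
  A.exists_K.choose_spec.2.1 i j k i' j' k'
lemma norm_D_le (i j k : ι) : ‖A.D i j k‖ ≤ A.K := A.exists_K.choose_spec.2.2 i j k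

lemma ratio_ge {i j k i' j' k' : ι} (h : A.d i j k ≠ 0) (h' : A.d i' j' k' ≠ 0) :
    A.K⁻¹ ≤ |A.d i j k / A.d i' j' k'| := by
  have := A.ratio_le i' j' k' i j k
  rw [← inv_div, abs_inv]
  exact inv_anti₀ (abs_pos.2 (div_ne_zero h' h)) this

lemma isOpen_M : IsOpen A.M := by
  simp only [M, Set.ofPred_forall]
  exact isOpen_iInter_of_finite fun i => isOpen_ne_fun (A.f i).continuous continuous_const

/-! Flats -/

/-- Sets of indices of lines, of triple points and of double points. -/
def IsFlat (s : Finset ι) : Prop :=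
  (∃ i, s = {i}) ∨ s ∈ A.T ∨ ∃ i j, i ≠ j ∧ s = {i, j} ∧ ∀ p ∈ A.T, ¬ s ⊆ p

variable {A}

lemma isFlat_single (i : ι) : A.IsFlat {i} := Or.inl ⟨i, rfl⟩

lemma IsFlat.nonempty {s : Finset ι} (h : A.IsFlat s) : s.Nonempty := by
  rcases h with ⟨i, rfl⟩ | h | ⟨i, j, -, rfl, -⟩
  · simp
  · rw [← Finset.card_pos, A.card_T s h]; norm_num
  · simp

lemma T_eq {p q : Finset ι} (hp : p ∈ A.T) (hq : q ∈ A.T) {i j : ι} (hij : i ≠ j) (h1 : i ∈ p)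
    (h2 : j ∈ p) (h3 : i ∈ q) (h4 : j ∈ q) : p = q := by
  by_contra hne
  have h := A.inter p hp q hq hne
  have : ({i, j} : Finset ι) ⊆ p ∩ q := by
    intro x hx; simp at hx; rcases hx with rfl | rfl <;> simp [*]
  have := Finset.card_le_card this
  rw [Finset.card_pair hij] at this
  omega

lemma IsFlat.d_eq_zero_iff {s : Finset ι} (h : A.IsFlat s) {i j : ι} (hi : i ∈ s) (hj : j ∈ s)
    (hij : i ≠ j) (k : ι) : A.d i j k = 0 ↔ k ∈ s := by
  by_cases hki : k = i
  · subst hki; simp [d_self_out, hi]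
  by_cases hkj : k = j
  · subst hkj; simp [d_self_right, hj]
  rw [d, A.det i j k hij (Ne.symm hkj) (Ne.symm hki)]
  rcases h with ⟨m, rfl⟩ | h | ⟨a, b, hab, rfl, hn⟩
  · simp at hi hj; exact absurd (hi.trans hj.symm) hij
  · constructor
    · intro hT
      rw [T_eq h hT hij hi hj (by simp) (by simp)]; simp
    · intro hk
      have : ({i, j, k} : Finset ι) = s := by
        apply Finset.eq_of_subset_of_card_le
        · intro x hx; simp at hx; rcases hx with rfl | rfl | rfl <;> assumption
        · rw [A.card_T s h, Finset.card_eq_three.2 ⟨i, j, k, hij, Ne.symm hki, Ne.symm hkj, rfl⟩]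
      rwa [this]
  · constructor
    · intro hT
      exfalso
      refine hn _ hT ?_
      intro x hx
      simp at hx hi hj ⊢
      rcases hx with rfl | rfl <;> rcases hi with rfl | rfl <;> rcases hj with rfl | rfl <;> simp_all
    · intro hk
      simp at hk hi hj
      rcases hk with rfl | rfl <;> rcases hi with rfl | rfl <;> rcases hj with rfl | rfl <;> simp_all

lemma IsFlat.eq_or_single {s s' : Finset ι} (h : A.IsFlat s) (h' : A.IsFlat s') (hs : s ⊆ s') :
    s = s' ∨ ∃ i, s = {i} := by
  by_cases h1 : ∃ i, s = {i}
  · exact Or.inr h1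
  left
  obtain ⟨i, hi⟩ := h.nonempty
  obtain ⟨j, hj, hij⟩ : ∃ j ∈ s, i ≠ j := by
    by_contra hcon
    push Not at hcon
    exact h1 ⟨i, Finset.eq_singleton_iff_unique_mem.2 ⟨hi, fun x hx => (hcon x hx).symm⟩⟩
  ext k
  rw [← h.d_eq_zero_iff hi hj hij k, ← h'.d_eq_zero_iff (hs hi) (hs hj) hij k]

lemma IsFlat.card_le {s : Finset ι} (h : A.IsFlat s) : s.card ≤ 3 := by
  rcases h with ⟨i, rfl⟩ | h | ⟨i, j, hij, rfl, -⟩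
  · simp
  · exact (A.card_T s h).le
  · rw [Finset.card_pair hij]; norm_num

lemma IsFlat.exists_notMem {s : Finset ι} (h : A.IsFlat s) (t : Finset ι) (ht : t.card ≤ 2) :
    ∃ k, k ∉ s ∧ k ∉ t := by
  by_contra hcon
  push Not at hcon
  have : (Finset.univ : Finset ι) ⊆ s ∪ t := fun k _ => by
    by_cases hk : k ∈ s
    · simp [hk]
    · simp [hcon k hk]
  have h1 := Finset.card_le_card this
  have h2 := Finset.card_union_le s t
  have h3 := h.card_le
  have h4 := A.card
  rw [Finset.card_univ] at h1
  omega

/-- Two distinct lines meet in a flat. -/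
lemma exists_flat {i j : ι} (hij : i ≠ j) : ∃ s, A.IsFlat s ∧ i ∈ s ∧ j ∈ s := by
  by_cases h : ∃ p ∈ A.T, i ∈ p ∧ j ∈ p
  · obtain ⟨p, hp, h⟩ := h
    exact ⟨p, Or.inr (Or.inl hp), h⟩
  · push Not at h
    refine ⟨{i, j}, Or.inr (Or.inr ⟨i, j, hij, rfl, fun p hp hs => ?_⟩), by simp, by simp⟩
    exact h p hp (hs (by simp)) (hs (by simp))

lemma IsFlat.eq_of_two {s s' : Finset ι} (h : A.IsFlat s) (h' : A.IsFlat s') {i j : ι}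
    (hij : i ≠ j) (h1 : i ∈ s) (h2 : j ∈ s) (h3 : i ∈ s') (h4 : j ∈ s') : s = s' := by
  ext k
  rw [← h.d_eq_zero_iff h1 h2 hij k, ← h'.d_eq_zero_iff h3 h4 hij k]

/-! Neighbourhoods of the strata -/

variable (A) in
/-- The part of the complement close to the flat `s` and away from the other lines. -/
def V (s : Finset ι) (η : ℝ) : Set E3 :=
  {x | x ∈ A.M ∧ ∀ i ∈ s, ∀ j ∉ s, ‖A.f i x‖ < η * ‖A.f j x‖}

lemma V_subset_M {s : Finset ι} {η : ℝ} : A.V s η ⊆ A.M := fun _ h => h.1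

lemma V_mono {s : Finset ι} {η η' : ℝ} (h : η ≤ η') : A.V s η ⊆ A.V s η' := fun x hx =>
  ⟨hx.1, fun i hi j hj => (hx.2 i hi j hj).trans_le (by gcongr)⟩

lemma isOpen_V (s : Finset ι) (η : ℝ) : IsOpen (A.V s η) := by
  have : A.V s η = A.M ∩ ⋂ i, ⋂ j, {x | i ∈ s → j ∉ s → ‖A.f i x‖ < η * ‖A.f j x‖} := by
    ext x; simp only [V, Set.mem_ofPred_eq, Set.mem_inter_iff, Set.mem_iInter]
    exact and_congr_right fun _ => ⟨fun h i j hi hj => h i hi j hj, fun h i hi j hj => h i j hi hj⟩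
  rw [this]
  refine A.isOpen_M.inter (isOpen_iInter_of_finite fun i => isOpen_iInter_of_finite fun j => ?_)
  by_cases hi : i ∈ s
  · by_cases hj : j ∈ s
    · simp [hj]
    · simp only [hi, hj, not_false_eq_true, forall_true_left]
      exact isOpen_lt (by fun_prop) (by fun_prop)
  · simp [hi]

lemma V_comparable {s s' : Finset ι} {η : ℝ} (hη : η ≤ 1) {x : E3} (h : x ∈ A.V s η)
    (h' : x ∈ A.V s' η) : s ⊆ s' ∨ s' ⊆ s := by
  by_contra hcon
  push Not at hcon
  obtain ⟨⟨i, hi, hi'⟩, j, hj, hj'⟩ := And.intro (Finset.not_subset.1 hcon.1)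
    (Finset.not_subset.1 hcon.2)
  have h1 := h.2 i hi j hj'
  have h2 := h'.2 j hj i hi'
  have h3 := norm_nonneg (A.f i x)
  have h4 := norm_nonneg (A.f j x)
  nlinarith

lemma V_of_comparable {s : Finset ι} {η : ℝ} {x y : E3} (hx : x ∈ A.V s η)
    (h1 : ∀ i ∈ s, ‖A.f i y‖ ≤ 2 * ‖A.f i x‖) (h2 : ∀ j ∉ s, ‖A.f j x‖ ≤ 2 * ‖A.f j y‖)
    (hy : y ∈ A.M) (hη : 0 ≤ η) : y ∈ A.V s (4 * η) := by
  refine ⟨hy, fun i hi j hj => ?_⟩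
  have := hx.2 i hi j hj
  have := h1 i hi
  have := h2 j hj
  nlinarith

/-! Rotations and contractions normal to a flat -/

variable (A) in
/-- `P` is a normal projection along the flat `s`, with image of weight `w`. -/
structure IsPiece (s w : Finset ι) (P : E3 →L[ℂ] E3) : Prop where
  sub : w ⊆ s
  mem : ∀ i ∈ w, ∀ x, A.f i (P x) = A.f i x
  nmem : ∀ i ∈ s, i ∉ w → ∀ x, A.f i (P x) = 0
  bd : ∀ x B, (∀ i ∈ s, ‖A.f i x‖ ≤ B) → ∀ j, ‖A.f j (P x)‖ ≤ 2 * A.K * B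

lemma IsPiece.quarter {s w : Finset ι} {P : E3 →L[ℂ] E3} (h : A.IsPiece s w P) {η : ℝ}
    (hη : 8 * A.K * η ≤ 1) {x : E3} (hx : x ∈ A.V s η) {j : ι} (hj : j ∉ s) :
    ‖A.f j (P x)‖ ≤ ‖A.f j x‖ / 4 := by
  have := h.bd x (η * ‖A.f j x‖) (fun i hi => (hx.2 i hi j hj).le) j
  nlinarith [norm_nonneg (A.f j x)]

lemma IsPiece.rotate {s w : Finset ι} {P : E3 →L[ℂ] E3} (h : A.IsPiece s w P) {η : ℝ}
    (hη : 8 * A.K * η ≤ 1) {x : E3} (hx : x ∈ A.V s η) {ζ : ℂ} (hζ : ‖ζ‖ = 1) (j : ι) :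
    ‖A.f j x‖ ≤ 2 * ‖A.f j (x + (ζ - 1) • P x)‖ ∧ ‖A.f j (x + (ζ - 1) • P x)‖ ≤ 2 * ‖A.f j x‖ := by
  have hn := norm_nonneg (A.f j x)
  rw [map_add, map_smul, smul_eq_mul]
  by_cases hj : j ∈ s
  · by_cases hw : j ∈ w
    · rw [h.mem j hw, show A.f j x + (ζ - 1) * A.f j x = ζ * A.f j x by ring, norm_mul, hζ]
      constructor <;> linarith
    · rw [h.nmem j hj hw, mul_zero, add_zero]
      constructor <;> linarith
  · have h1 := h.quarter hη hx hj
    have h2 : ‖(ζ - 1) * A.f j (P x)‖ ≤ ‖A.f j x‖ / 2 := by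
      rw [norm_mul]
      have : ‖ζ - 1‖ ≤ 2 := (norm_sub_le _ _).trans (by rw [hζ, norm_one]; norm_num)
      nlinarith [norm_nonneg (A.f j (P x)), norm_nonneg (ζ - 1)]
    have h3 := norm_add_le (A.f j x) ((ζ - 1) * A.f j (P x))
    have h4 := norm_sub_le (A.f j x + (ζ - 1) * A.f j (P x)) ((ζ - 1) * A.f j (P x))
    rw [add_sub_cancel_right] at h4
    constructor <;> linarith

lemma IsPiece.rotate_mem_M {s w : Finset ι} {P : E3 →L[ℂ] E3} (h : A.IsPiece s w P) {η : ℝ}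
    (hη : 8 * A.K * η ≤ 1) {x : E3} (hx : x ∈ A.V s η) {ζ : ℂ} (hζ : ‖ζ‖ = 1) :
    x + (ζ - 1) • P x ∈ A.M := fun j hj => by
  have := (h.rotate hη hx hζ j).1
  rw [hj, norm_zero, mul_zero] at this
  exact hx.1 j (norm_le_zero_iff.1 this)

lemma IsPiece.rotate_mem {s w : Finset ι} {P : E3 →L[ℂ] E3} (h : A.IsPiece s w P) {η : ℝ}
    (hη : 8 * A.K * η ≤ 1) {x : E3} (hx : x ∈ A.V s η) {ζ : ℂ} (hζ : ‖ζ‖ = 1)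
    {s' : Finset ι} {η' : ℝ} (h0' : 0 ≤ η') (hx' : x ∈ A.V s' η') :
    x + (ζ - 1) • P x ∈ A.V s' (4 * η') :=
  V_of_comparable hx' (fun i _ => (h.rotate hη hx hζ i).2) (fun j _ => (h.rotate hη hx hζ j).1)
    (h.rotate_mem_M hη hx hζ) h0'

lemma IsPiece.contract_mem {s : Finset ι} {P : E3 →L[ℂ] E3} (h : A.IsPiece s s P) {η : ℝ}
    (h0 : 0 ≤ η) (hη : 8 * A.K * η ≤ 1) {x : E3} (hx : x ∈ A.V s η) {r : ℝ} (hr : 0 < r)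
    (hr1 : r ≤ 1) : x + ((r : ℂ) - 1) • P x ∈ A.V s (4 * η) := by
  have hs : ∀ i ∈ s, A.f i (x + ((r : ℂ) - 1) • P x) = r * A.f i x := fun i hi => by
    rw [map_add, map_smul, smul_eq_mul, h.mem i hi]; ring
  have hn : ∀ j ∉ s, ‖A.f j x‖ ≤ 2 * ‖A.f j (x + ((r : ℂ) - 1) • P x)‖ := fun j hj => by
    have h1 := h.quarter hη hx hj
    have h2 : ‖((r : ℂ) - 1) * A.f j (P x)‖ ≤ ‖A.f j x‖ / 2 := by
      rw [norm_mul]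
      have : ‖(r : ℂ) - 1‖ ≤ 1 := by
        rw [← Complex.ofReal_one, ← Complex.ofReal_sub, Complex.norm_real, Real.norm_eq_abs,
          abs_le]
        constructor <;> linarith
      nlinarith [norm_nonneg (A.f j (P x)), norm_nonneg ((r : ℂ) - 1), norm_nonneg (A.f j x)]
    have h4 := norm_sub_le (A.f j x + ((r : ℂ) - 1) * A.f j (P x)) (((r : ℂ) - 1) * A.f j (P x))
    rw [add_sub_cancel_right] at h4
    rw [map_add, map_smul, smul_eq_mul]
    linarith
  refine V_of_comparable hx (fun i hi => ?_) hn (fun j hj => ?_) h0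
  · rw [hs i hi, norm_mul, Complex.norm_real, Real.norm_eq_abs, abs_of_pos hr]
    nlinarith [norm_nonneg (A.f i x)]
  · by_cases hjs : j ∈ s
    · rw [hs j hjs] at hj
      rcases mul_eq_zero.1 hj with h' | h'
      · exact hr.ne' (by exact_mod_cast h')
      · exact hx.1 j h'
    · have := hn j hjs
      rw [hj, norm_zero, mul_zero] at this
      exact hx.1 j (norm_le_zero_iff.1 this)

/-- Projection on the dual vector of the `i`-th form. -/
def rk (A : Arr ι) (i a b : ι) : E3 →L[ℂ] E3 := (A.f i).smulRight (A.D i a b)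

lemma rk_apply (i a b : ι) (x : E3) : A.rk i a b x = A.f i x • A.D i a b := rfl

lemma f_rk (i a b j : ι) (x : E3) : A.f j (A.rk i a b x) = A.f i x * (A.d j a b / A.d i a b : ℝ) := by
  rw [rk_apply, map_smul, f_D, smul_eq_mul]

lemma norm_f_rk_le (i a b j : ι) (x : E3) : ‖A.f j (A.rk i a b x)‖ ≤ A.K * ‖A.f i x‖ := by
  rw [f_rk, norm_mul, Complex.norm_real, mul_comm]
  exact mul_le_mul_of_nonneg_right (A.ratio_le _ _ _ _ _ _) (norm_nonneg _)

lemma isPiece_line {i a b : ι} (h : A.d i a b ≠ 0) : A.IsPiece {i} {i} (A.rk i a b) where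
  sub := subset_rfl
  mem j hj x := by
    rw [Finset.mem_singleton] at hj; subst hj
    rw [f_rk, div_self h]; simp
  nmem j hj hj' := absurd hj hj'
  bd x B hB j := by
    have := A.norm_f_rk_le i a b j x
    have h1 := hB i (by simp)
    have := A.one_le_K
    nlinarith [norm_nonneg (A.f i x)]

lemma isPiece_half {s : Finset ι} {i j k : ι} (hij : i ≠ j) (hs : s = {i, j})
    (h : A.d i j k ≠ 0) : A.IsPiece s {i} (A.rk i j k) := by
  subst hs
  refine ⟨by simp, fun m hm x => ?_, fun m hm hm' x => ?_, fun x B hB m => ?_⟩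
  · rw [Finset.mem_singleton] at hm; subst hm
    rw [f_rk, div_self h]; simp
  · have : m = j := by simp at hm hm'; tauto
    subst this
    rw [f_rk, d_self]; simp
  · have := A.norm_f_rk_le i j k m x
    have h1 := hB i (by simp)
    have := A.one_le_K
    nlinarith [norm_nonneg (A.f i x)]

lemma isPiece_point {s : Finset ι} (hs : A.IsFlat s) {i j k : ι} (hi : i ∈ s) (hj : j ∈ s)
    (hij : i ≠ j) (hk : k ∉ s) : A.IsPiece s s (A.rk i j k + A.rk j k i) := by
  have hd : A.d i j k ≠ 0 := fun h => hk ((hs.d_eq_zero_iff hi hj hij k).1 h)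
  refine ⟨subset_rfl, fun m hm x => ?_, fun m hm hm' => absurd hm hm', fun x B hB m => ?_⟩
  · have h0 : A.d i j m = 0 := (hs.d_eq_zero_iff hi hj hij m).2 hm
    have := A.f_cramer hd m x
    rw [h0, zero_div, Complex.ofReal_zero, zero_mul, add_zero] at this
    rw [add_apply, map_add, f_rk, f_rk, this, A.d_rot i j k,
      show A.d m k i = A.d i m k from A.d_rot i m k]
    ring
  · have h1 := A.norm_f_rk_le i j k m x
    have h2 := A.norm_f_rk_le j k i m x
    have h3 := hB i hi
    have h4 := hB j hj
    have := A.one_le_K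
    rw [add_apply, map_add]
    refine (norm_add_le _ _).trans ?_
    nlinarith

lemma IsFlat.exists_piece {s : Finset ι} (hs : A.IsFlat s) : ∃ P, A.IsPiece s s P := by
  by_cases h : ∃ i ∈ s, ∃ j ∈ s, i ≠ j
  · obtain ⟨i, hi, j, hj, hij⟩ := h
    obtain ⟨k, hk, -⟩ := hs.exists_notMem ∅ (by simp)
    exact ⟨_, isPiece_point hs hi hj hij hk⟩
  · push Not at h
    obtain ⟨i, hi⟩ := hs.nonempty
    have : s = {i} := Finset.eq_singleton_iff_unique_mem.2 ⟨hi, fun x hx => h x hx i hi⟩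
    subst this
    obtain ⟨a, ha, -⟩ := hs.exists_notMem ∅ (by simp)
    obtain ⟨p, hp, h1, h2⟩ := exists_flat (A := A) (i := i) (j := a) (fun h => ha (by simp [h]))
    obtain ⟨b, hb, -⟩ := hp.exists_notMem ∅ (by simp)
    refine ⟨_, isPiece_line (i := i) (a := a) (b := b) fun h => hb ?_⟩
    exact (hp.d_eq_zero_iff h1 h2 (fun h => ha (by simp [h])) b).1 h

end Arr

end

section

open unitInterval Topology
open Filter (Tendsto Eventually eventually_all)

/-! ### Loops around flats and characters -/

/-- The standard loop in the unit circle. -/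
def circ (t : I) : ℂ := Complex.exp (2 * Real.pi * (t : ℝ) * Complex.I)

@[fun_prop] lemma continuous_circ : Continuous circ := by unfold circ; fun_prop
lemma norm_circ (t : I) : ‖circ t‖ = 1 := by
  rw [circ, show (2 * Real.pi * (t : ℝ) * Complex.I : ℂ) = ((2 * Real.pi * t : ℝ) : ℂ) * Complex.I by
    push_cast; ring, Complex.norm_exp_ofReal_mul_I]
@[simp] lemma circ_zero : circ 0 = 1 := by simp [circ]
@[simp] lemma circ_one : circ 1 = 1 := by simp [circ]

/-- The loop obtained by rotating the image of `P`. -/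
def loop (P : E3 →L[ℂ] E3) (x : E3) : C(I, E3) := ⟨fun t => x + (circ t - 1) • P x, by fun_prop⟩

lemma loop_apply (P : E3 →L[ℂ] E3) (x : E3) (t : I) : loop P x t = x + (circ t - 1) • P x := rfl
@[simp] lemma loop_zero (P : E3 →L[ℂ] E3) (x : E3) : loop P x 0 = x := by simp [loop_apply]
@[simp] lemma loop_one (P : E3 →L[ℂ] E3) (x : E3) : loop P x 1 = x := by simp [loop_apply]

section ex

variable {ι : Type*} [Fintype ι]

/-- The exponential of a vector of angles, for the exponents `πiχ + εt`. -/
def ex (χ : ι → ℤ) (t : ι → ℝ) (a : ι → ℝ) : C(ℝ, ℂ) :=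
  ⟨fun ε => Complex.exp (∑ j, (Real.pi * Complex.I * χ j + ε * t j) * a j / (2 * Real.pi)),
    by fun_prop⟩

variable (χ : ι → ℤ) (t : ι → ℝ)

lemma ex_apply (a : ι → ℝ) (ε : ℝ) : ex χ t a ε =
    Complex.exp (∑ j, (Real.pi * Complex.I * χ j + ε * t j) * a j / (2 * Real.pi)) := rfl

lemma ex_add (a b : ι → ℝ) : ex χ t (fun j => a j + b j) = ex χ t a * ex χ t b := by
  ext ε
  rw [ContinuousMap.mul_apply, ex_apply, ex_apply, ex_apply, ← Complex.exp_add,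
    ← Finset.sum_add_distrib]
  congr 2
  ext j
  push_cast
  ring

lemma ex_zero : ex χ t (fun _ => 0) = 1 := by
  ext ε
  simp [ex_apply]

lemma ex_ne_zero (a : ι → ℝ) (ε : ℝ) : ex χ t a ε ≠ 0 := Complex.exp_ne_zero _

lemma ex_apply_two_pi (v : ι → ℤ) (ε : ℝ) : ex χ t (fun j => 2 * Real.pi * v j) ε =
    Complex.exp ((∑ j, χ j * v j : ℤ) * (Real.pi * Complex.I) + ε * (∑ j, t j * v j : ℝ)) := by
  have hp : (Real.pi : ℂ) ≠ 0 := by exact_mod_cast Real.pi_ne_zero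
  rw [ex_apply]
  congr 1
  push_cast
  rw [Finset.sum_mul, Finset.mul_sum, ← Finset.sum_add_distrib]
  refine Finset.sum_congr rfl fun j _ => ?_
  field_simp

lemma ex_eq_one {v : ι → ℤ} (h1 : Even (∑ j, χ j * v j)) (h2 : ∑ j, t j * v j = 0) :
    ex χ t (fun j => 2 * Real.pi * v j) = 1 := by
  ext ε
  obtain ⟨k, hk⟩ := h1
  rw [ex_apply_two_pi, h2, hk, ContinuousMap.one_apply, Complex.exp_eq_one_iff]
  exact ⟨k, by push_cast; ring⟩

end ex

namespace Arr

variable {ι : Type*} [Fintype ι] [DecidableEq ι] {A : Arr ι}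

lemma IsPiece.Theta_loop {s w : Finset ι} {P : E3 →L[ℂ] E3} (h : A.IsPiece s w P) {η : ℝ}
    (hη : 8 * A.K * η ≤ 1) {x : E3} (hx : x ∈ A.V s η) (j : ι) :
    Theta (A.f j) (loop P x) = if j ∈ w then 2 * Real.pi else 0 := by
  have hj0 := hx.1 j
  split_ifs with hw
  · rw [Theta, ang_eq ⟨fun t => Complex.log (A.f j x) + 2 * Real.pi * (t : ℝ) * Complex.I,
      by fun_prop⟩]
    · simp
    · intro t
      rw [ContinuousMap.coe_mk, Complex.exp_add, Complex.exp_log hj0, loop_apply, map_add,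
        map_smul, smul_eq_mul, h.mem j hw, circ]
      ring
  by_cases hs : j ∈ s
  · rw [Theta, ang_eq ⟨fun t => Complex.log (A.f j x), by fun_prop⟩]
    · simp
    · intro t
      rw [ContinuousMap.coe_mk, Complex.exp_log hj0, loop_apply, map_add,
        map_smul, smul_eq_mul, h.nmem j hs hw]
      ring
  · set q := A.f j (P x) / A.f j x with hq
    have hq4 : ‖q‖ ≤ 1 / 4 := by
      rw [hq, norm_div, div_le_iff₀ (norm_pos_iff.2 hj0)]
      linarith [h.quarter hη hx hs]
    have hre : ∀ t, 1 + (circ t - 1) * q ∈ Complex.slitPlane := fun t => by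
      refine Complex.mem_slitPlane_of_norm_lt_one ?_
      rw [norm_mul]
      have : ‖circ t - 1‖ ≤ 2 := (norm_sub_le _ _).trans (by rw [norm_circ, norm_one]; norm_num)
      nlinarith [norm_nonneg q]
    rw [Theta, ang_eq ⟨fun t => Complex.log (A.f j x) + Complex.log (1 + (circ t - 1) * q),
      continuous_const.add (Continuous.clog (by fun_prop) hre)⟩]
    · simp
    · intro t
      rw [ContinuousMap.coe_mk, Complex.exp_add, Complex.exp_log hj0,
        Complex.exp_log (Complex.slitPlane_ne_zero (hre t)), loop_apply, map_add,
        map_smul, smul_eq_mul, hq]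
      field_simp

variable (A) in
/-- The character with exponents `πiχ + εt`, as a function of `ε`. -/
def psi (χ : ι → ℤ) (t : ι → ℝ) (γ : C(I, E3)) : C(ℝ, ℂ) := ex χ t fun j => Theta (A.f j) γ

lemma isCrossed_Theta_f (j : ι) : IsCrossed A.M (fun _ => (1 : ℝ)) (Theta (A.f j)) :=
  isCrossed_Theta (A.f j).continuous.continuousOn fun _ hx => hx j

lemma isCocycle_psi (χ : ι → ℤ) (t : ι → ℝ) : IsCocycle A.M (A.psi χ t) := by
  constructor
  · intro γ hγ
    rw [psi, psi, psi, ← ex_add]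
    congr 1
    ext j
    simpa using (isCrossed_Theta_f j).half γ hγ
  · intro K hK
    rw [psi, psi, psi, psi, ← ex_add, ← ex_add]
    congr 1
    ext j
    simpa using (isCrossed_Theta_f j).sq K hK

/-- Evaluation of a family at a parameter. -/
lemma isCocycle_eval {S : Set E3} {Ψ : C(I, E3) → C(ℝ, ℂ)} (h : IsCocycle S Ψ) (ε : ℝ) :
    IsCocycle S (fun γ => Ψ γ ε) :=
  ⟨fun γ hγ => by rw [h.half γ hγ]; rfl, fun K hK => by
    have := congrArg (fun g : C(ℝ, ℂ) => g ε) (h.sq K hK); exact this⟩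

lemma isCrossed_eval {S : Set E3} {Ψ Δ : C(I, E3) → C(ℝ, ℂ)} (h : IsCrossed S Ψ Δ) (ε : ℝ) :
    IsCrossed S (fun γ => Ψ γ ε) (fun γ => Δ γ ε) :=
  ⟨fun γ hγ => by rw [h.half γ hγ]; rfl, fun K hK => by
    have := congrArg (fun g : C(ℝ, ℂ) => g ε) (h.sq K hK); exact this⟩

lemma IsPiece.psi_loop {s w : Finset ι} {P : E3 →L[ℂ] E3} (h : A.IsPiece s w P) {η : ℝ}
    (hη : 8 * A.K * η ≤ 1) {x : E3} (hx : x ∈ A.V s η) (χ : ι → ℤ) (t : ι → ℝ) (ε : ℝ) :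
    A.psi χ t (loop P x) ε = Complex.exp ((∑ j ∈ w, χ j : ℤ) * (Real.pi * Complex.I) +
      ε * (∑ j ∈ w, t j : ℝ)) := by
  have : (fun j => Theta (A.f j) (loop P x)) =
      fun j => 2 * Real.pi * (if j ∈ w then (1 : ℤ) else 0 : ℤ) := by
    ext j
    rw [h.Theta_loop hη hx j]
    split_ifs <;> simp
  rw [psi, this, ex_apply_two_pi]
  simp [Finset.sum_ite_mem]

/-- Rotating along a path. -/
def rotSq (P : E3 →L[ℂ] E3) (γ : C(I, E3)) : C(I × I, E3) :=
  ⟨fun p => γ p.1 + (circ p.2 - 1) • P (γ p.1), by fun_prop⟩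

lemma loop_sq (P : E3 →L[ℂ] E3) (γ : C(I, E3)) : sqBot (rotSq P γ) = γ ∧ sqTop (rotSq P γ) = γ ∧
    sqLeft (rotSq P γ) = loop P (γ 0) ∧ sqRight (rotSq P γ) = loop P (γ 1) := by
  refine ⟨?_, ?_, ?_, ?_⟩ <;> ext t <;> simp [sqBot, sqTop, sqLeft, sqRight, rotSq, loop]

/-- A crossed homomorphism near flats around which the character is nontrivial is principal. -/
theorem principal_of_pieces {F : Set (Finset ι)} {w : Finset ι → Finset ι}
    {P : Finset ι → E3 →L[ℂ] E3} (hP : ∀ s ∈ F, A.IsPiece s (w s) (P s)) {ψ δ : C(I, E3) → ℂ}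
    (hψ : IsCocycle A.M ψ) {η : ℝ} (h0 : 0 ≤ η) (hη : 128 * A.K * η ≤ 1) {q : Finset ι → ℂ}
    (hq : ∀ s ∈ F, q s ≠ 1) (hψq : ∀ s ∈ F, ∀ x ∈ A.V s η, ψ (loop (P s) x) = q s)
    (hδ : IsCrossed (⋃ s ∈ F, A.V s (16 * η)) ψ δ) :
    ∃ m : E3 → ℂ, (∀ s ∈ F, ∀ x ∈ A.V s η, m x = δ (loop (P s) x) / (1 - q s)) ∧
      ∀ γ : C(I, E3), (∀ t, γ t ∈ ⋃ s ∈ F, A.V s η) → δ γ = principal ψ m γ := by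
  classical
  have hK := A.one_le_K
  have hη8 : 8 * A.K * η ≤ 1 := by nlinarith
  have hη8' : 8 * A.K * (4 * η) ≤ 1 := by nlinarith
  have hq' : ∀ s ∈ F, 1 - q s ≠ 0 := fun s hs h => hq s hs (by linear_combination -h)
  let m : E3 → ℂ := fun x => if h : ∃ s ∈ F, x ∈ A.V s η then
    δ (loop (P h.choose) x) / (1 - q h.choose) else 0
  have hm : ∀ s ∈ F, ∀ x ∈ A.V s η, m x = δ (loop (P s) x) / (1 - q s) := by
    intro s hs x hx
    have h : ∃ s ∈ F, x ∈ A.V s η := ⟨s, hs, hx⟩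
    obtain ⟨hs', hx'⟩ := h.choose_spec
    simp only [m, dif_pos h]
    set s' := h.choose
    have hx4 : ∀ p : I, x + (circ p - 1) • P s x ∈ A.V s' (4 * η) := fun p =>
      (hP s hs).rotate_mem hη8 hx (norm_circ _) h0 hx'
    let Kq : C(I × I, E3) := ⟨fun p => (x + (circ p.1 - 1) • P s x) +
      (circ p.2 - 1) • P s' (x + (circ p.1 - 1) • P s x), by fun_prop⟩
    have hKm : ∀ p, Kq p ∈ A.V s' (16 * η) := fun p => by
      have := (hP s' hs').rotate_mem hη8' (hx4 p.1) (norm_circ p.2) (by positivity) (hx4 p.1)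
      rwa [show 4 * (4 * η) = 16 * η by ring] at this
    have e := hδ.sq Kq fun p => Set.mem_biUnion hs' (hKm p)
    have b : sqBot Kq = loop (P s) x := by ext p; simp [sqBot, Kq, loop]
    have t : sqTop Kq = loop (P s) x := by ext p; simp [sqTop, Kq, loop]
    have l : sqLeft Kq = loop (P s') x := by ext p; simp [sqLeft, Kq, loop]
    have r : sqRight Kq = loop (P s') x := by ext p; simp [sqRight, Kq, loop]
    rw [b, t, l, r, hψq s hs x hx, hψq s' hs' x hx'] at e
    rw [div_eq_div_iff (hq' _ hs') (hq' _ hs)]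
    linear_combination -e
  refine ⟨m, hm, ?_⟩
  have hU : (⋃ s : F, A.V s.1 η) = ⋃ s ∈ F, A.V s η := by rw [Set.biUnion_eq_iUnion]
  have hsub : (⋃ s : F, A.V s.1 η) ⊆ ⋃ s ∈ F, A.V s (16 * η) := by
    rw [hU]; exact Set.iUnion₂_mono fun s _ => V_mono (by linarith)
  rw [← hU]
  refine IsCrossed.eq_of_cover (fun s => isOpen_V s.1 η) (hδ.mono hsub)
    (isCrossed_principal (hψ.mono (Set.iUnion_subset fun s => V_subset_M)) m) ?_
  rintro ⟨s, hs⟩ γ hγ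
  obtain ⟨b, t, l, r⟩ := loop_sq (P s) γ
  have e := hδ.sq (rotSq (P s) γ) fun p => Set.mem_biUnion hs (V_mono (by linarith)
    ((hP s hs).rotate_mem hη8 (hγ p.1) (norm_circ _) h0 (hγ p.1)))
  rw [b, t, l, r, hψq s hs _ (hγ 0)] at e
  rw [principal, hm s hs _ (hγ 0), hm s hs _ (hγ 1)]
  field_simp [hq' s hs]
  linear_combination e

/-! Covering a neighbourhood of the lines -/

lemma norm_le_of_basis {a b c : ι} (h : A.d a b c ≠ 0) {x : E3} {B : ℝ} (ha : ‖A.f a x‖ ≤ B)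
    (hb : ‖A.f b x‖ ≤ B) (hc : ‖A.f c x‖ ≤ B) : ‖x‖ ≤ 3 * A.K * B := by
  rw [A.eq_sum_D h x]
  have hK := A.one_le_K
  have hB : 0 ≤ B := (norm_nonneg _).trans ha
  have key : ∀ u v w z, ‖A.f u x‖ ≤ B → ‖A.f u x • A.D v w z‖ ≤ A.K * B := fun u v w z hu => by
    rw [norm_smul, mul_comm]
    exact mul_le_mul (A.norm_D_le _ _ _) hu (norm_nonneg _) (by linarith)
  have h1 := key a a b c ha
  have h2 := key b b c a hb
  have h3 := key c c a b hc
  have h4 := norm_add_le (A.f a x • A.D a b c + A.f b x • A.D b c a) (A.f c x • A.D c a b)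
  have h5 := norm_add_le (A.f a x • A.D a b c) (A.f b x • A.D b c a)
  linarith

/-- If three pairwise distinct lines of a set always meet, the set has at most three lines. -/
lemma card_le_three_of_collinear {S : Finset ι} (h : ∀ i ∈ S, ∀ j ∈ S, ∀ k ∈ S, A.d i j k = 0) :
    S.card ≤ 3 := by
  by_contra hcon
  push Not at hcon
  obtain ⟨a, ha, b, hb, hab⟩ := Finset.one_lt_card.1 (by omega : 1 < S.card)
  obtain ⟨s, hs, has, hbs⟩ := exists_flat (A := A) hab
  have : S ⊆ s := fun k hk => (hs.d_eq_zero_iff has hbs hab k).1 (h a ha b hb k hk)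
  have := Finset.card_le_card this
  have := hs.card_le
  omega

theorem exists_mem_V {η : ℝ} (h0 : 0 < η) : ∃ η' > 0, ∀ x ∈ A.M, ∀ i, ‖A.f i x‖ < η' * ‖x‖ →
    ∃ s, A.IsFlat s ∧ x ∈ A.V s η := by
  have hK := A.one_le_K
  set e := min η (1 / (4 * A.K)) with he
  have he0 : 0 < e := by rw [he]; positivity
  have heK : 4 * A.K * e ≤ 1 := by
    have : e ≤ 1 / (4 * A.K) := min_le_right _ _
    rwa [le_div_iff₀ (by positivity), mul_comm] at this
  have hee : e ≤ η := min_le_left _ _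
  have he1 : e ≤ 1 := by nlinarith
  set d3 := 1 / (6 * A.K) with hd3
  have hd3p : 0 < d3 := by positivity
  refine ⟨e ^ 3 * d3, by positivity, fun x hx i hi => ?_⟩
  have hxp : 0 < ‖x‖ := by
    rw [norm_pos_iff]
    rintro rfl
    exact hx i (map_zero _)
  let S : ℕ → Finset ι := fun k => Finset.univ.filter fun j => ‖A.f j x‖ < e ^ (3 - k) * d3 * ‖x‖
  have hmono : ∀ k < 3, S k ⊆ S (k + 1) := fun k hk j hj => by
    simp only [S, Finset.mem_filter, Finset.mem_univ, true_and] at hj ⊢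
    refine hj.trans_le ?_
    gcongr ?_ * _ * _
    exact pow_le_pow_of_le_one he0.le he1 (by omega)
  have h3 : (S 3).card ≤ 3 := by
    apply card_le_three_of_collinear (A := A)
    intro a ha b hb c hc
    simp only [S, Finset.mem_filter, Finset.mem_univ, true_and, Nat.sub_self, pow_zero,
      one_mul] at ha hb hc
    by_contra hne
    have := norm_le_of_basis hne ha.le hb.le hc.le
    have h6 : 3 * A.K * (d3 * ‖x‖) = ‖x‖ / 2 := by rw [hd3]; field_simp; norm_num
    linarith
  have h00 : i ∈ S 0 := by simpa [S] using hi
  obtain ⟨k, hk, hkS⟩ : ∃ k < 3, S k = S (k + 1) := by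
    by_contra hcon
    push Not at hcon
    have hlt : ∀ k < 3, (S k).card < (S (k + 1)).card := fun k hk =>
      Finset.card_lt_card (Finset.ssubset_iff_subset_ne.2 ⟨hmono k hk, hcon k hk⟩)
    have h01 : (S 0).card < (S 1).card := hlt 0 (by norm_num)
    have h12 : (S 1).card < (S 2).card := hlt 1 (by norm_num)
    have h23 : (S 2).card < (S 3).card := hlt 2 (by norm_num)
    have : 0 < (S 0).card := Finset.card_pos.2 ⟨i, h00⟩
    omega
  have hki : i ∈ S k := by
    have : S 0 ⊆ S k := by
      interval_cases k
      · rfl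
      · exact hmono 0 (by norm_num)
      · exact (hmono 0 (by norm_num)).trans (hmono 1 (by norm_num))
    exact this h00
  have hk3 : S k ⊆ S 3 := by
    interval_cases k
    · exact (hmono 0 (by norm_num)).trans ((hmono 1 (by norm_num)).trans (hmono 2 (by norm_num)))
    · exact (hmono 1 (by norm_num)).trans (hmono 2 (by norm_num))
    · exact hmono 2 (by norm_num)
  have hgap : ∀ a ∈ S k, ∀ b ∉ S k, ‖A.f a x‖ < e * ‖A.f b x‖ := by
    intro a ha b hb
    rw [hkS] at hb
    simp only [S, Finset.mem_filter, Finset.mem_univ, true_and, not_lt] at ha hb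
    rw [show 3 - k = (3 - (k + 1)) + 1 by omega, pow_succ] at ha
    calc _ < _ := ha
      _ = e * (e ^ (3 - (k + 1)) * d3 * ‖x‖) := by ring
      _ ≤ _ := by gcongr
  refine ⟨S k, ?_, hx, fun a ha b hb => (hgap a ha b hb).trans_le (by gcongr)⟩
  by_cases h1 : ∃ j ∈ S k, i ≠ j
  · obtain ⟨j, hj, hij⟩ := h1
    obtain ⟨s, hs, his, hjs⟩ := exists_flat (A := A) hij
    have : S k = s := by
      ext c
      constructor
      · intro hc
        rw [← hs.d_eq_zero_iff his hjs hij c]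
        have ha := hk3 hki
        have hb := hk3 hj
        have hc := hk3 hc
        simp only [S, Finset.mem_filter, Finset.mem_univ, true_and, Nat.sub_self, pow_zero,
          one_mul] at ha hb hc
        by_contra hne
        have := norm_le_of_basis hne ha.le hb.le hc.le
        have h6 : 3 * A.K * (d3 * ‖x‖) = ‖x‖ / 2 := by rw [hd3]; field_simp; norm_num
        linarith
      · intro hc
        by_contra hcn
        obtain ⟨m, hm, -⟩ := hs.exists_notMem ∅ (by simp)
        have hmem := (isPiece_point hs his hjs hij hm).mem c hc x
        have g1 := hgap i hki c hcn
        have g2 := hgap j hj c hcn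
        rw [add_apply, map_add] at hmem
        have n1 := A.norm_f_rk_le i j m c x
        have n2 := A.norm_f_rk_le j m i c x
        have n3 := norm_add_le (A.f c (A.rk i j m x)) (A.f c (A.rk j m i x))
        rw [hmem] at n3
        have hc0 : 0 < ‖A.f c x‖ := norm_pos_iff.2 (hx c)
        nlinarith
    rwa [this]
  · push Not at h1
    exact Or.inl ⟨i, Finset.eq_singleton_iff_unique_mem.2 ⟨hki, fun y hy => (h1 y hy).symm⟩⟩

/-! Connecting paths -/

lemma exists_avoid {κ : Type*} (J : Finset κ) (a b : κ → ℂ) (ha : ∀ j ∈ J, a j ≠ 0)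
    (hb : ∀ j ∈ J, b j ≠ 0) : ∃ τ : C(I, ℂ), τ 0 = 0 ∧ τ 1 = 1 ∧
      ∀ t, ∀ j ∈ J, (1 - τ t) * a j + τ t * b j ≠ 0 := by
  classical
  let B : Set ℂ := ((J.filter fun j => a j ≠ b j).image fun j => a j / (a j - b j) : Finset ℂ)
  have hc : IsPathConnected Bᶜ := (Finset.countable_toSet _).isPathConnected_compl_of_one_lt_rank
    (by rw [Complex.rank_real_complex]; exact Cardinal.one_lt_two)
  have h0 : (0 : ℂ) ∈ Bᶜ := by
    simp only [B, Set.mem_compl_iff, Finset.mem_coe, Finset.mem_image, Finset.mem_filter, not_exists]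
    rintro j ⟨⟨hj, hne⟩, h⟩
    rw [div_eq_zero_iff] at h
    exact h.elim (ha j hj) fun h => hne (sub_eq_zero.1 h)
  have h1 : (1 : ℂ) ∈ Bᶜ := by
    simp only [B, Set.mem_compl_iff, Finset.mem_coe, Finset.mem_image, Finset.mem_filter, not_exists]
    rintro j ⟨⟨hj, hne⟩, h⟩
    rw [div_eq_one_iff_eq (sub_ne_zero.2 hne)] at h
    exact hb j hj (by linear_combination h)
  obtain ⟨γ, hγ⟩ := hc.joinedIn 0 h0 1 h1
  refine ⟨γ.toContinuousMap, γ.source, γ.target, fun t j hj h => ?_⟩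
  have hγt := hγ t
  change (1 - γ t) * a j + γ t * b j = 0 at h
  by_cases hne : a j = b j
  · rw [hne] at h
    exact hb j hj (by linear_combination h)
  · apply hγt
    simp only [B, Finset.mem_coe, Finset.mem_image, Finset.mem_filter]
    refine ⟨j, ⟨hj, hne⟩, ?_⟩
    rw [div_eq_iff (sub_ne_zero.2 hne)]
    linear_combination h

/-- A path in a flat avoiding the other lines, moved slightly off the flat, lies in `V`. -/
lemma eventually_mem_V {s : Finset ι} {η : ℝ} (h0 : 0 < η) (a b : C(I, E3))
    (ha : ∀ t, ∀ i ∈ s, A.f i (a t) = 0) (ha' : ∀ t, ∀ j ∉ s, A.f j (a t) ≠ 0)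
    (hb : ∀ t, ∀ i ∈ s, A.f i (b t) ≠ 0) :
    ∀ᶠ r : ℝ in 𝓝[>] 0, ∀ t, a t + (r : ℂ) • b t ∈ A.V s η := by
  have key : ∀ i j, ∀ᶠ r : ℝ in 𝓝[>] 0, ∀ t, j ∉ s → (A.f j (a t + (r : ℂ) • b t) ≠ 0 ∧
      (i ∈ s → ‖A.f i (a t + (r : ℂ) • b t)‖ < η * ‖A.f j (a t + (r : ℂ) • b t)‖)) := by
    intro i j
    by_cases hj : j ∉ s
    swap
    · exact Eventually.of_forall fun r t h => absurd h hj
    obtain ⟨t0, -, ht0⟩ := isCompact_univ.exists_isMinOn ⟨(0 : I), trivial⟩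
      (f := fun t => ‖A.f j (a t)‖) (by fun_prop)
    obtain ⟨t1, -, ht1⟩ := isCompact_univ.exists_isMaxOn ⟨(0 : I), trivial⟩
      (f := fun t => ‖A.f j (b t)‖) (by fun_prop)
    obtain ⟨t2, -, ht2⟩ := isCompact_univ.exists_isMaxOn ⟨(0 : I), trivial⟩
      (f := fun t => ‖A.f i (b t)‖) (by fun_prop)
    set m := ‖A.f j (a t0)‖
    set B := ‖A.f j (b t1)‖
    set B' := ‖A.f i (b t2)‖
    have hm : 0 < m := norm_pos_iff.2 (ha' t0 j hj)
    have e1 : ∀ᶠ r : ℝ in 𝓝[>] 0, r * B < m / 2 :=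
      (Tendsto.eventually_lt_const (u := m / 2) (v := 0 * B) (by simpa using hm)
        ((continuous_id.mul continuous_const).tendsto (0 : ℝ))).filter_mono nhdsWithin_le_nhds
    have e2 : ∀ᶠ r : ℝ in 𝓝[>] 0, r * B' < η * (m / 2) :=
      (Tendsto.eventually_lt_const (u := η * (m / 2)) (v := 0 * B') (by rw [zero_mul]; positivity)
        ((continuous_id.mul continuous_const).tendsto (0 : ℝ))).filter_mono nhdsWithin_le_nhds
    filter_upwards [e1, e2, self_mem_nhdsWithin] with r h1 h2 hr t hj
    have hr : 0 < r := hr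
    have g0 : m ≤ ‖A.f j (a t)‖ := ht0 (Set.mem_univ t)
    have g1 : ‖A.f j (b t)‖ ≤ B := ht1 (Set.mem_univ t)
    have g2 : ‖A.f i (b t)‖ ≤ B' := ht2 (Set.mem_univ t)
    have hlow : m / 2 < ‖A.f j (a t + (r : ℂ) • b t)‖ := by
      rw [map_add, map_smul, smul_eq_mul]
      have := norm_sub_le (A.f j (a t) + r * A.f j (b t)) (r * A.f j (b t))
      rw [add_sub_cancel_right, norm_mul, Complex.norm_real, Real.norm_eq_abs,
        abs_of_pos hr] at this
      nlinarith
    refine ⟨fun h => ?_, fun hi => ?_⟩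
    · rw [h, norm_zero] at hlow; linarith
    · have e : ‖A.f i (a t + (r : ℂ) • b t)‖ = r * ‖A.f i (b t)‖ := by
        rw [map_add, map_smul, smul_eq_mul, ha t i hi, zero_add, norm_mul, Complex.norm_real,
          Real.norm_eq_abs, abs_of_pos hr]
      rw [e]
      calc r * ‖A.f i (b t)‖ ≤ r * B' := by gcongr
        _ < η * (m / 2) := h2
        _ ≤ _ := by gcongr
  have key' := eventually_all.2 fun i => eventually_all.2 fun j => key i j
  filter_upwards [key', self_mem_nhdsWithin] with r h hr t
  have hr : 0 < r := hr
  refine ⟨fun j => ?_, fun i hi j hj => (h i j t hj).2 hi⟩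
  by_cases hj : j ∈ s
  · rw [map_add, map_smul, smul_eq_mul, ha t j hj, zero_add]
    exact mul_ne_zero (by exact_mod_cast hr.ne') (hb t j hj)
  · exact (h j j t hj).1

lemma IsPiece.joinedIn {s : Finset ι} {P : E3 →L[ℂ] E3} (h : A.IsPiece s s P) {η : ℝ}
    (h0 : 0 < η) (hη : 8 * A.K * η ≤ 1) {x y : E3} (hx : x ∈ A.V s η) (hy : y ∈ A.V s η)
    (a b : C(I, E3)) (a0 : a 0 = x - P x) (a1 : a 1 = y - P y) (b0 : b 0 = P x) (b1 : b 1 = P y)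
    (ha : ∀ t, ∀ i ∈ s, A.f i (a t) = 0) (ha' : ∀ t, ∀ j ∉ s, A.f j (a t) ≠ 0)
    (hb : ∀ t, ∀ i ∈ s, A.f i (b t) ≠ 0) (Q : Set E3)
    (hQ : ∀ r : ℝ, 0 < r → ∀ t, a t + (r : ℂ) • b t ∈ Q) : JoinedIn (A.V s (4 * η) ∩ Q) x y := by
  have ev := eventually_mem_V (A := A) (s := s) (η := 4 * η) (by positivity) a b ha ha' hb
  obtain ⟨r, hr, hr0, hr1⟩ := (ev.and (Ioo_mem_nhdsGT (zero_lt_one (α := ℝ)))).exists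
  have seg : ∀ z ∈ A.V s η, (∀ r' : ℝ, 0 < r' → z + ((r' : ℂ) - 1) • P z ∈ Q) →
      JoinedIn (A.V s (4 * η) ∩ Q) z (z + ((r : ℂ) - 1) • P z) := by
    intro z hz hzQ
    refine ⟨⟨⟨fun t : I => z + (((1 - t + t * r : ℝ) : ℂ) - 1) • P z, by fun_prop⟩, by simp, by simp⟩,
      fun t => ?_⟩
    have hp : 0 < 1 - (t : ℝ) + t * r := by
      have := t.2.1; have := t.2.2
      rcases eq_or_lt_of_le t.2.2 with h | h
      · rw [h]; linarith
      · nlinarith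
    exact ⟨h.contract_mem h0.le hη hz hp (by nlinarith [t.2.1]), hzQ _ hp⟩
  have jx := seg x hx fun r' hr' => by
    have := hQ r' hr' 0
    rw [a0, b0] at this
    convert this using 1
    module
  have jy := seg y hy fun r' hr' => by
    have := hQ r' hr' 1
    rw [a1, b1] at this
    convert this using 1
    module
  refine jx.trans (JoinedIn.trans ?_ jy.symm)
  refine ⟨⟨⟨fun t => a t + (r : ℂ) • b t, by fun_prop⟩, ?_, ?_⟩, fun t => ⟨hr t, hQ r hr0 t⟩⟩
  · simp only [a0, b0]; module
  · simp only [a1, b1]; module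

lemma IsPiece.f_sub_ne {s : Finset ι} {P : E3 →L[ℂ] E3} (h : A.IsPiece s s P) {η : ℝ}
    (hη : 8 * A.K * η ≤ 1) {x : E3} (hx : x ∈ A.V s η) {j : ι} (hj : j ∉ s) :
    A.f j (x - P x) ≠ 0 := fun h' => by
  have := h.quarter hη hx hj
  rw [map_sub, sub_eq_zero] at h'
  rw [← h'] at this
  have : 0 < ‖A.f j x‖ := norm_pos_iff.2 (hx.1 j)
  linarith

/-- The neighbourhood of a flat is path connected. -/
lemma IsFlat.joinedIn {s : Finset ι} (hs : A.IsFlat s) {η : ℝ} (h0 : 0 < η)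
    (hη : 8 * A.K * η ≤ 1) {x y : E3} (hx : x ∈ A.V s η) (hy : y ∈ A.V s η) :
    JoinedIn (A.V s (4 * η)) x y := by
  obtain ⟨P, hP⟩ := hs.exists_piece
  obtain ⟨τ, t0, t1, hτ⟩ := exists_avoid (Finset.univ \ s) (fun j => A.f j (x - P x))
    (fun j => A.f j (y - P y)) (fun j hj => hP.f_sub_ne hη hx (by simpa using hj))
    (fun j hj => hP.f_sub_ne hη hy (by simpa using hj))
  obtain ⟨τ', t0', t1', hτ'⟩ := exists_avoid s (fun j => A.f j x) (fun j => A.f j y)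
    (fun j _ => hx.1 j) (fun j _ => hy.1 j)
  have := hP.joinedIn h0 hη hx hy ⟨fun t => (1 - τ t) • (x - P x) + τ t • (y - P y), by fun_prop⟩
    ⟨fun t => (1 - τ' t) • P x + τ' t • P y, by fun_prop⟩ (by simp [t0]) (by simp [t1])
    (by simp [t0']) (by simp [t1']) (fun t i hi => by simp [hP.mem i hi])
    (fun t j hj => by simpa using hτ t j (by simpa using hj))
    (fun t i hi => by simpa [hP.mem i hi] using hτ' t i hi) Set.univ (fun _ _ _ => trivial)
  simpa using this

end Arr

end

section

open unitInterval Topology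

/-! ### Crossed homomorphisms supported on a wall -/

lemma sign_const {g : I → ℝ} (hg : Continuous g) (h : ∀ t, g t ≠ 0) : g 0 < 0 ↔ g 1 < 0 := by
  have key : ∀ a b : I, g a < 0 → ¬ 0 ≤ g b := fun a b ha hb => by
    obtain ⟨t, ht⟩ := mem_range_of_exists_le_of_exists_ge hg ⟨a, ha.le⟩ ⟨b, hb⟩
    exact h t ht
  exact ⟨fun h0 => not_le.1 (key 0 1 h0), fun h1 => not_le.1 (key 1 0 h1)⟩

/-- The positive imaginary half axis. -/
def wall : Set ℂ := {w | w.re = 0 ∧ 0 < w.im}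

theorem exists_wall {X : Type*} [TopologicalSpace X] {R : Type*} [CommRing R] {S S0 S1 : Set X}
    (hS : IsOpen S) (hS0 : IsOpen S0) (hS1 : IsOpen S1) (hS0S : S0 ⊆ S) (hS1S : S1 ⊆ S)
    {ψ : C(I, X) → R} (hψ : IsCocycle S ψ) {z : X → ℂ} (hz : ContinuousOn z S)
    (hz0 : ∀ x ∈ S, z x ≠ 0) {s s0 s1 : X → R} {u0 u1 : R}
    (hs : ∀ γ : C(I, X), (∀ t, γ t ∈ S ∧ 0 < (z (γ t)).im) → s (γ 0) = ψ γ * s (γ 1))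
    (hs0 : ∀ γ : C(I, X), (∀ t, γ t ∈ S0 ∧ z (γ t) ∉ wall) → s0 (γ 0) = ψ γ * s0 (γ 1))
    (hs1 : ∀ γ : C(I, X), (∀ t, γ t ∈ S1 ∧ z (γ t) ∉ wall) → s1 (γ 0) = ψ γ * s1 (γ 1))
    (e0 : ∀ x ∈ S0, 0 < (z x).im → s0 x = if (z x).re < 0 then u0 * s x else s x)
    (e1 : ∀ x ∈ S1, 0 < (z x).im → s1 x = if (z x).re < 0 then u1 * s x else s x) :
    ∃ κ : C(I, X) → R, IsCrossed S ψ κ ∧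
      (∀ γ : C(I, X), (∀ t, γ t ∈ S ∧ z (γ t) ∉ wall) → κ γ = 0) ∧
      (∀ γ : C(I, X), (∀ t, γ t ∈ S0) → (1 - u0) * κ γ = principal ψ s0 γ) ∧
      (∀ γ : C(I, X), (∀ t, γ t ∈ S1) → (1 - u1) * κ γ = principal ψ s1 γ) := by
  classical
  let U : Bool → Set X := fun b => cond b {x | x ∈ S ∧ 0 < (z x).im} {x | x ∈ S ∧ z x ∉ wall}
  have hUo : ∀ b, IsOpen (U b) := by
    intro b
    cases b
    · have hc : IsClosed {w : ℂ | w.re = 0 ∧ 0 ≤ w.im} :=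
        (isClosed_eq Complex.continuous_re continuous_const).inter
          (isClosed_le continuous_const Complex.continuous_im)
      have h1 : IsOpen (S ∩ z ⁻¹' {w : ℂ | w.re = 0 ∧ 0 ≤ w.im}ᶜ) :=
        hz.isOpen_inter_preimage hS hc.isOpen_compl
      convert h1 using 1
      ext x
      refine and_congr_right fun hx => not_congr (and_congr_right fun hre => ⟨le_of_lt, fun h => ?_⟩)
      exact lt_of_le_of_ne h fun h' => hz0 x hx (Complex.ext hre h'.symm)
    · exact hz.isOpen_inter_preimage hS (isOpen_lt continuous_const Complex.continuous_im)
  have hUS : (⋃ b, U b) = S := by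
    ext x
    simp only [Set.mem_iUnion, Bool.exists_bool, U, cond_true, cond_false, Set.mem_ofPred_eq, wall]
    constructor
    · rintro (h | h) <;> exact h.1
    · intro h
      by_cases hw : (z x).re = 0 ∧ 0 < (z x).im
      · exact Or.inr ⟨h, hw.2⟩
      · exact Or.inl ⟨h, hw⟩
  let b : X → R := fun x => if (z x).re < 0 then 1 else 0
  let D : Bool → C(I, X) → R := fun c => cond c (fun γ => -principal ψ (fun x => s x * b x) γ)
    (fun _ => 0)
  have hagree : ∀ γ : C(I, X), (∀ t, γ t ∈ U true) → (∀ t, γ t ∈ U false) → D true γ = 0 := by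
    intro γ h1 h2
    have hb : b (γ 0) = b (γ 1) := by
      have : Continuous fun t => (z (γ t)).re :=
        Complex.continuous_re.comp (hz.comp_continuous γ.continuous fun t => (h1 t).1)
      have := sign_const this fun t h => (h2 t).2 ⟨h, (h1 t).2⟩
      simp only [b, this]
    change -principal ψ (fun x => s x * b x) γ = 0
    rw [principal, hb, hs γ fun t => h1 t]
    ring
  obtain ⟨κ, hκ, hκD⟩ := IsCrossed.exists_glue hUo (by rwa [hUS]) D (fun c => by
      have hsub : U c ⊆ S := by rw [← hUS]; exact Set.subset_iUnion U c
      cases c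
      · exact IsCrossed.zero
      · have := (isCrossed_principal (hψ.mono hsub) fun x => s x * b x).smul (-1)
        simpa [D] using this) (fun c c' γ h h' => by
      cases c <;> cases c'
      · rfl
      · exact (hagree γ h' h).symm
      · exact hagree γ h h'
      · rfl)
  rw [hUS] at hκ
  have aux : ∀ (S0 : Set X) (_ : IsOpen S0) (_ : S0 ⊆ S) (s0 : X → R) (u0 : R)
      (_ : ∀ γ : C(I, X), (∀ t, γ t ∈ S0 ∧ z (γ t) ∉ wall) → s0 (γ 0) = ψ γ * s0 (γ 1))
      (_ : ∀ x ∈ S0, 0 < (z x).im → s0 x = if (z x).re < 0 then u0 * s x else s x)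
      (γ : C(I, X)), (∀ t, γ t ∈ S0) → (1 - u0) * κ γ = principal ψ s0 γ := by
    intro S0 hS0 hS0S s0 u0 hs0 e0 γ hγ
    have hcov : (⋃ c, U c ∩ S0) = S0 := by
      rw [← Set.iUnion_inter, hUS, Set.inter_eq_right.2 hS0S]
    refine IsCrossed.eq_of_cover (U := fun c => U c ∩ S0) (δ := fun γ => (1 - u0) * κ γ)
      (δ' := principal ψ s0) (fun c => (hUo c).inter hS0)
      (by rw [hcov]; exact (hκ.mono hS0S).smul _)
      (by rw [hcov]; exact isCrossed_principal (hψ.mono hS0S) s0) ?_ γ (by rw [hcov]; exact hγ)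
    intro c γ hγ
    have hk := hκD c γ fun t => (hγ t).1
    cases c
    · have h2 := hs0 γ fun t => ⟨(hγ t).2, (hγ t).1.2⟩
      rw [hk, principal, h2]
      simp [D]
    · have h1 : ∀ t, s0 (γ t) = s (γ t) + (u0 - 1) * (s (γ t) * b (γ t)) := fun t => by
        rw [e0 _ (hγ t).2 (hγ t).1.2]
        simp only [b]
        split_ifs <;> ring
      have h2 := hs γ fun t => (hγ t).1
      rw [hk]
      change (1 - u0) * -principal ψ (fun x => s x * b x) γ = _
      simp only [principal, h1]
      linear_combination -h2
  exact ⟨κ, hκ, fun γ h => hκD false γ h, aux S0 hS0 hS0S s0 u0 hs0 e0,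
    aux S1 hS1 hS1S s1 u1 hs1 e1⟩

/-! Branches of the argument -/

/-- The argument with values in `(-π/2, 3π/2]`. -/
def argUp (w : ℂ) : ℝ := Complex.arg (-Complex.I * w) + Real.pi / 2

/-- The argument with values in `(-3π/2, π/2]`. -/
def argDown (w : ℂ) : ℝ := Complex.arg (Complex.I * w) - Real.pi / 2

lemma eq_norm_mul_exp_argUp (w : ℂ) : w = ‖w‖ * Complex.exp (argUp w * Complex.I) := by
  have h := Complex.norm_mul_exp_arg_mul_I (-Complex.I * w)
  rw [norm_mul, norm_neg, Complex.norm_I, one_mul] at h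
  rw [argUp, Complex.ofReal_add, add_mul, Complex.exp_add, ← mul_assoc, h]
  rw [show ((Real.pi / 2 : ℝ) : ℂ) * Complex.I = Real.pi / 2 * Complex.I by push_cast; ring,
    Complex.exp_pi_div_two_mul_I]
  linear_combination w * Complex.I_mul_I

lemma eq_norm_mul_exp_argDown (w : ℂ) : w = ‖w‖ * Complex.exp (argDown w * Complex.I) := by
  have h := Complex.norm_mul_exp_arg_mul_I (Complex.I * w)
  rw [norm_mul, Complex.norm_I, one_mul] at h
  rw [argDown, Complex.ofReal_sub, sub_mul, Complex.exp_sub, mul_div_assoc', h,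
    show ((Real.pi / 2 : ℝ) : ℂ) * Complex.I = Real.pi / 2 * Complex.I by push_cast; ring,
    Complex.exp_pi_div_two_mul_I]
  field_simp

lemma argUp_of_re_pos {q : ℂ} (h : 0 < q.re) : argUp q = Complex.arg q := by
  have hq : q ≠ 0 := by rintro rfl; simp at h
  have h2 : |q.arg| < Real.pi / 2 := Complex.abs_arg_lt_pi_div_two_iff.2 (Or.inl h)
  rw [abs_lt] at h2
  have : Complex.arg (-Complex.I * q) = Complex.arg (-Complex.I) + Complex.arg q := by
    refine Complex.arg_mul (by simp) hq ?_
    rw [Complex.arg_neg_I]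
    constructor <;> linarith
  rw [argUp, this, Complex.arg_neg_I]
  ring

lemma argUp_mul {z q : ℂ} (hz : 0 < z.im) (hq : 0 < q.re) : argUp (z * q) = argUp z + argUp q := by
  have hq0 : q ≠ 0 := by rintro rfl; simp at hq
  have hz0 : z ≠ 0 := by rintro rfl; simp at hz
  have h1 : |(-Complex.I * z).arg| < Real.pi / 2 :=
    Complex.abs_arg_lt_pi_div_two_iff.2 (Or.inl (by simpa using hz))
  have h2 : |q.arg| < Real.pi / 2 := Complex.abs_arg_lt_pi_div_two_iff.2 (Or.inl hq)
  rw [abs_lt] at h1 h2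
  have : Complex.arg (-Complex.I * z * q) = Complex.arg (-Complex.I * z) + Complex.arg q :=
    Complex.arg_mul (by simp [hz0]) hq0 ⟨by linarith, by linarith⟩
  rw [argUp_of_re_pos hq, argUp, argUp, ← mul_assoc, this]
  ring

lemma argUp_sub_argDown {z : ℂ} (hz : 0 < z.im) :
    argUp z - argDown z = if z.re < 0 then 2 * Real.pi else 0 := by
  have e : Complex.I * z = -(-Complex.I * z) := by ring
  have hre : 0 < (-Complex.I * z).re := by simpa using hz
  have him : (-Complex.I * z).im = -z.re := by simp
  rw [argUp, argDown, e]
  split_ifs with h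
  · rw [Complex.arg_neg_eq_arg_sub_pi_of_im_pos (by rw [him]; linarith)]
    ring
  · rcases (not_lt.1 h).eq_or_lt with h0 | h0
    · have : -Complex.I * z = ((z.im : ℝ) : ℂ) := by
        apply Complex.ext
        · simp
        · rw [him, ← h0]; simp
      rw [this, ← Complex.ofReal_neg, Complex.arg_ofReal_of_nonneg hz.le,
        Complex.arg_ofReal_of_neg (by linarith)]
      ring
    · rw [Complex.arg_neg_eq_arg_add_pi_of_im_neg (by rw [him]; linarith)]
      ring

lemma ang_eq_argUp (c : C(I, ℂ)) (h : ∀ t, -Complex.I * c t ∈ Complex.slitPlane) :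
    ang c = argUp (c 1) - argUp (c 0) := by
  refine ang_eq_of_arg c (fun t h0 => Complex.slitPlane_ne_zero (h t) (by simp [h0]))
    (fun t => argUp (c t)) ?_ fun t => eq_norm_mul_exp_argUp _
  refine Continuous.add (continuous_iff_continuousAt.2 fun t => ?_) continuous_const
  exact (Complex.continuousAt_arg (h t)).comp (f := fun t => -Complex.I * c t) (by fun_prop)

lemma ang_eq_argDown (c : C(I, ℂ)) (h : ∀ t, Complex.I * c t ∈ Complex.slitPlane) :
    ang c = argDown (c 1) - argDown (c 0) := by
  refine ang_eq_of_arg c (fun t h0 => Complex.slitPlane_ne_zero (h t) (by simp [h0]))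
    (fun t => argDown (c t)) ?_ fun t => eq_norm_mul_exp_argDown _
  refine Continuous.sub (continuous_iff_continuousAt.2 fun t => ?_) continuous_const
  exact (Complex.continuousAt_arg (h t)).comp (f := fun t => Complex.I * c t) (by fun_prop)

lemma I_mul_mem_slitPlane {z : ℂ} (hz : z ≠ 0) (h : z ∉ wall) : Complex.I * z ∈ Complex.slitPlane := by
  rw [Complex.mem_slitPlane_iff]
  by_contra hcon
  push Not at hcon
  simp at hcon
  refine h ⟨hcon.2, lt_of_le_of_ne hcon.1 fun h' => hz (Complex.ext hcon.2 h'.symm)⟩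

lemma ang_const_mul (c : C(I, ℂ)) (hc : ∀ t, c t ≠ 0) {k : ℂ} (hk : k ≠ 0) :
    ang (fun t => k * c t) = ang c := by
  obtain ⟨L, hL⟩ := exists_log c hc
  rw [ang_eq L hL, ang_eq ⟨fun t => Complex.log k + L t, by fun_prop⟩]
  · simp
  · intro t; simp [Complex.exp_add, hL, Complex.exp_log hk]

lemma exists_int_ang (c : C(I, ℂ)) (hc : ∀ t, c t ≠ 0) :
    ∃ n : ℤ, ang c - (Complex.arg (c 1) - Complex.arg (c 0)) = 2 * Real.pi * n := by
  obtain ⟨L, hL⟩ := exists_log c hc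
  have key : ∀ t, ∃ n : ℤ, (L t).im = Complex.arg (c t) + 2 * Real.pi * n := fun t => by
    have : Complex.exp (L t) = Complex.exp (Complex.log (c t)) := by
      rw [hL, Complex.exp_log (hc t)]
    obtain ⟨n, hn⟩ := Complex.exp_eq_exp_iff_exists_int.1 this
    refine ⟨n, ?_⟩
    have := congrArg Complex.im hn
    simp [Complex.log_im] at this
    rw [this]; ring
  obtain ⟨n, hn⟩ := key 1
  obtain ⟨m, hm⟩ := key 0
  refine ⟨n - m, ?_⟩
  rw [ang_eq L hL, Complex.sub_im, hn, hm]
  push_cast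
  ring

namespace Arr

variable {ι : Type*} [Fintype ι] [DecidableEq ι] {A : Arr ι}

/-- The flat section attached to a choice `B` of angles relative to the two reference forms. -/
def sec (A : Arr ι) (χ : ι → ℤ) (t : ι → ℝ) (J : Finset ι) (b k : ι) (B : ι → ℝ) (x : E3) :
    C(ℝ, ℂ) :=
  ex χ t fun j => -(B j + Complex.arg (A.f (if j ∈ J then b else k) x))

/-- The total exponents over `J` and its complement are trivial. -/
structure Balanced (χ : ι → ℤ) (t : ι → ℝ) (J : Finset ι) : Prop where
  even : Even (∑ j ∈ J, χ j)
  even' : Even (∑ j ∈ Jᶜ, χ j)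
  sum : ∑ j ∈ J, t j = 0
  sum' : ∑ j ∈ Jᶜ, t j = 0

lemma Theta_f_eq (γ : C(I, E3)) (hγ : ∀ s, γ s ∈ A.M) (j b : ι) {k : ℂ} (hk : k ≠ 0) :
    Theta (A.f j) γ = Theta (A.f b) γ + ang (fun s => k * A.f j (γ s) / A.f b (γ s)) := by
  have hc : Continuous fun s => k * A.f j (γ s) / A.f b (γ s) :=
    Continuous.div (by fun_prop) (by fun_prop) fun s => hγ s b
  have h1 := ang_mul ⟨fun s => A.f b (γ s), by fun_prop⟩ ⟨_, hc⟩ (fun s => hγ s b)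
    (fun s => div_ne_zero (mul_ne_zero hk (hγ s j)) (hγ s b))
  have h2 := ang_const_mul ⟨fun s => A.f j (γ s), by fun_prop⟩ (fun s => hγ s j) hk
  simp only [ContinuousMap.coe_mk] at h1 h2
  rw [Theta, Theta, ← h2, ← h1]
  congr 1
  funext s
  rw [mul_div_cancel₀]
  exact hγ s b

lemma sec_flat {χ : ι → ℤ} {t : ι → ℝ} {J : Finset ι} (hJ : Balanced χ t J) {b k : ι}
    (B : E3 → ι → ℝ) (γ : C(I, E3)) (hγ : ∀ s, γ s ∈ A.M)
    (h1 : ∀ j ∈ J, Theta (A.f j) γ = Theta (A.f b) γ + (B (γ 1) j - B (γ 0) j))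
    (h2 : ∀ j ∉ J, Theta (A.f j) γ = Theta (A.f k) γ + (B (γ 1) j - B (γ 0) j)) :
    A.sec χ t J b k (B (γ 0)) (γ 0) = A.psi χ t γ * A.sec χ t J b k (B (γ 1)) (γ 1) := by
  obtain ⟨n, hn⟩ := exists_int_ang ⟨fun s => A.f b (γ s), by fun_prop⟩ fun s => hγ s b
  obtain ⟨m, hm⟩ := exists_int_ang ⟨fun s => A.f k (γ s), by fun_prop⟩ fun s => hγ s k
  change Theta (A.f b) γ - _ = _ at hn
  change Theta (A.f k) γ - _ = _ at hm
  simp only [ContinuousMap.coe_mk] at hn hm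
  have hv : ex χ t (fun j => 2 * Real.pi * ((if j ∈ J then n else m : ℤ) : ℝ)) = 1 := by
    refine ex_eq_one χ t ?_ ?_
    · rw [← Finset.sum_add_sum_compl J]
      refine Even.add ?_ ?_
      · rw [Finset.sum_congr rfl fun j hj => by rw [if_pos hj], ← Finset.sum_mul]
        exact hJ.even.mul_right _
      · rw [Finset.sum_congr rfl fun j hj => by rw [if_neg (Finset.mem_compl.1 hj)],
          ← Finset.sum_mul]
        exact hJ.even'.mul_right _
    · rw [← Finset.sum_add_sum_compl J, Finset.sum_congr rfl fun j hj => by rw [if_pos hj],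
        Finset.sum_congr (s₁ := Jᶜ) rfl fun j hj => by rw [if_neg (Finset.mem_compl.1 hj)],
        ← Finset.sum_mul, ← Finset.sum_mul, hJ.sum, hJ.sum', zero_mul, zero_mul, add_zero]
  rw [psi, sec, sec, ← ex_add, ← mul_one (ex χ t _), ← hv, ← ex_add]
  congr 1
  funext j
  by_cases hj : j ∈ J
  · simp only [hj, if_true, h1 j hj]
    linarith
  · simp only [hj, if_false, h2 j hj]
    linarith

lemma sec_eq_mul {χ : ι → ℤ} {t : ι → ℝ} {J : Finset ι} {b k : ι} (B B' : ι → ℝ) (x : E3) :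
    A.sec χ t J b k B x = ex χ t (fun j => B' j - B j) * A.sec χ t J b k B' x := by
  rw [sec, sec, ← ex_add]
  congr 1
  funext j
  ring

/-- A chain of three different flats does not exist. -/
lemma eq_of_three {s₁ s₂ s₃ : Finset ι} (h1 : A.IsFlat s₁) (h2 : A.IsFlat s₂) (h3 : A.IsFlat s₃)
    {η : ℝ} (hη : η ≤ 1) {x : E3} (x1 : x ∈ A.V s₁ η) (x2 : x ∈ A.V s₂ η) (x3 : x ∈ A.V s₃ η) :
    s₁ = s₂ ∨ s₁ = s₃ ∨ s₂ = s₃ := by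
  have single : ∀ i j : ι, ({i} : Finset ι) ⊆ {j} → ({i} : Finset ι) = {j} := by
    intro i j h; simpa using h
  have key : ∀ s s' : Finset ι, A.IsFlat s → A.IsFlat s' → x ∈ A.V s η → x ∈ A.V s' η →
      s = s' ∨ (∃ i, s = {i}) ∨ ∃ i, s' = {i} := by
    intro s s' h h' hx hx'
    rcases V_comparable hη hx hx' with hss | hss
    · rcases h.eq_or_single h' hss with e | e
      · exact Or.inl e
      · exact Or.inr (Or.inl e)
    · rcases h'.eq_or_single h hss with e | e
      · exact Or.inl e.symm
      · exact Or.inr (Or.inr e)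
  have ss : ∀ i j : ι, x ∈ A.V {i} η → x ∈ A.V {j} η → ({i} : Finset ι) = {j} := by
    intro i j hi hj
    rcases V_comparable hη hi hj with h | h
    · exact single _ _ h
    · exact (single _ _ h).symm
  rcases key _ _ h1 h2 x1 x2 with e | ⟨i, rfl⟩ | ⟨i, rfl⟩
  · exact Or.inl e
  · rcases key _ _ h2 h3 x2 x3 with e | ⟨j, rfl⟩ | ⟨j, rfl⟩
    · exact Or.inr (Or.inr e)
    · exact Or.inl (ss _ _ x1 x2)
    · exact Or.inr (Or.inl (ss _ _ x1 x3))
  · rcases key _ _ h1 h3 x1 x3 with e | ⟨j, rfl⟩ | ⟨j, rfl⟩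
    · exact Or.inr (Or.inl e)
    · exact Or.inl (ss _ _ x1 x2)
    · exact Or.inr (Or.inr (ss _ _ x2 x3))

/-- The union of the neighbourhoods of all flats. -/
def N (A : Arr ι) (η : ℝ) : Set E3 := ⋃ s ∈ {s | A.IsFlat s}, A.V s η

lemma N_mono {η η' : ℝ} (h : η ≤ η') : A.N η ⊆ A.N η' :=
  Set.iUnion₂_mono fun _ _ => V_mono h

lemma N_subset_M {η : ℝ} : A.N η ⊆ A.M := Set.iUnion₂_subset fun _ _ => V_subset_M

lemma V_subset_N {s : Finset ι} (hs : A.IsFlat s) {η : ℝ} : A.V s η ⊆ A.N η :=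
  Set.subset_biUnion_of_mem (u := fun s => A.V s η) hs

/-- The exponent vector of a set of lines. -/
def uu (χ : ι → ℤ) (t : ι → ℝ) (G : Finset ι) : C(ℝ, ℂ) :=
  ex χ t fun j => 2 * Real.pi * (if j ∈ G then (1 : ℤ) else 0 : ℤ)

lemma uu_apply (χ : ι → ℤ) (t : ι → ℝ) (G : Finset ι) (ε : ℝ) : uu χ t G ε =
    Complex.exp ((∑ j ∈ G, χ j : ℤ) * (Real.pi * Complex.I) + ε * (∑ j ∈ G, t j : ℝ)) := by
  rw [uu, ex_apply_two_pi]
  simp [Finset.sum_ite_mem]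

/-- The data of a wall near the flat `v`, reaching from `w0` to `w1`. -/
structure WallData (A : Arr ι) (η : ℝ) (v w0 w1 : Finset ι) where
  J : Finset ι
  G0 : Finset ι
  G1 : Finset ι
  a : ι
  b : ι
  k : ι
  c : ℝ
  sg : ι → ℝ
  c_ne : c ≠ 0
  sg_ne : ∀ j, sg j ≠ 0
  up : ∀ x ∈ A.V v η, 0 < (c * A.f a x / A.f b x).im → ∀ j ∈ J,
    -Complex.I * (sg j * A.f j x / A.f b x) ∈ Complex.slitPlane
  out : ∀ x ∈ A.V v η, ∀ j ∉ J, -Complex.I * (sg j * A.f j x / A.f k x) ∈ Complex.slitPlane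
  re0 : ∀ x ∈ A.V v η, x ∈ A.V w0 η → ∀ j ∈ G0, 0 < (sg j * A.f j x / (c * A.f a x)).re
  up0 : ∀ x ∈ A.V v η, x ∈ A.V w0 η → ∀ j ∈ J, j ∉ G0 →
    -Complex.I * (sg j * A.f j x / A.f b x) ∈ Complex.slitPlane
  re1 : ∀ x ∈ A.V v η, x ∈ A.V w1 η → ∀ j ∈ J, j ∉ G1 → 0 < (sg j * A.f j x / (c * A.f a x)).re
  up1 : ∀ x ∈ A.V v η, x ∈ A.V w1 η → ∀ j ∈ G1,
    -Complex.I * (sg j * A.f j x / A.f b x) ∈ Complex.slitPlane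
  sub0 : G0 ⊆ J
  sub1 : G1 ⊆ J
  off : ∀ u, A.IsFlat u → u ≠ v → u ≠ w0 → u ≠ w1 → ∀ x ∈ A.V v η, x ∈ A.V u η →
    (c * A.f a x / A.f b x : ℂ) ∉ wall

namespace WallData

variable {η : ℝ} {v w0 w1 : Finset ι} (W : WallData A η v w0 w1)

def z (x : E3) : ℂ := W.c * A.f W.a x / A.f W.b x

def angU (x : E3) (j : ι) : ℝ :=
  if j ∈ W.J then argUp (W.sg j * A.f j x / A.f W.b x) else argUp (W.sg j * A.f j x / A.f W.k x)

def angD (G : Finset ι) (x : E3) (j : ι) : ℝ :=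
  if j ∈ G then argDown (W.z x) + argUp (W.sg j * A.f j x / (W.c * A.f W.a x)) else W.angU x j

/-- The flat section near `w0`. -/
def s0 (χ : ι → ℤ) (t : ι → ℝ) (x : E3) : C(ℝ, ℂ) := A.sec χ t W.J W.b W.k (W.angD W.G0 x) x

/-- The flat section near `w1`. -/
def s1 (χ : ι → ℤ) (t : ι → ℝ) (x : E3) : C(ℝ, ℂ) :=
  A.sec χ t W.J W.b W.k (W.angD (W.J \ W.G1) x) x

lemma z_ne {x : E3} (hx : x ∈ A.M) : W.z x ≠ 0 :=
  div_ne_zero (mul_ne_zero (by exact_mod_cast W.c_ne) (hx _)) (hx _)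

lemma continuousOn_z : ContinuousOn W.z A.M :=
  ContinuousOn.div (by fun_prop) (by fun_prop) fun x hx => hx _

lemma Theta_up (γ : C(I, E3)) (hγ : ∀ s, γ s ∈ A.M) (j b : ι)
    (h : ∀ s, -Complex.I * (W.sg j * A.f j (γ s) / A.f b (γ s)) ∈ Complex.slitPlane) :
    Theta (A.f j) γ = Theta (A.f b) γ + (argUp (W.sg j * A.f j (γ 1) / A.f b (γ 1)) -
      argUp (W.sg j * A.f j (γ 0) / A.f b (γ 0))) := by
  rw [Theta_f_eq γ hγ j b (k := W.sg j) (by exact_mod_cast W.sg_ne j)]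
  congr 1
  exact ang_eq_argUp ⟨_, Continuous.div (by fun_prop) (by fun_prop) fun s => hγ s b⟩ h

lemma Theta_down (γ : C(I, E3)) (hγ : ∀ s, γ s ∈ A.M) (j : ι)
    (h : ∀ s, 0 < (W.sg j * A.f j (γ s) / (W.c * A.f W.a (γ s))).re)
    (hw : ∀ s, W.z (γ s) ∉ wall) :
    Theta (A.f j) γ = Theta (A.f W.b) γ + ((argDown (W.z (γ 1)) +
      argUp (W.sg j * A.f j (γ 1) / (W.c * A.f W.a (γ 1)))) - (argDown (W.z (γ 0)) +
      argUp (W.sg j * A.f j (γ 0) / (W.c * A.f W.a (γ 0))))) := by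
  have hc : (W.c : ℂ) ≠ 0 := by exact_mod_cast W.c_ne
  have hcz : Continuous fun s => W.z (γ s) := W.continuousOn_z.comp_continuous γ.continuous hγ
  have hcq : Continuous fun s => W.sg j * A.f j (γ s) / (W.c * A.f W.a (γ s)) :=
    Continuous.div (by fun_prop) (by fun_prop) fun s => mul_ne_zero hc (hγ s _)
  rw [Theta_f_eq γ hγ j W.b (k := W.sg j) (by exact_mod_cast W.sg_ne j)]
  congr 1
  have h1 := ang_mul ⟨_, hcz⟩ ⟨_, hcq⟩ (fun s => W.z_ne (hγ s)) (fun s h0 => by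
    have := h s; simp only [ContinuousMap.coe_mk] at h0; rw [h0] at this; simp at this)
  have h2 := ang_eq_argDown ⟨_, hcz⟩ fun s => I_mul_mem_slitPlane (W.z_ne (hγ s)) (hw s)
  have h3 := ang_eq_argUp ⟨_, hcq⟩ fun s => by
    rw [Complex.mem_slitPlane_iff]
    right
    simpa using (h s).ne'
  simp only [ContinuousMap.coe_mk] at h1 h2 h3
  rw [h2, h3] at h1
  rw [add_sub_add_comm, ← h1]
  congr 1
  funext s
  have := hγ s W.a
  have := hγ s W.b
  rw [z]
  field_simp

variable {χ : ι → ℤ} {t : ι → ℝ}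

/-- The angles near `w0` and near `w1` are treated alike. -/
lemma flat_aux (hJ : Balanced χ t W.J) (G : Finset ι) (hG : G ⊆ W.J) (w : Finset ι)
    (hre : ∀ x ∈ A.V v η, x ∈ A.V w η → ∀ j ∈ G, 0 < (W.sg j * A.f j x / (W.c * A.f W.a x)).re)
    (hup : ∀ x ∈ A.V v η, x ∈ A.V w η → ∀ j ∈ W.J, j ∉ G →
      -Complex.I * (W.sg j * A.f j x / A.f W.b x) ∈ Complex.slitPlane) (γ : C(I, E3))
    (hγ : ∀ s, γ s ∈ A.V v η ∩ A.V w η ∧ W.z (γ s) ∉ wall) :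
    A.sec χ t W.J W.b W.k (W.angD G (γ 0)) (γ 0) =
      A.psi χ t γ * A.sec χ t W.J W.b W.k (W.angD G (γ 1)) (γ 1) := by
  have hM : ∀ s, γ s ∈ A.M := fun s => (hγ s).1.1.1
  refine sec_flat hJ (W.angD G) γ hM (fun j hj => ?_) fun j hj => ?_
  · by_cases hjG : j ∈ G
    · simp only [angD, if_pos hjG]
      exact W.Theta_down γ hM j (fun s => hre _ (hγ s).1.1 (hγ s).1.2 j hjG) fun s => (hγ s).2
    · simp only [angD, if_neg hjG, angU, if_pos hj]
      exact W.Theta_up γ hM j W.b fun s => hup _ (hγ s).1.1 (hγ s).1.2 j hj hjG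
  · have hjG : j ∉ G := fun h => hj (hG h)
    simp only [angD, if_neg hjG, angU, if_neg hj]
    exact W.Theta_up γ hM j W.k fun s => W.out _ (hγ s).1.1 j hj

lemma jump_aux (G : Finset ι) (hG : G ⊆ W.J) {x : E3} (hx : x ∈ A.M)
    (hre : ∀ j ∈ G, 0 < (W.sg j * A.f j x / (W.c * A.f W.a x)).re) (him : 0 < (W.z x).im) :
    A.sec χ t W.J W.b W.k (W.angD G x) x = if (W.z x).re < 0 then
      uu χ t G * A.sec χ t W.J W.b W.k (W.angU x) x else A.sec χ t W.J W.b W.k (W.angU x) x := by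
  have hc : (W.c : ℂ) ≠ 0 := by exact_mod_cast W.c_ne
  have key : ∀ j, W.angU x j - W.angD G x j =
      if j ∈ G then (if (W.z x).re < 0 then 2 * Real.pi else 0) else 0 := by
    intro j
    by_cases hj : j ∈ G
    · have e : W.sg j * A.f j x / A.f W.b x = W.z x * (W.sg j * A.f j x / (W.c * A.f W.a x)) := by
        have := hx W.a
        have := hx W.b
        rw [z]; field_simp
      rw [angD, if_pos hj, angU, if_pos (hG hj), e, argUp_mul him (hre j hj), if_pos hj,
        ← argUp_sub_argDown him]
      ring
    · rw [angD, if_neg hj, if_neg hj, sub_self]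
  rw [sec_eq_mul (W.angD G x) (W.angU x) x]
  simp only [key]
  split_ifs with h
  · congr 1
    rw [uu]
    congr 1
    funext j
    split_ifs <;> simp
  · simp [ex_zero]

/-- The function whose coboundary is subtracted. -/
def F (χ : ι → ℤ) (t : ι → ℝ) (x : E3) : C(ℝ, ℂ) :=
  open Classical in
  if x ∈ A.V w0 η then (1 - uu χ t (W.J \ W.G1)) * W.s0 χ t x
  else if x ∈ A.V w1 η then (1 - uu χ t W.G0) * W.s1 χ t x else 0

/-- Every wall carries a crossed homomorphism. -/
theorem exists_class (hη : η ≤ 1) (hv : A.IsFlat v) (hw0 : A.IsFlat w0) (hw1 : A.IsFlat w1)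
    (h0v : w0 ≠ v) (h1v : w1 ≠ v) (h01 : w0 ≠ w1) (hJ : Balanced χ t W.J) :
    ∃ Ecl : C(I, E3) → C(ℝ, ℂ), IsCrossed (A.N η) (A.psi χ t) Ecl ∧
      (∀ u, A.IsFlat u → u ≠ v → ∀ γ : C(I, E3), (∀ s, γ s ∈ A.V u η) → Ecl γ = 0) ∧
      (∀ γ : C(I, E3), (∀ s, γ s ∈ A.V v η ∧ W.z (γ s) ∉ wall) →
        Ecl γ = -principal (A.psi χ t) (W.F χ t) γ) ∧
      (∀ γ : C(I, E3), (∀ s, γ s ∈ A.V v η) → ∀ ε, uu χ t W.G0 ε = 1 →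
        Ecl γ ε = -principal (A.psi χ t) (W.F χ t) γ ε) := by
  classical
  have hψ := isCocycle_psi (A := A) χ t
  have hsubD : W.J \ W.G1 ⊆ W.J := Finset.sdiff_subset
  obtain ⟨κ, hκ, hκm, hκ0, hκ1⟩ := exists_wall (isOpen_V v η) ((isOpen_V v η).inter (isOpen_V w0 η))
    ((isOpen_V v η).inter (isOpen_V w1 η)) Set.inter_subset_left Set.inter_subset_left
    (hψ.mono V_subset_M) (W.continuousOn_z.mono V_subset_M) (fun x hx => W.z_ne hx.1)
    (s := fun x => A.sec χ t W.J W.b W.k (W.angU x) x) (s0 := W.s0 χ t) (s1 := W.s1 χ t)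
    (u0 := uu χ t W.G0) (u1 := uu χ t (W.J \ W.G1))
    (fun γ hγ => by
      have hM : ∀ s, γ s ∈ A.M := fun s => (hγ s).1.1
      refine sec_flat hJ W.angU γ hM (fun j hj => ?_) fun j hj => ?_
      · simp only [angU, if_pos hj]
        exact W.Theta_up γ hM j W.b fun s => W.up _ (hγ s).1 (hγ s).2 j hj
      · simp only [angU, if_neg hj]
        exact W.Theta_up γ hM j W.k fun s => W.out _ (hγ s).1 j hj)
    (W.flat_aux hJ W.G0 W.sub0 w0 W.re0 W.up0)
    (W.flat_aux hJ _ hsubD w1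
      (fun x hx hx' j hj => W.re1 x hx hx' j (Finset.mem_sdiff.1 hj).1 (Finset.mem_sdiff.1 hj).2)
      (fun x hx hx' j hj hj' => W.up1 x hx hx' j (by
        by_contra h; exact hj' (Finset.mem_sdiff.2 ⟨hj, h⟩))))
    (fun x hx him => W.jump_aux W.G0 W.sub0 hx.1.1 (W.re0 x hx.1 hx.2) him)
    (fun x hx him => W.jump_aux _ hsubD hx.1.1 (fun j hj => W.re1 x hx.1 hx.2 j
      (Finset.mem_sdiff.1 hj).1 (Finset.mem_sdiff.1 hj).2) him)
  set u0 := uu χ t W.G0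
  set u1 := uu χ t (W.J \ W.G1)
  let EX : C(I, E3) → C(ℝ, ℂ) := fun γ =>
    (1 - u1) * (1 - u0) * κ γ - principal (A.psi χ t) (W.F χ t) γ
  have hEX : IsCrossed (A.V v η) (A.psi χ t) EX :=
    (hκ.smul _).sub (isCrossed_principal (hψ.mono V_subset_M) _)
  have hF0 : ∀ x ∈ A.V w0 η, W.F χ t x = (1 - u1) * W.s0 χ t x := fun x hx => by
    rw [F, if_pos hx]
  have hF1 : ∀ x ∈ A.V v η, x ∈ A.V w1 η → W.F χ t x = (1 - u0) * W.s1 χ t x := fun x hx hx' => by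
    have : x ∉ A.V w0 η := fun h => by
      rcases eq_of_three hv hw0 hw1 hη hx h hx' with e | e | e
      · exact h0v e.symm
      · exact h1v e.symm
      · exact h01 e
    rw [F, if_neg this, if_pos hx']
  have hFn : ∀ u, A.IsFlat u → u ≠ v → u ≠ w0 → u ≠ w1 → ∀ x ∈ A.V v η, x ∈ A.V u η →
      W.F χ t x = 0 := fun u hu huv hu0 hu1 x hx hxu => by
    have h0 : x ∉ A.V w0 η := fun h => by
      rcases eq_of_three hv hw0 hu hη hx h hxu with e | e | e
      · exact h0v e.symm
      · exact huv e.symm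
      · exact hu0 e.symm
    have h1 : x ∉ A.V w1 η := fun h => by
      rcases eq_of_three hv hw1 hu hη hx h hxu with e | e | e
      · exact h1v e.symm
      · exact huv e.symm
      · exact hu1 e.symm
    rw [F, if_neg h0, if_neg h1]
  have hzero : ∀ u, A.IsFlat u → u ≠ v → ∀ γ : C(I, E3), (∀ s, γ s ∈ A.V v η) →
      (∀ s, γ s ∈ A.V u η) → EX γ = 0 := by
    intro u hu huv γ hγ hγu
    by_cases h0 : u = w0
    · subst h0
      have := hκ0 γ fun s => ⟨hγ s, hγu s⟩
      simp only [EX, principal, hF0 _ (hγu _)] at this ⊢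
      linear_combination (1 - u1) * this
    by_cases h1 : u = w1
    · subst h1
      have := hκ1 γ fun s => ⟨hγ s, hγu s⟩
      simp only [EX, principal, hF1 _ (hγ _) (hγu _)] at this ⊢
      linear_combination (1 - u0) * this
    · have := hκm γ fun s => ⟨hγ s, W.off u hu huv h0 h1 _ (hγ s) (hγu s)⟩
      simp only [EX, principal, hFn u hu huv h0 h1 _ (hγ _) (hγu _), this]
      ring
  let Fl := {s : Finset ι // A.IsFlat s}
  have hN : (⋃ s : Fl, A.V s.1 η) = A.N η := by
    rw [N, Set.biUnion_eq_iUnion]; rfl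
  obtain ⟨Ecl, hE, hED⟩ := IsCrossed.exists_glue (U := fun s : Fl => A.V s.1 η)
    (fun s => isOpen_V s.1 η) (by rw [hN]; exact hψ.mono N_subset_M)
    (fun s γ => if s.1 = v then EX γ else 0) (fun s => by
      by_cases h : s.1 = v
      · simp only [h, if_true]; exact hEX
      · simp only [h, if_false]; exact IsCrossed.zero) (fun s s' γ h h' => by
      by_cases e : s.1 = v
      · by_cases e' : s'.1 = v
        · simp [e, e']
        · simp only [e, e', if_true, if_false]
          exact hzero s'.1 s'.2 e' γ (by rw [← e]; exact h) h'
      · by_cases e' : s'.1 = v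
        · simp only [e, e', if_true, if_false]
          exact (hzero s.1 s.2 e γ (by rw [← e']; exact h') h).symm
        · simp [e, e'])
  rw [hN] at hE
  have hEv : ∀ γ : C(I, E3), (∀ s, γ s ∈ A.V v η) → Ecl γ = EX γ := fun γ hγ => by
    have := hED ⟨v, hv⟩ γ hγ
    simpa using this
  refine ⟨Ecl, hE, fun u hu huv γ hγ => ?_, fun γ hγ => ?_, fun γ hγ ε hε => ?_⟩
  · have := hED ⟨u, hu⟩ γ hγ
    simpa [huv] using this
  · rw [hEv γ fun s => (hγ s).1]
    simp only [EX, hκm γ hγ]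
    ring
  · rw [hEv γ hγ]
    simp [EX, hε]

end WallData
end Arr

end

section

open unitInterval Topology

/-! ### Walls near lines and triple points -/

lemma slit_of_im_nonneg {w y : ℂ} (hw : w ≠ 0) (h : ‖w - y‖ ≤ ‖w‖ / 4) (hy : 0 ≤ y.im) :
    -Complex.I * w ∈ Complex.slitPlane := by
  rw [Complex.mem_slitPlane_iff]
  by_contra hcon
  push Not at hcon
  simp at hcon
  obtain ⟨h1, h2⟩ := hcon
  have hn : ‖w‖ = -w.im := by
    rw [Complex.norm_eq_sqrt_sq_add_sq, h2]
    rw [show (0 : ℝ) ^ 2 + w.im ^ 2 = (-w.im) ^ 2 by ring, Real.sqrt_sq (by linarith)]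
  have h3 := Complex.abs_im_le_norm (w - y)
  rw [Complex.sub_im, abs_le] at h3
  have : 0 < ‖w‖ := norm_pos_iff.2 hw
  linarith [h3.1]

lemma slit_of_near_real {w y : ℂ} (hw : w ≠ 0) (h : ‖w - y‖ ≤ ‖w‖ / 4) (hy : |y.im| ≤ |y.re| / 2) :
    -Complex.I * w ∈ Complex.slitPlane := by
  rw [Complex.mem_slitPlane_iff]
  by_contra hcon
  push Not at hcon
  simp at hcon
  obtain ⟨h1, h2⟩ := hcon
  have hn : ‖w‖ = -w.im := by
    rw [Complex.norm_eq_sqrt_sq_add_sq, h2]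
    rw [show (0 : ℝ) ^ 2 + w.im ^ 2 = (-w.im) ^ 2 by ring, Real.sqrt_sq (by linarith)]
  have h3 := Complex.abs_im_le_norm (w - y)
  have h4 := Complex.abs_re_le_norm (w - y)
  rw [Complex.sub_im, abs_le] at h3
  rw [Complex.sub_re, h2, zero_sub, abs_neg] at h4
  have : 0 < ‖w‖ := norm_pos_iff.2 hw
  linarith [h3.1, neg_abs_le y.im]

lemma re_pos_of_near {q Y : ℂ} {p : ℝ} (hp : 0 < p) (h : ‖q - Y‖ ≤ ‖q‖ / 4)
    (hY : ‖Y - p‖ ≤ p / 4) : 0 < q.re := by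
  have h1 := Complex.abs_re_le_norm (q - Y)
  have h2 := Complex.abs_re_le_norm (Y - p)
  rw [Complex.sub_re, abs_le] at h1 h2
  rw [Complex.ofReal_re] at h2
  have h3 : ‖q‖ ≤ ‖q - Y‖ + ‖Y - p‖ + ‖(p : ℂ)‖ := by
    calc ‖q‖ = ‖(q - Y) + (Y - p) + p‖ := by congr 1; ring
      _ ≤ _ := norm_add₃_le
  rw [Complex.norm_real, Real.norm_eq_abs, abs_of_pos hp] at h3
  linarith [h1.1, h2.1]

namespace Arr

variable {ι : Type*} [Fintype ι] [DecidableEq ι] {A : Arr ι}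

/-- Walls from approximate coordinates. -/
def WallData.mk' {η : ℝ} {v w0 w1 : Finset ι} (hη : 4 * A.K ^ 2 * η ≤ 1)
    (J G0 G1 : Finset ι) (a b k : ι) (c : ℝ) (hc : |c| = 1) (cj dj : ι → ℝ)
    (hrem : ∀ x ∈ A.V v η, ∀ j ∈ J,
      ‖A.f j x - (cj j * (c * A.f a x) + dj j * A.f b x)‖ ≤ ‖A.f j x‖ / 4)
    (hout : ∀ x ∈ A.V v η, ∀ j ∉ J, ∃ e : ℝ, ‖A.f j x - e * A.f k x‖ ≤ ‖A.f j x‖ / 4)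
    (hc0 : ∀ j ∈ J, cj j = 0 ↔ j ∈ G1) (hd0 : ∀ j ∈ J, dj j = 0 ↔ j ∈ G0)
    (hcK : ∀ j, |cj j| ≤ A.K) (hdK : ∀ j, |dj j| ≤ A.K)
    (hcK' : ∀ j, cj j ≠ 0 → A.K⁻¹ ≤ |cj j|) (hdK' : ∀ j, dj j ≠ 0 → A.K⁻¹ ≤ |dj j|)
    (sub0 : G0 ⊆ J) (sub1 : G1 ⊆ J)
    (h0 : ∀ x ∈ A.V v η, x ∈ A.V w0 η → ‖A.f a x‖ < η * ‖A.f b x‖)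
    (h1 : ∀ x ∈ A.V v η, x ∈ A.V w1 η → ‖A.f b x‖ < η * ‖A.f a x‖)
    (hoff : ∀ u, A.IsFlat u → u ≠ v → u ≠ w0 → u ≠ w1 → ∀ x ∈ A.V v η, x ∈ A.V u η →
      ∃ j ∈ J, j ∉ G0 ∧ j ∉ G1 ∧ ‖A.f j x‖ < η * ‖A.f b x‖) : WallData A η v w0 w1 := by
  have hK := A.one_le_K
  have hKp : 0 < A.K := by linarith
  have hcn : c ≠ 0 := by rintro rfl; simp at hc
  have hcn' : (c : ℂ) ≠ 0 := by exact_mod_cast hcn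
  have hcc : ‖(c : ℂ)‖ = 1 := by rw [Complex.norm_real, Real.norm_eq_abs, hc]
  let sg : ι → ℝ := fun j => if cj j < 0 then -1 else 1
  have hsg : ∀ j, |sg j| = 1 := fun j => by simp only [sg]; split_ifs <;> simp
  have hsgn : ∀ j, sg j ≠ 0 := fun j h => by have := hsg j; rw [h] at this; simp at this
  have hsgc : ∀ j, sg j * cj j = |cj j| := fun j => by
    simp only [sg]
    split_ifs with h
    · rw [abs_of_neg h]; ring
    · rw [abs_of_nonneg (not_lt.1 h)]; ring
  have hsgc' : ∀ j, (sg j : ℂ) * cj j = (|cj j| : ℝ) := fun j => by rw [← hsgc]; push_cast; ring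
  have hns : ∀ j, ‖(sg j : ℂ)‖ = 1 := fun j => by
    rw [Complex.norm_real, Real.norm_eq_abs, hsg]
  -- approximation of the quotients by the second and by the first reference form
  have hb : ∀ x ∈ A.V v η, ∀ j ∈ J, ‖sg j * A.f j x / A.f b x -
      ((|cj j| : ℝ) * (c * A.f a x / A.f b x) + sg j * dj j)‖ ≤ ‖sg j * A.f j x / A.f b x‖ / 4 := by
    intro x hx j hj
    have hbx := hx.1 b
    have e : sg j * A.f j x / A.f b x - ((|cj j| : ℝ) * (c * A.f a x / A.f b x) + sg j * dj j) =
        sg j * (A.f j x - (cj j * (c * A.f a x) + dj j * A.f b x)) / A.f b x := by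
      rw [← hsgc']; field_simp
    rw [e, norm_div, norm_mul, norm_div, norm_mul, hns, one_mul, one_mul, div_right_comm]
    exact div_le_div_of_nonneg_right (hrem x hx j hj) (norm_nonneg _)
  have ha : ∀ x ∈ A.V v η, ∀ j ∈ J, ‖sg j * A.f j x / (c * A.f a x) -
      ((|cj j| : ℝ) + sg j * dj j * (A.f b x / (c * A.f a x)))‖ ≤
        ‖sg j * A.f j x / (c * A.f a x)‖ / 4 := by
    intro x hx j hj
    have hax := hx.1 a
    have e : sg j * A.f j x / (c * A.f a x) -
        ((|cj j| : ℝ) + sg j * dj j * (A.f b x / (c * A.f a x))) =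
        sg j * (A.f j x - (cj j * (c * A.f a x) + dj j * A.f b x)) / (c * A.f a x) := by
      rw [← hsgc']; field_simp
    rw [e, norm_div, norm_mul (sg j : ℂ), norm_div, norm_mul (sg j : ℂ), hns, one_mul, one_mul,
      div_right_comm]
    exact div_le_div_of_nonneg_right (hrem x hx j hj) (norm_nonneg _)
  have hwn : ∀ x ∈ A.V v η, ∀ j i, sg j * A.f j x / A.f i x ≠ 0 := fun x hx j i =>
    div_ne_zero (mul_ne_zero (by exact_mod_cast hsgn j) (hx.1 j)) (hx.1 i)
  have hKη : ∀ p : ℝ, A.K⁻¹ ≤ p → A.K * η ≤ p / 4 := fun p hp => by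
    have h1 : A.K * A.K⁻¹ = 1 := mul_inv_cancel₀ hKp.ne'
    have h2 : A.K * (A.K * η * 4) ≤ A.K * A.K⁻¹ := by rw [h1]; linarith
    linarith [le_of_mul_le_mul_left h2 hKp]
  have hreal : ∀ r s : ℝ, ((r : ℂ) * s).im = 0 := fun r s => by simp
  exact
  { J := J, G0 := G0, G1 := G1, a := a, b := b, k := k, c := c, sg := sg
    c_ne := hcn
    sg_ne := hsgn
    up := fun x hx him j hj => by
      refine slit_of_im_nonneg (hwn x hx j b) (hb x hx j hj) ?_
      rw [Complex.add_im, Complex.im_ofReal_mul, hreal, add_zero]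
      exact mul_nonneg (abs_nonneg _) him.le
    out := fun x hx j hj => by
      obtain ⟨e, he⟩ := hout x hx j hj
      have hk := hx.1 k
      refine slit_of_near_real (y := (sg j : ℂ) * e) (hwn x hx j k) ?_ (by rw [hreal, abs_zero]; positivity)
      rw [show sg j * A.f j x / A.f k x - (sg j : ℂ) * e = sg j * (A.f j x - e * A.f k x) / A.f k x by
        field_simp, norm_div, norm_mul, norm_div, norm_mul, hns, one_mul, one_mul, div_right_comm]
      exact div_le_div_of_nonneg_right he (norm_nonneg _)
    re0 := fun x hx hx0 j hj => by
      have hd : dj j = 0 := (hd0 j (sub0 hj)).2 hj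
      have hcj : cj j ≠ 0 := fun h => by
        have := hrem x hx j (sub0 hj)
        rw [hd, h] at this
        simp only [Complex.ofReal_zero, zero_mul, add_zero, sub_zero] at this
        linarith [norm_pos_iff.2 (hx.1 j)]
      have := ha x hx j (sub0 hj)
      rw [hd, Complex.ofReal_zero, mul_zero, zero_mul, add_zero] at this
      exact re_pos_of_near (abs_pos.2 hcj) this (by rw [sub_self, norm_zero]; positivity)
    up0 := fun x hx hx0 j hj hj0 => by
      have hd : dj j ≠ 0 := fun h => hj0 ((hd0 j hj).1 h)
      have hz : ‖(c * A.f a x / A.f b x : ℂ)‖ ≤ η := by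
        rw [norm_div, norm_mul, hcc, one_mul, div_le_iff₀ (norm_pos_iff.2 (hx.1 b))]
        exact (h0 x hx hx0).le
      have hz' : |cj j| * ‖(c * A.f a x / A.f b x : ℂ)‖ ≤ |dj j| / 4 :=
        (mul_le_mul (hcK j) hz (norm_nonneg _) hKp.le).trans (hKη _ (hdK' j hd))
      refine slit_of_near_real (hwn x hx j b) (hb x hx j hj) ?_
      rw [Complex.add_im, Complex.im_ofReal_mul, hreal, add_zero, Complex.add_re,
        Complex.re_ofReal_mul, abs_mul, abs_abs]
      have h1 : |cj j| * |(c * A.f a x / A.f b x : ℂ).im| ≤ |dj j| / 4 :=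
        (mul_le_mul_of_nonneg_left (Complex.abs_im_le_norm _) (abs_nonneg _)).trans hz'
      have h2 : abs (|cj j| * (c * A.f a x / A.f b x : ℂ).re) ≤ |dj j| / 4 := by
        rw [abs_mul, abs_abs]
        exact (mul_le_mul_of_nonneg_left (Complex.abs_re_le_norm _) (abs_nonneg _)).trans hz'
      have h3 : |((sg j : ℂ) * dj j).re| = |dj j| := by
        rw [Complex.re_ofReal_mul, Complex.ofReal_re, abs_mul, hsg, one_mul]
      have h4 := abs_sub_abs_le_abs_sub ((sg j : ℂ) * dj j).re
        (-(|cj j| * (c * A.f a x / A.f b x : ℂ).re))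
      rw [abs_neg, sub_neg_eq_add, h3, add_comm] at h4
      linarith [abs_nonneg (dj j)]
    re1 := fun x hx hx1 j hj hj1 => by
      have hcj : cj j ≠ 0 := fun h => hj1 ((hc0 j hj).1 h)
      refine re_pos_of_near (abs_pos.2 hcj) (ha x hx j hj) ?_
      rw [add_sub_cancel_left, norm_mul, norm_mul, hns, one_mul, Complex.norm_real,
        Real.norm_eq_abs]
      have hz : ‖(A.f b x / (c * A.f a x) : ℂ)‖ ≤ η := by
        rw [norm_div, norm_mul, hcc, one_mul, div_le_iff₀ (norm_pos_iff.2 (hx.1 a))]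
        exact (h1 x hx hx1).le
      exact (mul_le_mul (hdK j) hz (norm_nonneg _) hKp.le).trans (hKη _ (hcK' j hcj))
    up1 := fun x hx hx1 j hj => by
      refine slit_of_near_real (hwn x hx j b) (hb x hx j (sub1 hj)) ?_
      rw [(hc0 j (sub1 hj)).2 hj, abs_zero, Complex.ofReal_zero, zero_mul, zero_add, hreal, abs_zero]
      positivity
    sub0 := sub0
    sub1 := sub1
    off := fun u hu huv hu0 hu1 x hx hxu hw => by
      obtain ⟨j, hj, hj0, hj1, hlt⟩ := hoff u hu huv hu0 hu1 x hx hxu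
      have hdj := hdK' j fun h => hj0 ((hd0 j hj).1 h)
      have h5 := hb x hx j hj
      have h6 : ‖sg j * A.f j x / A.f b x‖ < η := by
        rw [norm_div, norm_mul, hns, one_mul, div_lt_iff₀ (norm_pos_iff.2 (hx.1 b))]
        exact hlt
      set z : ℂ := c * A.f a x / A.f b x
      have h7 := Complex.abs_re_le_norm ((|cj j| : ℝ) * z + sg j * dj j)
      rw [Complex.add_re, Complex.re_ofReal_mul, hw.1, mul_zero, zero_add, Complex.re_ofReal_mul,
        Complex.ofReal_re, abs_mul, hsg, one_mul] at h7
      have h8 := norm_sub_norm_le ((|cj j| : ℝ) * z + sg j * dj j) (sg j * A.f j x / A.f b x)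
      rw [norm_sub_rev] at h8
      have h9 := hKη _ le_rfl
      have h10 : 0 < A.K⁻¹ := inv_pos.2 hKp
      have : η ≤ A.K * η := by
        have : 0 ≤ η := (norm_nonneg _).trans h6.le
        nlinarith
      linarith }

lemma eight_K_sq {η : ℝ} (h0 : 0 ≤ η) (hη : 8 * A.K ^ 2 * η ≤ 1) : A.K * η ≤ 1 / 8 ∧ η ≤ 1 := by
  have hK := A.one_le_K
  have h1 : A.K * η ≤ A.K * (A.K * η) := le_mul_of_one_le_left (by positivity) hK
  have h2 : η ≤ A.K * η := le_mul_of_one_le_left h0 hK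
  constructor <;> nlinarith

/-- Walls near a line, between two of its points. -/
theorem exists_wall_line {η : ℝ} (h0η : 0 ≤ η) (hη : 8 * A.K ^ 2 * η ≤ 1) {i a b : ι}
    {w0 w1 : Finset ι} (hw0 : A.IsFlat w0) (hw1 : A.IsFlat w1) (h01 : w0 ≠ w1) (hi0 : i ∈ w0)
    (hi1 : i ∈ w1) (ha : a ∈ w0) (hai : a ≠ i) (hb : b ∈ w1) (hbi : b ≠ i) {c : ℝ} (hc : |c| = 1) :
    ∃ W : WallData A η {i} w0 w1, W.J = {i}ᶜ ∧ W.G0 = w0.erase i ∧ W.G1 = w1.erase i ∧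
      W.a = a ∧ W.b = b ∧ W.c = c := by
  obtain ⟨hK4, hη1⟩ := eight_K_sq h0η hη
  have hb0 : b ∉ w0 := fun h => h01 (hw0.eq_of_two hw1 hbi h hi0 hb hi1)
  have ha1 : a ∉ w1 := fun h => h01 (hw0.eq_of_two hw1 hai ha hi0 h hi1)
  have hd : A.d a b i ≠ 0 := fun h => by
    rw [A.d_rot i a b] at h
    exact hb0 ((hw0.d_eq_zero_iff hi0 ha hai.symm b).1 h)
  have hc0 : c ≠ 0 := by rintro rfl; simp at hc
  have hcc : c * c = 1 := by rw [← abs_mul_abs_self, hc, one_mul]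
  have hcc' : (c : ℂ) * c = 1 := by exact_mod_cast hcc
  refine ⟨WallData.mk' (by nlinarith [sq_nonneg A.K]) {i}ᶜ (w0.erase i) (w1.erase i) a b i c hc
    (fun j => c * (A.d j b i / A.d a b i)) (fun j => A.d a j i / A.d a b i) ?_ ?_ ?_ ?_ ?_ ?_ ?_ ?_
    ?_ ?_ ?_ ?_ ?_, rfl, rfl, rfl, rfl, rfl, rfl⟩
  · intro x hx j hj
    have hji : j ≠ i := by simpa using hj
    have e : A.f j x - (((c * (A.d j b i / A.d a b i) : ℝ) : ℂ) * (c * A.f a x) +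
        ((A.d a j i / A.d a b i : ℝ) : ℂ) * A.f b x) = ((A.d a b j / A.d a b i : ℝ) : ℂ) * A.f i x := by
      rw [A.f_cramer hd j x, Complex.ofReal_mul]
      linear_combination (-(A.d j b i / A.d a b i : ℝ) * A.f a x : ℂ) * hcc'
    rw [e, norm_mul, Complex.norm_real]
    have h1 := hx.2 i (by simp) j (by simpa using hji)
    have h2 := mul_le_mul (A.ratio_le a b j a b i) h1.le (norm_nonneg _) (by linarith [A.one_le_K])
    rw [Real.norm_eq_abs]
    nlinarith [norm_nonneg (A.f j x)]
  · intro x hx j hj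
    have : j = i := by simpa using hj
    subst this
    exact ⟨1, by rw [Complex.ofReal_one, one_mul, sub_self, norm_zero]; positivity⟩
  · intro j hj
    have hji : j ≠ i := by simpa using hj
    rw [mul_eq_zero_iff_left hc0, div_eq_zero_iff, or_iff_left hd, ← A.d_rot j b i,
      hw1.d_eq_zero_iff hb hi1 hbi j]
    simp [hji]
  · intro j hj
    have hji : j ≠ i := by simpa using hj
    rw [div_eq_zero_iff, or_iff_left hd, A.d_swap j a i, neg_eq_zero, ← A.d_rot j a i,
      hw0.d_eq_zero_iff ha hi0 hai j]
    simp [hji]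
  · intro j; rw [abs_mul, hc, one_mul]; exact A.ratio_le _ _ _ _ _ _
  · intro j; exact A.ratio_le _ _ _ _ _ _
  · intro j hj
    rw [abs_mul, hc, one_mul]
    refine A.ratio_ge (fun h => hj ?_) hd
    rw [h, zero_div, mul_zero]
  · intro j hj
    refine A.ratio_ge (fun h => hj ?_) hd
    rw [h, zero_div]
  · intro j hj; simpa using Finset.ne_of_mem_erase hj
  · intro j hj; simpa using Finset.ne_of_mem_erase hj
  · intro x hx hx0; exact hx0.2 a ha b hb0
  · intro x hx hx1; exact hx1.2 b hb a ha1
  · intro u hu huv hu0 hu1 x hx hxu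
    have hiu : i ∈ u := by
      rcases V_comparable hη1 hx hxu with h | h
      · exact h (by simp)
      · exact absurd ((Finset.subset_singleton_iff.1 h).resolve_left hu.nonempty.ne_empty) huv
    obtain ⟨j, hj, hji⟩ : ∃ j ∈ u, j ≠ i := by
      by_contra hcon
      push Not at hcon
      exact huv (Finset.eq_singleton_iff_unique_mem.2 ⟨hiu, hcon⟩)
    have hj0 : j ∉ w0 := fun h => hu0 (hu.eq_of_two hw0 hji hj hiu h hi0)
    have hj1 : j ∉ w1 := fun h => hu1 (hu.eq_of_two hw1 hji hj hiu h hi1)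
    have hbu : b ∉ u := fun h => hu1 (hu.eq_of_two hw1 hbi h hiu hb hi1)
    exact ⟨j, by simpa using hji, by simp [hj0], by simp [hj1], hxu.2 j hj b hbu⟩

/-- Walls near a triple point, between two of its lines. -/
theorem exists_wall_point {η : ℝ} (h0η : 0 ≤ η) (hη : 8 * A.K ^ 2 * η ≤ 1) {p : Finset ι}
    (hp : p ∈ A.T) {a b k : ι} (ha : a ∈ p) (hb : b ∈ p) (hab : a ≠ b) (hk : k ∉ p) {c : ℝ}
    (hc : |c| = 1) :
    ∃ W : WallData A η p {a} {b}, W.J = p ∧ W.G0 = {a} ∧ W.G1 = {b} ∧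
      W.a = a ∧ W.b = b ∧ W.c = c := by
  obtain ⟨hK4, hη1⟩ := eight_K_sq h0η hη
  have hpf : A.IsFlat p := Or.inr (Or.inl hp)
  have hd : A.d a b k ≠ 0 := fun h => hk ((hpf.d_eq_zero_iff ha hb hab k).1 h)
  have hc0 : c ≠ 0 := by rintro rfl; simp at hc
  have hcc : c * c = 1 := by rw [← abs_mul_abs_self, hc, one_mul]
  have hcc' : (c : ℂ) * c = 1 := by exact_mod_cast hcc
  have hz : ∀ j ∈ p, ∀ m ∈ p, j ≠ m → (A.d m j k = 0 ↔ False) := fun j hj m hm hjm =>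
    ⟨fun h => hk ((hpf.d_eq_zero_iff hm hj hjm.symm k).1 h), False.elim⟩
  refine ⟨WallData.mk' (by nlinarith [sq_nonneg A.K]) p {a} {b} a b k c hc
    (fun j => c * (A.d j b k / A.d a b k)) (fun j => A.d a j k / A.d a b k) ?_ ?_ ?_ ?_ ?_ ?_ ?_ ?_
    ?_ ?_ ?_ ?_ ?_, rfl, rfl, rfl, rfl, rfl, rfl⟩
  · intro x hx j hj
    have h0 : A.d a b j = 0 := (hpf.d_eq_zero_iff ha hb hab j).2 hj
    have e : A.f j x - (((c * (A.d j b k / A.d a b k) : ℝ) : ℂ) * (c * A.f a x) +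
        ((A.d a j k / A.d a b k : ℝ) : ℂ) * A.f b x) = 0 := by
      rw [A.f_cramer hd j x, Complex.ofReal_mul, h0, zero_div, Complex.ofReal_zero]
      linear_combination (-(A.d j b k / A.d a b k : ℝ) * A.f a x : ℂ) * hcc'
    rw [e, norm_zero]
    positivity
  · intro x hx j hj
    refine ⟨A.d a b j / A.d a b k, ?_⟩
    have hP := isPiece_point hpf ha hb hab hk
    have hK1 := A.one_le_K
    have h1 := hx.2 a ha j hj
    have h2 := hx.2 b hb j hj
    have e : A.f j x - ((A.d a b j / A.d a b k : ℝ) : ℂ) * A.f k x =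
      (A.d j b k / A.d a b k : ℝ) * A.f a x + (A.d a j k / A.d a b k : ℝ) * A.f b x := by
      rw [A.f_cramer hd j x]; ring
    rw [e]
    refine (norm_add_le _ _).trans ?_
    rw [norm_mul, norm_mul, Complex.norm_real, Complex.norm_real, Real.norm_eq_abs, Real.norm_eq_abs]
    have h3 := mul_le_mul (A.ratio_le j b k a b k) h1.le (norm_nonneg _) (by linarith)
    have h4 := mul_le_mul (A.ratio_le a j k a b k) h2.le (norm_nonneg _) (by linarith)
    nlinarith [norm_nonneg (A.f j x)]
  · intro j hj
    rw [mul_eq_zero_iff_left hc0, div_eq_zero_iff, or_iff_left hd, Finset.mem_singleton]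
    by_cases h : j = b
    · subst h; simp [d_self]
    · simp only [h, iff_false]; exact fun h' => (hz b hb j hj (Ne.symm h)).1 h'
  · intro j hj
    rw [div_eq_zero_iff, or_iff_left hd, Finset.mem_singleton]
    by_cases h : j = a
    · subst h; simp [d_self]
    · simp only [h, iff_false]; exact fun h' => (hz j hj a ha h).1 h'
  · intro j; rw [abs_mul, hc, one_mul]; exact A.ratio_le _ _ _ _ _ _
  · intro j; exact A.ratio_le _ _ _ _ _ _
  · intro j hj
    rw [abs_mul, hc, one_mul]
    refine A.ratio_ge (fun h => hj ?_) hd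
    rw [h, zero_div, mul_zero]
  · intro j hj
    refine A.ratio_ge (fun h => hj ?_) hd
    rw [h, zero_div]
  · simpa using ha
  · simpa using hb
  · intro x hx hx0; exact hx0.2 a (by simp) b (by simpa using hab.symm)
  · intro x hx hx1; exact hx1.2 b (by simp) a (by simpa using hab)
  · intro u hu huv hu0 hu1 x hx hxu
    have hup : u ⊆ p := by
      rcases V_comparable hη1 hx hxu with h | h
      · rcases hpf.eq_or_single hu h with e | ⟨i, rfl⟩
        · exact e ▸ subset_rfl
        · have := A.card_T _ hp; simp at this
      · exact h
    rcases hu.eq_or_single hpf hup with e | ⟨j, rfl⟩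
    · exact absurd e huv
    · have hja : j ≠ a := by rintro rfl; exact hu0 rfl
      have hjb : j ≠ b := by rintro rfl; exact hu1 rfl
      exact ⟨j, hup (by simp), by simpa using hja, by simpa using hjb,
        hxu.2 j (by simp) b (by simpa using hjb.symm)⟩

end Arr

end

section

open unitInterval Topology

/-! ### Coordinates near points of the arrangement -/

/-- A logarithmic interpolation between two nonzero complex numbers. -/
def logPath (u v : ℂ) : C(I, ℂ) :=
  ⟨fun t => Complex.exp ((1 - (t : ℝ)) * Complex.log u + (t : ℝ) * Complex.log v), by fun_prop⟩

lemma logPath_ne_zero (u v : ℂ) (t : I) : logPath u v t ≠ 0 := Complex.exp_ne_zero _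

lemma logPath_zero {u v : ℂ} (hu : u ≠ 0) : logPath u v 0 = u := by simp [logPath, Complex.exp_log hu]

lemma logPath_one {u v : ℂ} (hv : v ≠ 0) : logPath u v 1 = v := by simp [logPath, Complex.exp_log hv]

lemma norm_logPath (u v : ℂ) (t : I) :
    ‖logPath u v t‖ = Real.exp ((1 - (t : ℝ)) * Real.log ‖u‖ + (t : ℝ) * Real.log ‖v‖) := by
  have : (1 - ((t : ℝ) : ℂ)) = ((1 - (t : ℝ) : ℝ) : ℂ) := by push_cast; ring
  rw [logPath, ContinuousMap.coe_mk, Complex.norm_exp, Complex.add_re, this, Complex.re_ofReal_mul,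
    Complex.re_ofReal_mul, Complex.log_re, Complex.log_re]

lemma norm_logPath_le {u v u' v' : ℂ} (hu : u ≠ 0) (hv : v ≠ 0) {e : ℝ} (h1 : ‖u‖ ≤ e * ‖u'‖)
    (h2 : ‖v‖ ≤ e * ‖v'‖) (t : I) : ‖logPath u v t‖ ≤ e * ‖logPath u' v' t‖ := by
  have pu := norm_pos_iff.2 hu
  have pv := norm_pos_iff.2 hv
  have he : 0 < e := by
    by_contra hcon
    nlinarith [norm_nonneg u']
  have hu' : 0 < ‖u'‖ := by nlinarith [norm_nonneg u']
  have hv' : 0 < ‖v'‖ := by nlinarith [norm_nonneg v']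
  have l1 := Real.log_le_log pu h1
  have l2 := Real.log_le_log pv h2
  rw [Real.log_mul he.ne' hu'.ne'] at l1
  rw [Real.log_mul he.ne' hv'.ne'] at l2
  rw [norm_logPath, norm_logPath]
  nth_rewrite 1 [← Real.exp_log he]
  rw [← Real.exp_add]
  apply Real.exp_le_exp.2
  have t0 := t.2.1
  have t1 := t.2.2
  have m1 := mul_le_mul_of_nonneg_left l1 (by linarith : 0 ≤ 1 - (t : ℝ))
  have m2 := mul_le_mul_of_nonneg_left l2 t0
  linarith

namespace Arr

variable {ι : Type*} [Fintype ι] [DecidableEq ι] {A : Arr ι}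

variable (A) in
/-- The point with given values of three forms. -/
def pt (a b k : ι) (u v w : ℂ) : E3 := u • A.D a b k + v • A.D b k a + w • A.D k a b

lemma f_pt {a b k : ι} (m : ι) (u v w : ℂ) : A.f m (A.pt a b k u v w) =
    (A.d m b k / A.d a b k : ℝ) * u + (A.d a m k / A.d a b k : ℝ) * v +
      (A.d a b m / A.d a b k : ℝ) * w := by
  rw [pt, map_add, map_add, map_smul, map_smul, map_smul, f_D, f_D, f_D, A.d_rot a b k,
    A.d_rot a m k, show A.d m a b = A.d a b m from (A.d_rot m a b).symm,
    show A.d k a b = A.d a b k from (A.d_rot k a b).symm]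
  simp only [smul_eq_mul]
  ring

lemma f_pt_fst {a b k : ι} (h : A.d a b k ≠ 0) (u v w : ℂ) : A.f a (A.pt a b k u v w) = u := by
  rw [f_pt, div_self h, d_self, d_self_out]; simp

lemma f_pt_snd {a b k : ι} (h : A.d a b k ≠ 0) (u v w : ℂ) : A.f b (A.pt a b k u v w) = v := by
  rw [f_pt, div_self h, d_self, d_self_right]; simp

lemma f_pt_trd {a b k : ι} (h : A.d a b k ≠ 0) (u v w : ℂ) : A.f k (A.pt a b k u v w) = w := by
  rw [f_pt, div_self h, d_self_out, d_self_right]; simp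

lemma pt_f {a b k : ι} (h : A.d a b k ≠ 0) (x : E3) :
    A.pt a b k (A.f a x) (A.f b x) (A.f k x) = x := (A.eq_sum_D h x).symm

/-- Points close to a line and even closer to it than to one of its points. -/
lemma flag_mem {w : Finset ι} (hw : A.IsFlat w) {i m n : ι} (hi : i ∈ w) (hm : m ∈ w) (him : i ≠ m)
    (hn : n ∉ w) {e : ℝ} (he : 8 * A.K ^ 2 * e ≤ 1) {x : E3} (hi0 : A.f i x ≠ 0)
    (h1 : ‖A.f i x‖ ≤ e * ‖A.f m x‖) (h2 : ‖A.f m x‖ ≤ e * ‖A.f n x‖) :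
    x ∈ A.V {i} (8 * A.K ^ 2 * e) ∧ x ∈ A.V w (8 * A.K ^ 2 * e) := by
  have hK := A.one_le_K
  have hd : A.d i m n ≠ 0 := fun h => hn ((hw.d_eq_zero_iff hi hm him n).1 h)
  have pi := norm_pos_iff.2 hi0
  have e0 : 0 < e := by
    by_contra hcon
    nlinarith [norm_nonneg (A.f m x)]
  have pm : 0 < ‖A.f m x‖ := by nlinarith [norm_nonneg (A.f m x)]
  have pn : 0 < ‖A.f n x‖ := by nlinarith [norm_nonneg (A.f n x)]
  obtain ⟨hKe, he1⟩ := eight_K_sq e0.le he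
  have hKe2 : A.K * e ≤ A.K⁻¹ / 8 := by
    have h1 : A.K * A.K⁻¹ = 1 := mul_inv_cancel₀ (by linarith)
    have h2 : A.K * (A.K * e * 8) ≤ A.K * A.K⁻¹ := by rw [h1]; linarith
    linarith [le_of_mul_le_mul_left h2 (by linarith)]
  have kp : 0 < A.K⁻¹ := inv_pos.2 (by linarith)
  have hKK : A.K * A.K⁻¹ = 1 := mul_inv_cancel₀ (by linarith)
  set fi := ‖A.f i x‖
  set fm := ‖A.f m x‖
  set fn := ‖A.f n x‖
  have h3 : fi ≤ fm := by nlinarith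
  have h4 : fm ≤ fn := by nlinarith
  have hub : ∀ j i' j' l, ‖((A.d j i' j' / A.d i m n : ℝ) : ℂ) * A.f l x‖ ≤ A.K * ‖A.f l x‖ :=
    fun j i' j' l => by
      rw [norm_mul, Complex.norm_real, Real.norm_eq_abs]
      exact mul_le_mul_of_nonneg_right (A.ratio_le _ _ _ _ _ _) (norm_nonneg _)
  have hlb : ∀ j i' j' l, A.d j i' j' ≠ 0 →
      A.K⁻¹ * ‖A.f l x‖ ≤ ‖((A.d j i' j' / A.d i m n : ℝ) : ℂ) * A.f l x‖ :=
    fun j i' j' l h => by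
      rw [norm_mul, Complex.norm_real, Real.norm_eq_abs]
      exact mul_le_mul_of_nonneg_right (A.ratio_ge h hd) (norm_nonneg _)
  have hin : ∀ j ∈ w, A.f j x = ((A.d j m n / A.d i m n : ℝ) : ℂ) * A.f i x +
      ((A.d i j n / A.d i m n : ℝ) : ℂ) * A.f m x := fun j hj => by
    rw [A.f_cramer hd j x, (hw.d_eq_zero_iff hi hm him j).2 hj]
    simp
  have L1 : ∀ j ∈ w, j ≠ i → A.K⁻¹ / 2 * fm ≤ ‖A.f j x‖ := fun j hj hji => by
    have hj0 : A.d i j n ≠ 0 := fun h => hn ((hw.d_eq_zero_iff hi hj hji.symm n).1 h)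
    have a1 := hlb i j n m hj0
    have a2 := hub j m n i
    have a3 := norm_sub_norm_le (((A.d i j n / A.d i m n : ℝ) : ℂ) * A.f m x)
      (-(((A.d j m n / A.d i m n : ℝ) : ℂ) * A.f i x))
    rw [norm_neg, sub_neg_eq_add, add_comm (_ * _) (_ * _), ← hin j hj] at a3
    have : A.K * fi ≤ A.K⁻¹ / 8 * fm := by
      calc A.K * fi ≤ A.K * (e * fm) := by gcongr
        _ = A.K * e * fm := by ring
        _ ≤ _ := by gcongr
    nlinarith
  have L2 : ∀ j ∉ w, A.K⁻¹ / 2 * fn ≤ ‖A.f j x‖ := fun j hj => by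
    have hj0 : A.d i m j ≠ 0 := fun h => hj ((hw.d_eq_zero_iff hi hm him j).1 h)
    have a1 := hlb i m j n hj0
    have a2 := hub j m n i
    have a4 := hub i j n m
    have a5 := norm_add_le (((A.d j m n / A.d i m n : ℝ) : ℂ) * A.f i x)
      (((A.d i j n / A.d i m n : ℝ) : ℂ) * A.f m x)
    have a3 := norm_sub_norm_le (((A.d i m j / A.d i m n : ℝ) : ℂ) * A.f n x)
      (-(((A.d j m n / A.d i m n : ℝ) : ℂ) * A.f i x +
        ((A.d i j n / A.d i m n : ℝ) : ℂ) * A.f m x))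
    rw [norm_neg, sub_neg_eq_add, add_comm (_ * _) (_ + _), ← A.f_cramer hd j x] at a3
    have : A.K * fm ≤ A.K⁻¹ / 8 * fn := by
      calc A.K * fm ≤ A.K * (e * fn) := by gcongr
        _ = A.K * e * fn := by ring
        _ ≤ _ := by gcongr
    have : A.K * fi ≤ A.K * fm := by gcongr
    nlinarith
  have hM : x ∈ A.M := fun j hj => by
    by_cases hjw : j ∈ w
    · by_cases hji : j = i
      · exact hi0 (hji ▸ hj)
      · have := L1 j hjw hji
        rw [hj, norm_zero] at this
        nlinarith
    · have := L2 j hjw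
      rw [hj, norm_zero] at this
      nlinarith
  have big : ∀ y r : ℝ, A.K⁻¹ / 2 * y ≤ r → y ≤ 2 * A.K * r := fun y r h => by
    have : A.K * (A.K⁻¹ / 2 * y) ≤ A.K * r := by gcongr
    have e : A.K * (A.K⁻¹ / 2 * y) = y / 2 := by rw [← mul_assoc, ← mul_div_assoc, hKK]; ring
    linarith
  refine ⟨⟨hM, fun i' hi' j hj => ?_⟩, ⟨hM, fun i' hi' j hj => ?_⟩⟩
  · rw [Finset.mem_singleton] at hi' hj
    subst hi'
    have pj := norm_pos_iff.2 (hM j)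
    have key : fm ≤ 2 * A.K * ‖A.f j x‖ := by
      by_cases hjw : j ∈ w
      · exact big _ _ (L1 j hjw hj)
      · exact h4.trans (big _ _ (L2 j hjw))
    calc fi ≤ e * fm := h1
      _ ≤ e * (2 * A.K * ‖A.f j x‖) := by gcongr
      _ < 8 * A.K ^ 2 * e * ‖A.f j x‖ := by
        have : 0 < e * ‖A.f j x‖ := by positivity
        have : A.K ≤ A.K ^ 2 := by nlinarith
        nlinarith
  · have pj := norm_pos_iff.2 (hM j)
    have key := big _ _ (L2 j hj)
    have up : ‖A.f i' x‖ ≤ 2 * A.K * fm := by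
      rw [hin i' hi']
      refine (norm_add_le _ _).trans ?_
      have := hub i' m n i
      have := hub i i' n m
      have : A.K * fi ≤ A.K * fm := by gcongr
      linarith
    calc ‖A.f i' x‖ ≤ 2 * A.K * fm := up
      _ ≤ 2 * A.K * (e * (2 * A.K * ‖A.f j x‖)) := by gcongr; exact h2.trans (by gcongr)
      _ < 8 * A.K ^ 2 * e * ‖A.f j x‖ := by
        have : 0 < A.K ^ 2 * e * ‖A.f j x‖ := by positivity
        nlinarith

/-- Points close to a point of the arrangement. -/
lemma point_mem {w : Finset ι} (hw : A.IsFlat w) {i m n : ι} (hi : i ∈ w) (hm : m ∈ w) (him : i ≠ m)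
    (hn : n ∉ w) {e : ℝ} (he : 8 * A.K ^ 2 * e ≤ 1) {x : E3} (h0 : ∀ j ∈ w, A.f j x ≠ 0)
    (h1 : ‖A.f i x‖ ≤ e * ‖A.f n x‖) (h2 : ‖A.f m x‖ ≤ e * ‖A.f n x‖) :
    x ∈ A.V w (8 * A.K ^ 2 * e) := by
  have hK := A.one_le_K
  have hd : A.d i m n ≠ 0 := fun h => hn ((hw.d_eq_zero_iff hi hm him n).1 h)
  have pi := norm_pos_iff.2 (h0 i hi)
  have e0 : 0 < e := by
    by_contra hcon
    nlinarith [norm_nonneg (A.f n x)]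
  have pn : 0 < ‖A.f n x‖ := by nlinarith [norm_nonneg (A.f n x)]
  obtain ⟨hKe, he1⟩ := eight_K_sq e0.le he
  have hKe2 : A.K * e ≤ A.K⁻¹ / 8 := by
    have h1 : A.K * A.K⁻¹ = 1 := mul_inv_cancel₀ (by linarith)
    have h2 : A.K * (A.K * e * 8) ≤ A.K * A.K⁻¹ := by rw [h1]; linarith
    linarith [le_of_mul_le_mul_left h2 (by linarith)]
  have kp : 0 < A.K⁻¹ := inv_pos.2 (by linarith)
  have hKK : A.K * A.K⁻¹ = 1 := mul_inv_cancel₀ (by linarith)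
  set fn := ‖A.f n x‖
  have hub : ∀ j i' j' l, ‖((A.d j i' j' / A.d i m n : ℝ) : ℂ) * A.f l x‖ ≤ A.K * ‖A.f l x‖ :=
    fun j i' j' l => by
      rw [norm_mul, Complex.norm_real, Real.norm_eq_abs]
      exact mul_le_mul_of_nonneg_right (A.ratio_le _ _ _ _ _ _) (norm_nonneg _)
  have k1 : A.K * ‖A.f i x‖ ≤ A.K * e * fn := by
    rw [mul_assoc]; gcongr
  have k2 : A.K * ‖A.f m x‖ ≤ A.K * e * fn := by
    rw [mul_assoc]; gcongr
  have k3 : A.K * e * fn ≤ A.K⁻¹ / 8 * fn := by gcongr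
  have L2 : ∀ j ∉ w, A.K⁻¹ / 2 * fn ≤ ‖A.f j x‖ := fun j hj => by
    have hj0 : A.d i m j ≠ 0 := fun h => hj ((hw.d_eq_zero_iff hi hm him j).1 h)
    have a1 : A.K⁻¹ * fn ≤ ‖((A.d i m j / A.d i m n : ℝ) : ℂ) * A.f n x‖ := by
      rw [norm_mul, Complex.norm_real, Real.norm_eq_abs]
      exact mul_le_mul_of_nonneg_right (A.ratio_ge hj0 hd) (norm_nonneg _)
    have a2 := hub j m n i
    have a4 := hub i j n m
    have a5 := norm_add_le (((A.d j m n / A.d i m n : ℝ) : ℂ) * A.f i x)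
      (((A.d i j n / A.d i m n : ℝ) : ℂ) * A.f m x)
    have a3 := norm_sub_norm_le (((A.d i m j / A.d i m n : ℝ) : ℂ) * A.f n x)
      (-(((A.d j m n / A.d i m n : ℝ) : ℂ) * A.f i x +
        ((A.d i j n / A.d i m n : ℝ) : ℂ) * A.f m x))
    rw [norm_neg, sub_neg_eq_add, add_comm (_ * _) (_ + _), ← A.f_cramer hd j x] at a3
    nlinarith
  have hM : x ∈ A.M := fun j hj => by
    by_cases hjw : j ∈ w
    · exact h0 j hjw hj
    · have := L2 j hjw
      rw [hj, norm_zero] at this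
      nlinarith
  refine ⟨hM, fun i' hi' j hj => ?_⟩
  have pj := norm_pos_iff.2 (hM j)
  have key : fn ≤ 2 * A.K * ‖A.f j x‖ := by
    have h := L2 j hj
    have : A.K * (A.K⁻¹ / 2 * fn) ≤ A.K * ‖A.f j x‖ := by gcongr
    have e : A.K * (A.K⁻¹ / 2 * fn) = fn / 2 := by rw [← mul_assoc, ← mul_div_assoc, hKK]; ring
    linarith
  have up : ‖A.f i' x‖ ≤ 2 * A.K * e * fn := by
    have := A.f_cramer hd i' x
    rw [(hw.d_eq_zero_iff hi hm him i').2 hi', zero_div, Complex.ofReal_zero, zero_mul,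
      add_zero] at this
    rw [this]
    refine (norm_add_le _ _).trans ?_
    have := hub i' m n i
    have := hub i i' n m
    linarith
  calc ‖A.f i' x‖ ≤ 2 * A.K * e * fn := up
    _ ≤ 2 * A.K * e * (2 * A.K * ‖A.f j x‖) := by gcongr
    _ < 8 * A.K ^ 2 * e * ‖A.f j x‖ := by
      have : 0 < A.K ^ 2 * e * ‖A.f j x‖ := by positivity
      nlinarith

/-- The logarithmic interpolation of points. -/
def lpt (A : Arr ι) (a b k : ι) (x y : E3) : C(I, E3) :=
  ⟨fun t => A.pt a b k (logPath (A.f a x) (A.f a y) t) (logPath (A.f b x) (A.f b y) t)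
    (logPath (A.f k x) (A.f k y) t), by unfold pt; fun_prop⟩

/-- Flags are connected. -/
lemma flag_joined {w : Finset ι} (hw : A.IsFlat w) {i : ι} (hi : i ∈ w) (hwi : w ≠ {i}) {e : ℝ}
    (he : 8 * A.K ^ 2 * e ≤ 1) {x y : E3} (hx : x ∈ A.V {i} e) (hx' : x ∈ A.V w e)
    (hy : y ∈ A.V {i} e) (hy' : y ∈ A.V w e) : ∃ γ : C(I, E3), γ 0 = x ∧ γ 1 = y ∧
      ∀ t, γ t ∈ A.V {i} (8 * A.K ^ 2 * e) ∧ γ t ∈ A.V w (8 * A.K ^ 2 * e) := by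
  obtain ⟨m, hm, hmi⟩ : ∃ m ∈ w, m ≠ i := by
    by_contra hcon
    push Not at hcon
    exact hwi (Finset.eq_singleton_iff_unique_mem.2 ⟨hi, hcon⟩)
  obtain ⟨n, hn, -⟩ := hw.exists_notMem ∅ (by simp)
  have hd : A.d i m n ≠ 0 := fun h => hn ((hw.d_eq_zero_iff hi hm hmi.symm n).1 h)
  refine ⟨A.lpt i m n x y, ?_, ?_, fun t => flag_mem hw hi hm hmi.symm hn he ?_ ?_ ?_⟩
  · simp only [lpt, ContinuousMap.coe_mk, logPath_zero (hx.1 _), pt_f hd]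
  · simp only [lpt, ContinuousMap.coe_mk, logPath_one (hy.1 _), pt_f hd]
  · rw [lpt, ContinuousMap.coe_mk, f_pt_fst hd]; exact logPath_ne_zero _ _ _
  · rw [lpt, ContinuousMap.coe_mk, f_pt_fst hd, f_pt_snd hd]
    exact norm_logPath_le (hx.1 _) (hy.1 _) (hx.2 i (by simp) m (by simpa using hmi)).le
      (hy.2 i (by simp) m (by simpa using hmi)).le t
  · rw [lpt, ContinuousMap.coe_mk, f_pt_snd hd, f_pt_trd hd]
    exact norm_logPath_le (hx.1 _) (hy.1 _) (hx'.2 m hm n hn).le (hy'.2 m hm n hn).le t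

end Arr

end

section

open unitInterval Topology

/-! ### Resonance -/

namespace Arr

variable {ι : Type*} [Fintype ι] [DecidableEq ι] {A : Arr ι}

/-- Three lines through a triple point and a line off it. -/
structure Tri (A : Arr ι) (p : Finset ι) (a b c k : ι) : Prop where
  mem : p ∈ A.T
  eq : p = {a, b, c}
  ab : a ≠ b
  ac : a ≠ c
  bc : b ≠ c
  k : k ∉ p

namespace Tri

variable {p : Finset ι} {a b c k : ι} (h : A.Tri p a b c k)

include h

lemma flat : A.IsFlat p := Or.inr (Or.inl h.mem)
lemma ma : a ∈ p := by rw [h.eq]; simp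
lemma mb : b ∈ p := by rw [h.eq]; simp
lemma mc : c ∈ p := by rw [h.eq]; simp
lemma d_ne : A.d a b k ≠ 0 := fun h' => h.k ((h.flat.d_eq_zero_iff h.ma h.mb h.ab k).1 h')
lemma d1 : A.d c b k ≠ 0 := fun h' => h.k ((h.flat.d_eq_zero_iff h.mc h.mb h.bc.symm k).1 h')

lemma f_eq (x : E3) : A.f c x = (A.d c b k / A.d a b k : ℝ) * A.f a x +
    (A.d a c k / A.d a b k : ℝ) * A.f b x := by
  rw [A.f_cramer h.d_ne c x, (h.flat.d_eq_zero_iff h.ma h.mb h.ab c).2 h.mc]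
  simp

lemma r1 : ((A.d c b k / A.d a b k : ℝ) : ℂ) ≠ 0 := by
  exact_mod_cast div_ne_zero h.d1 h.d_ne

end Tri

end Arr

end

section

open unitInterval Topology

namespace Arr

variable {ι : Type*} [Fintype ι] [DecidableEq ι] {A : Arr ι}

variable (A) in
/-- The character `ψ` is nontrivial on some loop around the flat `u`. -/
def Good (χ : ι → ℤ) (t : ι → ℝ) (ε : ℝ) (u : Finset ι) : Prop :=
  ∃ w P, A.IsPiece u w P ∧ uu χ t w ε ≠ 1

variable {χ : ι → ℤ} {t : ι → ℝ} {ε : ℝ}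

lemma isCocycle_psi_eval (χ : ι → ℤ) (t : ι → ℝ) (ε : ℝ) : IsCocycle A.M (fun γ => A.psi χ t γ ε) :=
  isCocycle_eval (isCocycle_psi χ t) ε

lemma loop_mem {s w : Finset ι} {P : E3 →L[ℂ] E3} (h : A.IsPiece s w P) {η : ℝ}
    (h0 : 0 ≤ η) (hη : 8 * A.K * η ≤ 1) {x : E3} (hx : x ∈ A.V s η) {s' : Finset ι}
    (hx' : x ∈ A.V s' η) (r : I) : loop P x r ∈ A.V s' (4 * η) :=
  h.rotate_mem hη hx (norm_circ r) h0 hx'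

/-- Near a nonresonant flat, functions with vanishing coboundary vanish. -/
lemma Good.eq_zero {u : Finset ι} (hu : A.Good χ t ε u) {η : ℝ} (h0 : 0 ≤ η)
    (hη : 8 * A.K * η ≤ 1) {m : E3 → ℂ} {x : E3} (hx : x ∈ A.V u η) {v : Finset ι}
    (hx' : x ∈ A.V v η)
    (hm : ∀ γ : C(I, E3), (∀ s, γ s ∈ A.V u (4 * η)) → (∀ s, γ s ∈ A.V v (4 * η)) →
      principal (fun γ => A.psi χ t γ ε) m γ = 0) : m x = 0 := by
  obtain ⟨w, P, hP, hq⟩ := hu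
  have := hm (loop P x) (loop_mem hP h0 hη hx hx) (loop_mem hP h0 hη hx hx')
  rw [principal, loop_zero, loop_one, hP.psi_loop hη hx, ← uu_apply] at this
  have : (1 - uu χ t w ε) * m x = 0 := by linear_combination this
  exact (mul_eq_zero.1 this).resolve_left (sub_ne_zero.2 hq.symm)

/-- Crossed homomorphisms are principal near nonresonant flats. -/
theorem exists_principal {F : Set (Finset ι)} (hF : ∀ s ∈ F, A.Good χ t ε s)
    {δ : C(I, E3) → ℂ} {η : ℝ} (h0 : 0 ≤ η) (hη : 128 * A.K * η ≤ 1)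
    (hδ : IsCrossed (⋃ s ∈ F, A.V s (16 * η)) (fun γ => A.psi χ t γ ε) δ) :
    ∃ m : E3 → ℂ, ∀ γ : C(I, E3), (∀ r, γ r ∈ ⋃ s ∈ F, A.V s η) →
      δ γ = principal (fun γ => A.psi χ t γ ε) m γ := by
  classical
  choose! w P hP hq using hF
  obtain ⟨m, -, hm⟩ := principal_of_pieces (F := F) (w := w) (P := P) (fun s hs => hP s hs)
    (isCocycle_psi_eval χ t ε) h0 hη (q := fun s => uu χ t (w s) ε) (fun s hs => hq s hs)
    (fun s hs x hx => by
      have hK := A.one_le_K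
      rw [(hP s hs).psi_loop (by nlinarith) hx, ← uu_apply]) hδ
  exact ⟨m, hm⟩

lemma iUnion_flat (η : ℝ) : (⋃ s : {s : Finset ι // A.IsFlat s}, A.V s.1 η) = A.N η := by
  rw [N, Set.biUnion_eq_iUnion]; rfl

/-! Paths off the wall -/

/-- A path near a triple point from one line to another, off the wall. -/
lemma Tri.exists_path {p : Finset ι} {a b c k : ι} (h : A.Tri p a b c k) {η : ℝ}
    (h0 : 0 < η) : ∃ γ : C(I, E3), (∀ r, γ r ∈ A.V p η) ∧ γ 0 ∈ A.V {a} η ∧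
      γ 1 ∈ A.V {b} η ∧ ∀ r, (A.f a (γ r) / A.f b (γ r)).im < 0 := by
  have hK := A.one_le_K
  obtain ⟨e, e0, he, heη⟩ : ∃ e : ℝ, 0 < e ∧ 8 * A.K ^ 2 * e ≤ 1 ∧ 8 * A.K ^ 2 * e ≤ η := by
    refine ⟨min 1 η / (8 * A.K ^ 2), by positivity, ?_, ?_⟩ <;>
      rw [mul_div_cancel₀ _ (by positivity)]
    · exact min_le_left _ _
    · exact min_le_right _ _
  let α : I → ℝ := fun r => (1 - (r : ℝ)) * e + r
  let β : I → ℝ := fun r => (1 - (r : ℝ)) + r * e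
  have e1 : e ≤ 1 := (eight_K_sq e0.le he).2
  have α0 : ∀ r, 0 < α r := fun r => by
    have h1 := r.2.1; have h2 := r.2.2
    have : e ≤ α r := by simp only [α]; nlinarith
    linarith
  have β0 : ∀ r, 0 < β r := fun r => by
    have h1 := r.2.1; have h2 := r.2.2
    have : e ≤ β r := by simp only [β]; nlinarith
    linarith
  have α1 : ∀ r, α r ≤ 1 := fun r => by
    have h1 := r.2.1; have h2 := r.2.2
    simp only [α]; nlinarith
  have β1 : ∀ r, β r ≤ 1 := fun r => by
    have h1 := r.2.1; have h2 := r.2.2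
    simp only [β]; nlinarith
  let γ : C(I, E3) := ⟨fun r => A.pt a b k ((-(e * α r) : ℝ) * Complex.I) ((e * β r : ℝ)) 1, by
    simp only [α, β, pt]; fun_prop⟩
  have fa : ∀ r, A.f a (γ r) = (-(e * α r) : ℝ) * Complex.I := fun r => f_pt_fst h.d_ne _ _ _
  have fb : ∀ r, A.f b (γ r) = (e * β r : ℝ) := fun r => f_pt_snd h.d_ne _ _ _
  have fk : ∀ r, A.f k (γ r) = 1 := fun r => f_pt_trd h.d_ne _ _ _
  have na : ∀ r, ‖A.f a (γ r)‖ = e * α r := fun r => by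
    rw [fa, norm_mul, Complex.norm_I, mul_one, Complex.norm_real, Real.norm_eq_abs, abs_neg,
      abs_of_pos (mul_pos e0 (α0 r))]
  have nb : ∀ r, ‖A.f b (γ r)‖ = e * β r := fun r => by
    rw [fb, Complex.norm_real, Real.norm_eq_abs, abs_of_pos (mul_pos e0 (β0 r))]
  have ha : ∀ r, A.f a (γ r) ≠ 0 := fun r => norm_ne_zero_iff.1 (by
    rw [na]; exact (mul_pos e0 (α0 r)).ne')
  have hb : ∀ r, A.f b (γ r) ≠ 0 := fun r => norm_ne_zero_iff.1 (by
    rw [nb]; exact (mul_pos e0 (β0 r)).ne')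
  refine ⟨γ, fun r => V_mono heη (point_mem h.flat h.ma h.mb h.ab h.k he ?_ ?_ ?_), ?_, ?_, ?_⟩
  · intro j hj
    rw [h.eq] at hj
    simp only [Finset.mem_insert, Finset.mem_singleton] at hj
    rcases hj with rfl | rfl | rfl
    · exact ha r
    · exact hb r
    · intro h'
      have := congrArg Complex.im h'
      rw [h.f_eq, fa, fb, Complex.add_im, Complex.im_ofReal_mul, Complex.im_ofReal_mul,
        Complex.im_ofReal_mul, Complex.I_im, Complex.ofReal_im, mul_zero, add_zero,
        Complex.zero_im, mul_eq_zero, mul_one, neg_eq_zero] at this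
      rcases this with h' | h'
      · exact h.r1 (by exact_mod_cast h')
      · exact (mul_pos e0 (α0 r)).ne' h'
  · rw [na, fk, norm_one]
    nlinarith [α1 r]
  · rw [nb, fk, norm_one]
    nlinarith [β1 r]
  · refine V_mono heη (flag_mem h.flat h.ma h.mb h.ab h.k he (ha 0) ?_ ?_).1
    · rw [na, nb]; simp [α, β]
    · rw [nb, fk]; simp [β]
  · refine V_mono heη (flag_mem h.flat h.mb h.ma h.ab.symm h.k he (hb 1) ?_ ?_).1
    · rw [na, nb]; simp [α, β]
    · rw [na, fk]; simp [α]
  · intro r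
    rw [fa, fb]
    rw [show ((-(e * α r) : ℝ) : ℂ) * Complex.I / ((e * β r : ℝ) : ℂ) =
      ((-((e * α r) / (e * β r)) : ℝ) : ℂ) * Complex.I by push_cast; ring,
      Complex.im_ofReal_mul, Complex.I_im, mul_one, neg_lt_zero]
    exact div_pos (mul_pos e0 (α0 r)) (mul_pos e0 (β0 r))

end Arr

end

section

open unitInterval Topology

/-! ### Nonprincipal classes -/

namespace Arr

variable {ι : Type*} [Fintype ι] [DecidableEq ι] {A : Arr ι}

/-- A path near a line between two of its points, off the wall. -/
lemma exists_path_line {i a b : ι} {w0 w1 : Finset ι} (hw0 : A.IsFlat w0) (hw1 : A.IsFlat w1)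
    (h01 : w0 ≠ w1) (hi0 : i ∈ w0) (hi1 : i ∈ w1) (ha : a ∈ w0) (hai : a ≠ i) (hb : b ∈ w1)
    (hbi : b ≠ i) {η : ℝ} (h0 : 0 < η) : ∃ γ : C(I, E3), (∀ r, γ r ∈ A.V {i} η) ∧
      γ 0 ∈ A.V w0 η ∧ γ 1 ∈ A.V w1 η ∧ ∀ r, (A.f a (γ r) / A.f b (γ r)).im < 0 := by
  have hK := A.one_le_K
  have hb0 : b ∉ w0 := fun h => h01 (hw0.eq_of_two hw1 hbi h hi0 hb hi1)
  have ha1 : a ∉ w1 := fun h => h01 (hw0.eq_of_two hw1 hai ha hi0 h hi1)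
  have hd : A.d a b i ≠ 0 := fun h => by
    rw [A.d_rot i a b] at h
    exact hb0 ((hw0.d_eq_zero_iff hi0 ha hai.symm b).1 h)
  let r1 : ι → ℝ := fun j => A.d j b i / A.d a b i
  let r2 : ι → ℝ := fun j => A.d a j i / A.d a b i
  let r3 : ι → ℝ := fun j => A.d a b j / A.d a b i
  have b3 : ∀ j, |r3 j| ≤ A.K := fun j => A.ratio_le _ _ _ _ _ _
  obtain ⟨e, e0, he, heη⟩ : ∃ e : ℝ, 0 < e ∧ 8 * A.K ^ 2 * e ≤ 1 ∧ 8 * A.K ^ 2 * e ≤ η := by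
    refine ⟨min 1 η / (8 * A.K ^ 2), by positivity, ?_, ?_⟩ <;>
      rw [mul_div_cancel₀ _ (by positivity)]
    · exact min_le_left _ _
    · exact min_le_right _ _
  obtain ⟨hKe, e1⟩ := eight_K_sq e0.le he
  let α : I → ℝ := fun r => (1 - (r : ℝ)) * e + r
  let β : I → ℝ := fun r => (1 - (r : ℝ)) + r * e
  have αe : ∀ r, e ≤ α r := fun r => by
    have h1 := r.2.1; have h2 := r.2.2
    simp only [α]; nlinarith
  have βe : ∀ r, e ≤ β r := fun r => by
    have h1 := r.2.1; have h2 := r.2.2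
    simp only [β]; nlinarith
  have α0 : ∀ r, 0 < α r := fun r => e0.trans_le (αe r)
  have β0 : ∀ r, 0 < β r := fun r => e0.trans_le (βe r)
  let γ : C(I, E3) := ⟨fun r => A.pt a b i ((-α r : ℝ) * Complex.I) (β r : ℝ) (e ^ 2 : ℝ), by
    simp only [α, β, pt]; fun_prop⟩
  have fa : ∀ r, A.f a (γ r) = (-α r : ℝ) * Complex.I := fun r => f_pt_fst hd _ _ _
  have fb : ∀ r, A.f b (γ r) = (β r : ℝ) := fun r => f_pt_snd hd _ _ _
  have fi : ∀ r, A.f i (γ r) = (e ^ 2 : ℝ) := fun r => f_pt_trd hd _ _ _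
  have fj : ∀ j r, A.f j (γ r) = (r1 j : ℝ) * ((-α r : ℝ) * Complex.I) + (r2 j : ℝ) * (β r : ℝ) +
    (r3 j : ℝ) * (e ^ 2 : ℝ) := fun j r => f_pt j _ _ _
  have jre : ∀ j r, (A.f j (γ r)).re = r2 j * β r + r3 j * e ^ 2 := fun j r => by
    rw [fj, Complex.add_re, Complex.add_re, Complex.re_ofReal_mul, Complex.re_ofReal_mul,
      Complex.re_ofReal_mul, Complex.re_ofReal_mul, Complex.I_re, Complex.ofReal_re,
      Complex.ofReal_re]
    ring
  have jim : ∀ j r, (A.f j (γ r)).im = -α r * r1 j := fun j r => by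
    rw [fj, Complex.add_im, Complex.add_im, Complex.im_ofReal_mul, Complex.im_ofReal_mul,
      Complex.im_ofReal_mul, Complex.im_ofReal_mul, Complex.I_im, Complex.ofReal_im,
      Complex.ofReal_im]
    ring
  have na : ∀ r, ‖A.f a (γ r)‖ = α r := fun r => by
    rw [fa, norm_mul, Complex.norm_I, mul_one, Complex.norm_real, Real.norm_eq_abs, abs_neg,
      abs_of_pos (α0 r)]
  have nb : ∀ r, ‖A.f b (γ r)‖ = β r := fun r => by
    rw [fb, Complex.norm_real, Real.norm_eq_abs, abs_of_pos (β0 r)]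
  have ni : ∀ r, ‖A.f i (γ r)‖ = e ^ 2 := fun r => by
    rw [fi, Complex.norm_real, Real.norm_eq_abs, abs_of_pos (by positivity)]
  have hi : ∀ r, A.f i (γ r) ≠ 0 := fun r => norm_ne_zero_iff.1 (by rw [ni]; positivity)
  have hKe2 : A.K * e ≤ A.K⁻¹ / 8 := by
    have h1 : A.K * A.K⁻¹ = 1 := mul_inv_cancel₀ (by linarith)
    have h2 : A.K * (A.K * e * 8) ≤ A.K * A.K⁻¹ := by rw [h1]; linarith
    linarith [le_of_mul_le_mul_left h2 (by linarith)]
  have kp : 0 < A.K⁻¹ := inv_pos.2 (by linarith)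
  have low : ∀ j r, j ≠ i → A.K⁻¹ / 2 * e ≤ ‖A.f j (γ r)‖ := by
    intro j r hji
    by_cases hj : r1 j = 0
    · have hr2 : A.K⁻¹ ≤ |r2 j| := by
        refine A.ratio_ge (fun h => ?_) hd
        have hj1 : j ∈ w1 := by
          rw [← hw1.d_eq_zero_iff hb hi1 hbi j, A.d_rot j b i]
          exact (div_eq_zero_iff.1 hj).resolve_right hd
        have hj0 : j ∈ w0 := by
          rw [← hw0.d_eq_zero_iff ha hi0 hai j, A.d_rot j a i, A.d_swap a j i, h, neg_zero]
        exact h01 (hw0.eq_of_two hw1 hji hj0 hi0 hj1 hi1)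
      have h1 := Complex.abs_re_le_norm (A.f j (γ r))
      rw [jre] at h1
      have h2 := abs_sub_abs_le_abs_sub (r2 j * β r) (-(r3 j * e ^ 2))
      rw [sub_neg_eq_add, abs_neg, abs_mul, abs_mul, abs_of_pos (β0 r),
        abs_of_pos (by positivity : 0 < e ^ 2)] at h2
      have h3 : A.K⁻¹ * e ≤ |r2 j| * β r := mul_le_mul hr2 (βe r) e0.le (abs_nonneg _)
      have h4 : |r3 j| * e ^ 2 ≤ A.K⁻¹ / 8 * e := by
        calc |r3 j| * e ^ 2 ≤ A.K * e ^ 2 := by gcongr; exact b3 j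
          _ = A.K * e * e := by ring
          _ ≤ _ := by gcongr
      have : 0 < A.K⁻¹ * e := by positivity
      linarith
    · have hr1 : A.K⁻¹ ≤ |r1 j| := A.ratio_ge (fun h => hj (by simp only [r1, h, zero_div])) hd
      have h1 := Complex.abs_im_le_norm (A.f j (γ r))
      rw [jim, abs_mul, abs_neg, abs_of_pos (α0 r)] at h1
      have h3 : A.K⁻¹ * e ≤ |r1 j| * α r := mul_le_mul hr1 (αe r) e0.le (abs_nonneg _)
      have : 0 < A.K⁻¹ * e := by positivity
      linarith
  have hV : ∀ r, γ r ∈ A.V {i} η := by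
    intro r
    refine ⟨fun j hj => ?_, fun i' hi' j hj => ?_⟩
    · by_cases hji : j = i
      · exact hi r (hji ▸ hj)
      · have := low j r hji
        rw [hj, norm_zero] at this
        have : 0 < A.K⁻¹ * e := by positivity
        linarith
    · rw [Finset.mem_singleton] at hi' hj
      subst hi'
      rw [ni]
      have h1 := low j r hj
      have hKK : A.K * A.K⁻¹ = 1 := mul_inv_cancel₀ (by linarith)
      calc e ^ 2 = (e * A.K * 2) * (A.K⁻¹ / 2 * e) := by
            linear_combination (-(e ^ 2)) * hKK
        _ < (8 * A.K ^ 2 * e) * (A.K⁻¹ / 2 * e) := by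
            have : 0 < A.K * e := by positivity
            refine mul_lt_mul_of_pos_right ?_ (by positivity)
            nlinarith
        _ ≤ η * ‖A.f j (γ r)‖ := by gcongr
  refine ⟨γ, hV, ?_, ?_, fun r => ?_⟩
  · refine V_mono heη (flag_mem hw0 hi0 ha hai.symm hb0 he (hi 0) ?_ ?_).2
    · rw [ni, na]; simp [α, sq]
    · rw [na, nb]; simp [α, β]
  · refine V_mono heη (flag_mem hw1 hi1 hb hbi.symm ha1 he (hi 1) ?_ ?_).2
    · rw [ni, nb]; simp [β, sq]
    · rw [na, nb]; simp [α, β]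
  · rw [fa, fb]
    rw [show ((-α r : ℝ) : ℂ) * Complex.I / (β r : ℂ) = ((-(α r / β r) : ℝ) : ℂ) * Complex.I by
      push_cast; ring, Complex.im_ofReal_mul, Complex.I_im, mul_one, neg_lt_zero]
    exact div_pos (α0 r) (β0 r)

variable {χ : ι → ℤ} {t : ι → ℝ} {ε : ℝ}

/-- Values on paths between nonresonant flats are obstructions to being principal. -/
lemma eq_zero_of_principal {v w0 w1 : Finset ι} (hv : A.IsFlat v) (hw0 : A.IsFlat w0)
    (hw1 : A.IsFlat w1) (h0v : w0 ≠ v) (h1v : w1 ≠ v) (g0 : A.Good χ t ε w0)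
    (g1 : A.Good χ t ε w1) {η η' : ℝ} (h0 : 0 < η') (hη : 4 * η' ≤ η) (hK : 8 * A.K * η' ≤ 1)
    {δ : C(I, E3) → ℂ}
    (hz : ∀ u, A.IsFlat u → u ≠ v → ∀ γ : C(I, E3), (∀ s, γ s ∈ A.V u η) → δ γ = 0)
    {m : E3 → ℂ} (hm : ∀ γ : C(I, E3), (∀ s, γ s ∈ A.N (4 * η')) →
      δ γ = principal (fun γ => A.psi χ t γ ε) m γ)
    {γ : C(I, E3)} (hγ : ∀ s, γ s ∈ A.V v η') (hγ0 : γ 0 ∈ A.V w0 η') (hγ1 : γ 1 ∈ A.V w1 η') :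
    δ γ = 0 := by
  have key : ∀ w, A.IsFlat w → w ≠ v → A.Good χ t ε w → ∀ x ∈ A.V w η', m x = 0 := by
    intro w hw hwv hg x hx
    refine hg.eq_zero h0.le hK hx hx fun γ h1 _ => ?_
    rw [← hm γ fun s => V_subset_N hw (h1 s)]
    exact hz w hw hwv γ fun s => V_mono hη (h1 s)
  rw [hm γ fun s => N_mono (by linarith) (V_subset_N hv (hγ s)), principal, key _ hw0 h0v g0 _ hγ0,
    key _ hw1 h1v g1 _ hγ1]
  ring

lemma ex_pos (t a : ι → ℝ) (ε : ℝ) : ∃ r : ℝ, 0 < r ∧ ex (fun _ => 0) t a ε = r := by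
  refine ⟨Real.exp (∑ j, ε * t j * a j / (2 * Real.pi)), Real.exp_pos _, ?_⟩
  rw [ex_apply]
  push_cast
  simp

lemma uu_zero (t : ι → ℝ) (G : Finset ι) :
    uu (fun _ => 0) t G 1 = Real.exp (∑ j ∈ G, t j) := by
  rw [uu_apply]; simp

/-- The value of a wall class on a path joining the two ends off the wall. -/
lemma WallData.eval_path {η : ℝ} {v w0 w1 : Finset ι} (W : WallData A η v w0 w1) (hη : η ≤ 1)
    (hv : A.IsFlat v) (hw0 : A.IsFlat w0) (hw1 : A.IsFlat w1) (h0v : w0 ≠ v) (h1v : w1 ≠ v)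
    (h01 : w0 ≠ w1) {Ecl : C(I, E3) → C(ℝ, ℂ)}
    (hE : ∀ γ : C(I, E3), (∀ s, γ s ∈ A.V v η ∧ W.z (γ s) ∉ wall) →
      Ecl γ = -principal (A.psi χ t) (W.F χ t) γ) {γ : C(I, E3)}
    (hγ : ∀ s, γ s ∈ A.V v η ∧ W.z (γ s) ∉ wall) (hγ0 : γ 0 ∈ A.V w0 η) (hγ1 : γ 1 ∈ A.V w1 η) :
    Ecl γ = A.psi χ t γ * ((1 - uu χ t W.G0) * W.s1 χ t (γ 1)) -
      (1 - uu χ t (W.J \ W.G1)) * W.s0 χ t (γ 0) := by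
  have : γ 1 ∉ A.V w0 η := fun h => by
    rcases eq_of_three hv hw0 hw1 hη (hγ 1).1 h hγ1 with e | e | e
    · exact h0v e.symm
    · exact h1v e.symm
    · exact h01 e
  rw [hE γ hγ, principal, F, if_pos hγ0, F, if_neg this, if_pos hγ1]
  ring

lemma WallData.eval_path_ne {η : ℝ} {v w0 w1 : Finset ι} (W : WallData A η v w0 w1)
    (h0 : 0 < ∑ j ∈ W.G0, t j) (h1 : 0 < ∑ j ∈ W.G1, t j) (hJ : ∑ j ∈ W.J, t j = 0)
    (γ : C(I, E3)) (x y : E3) :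
    (A.psi (fun _ => 0) t γ * ((1 - uu (fun _ => 0) t W.G0) * W.s1 (fun _ => 0) t y) -
      (1 - uu (fun _ => 0) t (W.J \ W.G1)) * W.s0 (fun _ => 0) t x) 1 ≠ 0 := by
  obtain ⟨a, a0, ha⟩ := ex_pos t (fun j => Theta (A.f j) γ) 1
  obtain ⟨b, b0, hb⟩ : ∃ r : ℝ, 0 < r ∧ W.s1 (fun _ => 0) t y 1 = r := ex_pos t _ 1
  obtain ⟨c, c0, hc⟩ : ∃ r : ℝ, 0 < r ∧ W.s0 (fun _ => 0) t x 1 = r := ex_pos t _ 1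
  have ha' : A.psi (fun _ => 0) t γ 1 = a := ha
  simp only [ContinuousMap.sub_apply, ContinuousMap.mul_apply, ContinuousMap.one_apply, ha', hb, hc,
    uu_zero]
  have hsum : ∑ j ∈ W.J \ W.G1, t j < 0 := by
    have := Finset.sum_sdiff (f := t) W.sub1
    linarith
  have h2 : 1 < Real.exp (∑ j ∈ W.G0, t j) := Real.one_lt_exp_iff.2 h0
  have h3 : Real.exp (∑ j ∈ W.J \ W.G1, t j) < 1 := by
    rw [← Real.exp_zero]; exact Real.exp_lt_exp.2 hsum
  have h4 : a * ((1 - Real.exp (∑ j ∈ W.G0, t j)) * b) -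
      (1 - Real.exp (∑ j ∈ W.J \ W.G1, t j)) * c < 0 := by
    have : 0 < a * ((Real.exp (∑ j ∈ W.G0, t j) - 1) * b) :=
      mul_pos a0 (mul_pos (by linarith) b0)
    have : 0 < (1 - Real.exp (∑ j ∈ W.J \ W.G1, t j)) * c := mul_pos (by linarith) c0
    linarith
  intro h5
  apply h4.ne
  exact_mod_cast h5

lemma not_mem_wall {z : ℂ} (h : z.im < 0) : z ∉ wall := fun h' => by
  have := h'.2; linarith

lemma balanced_zero {J : Finset ι} (h : ∑ j ∈ J, t j = 0) (h' : ∑ j, t j = 0) :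
    Balanced (fun _ => 0) t J := by
  refine ⟨by simp, by simp, h, ?_⟩
  have := Finset.sum_add_sum_compl J t
  linarith

variable (A) in
/-- A radius at which all constructions work. -/
lemma exists_radius : ∃ η : ℝ, 0 < η ∧ η ≤ 1 ∧ 8 * A.K ^ 2 * η ≤ 1 ∧ 8 * A.K * η ≤ 1 := by
  have hK := A.one_le_K
  have h1 : 8 * A.K ^ 2 * (1 / (8 * A.K ^ 2)) = 1 := mul_div_cancel₀ _ (by positivity)
  have h0 : (0 : ℝ) < 1 / (8 * A.K ^ 2) := by positivity
  refine ⟨1 / (8 * A.K ^ 2), h0, (eight_K_sq h0.le h1.le).2, h1.le, ?_⟩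
  have := (eight_K_sq h0.le h1.le).1
  linarith

/-- A path off the wall shows that the class of the wall is not principal. -/
lemma WallData.exists_class_ne {η : ℝ} {v w0 w1 : Finset ι} (W : WallData A η v w0 w1) (η0 : 0 < η)
    (η1 : η ≤ 1) (hη2 : 8 * A.K * η ≤ 1) (hv : A.IsFlat v) (hw0 : A.IsFlat w0) (hw1 : A.IsFlat w1)
    (h0v : w0 ≠ v) (h1v : w1 ≠ v) (h01 : w0 ≠ w1) (hJ : ∑ j ∈ W.J, t j = 0) (ht : ∑ j, t j = 0)
    (h0 : 0 < ∑ j ∈ W.G0, t j) (h1 : 0 < ∑ j ∈ W.G1, t j)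
    (hgood : ∀ u, A.IsFlat u → u ≠ v → A.Good (fun _ => 0) t 1 u)
    (hpath : ∀ η' > 0, ∃ γ : C(I, E3), (∀ r, γ r ∈ A.V v η') ∧ γ 0 ∈ A.V w0 η' ∧ γ 1 ∈ A.V w1 η' ∧
      ∀ r, (W.z (γ r)).im < 0) :
    ∃ η > 0, ∃ δ : C(I, E3) → ℂ, IsCrossed (A.N η) (fun γ => A.psi (fun _ => 0) t γ 1) δ ∧
      ∀ η' > 0, ¬ ∃ m : E3 → ℂ, ∀ γ : C(I, E3), (∀ s, γ s ∈ A.N η') →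
        δ γ = principal (fun γ => A.psi (fun _ => 0) t γ 1) m γ := by
  obtain ⟨E, hE, hEz, hEw, -⟩ := W.exists_class η1 hv hw0 hw1 h0v h1v h01 (balanced_zero hJ ht)
  refine ⟨η, η0, fun γ => E γ 1, isCrossed_eval hE 1, ?_⟩
  rintro η' h0' ⟨m, hm⟩
  set η'' := min η η' / 4 with hη''
  have h0'' : 0 < η'' := by positivity
  have hle : 4 * η'' ≤ η := by rw [hη'']; linarith [min_le_left η η']
  have hle' : 4 * η'' ≤ η' := by rw [hη'']; linarith [min_le_right η η']
  obtain ⟨γ, hγ, γ0, γ1, hz⟩ := hpath _ h0''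
  have hmono : ∀ {w x}, x ∈ A.V w η'' → x ∈ A.V w η := fun hx => V_mono (by linarith) hx
  have key : E γ 1 = 0 := eq_zero_of_principal (δ := fun γ => E γ 1) hv hw0 hw1 h0v h1v
    (hgood _ hw0 h0v) (hgood _ hw1 h1v) h0'' hle (by have := A.one_le_K; nlinarith)
    (fun u hu hup γ hγ => by simp only [hEz u hu hup γ hγ]; rfl)
    (fun γ hγ => hm γ fun s => N_mono hle' (hγ s)) hγ γ0 γ1
  rw [W.eval_path η1 hv hw0 hw1 h0v h1v h01 hEw (fun s => ⟨hmono (hγ s), not_mem_wall (hz s)⟩)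
    (hmono γ0) (hmono γ1)] at key
  exact W.eval_path_ne h0 h1 hJ γ _ _ key

/-- Resonance at a triple point only yields a nonprincipal crossed homomorphism. -/
theorem exists_class_point {p : Finset ι} {a b c k : ι} (h : A.Tri p a b c k)
    (hp : ∑ j ∈ p, t j = 0) (ht : ∑ j, t j = 0) (ha : 0 < t a) (hb : 0 < t b)
    (hgood : ∀ u, A.IsFlat u → u ≠ p → A.Good (fun _ => 0) t 1 u) :
    ∃ η > 0, ∃ δ : C(I, E3) → ℂ, IsCrossed (A.N η) (fun γ => A.psi (fun _ => 0) t γ 1) δ ∧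
      ∀ η' > 0, ¬ ∃ m : E3 → ℂ, ∀ γ : C(I, E3), (∀ s, γ s ∈ A.N η') →
        δ γ = principal (fun γ => A.psi (fun _ => 0) t γ 1) m γ := by
  obtain ⟨η, η0, η1, hη, hη2⟩ := A.exists_radius
  obtain ⟨W, WJ, W0, W1, Wa, Wb, Wc⟩ := exists_wall_point η0.le hη h.mem h.ma h.mb h.ab h.k
    (c := 1) (by simp)
  have hne : ∀ i, ({i} : Finset ι) ≠ p := fun i h' => by
    have := A.card_T p h.mem
    rw [← h'] at this; simp at this
  exact W.exists_class_ne η0 η1 hη2 h.flat (isFlat_single a) (isFlat_single b) (hne a) (hne b)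
    (fun h' => h.ab (Finset.singleton_inj.1 h')) (by rw [WJ]; exact hp) ht
    (by rw [W0]; simpa using ha) (by rw [W1]; simpa using hb) hgood fun η' h0' => by
      simpa only [WallData.z, Wa, Wb, Wc, Complex.ofReal_one, one_mul] using h.exists_path h0'

/-- Resonance at a line only yields a nonprincipal crossed homomorphism. -/
theorem exists_class_line {i : ι} {w0 w1 : Finset ι} (hw0 : A.IsFlat w0) (hw1 : A.IsFlat w1)
    (hi0 : i ∈ w0) (hi1 : i ∈ w1) (h0i : w0 ≠ {i}) (h1i : w1 ≠ {i}) (h01 : w0 ≠ w1)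
    (hi : t i = 0) (ht : ∑ j, t j = 0) (h0 : 0 < ∑ j ∈ w0.erase i, t j)
    (h1 : 0 < ∑ j ∈ w1.erase i, t j)
    (hgood : ∀ u, A.IsFlat u → u ≠ {i} → A.Good (fun _ => 0) t 1 u) :
    ∃ η > 0, ∃ δ : C(I, E3) → ℂ, IsCrossed (A.N η) (fun γ => A.psi (fun _ => 0) t γ 1) δ ∧
      ∀ η' > 0, ¬ ∃ m : E3 → ℂ, ∀ γ : C(I, E3), (∀ s, γ s ∈ A.N η') →
        δ γ = principal (fun γ => A.psi (fun _ => 0) t γ 1) m γ := by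
  obtain ⟨η, η0, η1, hη, hη2⟩ := A.exists_radius
  have hex : ∀ w : Finset ι, i ∈ w → w ≠ {i} → ∃ a ∈ w, a ≠ i := fun w hw hn => by
    by_contra hcon
    push Not at hcon
    exact hn (Finset.eq_singleton_iff_unique_mem.2 ⟨hw, hcon⟩)
  obtain ⟨a, ha, hai⟩ := hex w0 hi0 h0i
  obtain ⟨b, hb, hbi⟩ := hex w1 hi1 h1i
  obtain ⟨W, WJ, W0, W1, Wa, Wb, Wc⟩ := exists_wall_line η0.le hη hw0 hw1 h01 hi0 hi1 ha hai hb hbi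
    (c := 1) (by simp)
  have hJ : ∑ j ∈ ({i}ᶜ : Finset ι), t j = 0 := by
    have := Finset.sum_add_sum_compl {i} t
    rw [Finset.sum_singleton, hi, zero_add] at this
    rw [this, ht]
  exact W.exists_class_ne η0 η1 hη2 (isFlat_single i) hw0 hw1 h0i h1i h01 (by rw [WJ]; exact hJ) ht
    (by rw [W0]; exact h0) (by rw [W1]; exact h1) hgood fun η' h0' => by
      simpa only [WallData.z, Wa, Wb, Wc, Complex.ofReal_one, one_mul] using
        exists_path_line hw0 hw1 h01 hi0 hi1 ha hai hb hbi h0'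

end Arr

end

section

open unitInterval Topology
open Filter (Tendsto Eventually eventually_all)

/-! ### Additive cocycles on the complement are determined by their values on small loops -/

/-- Additive cocycles on paths. -/
abbrev IsAdd (S : Set E3) (φ : C(I, E3) → ℝ) : Prop := IsCrossed S (fun _ => (1 : ℝ)) φ

/-- `c` is a primitive of `φ` on `S`. -/
def IsPrim (S : Set E3) (φ : C(I, E3) → ℝ) (c : E3 → ℝ) : Prop :=
  ∀ γ : C(I, E3), (∀ t, γ t ∈ S) → φ γ = c (γ 0) - c (γ 1)

lemma isCocycle_one (S : Set E3) : IsCocycle S (fun _ => (1 : ℝ)) :=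
  ⟨fun _ _ => by simp, fun _ _ => rfl⟩

lemma isPrim_principal (S : Set E3) (c : E3 → ℝ) : IsPrim S (principal (fun _ => (1 : ℝ)) c) c :=
  fun γ _ => by simp [principal]

/-- The straight path. -/
def seg (x y : E3) : C(I, E3) := ⟨fun t => (1 - (t : ℝ)) • x + (t : ℝ) • y, by fun_prop⟩

lemma seg_apply (x y : E3) (t : I) : seg x y t = (1 - (t : ℝ)) • x + (t : ℝ) • y := rfl
@[simp] lemma seg_zero (x y : E3) : seg x y 0 = x := by simp [seg_apply]
@[simp] lemma seg_one (x y : E3) : seg x y 1 = y := by simp [seg_apply]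

lemma map_seg (g : E3 →L[ℂ] ℂ) (x y : E3) (t : I) :
    g (seg x y t) = (1 - (t : ℝ)) * g x + (t : ℝ) * g y := by
  simp [seg_apply, ← Complex.coe_smul]

lemma seg_mem {W : Set E3} (hW : Convex ℝ W) {x y : E3} (hx : x ∈ W) (hy : y ∈ W) (t : I) :
    seg x y t ∈ W := hW hx hy (by linarith [t.2.2]) t.2.1 (by ring)

lemma seg_mem_slit {z w : ℂ} (hz : z ≠ 0) (h : w / z ∈ Complex.slitPlane) (t : I) :
    (1 - ((t : ℝ) : ℂ)) * z + (t : ℝ) * w ≠ 0 := by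
  have h1 := Complex.starConvex_one_slitPlane h (sub_nonneg.2 t.2.2) t.2.1 (by ring)
  have h2 := Complex.slitPlane_ne_zero h1
  have : (1 - ((t : ℝ) : ℂ)) * z + (t : ℝ) * w =
      z * ((1 - (t : ℝ)) • (1 : ℂ) + (t : ℝ) • (w / z)) := by
    simp only [Complex.real_smul]; push_cast; field_simp
  rw [this]
  exact mul_ne_zero hz h2

lemma IsAdd.exists_prim_of_star {S : Set E3} {φ : C(I, E3) → ℝ} (h : IsAdd S φ) {x₀ : E3}
    (hS : StarConvex ℝ x₀ S) : ∃ c, IsPrim S φ c := by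
  refine ⟨fun x => φ (seg x x₀), fun γ hγ => ?_⟩
  have hm : ∀ x ∈ S, ∀ t : I, seg x x₀ t ∈ S := fun x hx t => by
    rw [seg_apply, add_comm]
    exact hS hx t.2.1 (by linarith [t.2.2]) (by ring)
  let K : C(I × I, E3) := ⟨fun p => (1 - (p.2 : ℝ)) • γ p.1 + (p.2 : ℝ) • x₀, by fun_prop⟩
  have h1 := h.sq K fun p => hm _ (hγ p.1) p.2
  have hx₀ : x₀ ∈ S := by simpa using hm _ (hγ 0) 1
  have e : ∀ f : C(I, I), (sqTop K).comp f = sqTop K := fun f => by ext; simp [sqTop, K]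
  have h2 := h.half (sqTop K) fun t => by simpa [sqTop, K] using hx₀
  rw [e, e] at h2
  have e1 : sqBot K = γ := by ext; simp [sqBot, K]
  have e2 : sqLeft K = seg (γ 0) x₀ := by ext; simp [sqLeft, K, seg_apply]
  have e3 : sqRight K = seg (γ 1) x₀ := by ext; simp [sqRight, K, seg_apply]
  rw [e1, e2, e3] at h1
  linarith

/-- A convex open set minus a complex hyperplane is connected. -/
lemma eq_of_locally_const {W : Set E3} (hW : Convex ℝ W) (hWo : IsOpen W) {g : E3 →L[ℂ] ℂ}
    {D : E3} (hD : g D = 1) {u : E3 → ℝ}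
    (hu : ∀ γ : C(I, E3), (∀ t, γ t ∈ W ∩ {x | g x ≠ 0}) → u (γ 0) = u (γ 1)) {x y : E3}
    (hx : x ∈ W) (hy : y ∈ W) (hgx : g x ≠ 0) (hgy : g y ≠ 0) : u x = u y := by
  have key : ∀ x ∈ W, ∀ y ∈ W, g x ≠ 0 → g y / g x ∈ Complex.slitPlane → u x = u y :=
    fun x hx y hy hgx h => by
      have := hu (seg x y) fun t => ⟨seg_mem hW hx hy t, by
        rw [Set.mem_ofPred_eq, map_seg]; exact seg_mem_slit hgx h t⟩
      simpa using this
  by_cases h : g y / g x ∈ Complex.slitPlane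
  · exact key x hx y hy hgx h
  have hc : Continuous fun τ : ℝ => x + ((τ : ℂ) * Complex.I * g x) • D := by fun_prop
  have h1 : ∀ᶠ τ : ℝ in 𝓝[>] 0, x + ((τ : ℂ) * Complex.I * g x) • D ∈ W :=
    (hc.tendsto 0 |>.eventually (hWo.mem_nhds (by simpa using hx))).filter_mono nhdsWithin_le_nhds
  obtain ⟨τ, hτ, hτ0⟩ := (h1.and self_mem_nhdsWithin).exists
  have hτ0 : 0 < τ := hτ0
  have hgw : g (x + ((τ : ℂ) * Complex.I * g x) • D) = g x * (1 + τ * Complex.I) := by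
    simp [hD]; ring
  have hne : (1 + τ * Complex.I : ℂ) ≠ 0 := fun h => by simpa using congrArg Complex.re h
  refine (key x hx _ hτ hgx ?_).trans (key _ hτ y hy ?_ ?_)
  · rw [hgw, mul_div_cancel_left₀ _ hgx, Complex.mem_slitPlane_iff]; simp
  · rw [hgw]; exact mul_ne_zero hgx hne
  · rw [hgw, ← div_div, Complex.mem_slitPlane_iff]
    rw [Complex.mem_slitPlane_iff, not_or, not_lt, not_not] at h
    set r := g y / g x
    have hr : r = (r.re : ℂ) := Complex.ext rfl (by simpa using h.2)
    have hr0 : r.re ≠ 0 := fun h0 => div_ne_zero hgy hgx (by rw [← Complex.re_add_im (g y / g x)]; simp [r] at h0 h; simp [h0, h.2])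
    right
    rw [hr, Complex.div_im]
    have : Complex.normSq (1 + τ * Complex.I) ≠ 0 := by simpa using hne
    simp
    refine ⟨⟨hr0, hτ0.ne'⟩, hne⟩

lemma slit_of_norm_one {z : ℂ} (h : ‖z‖ = 1) (h0 : 0 ≤ z.re) : z ∈ Complex.slitPlane := by
  rw [Complex.mem_slitPlane_iff]
  by_contra hcon
  push Not at hcon
  have : z = 0 := Complex.ext (le_antisymm hcon.1 h0) hcon.2
  simp [this] at h

lemma re_circ (t : I) : (circ t).re = Real.cos (2 * Real.pi * t) := by
  rw [circ, show (2 * Real.pi * (t : ℝ) * Complex.I : ℂ) = ((2 * Real.pi * t : ℝ) : ℂ) * Complex.I by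
    push_cast; ring, Complex.exp_ofReal_mul_I_re]

lemma im_circ (t : I) : (circ t).im = Real.sin (2 * Real.pi * t) := by
  rw [circ, show (2 * Real.pi * (t : ℝ) * Complex.I : ℂ) = ((2 * Real.pi * t : ℝ) : ℂ) * Complex.I by
    push_cast; ring, Complex.exp_ofReal_mul_I_im]

/-- An additive cocycle on a punctured convex set that vanishes on the loop has a primitive. -/
lemma IsAdd.exists_prim_of_loop {W : Set E3} (hW : Convex ℝ W) (hWo : IsOpen W)
    {g : E3 →L[ℂ] ℂ} {φ : C(I, E3) → ℝ} (h : IsAdd (W ∩ {x | g x ≠ 0}) φ) {L : C(I, E3)}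
    (hL : ∀ t, L t ∈ W) (hg0 : g (L 0) ≠ 0) (hg : ∀ t, g (L t) = circ t * g (L 0))
    (hL01 : L 1 = L 0) (hφ : φ L = 0) : ∃ c, IsPrim (W ∩ {x | g x ≠ 0}) φ c := by
  classical
  let z : E3 → ℂ := fun y => g y / g (L 0)
  have hzL : ∀ t, z (L t) = circ t := fun t => by simp only [z]; rw [hg t, mul_div_cancel_right₀ _ hg0]
  have hzc : Continuous z := by fun_prop
  have hz0 : ∀ y, z y ≠ 0 → g y ≠ 0 := fun y hy h0 => hy (by simp [z, h0])
  have hzl : ∀ x y (a b : ℝ), z (a • x + b • y) = a * z x + b * z y := fun x y a b => by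
    simp only [z, ← Complex.coe_smul, map_add, map_smul, smul_eq_mul]; ring
  let U : Bool → Set E3 := fun b => W ∩ {y | (bif b then z y else -z y) ∈ Complex.slitPlane}
  have hUo : ∀ b, IsOpen (U b) := fun b => hWo.inter (Complex.isOpen_slitPlane.preimage
    (by cases b <;> simp <;> fun_prop))
  have hUS : ∀ b, U b ⊆ W ∩ {x | g x ≠ 0} := fun b y hy => ⟨hy.1, hz0 y (by
    have := Complex.slitPlane_ne_zero hy.2
    cases b <;> simpa using this)⟩
  have hstar : ∀ b, ∀ x ∈ W, (bif b then z x else -z x) = 1 → StarConvex ℝ x (U b) :=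
    fun b x hx h1 y hy a' b' ha hb hab => ⟨hW hx hy.1 ha hb hab, by
      have := Complex.starConvex_one_slitPlane hy.2 ha hb hab
      rw [← h1] at this
      have e := hzl x y a' b'
      cases b <;> simp only [cond_true, cond_false, Complex.real_smul, Set.mem_ofPred_eq, e] at this ⊢
      · convert this using 1; ring
      · exact this⟩
  obtain ⟨c₁, h₁⟩ := IsAdd.exists_prim_of_star (h.mono (hUS true)) (hstar true (L 0) (hL 0)
    (by simp [hzL]))
  have hc2 : circ (halfR 0) = -1 := by
    apply Complex.ext
    · rw [re_circ, coe_halfR]; simp [show 2 * Real.pi * 2⁻¹ = Real.pi by ring]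
    · rw [im_circ, coe_halfR]; simp [show 2 * Real.pi * 2⁻¹ = Real.pi by ring]
  obtain ⟨c₂, h₂⟩ := IsAdd.exists_prim_of_star (h.mono (hUS false)) (hstar false (L (halfR 0))
    (hL _) (by simp [hzL, hc2]))
  have hag : ∀ s : ℝ, ∀ x ∈ W, ∀ y ∈ W, 0 < s * (z x).im → 0 < s * (z y).im →
      c₂ x - c₁ x = c₂ y - c₁ y := fun s x hx y hy hzx hzy => by
    have him : ∀ t, (z (seg x y t)).im ≠ 0 := fun t => by
      rw [seg_apply, hzl]
      have : 0 < s * ((1 - (t : ℝ)) * (z x).im + t * (z y).im) := by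
        rcases eq_or_lt_of_le t.2.1 with h0 | h0
        · rw [← h0]; simpa using hzx
        · nlinarith [t.2.2, mul_pos h0 hzy, mul_nonneg (sub_nonneg.2 t.2.2) hzx.le]
      rw [Complex.add_im, Complex.im_ofReal_mul, Complex.im_ofReal_mul]
      exact fun h0 => by rw [h0] at this; simp at this
    have e1 := h₁ (seg x y) fun t => ⟨seg_mem hW hx hy t, Or.inr (him t)⟩
    have e2 := h₂ (seg x y) fun t => ⟨seg_mem hW hx hy t, Or.inr (by simpa using him t)⟩
    simp only [seg_zero, seg_one] at e1 e2
    linarith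
  have hpi := Real.pi_pos
  have hq1 : ∀ t : I, (t : ℝ) ≤ 1 / 4 ∨ 3 / 4 ≤ (t : ℝ) → L t ∈ U true := fun t ht => ⟨hL t, by
    simp only [cond_true, Set.mem_ofPred_eq, hzL]
    refine slit_of_norm_one (norm_circ t) ?_
    rw [re_circ]
    rcases ht with ht | ht
    · exact Real.cos_nonneg_of_mem_Icc ⟨by nlinarith [t.2.1], by nlinarith⟩
    · rw [← Real.cos_sub_two_pi]
      exact Real.cos_nonneg_of_mem_Icc ⟨by nlinarith [t.2.2], by nlinarith [t.2.2]⟩⟩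
  have hq2 : ∀ t : I, 1 / 4 ≤ (t : ℝ) → (t : ℝ) ≤ 3 / 4 → L t ∈ U false := fun t ht ht' => ⟨hL t, by
    simp only [cond_false, Set.mem_ofPred_eq, hzL]
    refine slit_of_norm_one (by rw [norm_neg, norm_circ t]) ?_
    rw [Complex.neg_re, re_circ, Left.nonneg_neg_iff]
    exact Real.cos_nonpos_of_pi_div_two_le_of_le (by nlinarith) (by nlinarith)⟩
  have hM : ∀ t, L t ∈ W ∩ {x | g x ≠ 0} := fun t => ⟨hL t, by
    rw [Set.mem_ofPred_eq, hg]
    exact mul_ne_zero (fun h0 => by simpa [h0] using norm_circ t) hg0⟩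
  have e0 := h.half L hM
  have e1 := h.half (L.comp halfL) fun t => hM _
  have e2 := h.half (L.comp halfR) fun t => hM _
  rw [h₁ ((L.comp halfL).comp halfL) fun t => hq1 _ (Or.inl (by
      rw [coe_halfL, coe_halfL]; linarith [t.2.2])),
    h₂ ((L.comp halfL).comp halfR) fun t => hq2 _ (by
      rw [coe_halfL, coe_halfR]; linarith [t.2.1]) (by rw [coe_halfL, coe_halfR]; linarith [t.2.2])] at e1
  rw [h₂ ((L.comp halfR).comp halfL) fun t => hq2 _ (by
      rw [coe_halfR, coe_halfL]; linarith [t.2.1]) (by rw [coe_halfR, coe_halfL]; linarith [t.2.2]),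
    h₁ ((L.comp halfR).comp halfR) fun t => hq1 _ (Or.inr (by
      rw [coe_halfR, coe_halfR]; linarith [t.2.1]))] at e2
  simp only [ContinuousMap.comp_apply, halfL_zero, halfR_one, halfL_one, hL01] at e0 e1 e2
  set k := c₂ (L (halfL (halfR 0))) - c₁ (L (halfL (halfR 0))) with hk
  have hk' : c₂ (L (halfR (halfR 0))) - c₁ (L (halfR (halfR 0))) = k := by linarith
  have hov : ∀ y ∈ W, (z y).im ≠ 0 → c₂ y - c₁ y = k := fun y hy him => by
    rcases lt_or_gt_of_ne him with h0 | h0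
    · rw [← hk']
      refine hag (-1) _ hy _ (hL _) (by linarith) ?_
      rw [hzL, im_circ, coe_halfR, coe_halfR, show 2 * Real.pi * ((1 + (1 + ((0 : I) : ℝ)) / 2) / 2) =
        Real.pi / 2 + Real.pi by simp; ring, Real.sin_add_pi]
      simp
    · refine hag 1 _ hy _ (hL _) (by linarith) ?_
      rw [hzL, im_circ, coe_halfL, coe_halfR, show 2 * Real.pi * ((1 + ((0 : I) : ℝ)) / 2 / 2) =
        Real.pi / 2 by simp; ring]
      simp
  let C : E3 → ℝ := fun y => if z y ∈ Complex.slitPlane then c₁ y else c₂ y - k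
  refine ⟨C, fun γ hγ => ?_⟩
  have hcov : W ∩ {x | g x ≠ 0} = ⋃ b, U b := by
    refine Set.Subset.antisymm (fun y hy => ?_) (Set.iUnion_subset hUS)
    rw [Set.mem_iUnion]
    by_cases hz : z y ∈ Complex.slitPlane
    · exact ⟨true, hy.1, hz⟩
    · refine ⟨false, hy.1, ?_⟩
      rw [Complex.mem_slitPlane_iff, not_or, not_lt, not_not] at hz
      refine Or.inl ?_
      rw [cond_false, Complex.neg_re, Left.neg_pos_iff]
      exact lt_of_le_of_ne hz.1 fun h0 => (div_ne_zero hy.2 hg0 : z y ≠ 0) (Complex.ext h0 hz.2)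
  rw [hcov] at hγ h
  refine (IsCrossed.eq_of_cover hUo h (isCrossed_principal (isCocycle_one _) C) (fun b γ hγ => ?_) γ
    hγ).trans (isPrim_principal Set.univ C γ fun _ => trivial)
  rw [isPrim_principal Set.univ _ γ fun _ => trivial]
  cases b
  · have e : ∀ y ∈ U false, C y = c₂ y - k := by
      intro y hy
      simp only [C]
      split_ifs with hz
      · have h2 := hy.2
        rw [Set.mem_ofPred_eq, cond_false, Complex.mem_slitPlane_iff, Complex.neg_re,
          Complex.neg_im] at h2
        rw [Complex.mem_slitPlane_iff] at hz
        have := hov y hy.1 (by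
          rcases h2 with h2 | h2
          · rcases hz with hz | hz
            · linarith
            · exact hz
          · simpa using h2)
        linarith
      · rfl
    rw [h₂ γ hγ, e _ (hγ 0), e _ (hγ 1)]
    ring
  · rw [h₁ γ hγ]
    have e : ∀ y ∈ U true, C y = c₁ y :=
      fun y hy => if_pos hy.2
    rw [e _ (hγ 0), e _ (hγ 1)]

/-- An additive cocycle extends over a hyperplane around which it vanishes. -/
lemma IsAdd.exists_extension {S : Set E3} (hS : IsOpen S) {g : E3 →L[ℂ] ℂ} {D : E3} (hD : g D = 1)
    {φ : C(I, E3) → ℝ} (h : IsAdd (S ∩ {x | g x ≠ 0}) φ)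
    (hloop : ∀ q ∈ S, g q = 0 → ∀ ρ > 0, ∃ L : C(I, E3), (∀ t, L t ∈ Metric.ball q ρ) ∧
      g (L 0) ≠ 0 ∧ (∀ t, g (L t) = circ t * g (L 0)) ∧ L 1 = L 0 ∧ φ L = 0) :
    ∃ φ' : C(I, E3) → ℝ, IsAdd S φ' ∧ ∀ γ, (∀ t, γ t ∈ S ∩ {x | g x ≠ 0}) → φ' γ = φ γ := by
  classical
  have hex : ∀ q : {q // q ∈ S ∧ g q = 0}, ∃ ρ > 0, Metric.ball q.1 ρ ⊆ S ∧
      ∃ c, IsPrim (Metric.ball q.1 ρ ∩ {x | g x ≠ 0}) φ c := by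
    rintro ⟨q, hq, hgq⟩
    obtain ⟨ρ, hρ, hb⟩ := Metric.isOpen_iff.1 hS q hq
    obtain ⟨L, h1, h2, h3, h4, h5⟩ := hloop q hq hgq ρ hρ
    exact ⟨ρ, hρ, hb, IsAdd.exists_prim_of_loop (convex_ball q ρ) Metric.isOpen_ball
      (h.mono (Set.inter_subset_inter_left _ hb)) h1 h2 h3 h4 h5⟩
  choose ρ hρ hb c hc using hex
  let B : {q // q ∈ S ∧ g q = 0} → Set E3 := fun q => Metric.ball q.1 (ρ q)
  have hconst : ∀ q q' x y, x ∈ B q ∩ B q' → y ∈ B q ∩ B q' → g x ≠ 0 → g y ≠ 0 →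
      c q x - c q' x = c q y - c q' y := fun q q' x y hx hy hgx hgy =>
    eq_of_locally_const ((convex_ball _ _).inter (convex_ball _ _))
      (Metric.isOpen_ball.inter Metric.isOpen_ball) hD (u := fun x => c q x - c q' x)
      (fun γ hγ => by
        have e1 := hc q γ fun t => ⟨(hγ t).1.1, (hγ t).2⟩
        have e2 := hc q' γ fun t => ⟨(hγ t).1.2, (hγ t).2⟩
        change c q _ - c q' _ = c q _ - c q' _
        linarith) hx hy hgx hgy
  have hnear : ∀ O : Set E3, IsOpen O → ∀ x ∈ O, g x = 0 → ∃ y ∈ O, g y ≠ 0 := by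
    intro O hO x hx hgx
    have hcn : Continuous fun τ : ℝ => x + (τ : ℂ) • D := by fun_prop
    have h1 : ∀ᶠ τ : ℝ in 𝓝[>] 0, x + (τ : ℂ) • D ∈ O :=
      (hcn.tendsto 0 |>.eventually (hO.mem_nhds (by simpa using hx))).filter_mono nhdsWithin_le_nhds
    obtain ⟨τ, hτ, hτ0⟩ := (h1.and self_mem_nhdsWithin).exists
    have hτ0 : 0 < τ := hτ0
    exact ⟨_, hτ, by simp [hgx, hD, hτ0.ne']⟩
  have hself : ∀ q, q.1 ∈ B q := fun q => Metric.mem_ball_self (hρ q)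
  let c' : {q // q ∈ S ∧ g q = 0} → E3 → ℝ := fun q x =>
    if hx : x ∈ S ∧ g x = 0 then
      if hy : ∃ y ∈ B q ∩ B ⟨x, hx⟩, g y ≠ 0 then c q hy.choose - c ⟨x, hx⟩ hy.choose else 0
    else c q x
  have hc'0 : ∀ q x, g x ≠ 0 → c' q x = c q x := fun q x hx => dif_neg fun h => hx h.2
  have hc'1 : ∀ q x (hx : x ∈ S ∧ g x = 0) y, y ∈ B q ∩ B ⟨x, hx⟩ → g y ≠ 0 →
      c' q x = c q y - c ⟨x, hx⟩ y := fun q x hx y hy hgy => by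
    have hy' : ∃ y ∈ B q ∩ B ⟨x, hx⟩, g y ≠ 0 := ⟨y, hy, hgy⟩
    simp only [c', dif_pos hx, dif_pos hy']
    exact hconst _ _ _ _ hy'.choose_spec.1 hy hy'.choose_spec.2 hgy
  have hc' : ∀ q q' x y, x ∈ B q ∩ B q' → y ∈ B q ∩ B q' → c' q x - c' q' x = c' q y - c' q' y := by
    have key : ∀ q q' x, x ∈ B q ∩ B q' → ∃ y ∈ B q ∩ B q', g y ≠ 0 ∧
        c' q x - c' q' x = c q y - c q' y := by
      intro q q' x hx
      by_cases hgx : g x = 0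
      · have hxS : x ∈ S ∧ g x = 0 := ⟨hb q hx.1, hgx⟩
        obtain ⟨y, hy, hgy⟩ := hnear (B q ∩ B q' ∩ B ⟨x, hxS⟩) ((Metric.isOpen_ball.inter
          Metric.isOpen_ball).inter Metric.isOpen_ball) x ⟨hx, hself ⟨x, hxS⟩⟩ hgx
        refine ⟨y, hy.1, hgy, ?_⟩
        rw [hc'1 q x hxS y ⟨hy.1.1, hy.2⟩ hgy, hc'1 q' x hxS y ⟨hy.1.2, hy.2⟩ hgy]
        ring
      · exact ⟨x, hx, hgx, by rw [hc'0 _ _ hgx, hc'0 _ _ hgx]⟩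
    intro q q' x y hx hy
    obtain ⟨x', hx', hgx', e⟩ := key q q' x hx
    obtain ⟨y', hy', hgy', e'⟩ := key q q' y hy
    rw [e, e', hconst q q' x' y' hx' hy' hgx' hgy']
  let U : Option {q // q ∈ S ∧ g q = 0} → Set E3 := fun o => o.elim (S ∩ {x | g x ≠ 0}) B
  have hU : ⋃ o, U o = S := by
    refine Set.Subset.antisymm (Set.iUnion_subset ?_) fun x hx => ?_
    · rintro (_ | q)
      · exact Set.inter_subset_left
      · exact hb q
    · by_cases hgx : g x = 0
      · exact Set.mem_iUnion.2 ⟨some ⟨x, hx, hgx⟩, hself ⟨x, hx, hgx⟩⟩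
      · exact Set.mem_iUnion.2 ⟨none, hx, hgx⟩
  obtain ⟨φ', h1, h2⟩ := IsCrossed.exists_glue (U := U) (ψ := fun _ => (1 : ℝ))
    (by
      rintro (_ | q)
      · exact hS.inter (isOpen_ne_fun g.continuous continuous_const)
      · exact Metric.isOpen_ball) (isCocycle_one _)
    (fun o => o.elim φ fun q => principal (fun _ => 1) (c' q))
    (by
      rintro (_ | q)
      · exact h
      · exact isCrossed_principal (isCocycle_one _) _)
    (by
      have key : ∀ q, ∀ γ : C(I, E3), (∀ t, γ t ∈ S ∩ {x | g x ≠ 0}) → (∀ t, γ t ∈ B q) →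
          φ γ = principal (fun _ => 1) (c' q) γ := fun q γ h1 h2 => by
        rw [isPrim_principal Set.univ _ γ fun _ => trivial, hc'0 _ _ (h1 0).2, hc'0 _ _ (h1 1).2,
          hc q γ fun t => ⟨h2 t, (h1 t).2⟩]
      rintro (_ | q) (_ | q') γ hγ hγ'
      · rfl
      · exact key q' γ hγ hγ'
      · exact (key q γ hγ' hγ).symm
      · change principal (fun _ => (1 : ℝ)) (c' q) γ = principal (fun _ => (1 : ℝ)) (c' q') γ
        rw [isPrim_principal Set.univ _ γ fun _ => trivial,
          isPrim_principal Set.univ _ γ fun _ => trivial]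
        have := hc' q q' (γ 0) (γ 1) ⟨hγ 0, hγ' 0⟩ ⟨hγ 1, hγ' 1⟩
        linarith)
  rw [hU] at h1
  exact ⟨φ', h1, fun γ hγ => h2 none γ hγ⟩

namespace Arr

variable {ι : Type*} [Fintype ι] [DecidableEq ι] {A : Arr ι}

lemma exists_generic_point (j : ι) : ∃ v : E3, A.f j v = 0 ∧ ∀ i ≠ j, A.f i v ≠ 0 := by
  obtain ⟨v, hv, h⟩ := Module.Dual.exists_forall_mem_ne_zero_of_forall_exists
    (p := LinearMap.ker (A.f j : E3 →ₗ[ℂ] ℂ)) (f := fun i : {i // i ≠ j} => (A.f i : E3 →ₗ[ℂ] ℂ))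
    fun i => by
      obtain ⟨s, hs, hi, hj⟩ := A.exists_flat i.2
      obtain ⟨k, hk, -⟩ := hs.exists_notMem ∅ (by simp)
      have hd : A.d i j k ≠ 0 := fun h => hk ((hs.d_eq_zero_iff hi hj i.2 k).1 h)
      refine ⟨A.D i j k, ?_, ?_⟩
      · simp [A.f_D, d_self]
      · simp [A.f_D, hd]
  exact ⟨v, by simpa using hv, fun i hi => h ⟨i, hi⟩⟩

/-- An additive cocycle on the complement that vanishes on the small loops around the lines has a
primitive. -/
theorem exists_prim {φ : C(I, E3) → ℝ} (h : IsAdd A.M φ)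
    (hl : ∀ j, ∃ a b, A.d j a b ≠ 0 ∧ ∃ η > 0, ∀ x ∈ A.V {j} η, φ (loop (A.rk j a b) x) = 0) :
    ∃ c, IsPrim A.M φ c := by
  have key : ∀ s : Finset ι, ∃ φ', IsAdd {x | ∀ i ∉ s, A.f i x ≠ 0} φ' ∧
      ∀ γ : C(I, E3), (∀ t, γ t ∈ A.M) → φ' γ = φ γ := by
    intro s
    induction s using Finset.induction_on with
    | empty => exact ⟨φ, h.mono fun x hx i => hx i (by simp), fun _ _ => rfl⟩
    | insert j s hj ih =>
      obtain ⟨φ', h', hφ'⟩ := ih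
      obtain ⟨a, b, hd, η, η0, hη⟩ := hl j
      have hS : IsOpen {x | ∀ i ∉ insert j s, A.f i x ≠ 0} := by
        simp only [Set.ofPred_forall]
        exact isOpen_iInter_of_finite fun i => isOpen_iInter_of_finite fun _ =>
          isOpen_ne_fun (A.f i).continuous continuous_const
      have hD : A.f j (A.D j a b) = 1 := by rw [A.f_D, div_self hd]; simp
      obtain ⟨φ'', h'', e⟩ := IsAdd.exists_extension hS hD (φ := φ') (h'.mono fun x hx i hi => by
        by_cases hij : i = j
        · rw [hij]; exact hx.2
        · exact hx.1 i (by simp [hij, hi])) (by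
        intro q hq hgq ρ hρ
        obtain ⟨v, hv, hv'⟩ := A.exists_generic_point j
        have hc : ∀ᶠ τ : ℝ in 𝓝[>] 0, q + (τ : ℂ) • v ∈ Metric.ball q ρ := by
          have : Continuous fun τ : ℝ => q + (τ : ℂ) • v := by fun_prop
          exact (this.tendsto 0 |>.eventually (Metric.isOpen_ball.mem_nhds
            (by simpa using hρ))).filter_mono nhdsWithin_le_nhds
        have hg : ∀ i, ∀ᶠ τ : ℝ in 𝓝[>] 0, i ≠ j → A.f i (q + (τ : ℂ) • v) ≠ 0 := fun i => by
          by_cases h0 : A.f i q = 0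
          · filter_upwards [self_mem_nhdsWithin] with τ hτ hij
            have : 0 < τ := hτ
            simp [h0, this.ne', hv' i hij]
          · have : Continuous fun τ : ℝ => A.f i (q + (τ : ℂ) • v) := by fun_prop
            exact ((this.tendsto 0 |>.eventually_ne (by simpa using h0)).filter_mono
              nhdsWithin_le_nhds).mono fun _ h _ => h
        obtain ⟨τ, hτ, hτ'⟩ := (hc.and (eventually_all.2 hg)).exists
        set q' := q + (τ : ℂ) • v with hq'
        have hq'j : A.f j q' = 0 := by simp [hq', hgq, hv]
        have e1 := A.eventually_mem_V (s := {j}) η0 (ContinuousMap.const I q')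
          ⟨fun t => circ t • A.D j a b, by fun_prop⟩ (by simpa using hq'j) (by simpa using hτ')
          (by
            intro t i hi
            rw [Finset.mem_singleton] at hi
            subst hi
            simpa [hD] using fun h0 => by simpa [h0] using norm_circ t)
        have e2 : ∀ᶠ r : ℝ in 𝓝[>] 0, r * ‖A.D j a b‖ < ρ - dist q' q := by
          have : Continuous fun r : ℝ => r * ‖A.D j a b‖ := by fun_prop
          exact (this.tendsto 0 |>.eventually_lt_const (by simpa using hτ)).filter_mono
            nhdsWithin_le_nhds
        obtain ⟨r, ⟨hr1, hr2⟩, hr0⟩ := ((e1.and e2).and self_mem_nhdsWithin).exists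
        have hr0 : 0 < r := hr0
        have hL : ∀ t, loop (A.rk j a b) (q' + (r : ℂ) • A.D j a b) t =
            q' + (r : ℂ) • circ t • A.D j a b := fun t => by
          rw [loop_apply, rk_apply]
          simp only [map_add, map_smul, hq'j, hD, smul_eq_mul, mul_one, zero_add]
          rw [add_assoc, ← smul_assoc, ← smul_assoc, ← add_smul]
          simp only [smul_eq_mul]
          ring_nf
        have h0V : q' + (r : ℂ) • A.D j a b ∈ A.V {j} η := by simpa using hr1 0
        refine ⟨loop (A.rk j a b) (q' + (r : ℂ) • A.D j a b), fun t => ?_, ?_, fun t => ?_, ?_, ?_⟩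
        · rw [hL, Metric.mem_ball]
          refine (dist_triangle _ q' _).trans_lt ?_
          rw [dist_eq_norm, add_sub_cancel_left, norm_smul, norm_smul, norm_circ, one_mul,
            Complex.norm_real, Real.norm_of_nonneg hr0.le]
          linarith
        · rw [loop_zero]; exact h0V.1 j
        · rw [hL, loop_zero]; simp [hq'j, hD]; ring
        · simp
        · rw [hφ' _ fun t => by rw [hL]; exact (hr1 t).1]
          exact hη _ h0V)
      refine ⟨φ'', h'', fun γ hγ => (e γ fun t => ⟨fun i _ => hγ t i, hγ t j⟩).trans (hφ' γ hγ)⟩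
  obtain ⟨φ', h', e⟩ := key Finset.univ
  obtain ⟨c, hc⟩ := IsAdd.exists_prim_of_star (S := Set.univ) (h'.mono fun x _ => by simp)
    (x₀ := 0) (starConvex_univ _)
  exact ⟨c, fun γ hγ => (e γ hγ).symm.trans (hc γ fun _ => trivial)⟩

end Arr

end

section

open unitInterval Topology
open Filter (Tendsto Eventually eventually_all)

/-! ### Transport of crossed homomorphisms by homeomorphisms of the complements -/

/-- The image of a map under `g`, when it is continuous. -/
def push {Y : Type*} [TopologicalSpace Y] (g : E3 → E3) (γ : C(Y, E3)) : C(Y, E3) :=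
  open Classical in if h : Continuous fun t => g (γ t) then ⟨fun t => g (γ t), h⟩ else γ

section push

variable {Y : Type*} [TopologicalSpace Y] {g : E3 → E3} {S S' : Set E3}

lemma push_apply (hg : ContinuousOn g S') {γ : C(Y, E3)} (hγ : ∀ t, γ t ∈ S') (t : Y) :
    push g γ t = g (γ t) := by
  have h : Continuous fun t => g (γ t) := hg.comp_continuous γ.continuous hγ
  rw [push, dif_pos h]; rfl

lemma push_comp {Z : Type*} [TopologicalSpace Z] (hg : ContinuousOn g S') {γ : C(Y, E3)}
    (hγ : ∀ t, γ t ∈ S') (f : C(Z, Y)) : push g (γ.comp f) = (push g γ).comp f := by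
  ext1 t
  rw [push_apply hg fun t => hγ (f t), ContinuousMap.comp_apply, ContinuousMap.comp_apply,
    push_apply hg hγ]

lemma IsCrossed.pull {R : Type*} [CommRing R] {ψ δ : C(I, E3) → R} (h : IsCrossed S ψ δ)
    (hg : ContinuousOn g S') (hm : ∀ x ∈ S', g x ∈ S) :
    IsCrossed S' (fun γ => ψ (push g γ)) (fun γ => δ (push g γ)) := by
  constructor
  · intro γ hγ
    simp only [push_comp hg hγ]
    exact h.half _ fun t => by rw [push_apply hg hγ]; exact hm _ (hγ t)
  · intro K hK
    have e : ∀ f : C(I, I × I), push g (K.comp f) = (push g K).comp f := push_comp hg hK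
    have := h.sq (push g K) fun t => by rw [push_apply hg hK]; exact hm _ (hK t)
    have e1 : push g (sqBot K) = sqBot (push g K) := e ⟨fun t => (t, 0), by fun_prop⟩
    have e2 : push g (sqTop K) = sqTop (push g K) := e ⟨fun t => (t, 1), by fun_prop⟩
    have e3 : push g (sqLeft K) = sqLeft (push g K) := e ⟨fun t => (0, t), by fun_prop⟩
    have e4 : push g (sqRight K) = sqRight (push g K) := e ⟨fun t => (1, t), by fun_prop⟩
    rw [e1, e2, e3, e4]
    exact this

lemma IsCrossed.gauge {R : Type*} [CommRing R] {ψ ψ' δ : C(I, E3) → R} (h : IsCrossed S ψ δ)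
    {G : E3 → R} (hψ : ∀ γ : C(I, E3), (∀ t, γ t ∈ S) → G (γ 0) * ψ γ = ψ' γ * G (γ 1)) :
    IsCrossed S ψ' (fun γ => G (γ 0) * δ γ) := by
  constructor
  · intro γ hγ
    have e := hψ (γ.comp halfL) fun t => hγ _
    simp only [ContinuousMap.comp_apply, halfL_zero, halfL_one] at e ⊢
    rw [h.half γ hγ]
    linear_combination δ (γ.comp halfR) * e
  · intro K hK
    have e1 := hψ (sqBot K) fun t => hK _
    have e2 := hψ (sqLeft K) fun t => hK _
    have e3 := h.sq K hK
    simp only [sqBot, sqLeft, sqRight, sqTop, ContinuousMap.coe_mk] at e1 e2 e3 ⊢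
    linear_combination G (K (0, 0)) * e3 - δ ⟨fun s => K (1, s), _⟩ * e1 +
      δ ⟨fun s => K (s, 1), _⟩ * e2

end push

lemma ex_pull {ι : Type*} [Fintype ι] (χ : ι → ℤ) (t : ι → ℝ) (Y : ι → ι → ℤ) (a : ι → ℝ) :
    ex χ t (fun i => ∑ j, Y i j * a j) =
      ex (fun j => ∑ i, χ i * Y i j) (fun j => ∑ i, t i * Y i j) a := by
  ext ε
  rw [ex_apply, ex_apply]
  congr 1
  push_cast
  simp only [Finset.mul_sum, ← Finset.sum_add_distrib, Finset.sum_mul, Finset.sum_div]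
  rw [Finset.sum_comm]
  exact Finset.sum_congr rfl fun _ _ => Finset.sum_congr rfl fun _ _ => by ring

namespace Arr

variable {ι : Type*} [Fintype ι] [DecidableEq ι]

/-- A homogeneous homeomorphism from the complement of `B` to that of `A`. -/
structure ConeIso (A B : Arr ι) where
  g : E3 → E3
  g' : E3 → E3
  mem : ∀ x ∈ B.M, g x ∈ A.M
  mem' : ∀ x ∈ A.M, g' x ∈ B.M
  left : ∀ x ∈ B.M, g' (g x) = x
  right : ∀ x ∈ A.M, g (g' x) = x
  cont : ContinuousOn g B.M
  cont' : ContinuousOn g' A.M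
  smul : ∀ x ∈ B.M, ∀ c : ℂ, c ≠ 0 → g (c • x) = c • g x
  smul' : ∀ x ∈ A.M, ∀ c : ℂ, c ≠ 0 → g' (c • x) = c • g' x

variable {A B : Arr ι}

lemma smul_mem_M {x : E3} (hx : x ∈ A.M) {c : ℂ} (hc : c ≠ 0) : c • x ∈ A.M := fun i => by
  rw [map_smul]; exact mul_ne_zero hc (hx i)

lemma ne_zero_of_mem_M {x : E3} (hx : x ∈ A.M) : x ≠ 0 := by
  have : Nonempty ι := Fintype.card_pos_iff.1 (by linarith [A.card])
  rintro rfl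
  exact hx (Classical.arbitrary ι) (map_zero _)

namespace ConeIso

variable (h : ConeIso A B)

def symm : ConeIso B A := ⟨h.g', h.g, h.mem', h.mem, h.right, h.left, h.cont', h.cont, h.smul', h.smul⟩

/-- Small neighbourhoods of the flats are mapped into given ones. -/
theorem exists_N {ε : ℝ} (h0 : 0 < ε) : ∃ η > 0, ∀ η' ≤ η, ∀ x ∈ B.N η', h.g x ∈ A.N ε := by
  obtain ⟨e, e0, he⟩ := A.exists_mem_V h0
  let K : Set E3 := Metric.sphere 0 1 ∩ ⋂ i, {y | e ≤ ‖A.f i y‖}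
  have hK : IsCompact K := (isCompact_sphere _ _).inter_right
    (isClosed_iInter fun i => isClosed_le continuous_const (by fun_prop))
  have hKM : K ⊆ A.M := fun y hy i h => by
    have : e ≤ ‖A.f i y‖ := Set.mem_iInter.1 hy.2 i
    rw [h, norm_zero] at this; linarith
  have key : ∀ p : ι × ι, ∃ c > 0, ∀ y ∈ K, c * ‖B.f p.2 (h.g' y)‖ ≤ ‖B.f p.1 (h.g' y)‖ := by
    rintro ⟨i, j⟩
    have hc : ContinuousOn (fun y => ‖B.f i (h.g' y)‖ / ‖B.f j (h.g' y)‖) K := by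
      refine ContinuousOn.div ?_ ?_ fun y hy => norm_ne_zero_iff.2 (h.mem' y (hKM hy) j)
      · exact ((B.f i).continuous.comp_continuousOn (h.cont'.mono hKM)).norm
      · exact ((B.f j).continuous.comp_continuousOn (h.cont'.mono hKM)).norm
    obtain hem | hne := K.eq_empty_or_nonempty
    · exact ⟨1, one_pos, by simp [hem]⟩
    obtain ⟨y, hy, hmin⟩ := hK.exists_isMinOn hne hc
    have hp : ∀ k, ∀ y ∈ K, 0 < ‖B.f k (h.g' y)‖ := fun k y hy =>
      norm_pos_iff.2 (h.mem' y (hKM hy) k)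
    refine ⟨_, div_pos (hp i y hy) (hp j y hy), fun y' hy' => ?_⟩
    have := hmin hy'
    rwa [Set.mem_ofPred_eq, le_div_iff₀ (hp j y' hy')] at this
  choose c c0 hc using key
  have : Nonempty ι := Fintype.card_pos_iff.1 (by linarith [A.card])
  obtain ⟨p, -, hp⟩ := Finset.exists_min_image Finset.univ c Finset.univ_nonempty
  refine ⟨c p, c0 p, fun η' hη' x hx => ?_⟩
  obtain ⟨s, hs, hxs⟩ := Set.mem_iUnion₂.1 hx
  have hxM : x ∈ B.M := hxs.1
  have hg : h.g x ∈ A.M := h.mem x hxM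
  have hn : 0 < ‖h.g x‖ := norm_pos_iff.2 (ne_zero_of_mem_M hg)
  have hn' : ((‖h.g x‖⁻¹ : ℝ) : ℂ) ≠ 0 := by exact_mod_cast (inv_pos.2 hn).ne'
  by_cases hcase : ∃ i, ‖A.f i (h.g x)‖ < e * ‖h.g x‖
  · obtain ⟨i, hi⟩ := hcase
    obtain ⟨u, hu, hxu⟩ := he _ hg i hi
    exact V_subset_N hu hxu
  · push Not at hcase
    exfalso
    have hy : ((‖h.g x‖⁻¹ : ℝ) : ℂ) • h.g x ∈ K := by
      refine ⟨?_, Set.mem_iInter.2 fun i => ?_⟩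
      · rw [mem_sphere_zero_iff_norm, norm_smul, Complex.norm_real, norm_inv, norm_norm,
          inv_mul_cancel₀ hn.ne']
      · rw [Set.mem_ofPred_eq, map_smul, norm_smul, Complex.norm_real, norm_inv, norm_norm,
          inv_mul_eq_div, le_div_iff₀ hn]
        exact hcase i
    obtain ⟨i, hi⟩ := hs.nonempty
    obtain ⟨j, hj, -⟩ := hs.exists_notMem ∅ (by simp)
    have h1 := hc (i, j) _ hy
    rw [h.smul' _ hg _ hn', h.left x hxM, map_smul, map_smul, norm_smul, norm_smul] at h1
    have h2 := hxs.2 i hi j hj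
    have h3 : c (i, j) * ‖B.f j x‖ ≤ ‖B.f i x‖ := by
      have := norm_pos_iff.2 hn'
      nlinarith
    have := hp (i, j) (Finset.mem_univ _)
    nlinarith [norm_nonneg (B.f j x)]

lemma push_mem {γ : C(I, E3)} (hγ : ∀ t, γ t ∈ B.M) (t : I) : push h.g γ t ∈ A.M := by
  rw [push_apply h.cont hγ]; exact h.mem _ (hγ t)

lemma push_push {γ : C(I, E3)} (hγ : ∀ t, γ t ∈ B.M) : push h.g' (push h.g γ) = γ := by
  ext1 t
  rw [push_apply h.cont' fun t => h.push_mem hγ t, push_apply h.cont hγ, h.left _ (hγ t)]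

lemma isAdd_pull (i : ι) : IsAdd B.M (fun γ => Theta (A.f i) (push h.g γ)) :=
  (isCrossed_Theta_f i).pull h.cont h.mem

/-- The action on the first cohomology. -/
theorem exists_Y : ∃ (Y : ι → ι → ℤ) (c : ι → E3 → ℝ), ∀ i, ∀ γ : C(I, E3), (∀ t, γ t ∈ B.M) →
    Theta (A.f i) (push h.g γ) = (∑ j, Y i j * Theta (B.f j) γ) + (c i (γ 0) - c i (γ 1)) := by
  have hex : ∀ j, ∃ a b, B.d j a b ≠ 0 := fun j => by
    obtain ⟨i, hi, -⟩ := (B.isFlat_single j).exists_notMem ∅ (by simp)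
    obtain ⟨s, hs, his, hjs⟩ := B.exists_flat (Finset.notMem_singleton.1 hi)
    obtain ⟨k, hk, -⟩ := hs.exists_notMem ∅ (by simp)
    exact ⟨i, k, fun h => hk ((hs.d_eq_zero_iff hjs his (Finset.notMem_singleton.1 hi).symm k).1 h)⟩
  choose a b hd using hex
  obtain ⟨η, η0, -, -, hη⟩ := B.exists_radius
  have hpos : 0 < η / 4 := by positivity
  have hη4 : 8 * B.K * (η / 4) ≤ 1 := by linarith
  have hP := fun j => B.isPiece_line (hd j)
  have key : ∀ i j, ∃ n : ℤ, ∀ x ∈ B.V {j} (η / 4),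
      Theta (A.f i) (push h.g (loop (B.rk j (a j) (b j)) x)) = 2 * Real.pi * n := by
    intro i j
    have hl : ∀ x ∈ B.V {j} η, ∀ t, loop (B.rk j (a j) (b j)) x t ∈ B.M := fun x hx t =>
      (loop_mem (hP j) η0.le hη hx hx t).1
    have hwind : ∀ x ∈ B.V {j} (η / 4), ∃ n : ℤ,
        Theta (A.f i) (push h.g (loop (B.rk j (a j) (b j)) x)) = 2 * Real.pi * n := by
      intro x hx
      have hl := hl x (V_mono (by linarith) hx)
      obtain ⟨n, hn⟩ := exists_int_ang
        ⟨fun s => A.f i (push h.g (loop (B.rk j (a j) (b j)) x) s), by fun_prop⟩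
        fun s => h.push_mem hl s i
      refine ⟨n, ?_⟩
      simp only [ContinuousMap.coe_mk] at hn
      rw [push_apply h.cont hl, push_apply h.cont hl, loop_zero, loop_one, sub_self, sub_zero] at hn
      exact hn
    obtain hem | ⟨x₀, hx₀⟩ := (B.V {j} (η / 4)).eq_empty_or_nonempty
    · exact ⟨0, by simp [hem]⟩
    obtain ⟨n, hn⟩ := hwind x₀ hx₀
    refine ⟨n, fun x hx => ?_⟩
    rw [← hn]
    obtain ⟨γ, hγ⟩ := (B.isFlat_single j).joinedIn hpos hη4 hx hx₀
    rw [mul_div_cancel₀ _ four_ne_zero] at hγ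
    obtain ⟨e1, e2, e3, e4⟩ := loop_sq (B.rk j (a j) (b j)) γ.toContinuousMap
    have := (h.isAdd_pull i).sq (rotSq (B.rk j (a j) (b j)) γ.toContinuousMap)
      fun p => hl _ (hγ p.1) p.2
    rw [e1, e2, e3, e4] at this
    have g0 : γ.toContinuousMap 0 = x := γ.source
    have g1 : γ.toContinuousMap 1 = x₀ := γ.target
    rw [g0, g1] at this
    linarith
  choose Y hY using key
  have hprim : ∀ i, ∃ c, IsPrim B.M (fun γ => Theta (A.f i) (push h.g γ) -
      ∑ j, Y i j * Theta (B.f j) γ) c := fun i => by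
    refine exists_prim ((h.isAdd_pull i).sub (IsCrossed.sum fun j _ =>
      (isCrossed_Theta_f j).smul _)) fun j => ⟨a j, b j, hd j, η / 4, hpos, fun x hx => ?_⟩
    simp only [hY i j x hx, (hP j).Theta_loop hη4 hx, Finset.mem_singleton, mul_ite, mul_zero,
      Finset.sum_ite_eq', Finset.mem_univ, if_true]
    ring
  choose c hc using hprim
  exact ⟨Y, c, fun i γ hγ => by linarith [hc i γ hγ]⟩

end ConeIso

/-- The integers `Y` describe the effect of `g` on angles. -/
structure IsAngleMap (h : ConeIso A B) (Y : ι → ι → ℤ) (c : ι → E3 → ℝ) : Prop where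
  eq : ∀ i, ∀ γ : C(I, E3), (∀ t, γ t ∈ B.M) →
    Theta (A.f i) (push h.g γ) = (∑ j, Y i j * Theta (B.f j) γ) + (c i (γ 0) - c i (γ 1))

namespace IsAngleMap

variable {h : ConeIso A B} {Y : ι → ι → ℤ} {c : ι → E3 → ℝ}

lemma psi_push (H : IsAngleMap h Y c) (χ : ι → ℤ) (t : ι → ℝ) {γ : C(I, E3)}
    (hγ : ∀ s, γ s ∈ B.M) : ex χ t (fun i => -c i (γ 0)) * A.psi χ t (push h.g γ) =
      B.psi (fun j => ∑ i, χ i * Y i j) (fun j => ∑ i, t i * Y i j) γ *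
        ex χ t (fun i => -c i (γ 1)) := by
  rw [psi, psi, ← ex_pull, ← ex_add, ← ex_add]
  congr 1
  funext i
  rw [H.eq i γ hγ]
  ring

lemma isCrossed_pull_eval (H : IsAngleMap h Y c) {χ : ι → ℤ} {t : ι → ℝ} {ε : ℝ}
    {δ : C(I, E3) → ℂ} {η η' : ℝ} (hδ : IsCrossed (A.N η) (fun γ => A.psi χ t γ ε) δ)
    (hN : ∀ x ∈ B.N η', h.g x ∈ A.N η) :
    IsCrossed (B.N η') (fun γ => B.psi (fun j => ∑ i, χ i * Y i j) (fun j => ∑ i, t i * Y i j) γ ε)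
      (fun γ => ex χ t (fun i => -c i (γ 0)) ε * δ (push h.g γ)) :=
  (hδ.pull (h.cont.mono N_subset_M) hN).gauge (G := fun x => ex χ t (fun i => -c i x) ε)
    fun _ hγ => congrArg (fun f : C(ℝ, ℂ) => f ε) (H.psi_push χ t fun s => N_subset_M (hγ s))

/-- A crossed homomorphism with principal pullback is principal. -/
lemma _root_.Arr.ConeIso.principal_of_pull (h : ConeIso A B) {ψ ψ' : C(I, E3) → ℂ} {G : E3 → ℂ}
    (hG : ∀ x, G x ≠ 0) (hψ : ∀ γ : C(I, E3), (∀ s, γ s ∈ B.M) →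
      G (γ 0) * ψ (push h.g γ) = ψ' γ * G (γ 1)) {δ : C(I, E3) → ℂ} {η η' : ℝ}
    (hN : ∀ x ∈ A.N η', h.g' x ∈ B.N η) {m : E3 → ℂ} (hm : ∀ γ : C(I, E3), (∀ s, γ s ∈ B.N η) →
      G (γ 0) * δ (push h.g γ) = principal ψ' m γ) :
    ∃ m : E3 → ℂ, ∀ γ : C(I, E3), (∀ s, γ s ∈ A.N η') → δ γ = principal ψ m γ := by
  refine ⟨fun x => (G (h.g' x))⁻¹ * m (h.g' x), fun γ hγ => ?_⟩
  have hM : ∀ s, γ s ∈ A.M := fun s => N_subset_M (hγ s)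
  have hp : ∀ s, push h.g' γ s = h.g' (γ s) := push_apply h.cont' hM
  have e1 := hm (push h.g' γ) fun s => by rw [hp]; exact hN _ (hγ s)
  have e2 := hψ (push h.g' γ) fun s => by rw [hp]; exact h.mem' _ (hM s)
  have e3 : push h.g (push h.g' γ) = γ := h.symm.push_push hM
  rw [e3] at e1 e2
  simp only [principal, hp] at e1 e2 ⊢
  have n0 := hG (h.g' (γ 0))
  have n1 := hG (h.g' (γ 1))
  field_simp
  linear_combination G (h.g' (γ 1)) * e1 + m (h.g' (γ 1)) * e2

lemma principal_of_pull (H : IsAngleMap h Y c) {χ : ι → ℤ} {t : ι → ℝ} {ε : ℝ}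
    {δ : C(I, E3) → ℂ} {η η' : ℝ} (hN : ∀ x ∈ A.N η', h.g' x ∈ B.N η) {m : E3 → ℂ}
    (hm : ∀ γ : C(I, E3), (∀ s, γ s ∈ B.N η) → ex χ t (fun i => -c i (γ 0)) ε * δ (push h.g γ) =
      principal (fun γ => B.psi (fun j => ∑ i, χ i * Y i j) (fun j => ∑ i, t i * Y i j) γ ε) m γ) :
    ∃ m : E3 → ℂ, ∀ γ : C(I, E3), (∀ s, γ s ∈ A.N η') →
      δ γ = principal (fun γ => A.psi χ t γ ε) m γ :=
  h.principal_of_pull (G := fun x => ex χ t (fun i => -c i x) ε) (fun _ => ex_ne_zero _ _ _ _)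
    (fun _ hγ => congrArg (fun f : C(ℝ, ℂ) => f ε) (H.psi_push χ t hγ)) hN hm

end IsAngleMap

lemma exists_mem_V_single (A : Arr ι) (k : ι) {η : ℝ} (h0 : 0 < η) : (A.V {k} η).Nonempty := by
  obtain ⟨v, hv, hv'⟩ := A.exists_generic_point k
  obtain ⟨j, hj, -⟩ := (A.isFlat_single k).exists_notMem ∅ (by simp)
  obtain ⟨w, -, hw⟩ := A.exists_generic_point j
  have := A.eventually_mem_V (s := {k}) h0 (ContinuousMap.const I v) (ContinuousMap.const I w)
    (by simpa using hv) (by simpa using hv') (by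
      simpa using hw k (Finset.notMem_singleton.1 hj).symm)
  obtain ⟨r, hr⟩ := this.exists
  exact ⟨_, hr 0⟩

namespace IsAngleMap

variable {h : ConeIso A B} {Y Y' : ι → ι → ℤ} {c c' : ι → E3 → ℝ}

lemma sum_Y (H : IsAngleMap h Y c) (i : ι) : ∑ j, Y i j = 1 := by
  obtain ⟨x, hx⟩ := B.exists_mem_V_single i one_pos
  have key : ∀ (f : E3 →L[ℂ] ℂ) (γ : C(I, E3)) (y : E3), f y ≠ 0 → (∀ t, γ t = circ t • y) →
      Theta f γ = 2 * Real.pi := fun f γ y hy hγ => by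
    rw [Theta, ang_eq ⟨fun t => Complex.log (f y) + 2 * Real.pi * (t : ℝ) * Complex.I,
      by fun_prop⟩]
    · simp
    · intro t
      rw [ContinuousMap.coe_mk, Complex.exp_add, Complex.exp_log hy, hγ, map_smul, circ,
        smul_eq_mul, mul_comm]
  have hc : ∀ t, circ t ≠ 0 := fun t h0 => by simpa [h0] using norm_circ t
  let γ : C(I, E3) := ⟨fun t => circ t • x, by fun_prop⟩
  have hγ : ∀ t, γ t ∈ B.M := fun t => smul_mem_M hx.1 (hc t)
  have e := H.eq i γ hγ
  rw [key (A.f i) (push h.g γ) (h.g x) (h.mem x hx.1 i) fun t => by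
    rw [push_apply h.cont hγ]; exact h.smul x hx.1 _ (hc t)] at e
  simp only [key (B.f _) γ x (hx.1 _) fun t => rfl, ← Finset.sum_mul,
    show γ 0 = γ 1 by simp [γ], sub_self, add_zero] at e
  have : ((∑ j, Y i j : ℤ) : ℝ) = 1 := by
    push_cast
    have := Real.pi_pos
    nlinarith
  exact_mod_cast this

lemma mul_Y (H : IsAngleMap h Y c) (H' : IsAngleMap h.symm Y' c') (i k : ι) :
    ∑ j, Y i j * Y' j k = if i = k then 1 else 0 := by
  obtain ⟨η, η0, -, -, hη⟩ := A.exists_radius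
  obtain ⟨x, hx⟩ := A.exists_mem_V_single k η0
  obtain ⟨j, hj, -⟩ := (A.isFlat_single k).exists_notMem ∅ (by simp)
  obtain ⟨s, hs, hjs, hks⟩ := A.exists_flat (Finset.notMem_singleton.1 hj)
  obtain ⟨l, hl, -⟩ := hs.exists_notMem ∅ (by simp)
  have hd : A.d k j l ≠ 0 := fun h =>
    hl ((hs.d_eq_zero_iff hks hjs (Finset.notMem_singleton.1 hj).symm l).1 h)
  have hP := A.isPiece_line hd
  have hM := fun t => (loop_mem hP η0.le hη hx hx t).1
  have hp : ∀ t, push h.g' (loop (A.rk k j l) x) t = h.g' (loop (A.rk k j l) x t) :=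
    push_apply h.cont' hM
  have e := H.eq i (push h.g' (loop (A.rk k j l) x)) fun t => by rw [hp]; exact h.mem' _ (hM t)
  have e' : push h.g (push h.g' (loop (A.rk k j l) x)) = loop (A.rk k j l) x :=
    h.symm.push_push hM
  have e'' := fun m => H'.eq m (loop (A.rk k j l) x) hM
  rw [e', hp, hp, loop_zero, loop_one] at e
  simp only [loop_zero, loop_one, sub_self, add_zero] at e e''
  change ∀ m, Theta (B.f m) (push h.g' (loop (A.rk k j l) x)) = _ at e''
  simp only [e'', hP.Theta_loop hη hx, Finset.mem_singleton, mul_ite, mul_zero, Finset.sum_ite_eq',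
    Finset.mem_univ, if_true] at e
  have e2 : ((∑ j, Y i j * Y' j k : ℤ) : ℝ) * (2 * Real.pi) =
      (if i = k then (1 : ℤ) else 0 : ℤ) * (2 * Real.pi) := by
    push_cast
    rw [Finset.sum_mul]
    simp only [ite_mul, one_mul, zero_mul]
    rw [e]
    exact Finset.sum_congr rfl fun _ _ => by ring
  exact_mod_cast mul_right_cancel₀ (by positivity) e2

end IsAngleMap
end Arr

end

section

open unitInterval Topology
open Filter (Tendsto Eventually eventually_all)

/-! ### Homeomorphisms of the complements permute the lines -/

lemma exists_generic {E κ : Type*} [NormedAddCommGroup E] [NormedSpace ℝ E] [Finite κ]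
    (H : Submodule ℝ E) (Φ : κ → Module.Dual ℝ E) {t₀ : E} (h₀ : t₀ ∈ H) {O : Set E}
    (hO : O ∈ 𝓝 t₀) (hΦ : ∀ k, Continuous (Φ k)) :
    ∃ t ∈ H, t ∈ O ∧ ∀ k, (∃ s ∈ H, Φ k s ≠ 0) → Φ k t ≠ 0 := by
  obtain ⟨s, hs, h⟩ := Module.Dual.exists_forall_mem_ne_zero_of_forall_exists (p := H)
    (f := fun k : {k // ∃ s ∈ H, Φ k s ≠ 0} => Φ k) fun k => k.2
  have h1 : ∀ᶠ τ : ℝ in 𝓝[>] 0, t₀ + τ • s ∈ O := by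
    have : Continuous fun τ : ℝ => t₀ + τ • s := by fun_prop
    exact ((this.tendsto 0).eventually (by simpa using hO)).filter_mono nhdsWithin_le_nhds
  have h2 : ∀ k : {k // ∃ s ∈ H, Φ k s ≠ 0}, ∀ᶠ τ : ℝ in 𝓝[>] 0, Φ k (t₀ + τ • s) ≠ 0 := fun k => by
    by_cases h0 : Φ k t₀ = 0
    · filter_upwards [self_mem_nhdsWithin] with τ hτ
      have : 0 < τ := hτ
      simp [h0, this.ne', h k]
    · have := hΦ k
      have : Continuous fun τ : ℝ => Φ k (t₀ + τ • s) := by fun_prop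
      exact ((this.tendsto 0).eventually_ne (by simpa using h0)).filter_mono nhdsWithin_le_nhds
  obtain ⟨τ, hτ, hτ'⟩ := (h1.and (eventually_all.2 h2)).exists
  exact ⟨_, H.add_mem h₀ (H.smul_mem _ hs), hτ, fun k hk => hτ' ⟨k, hk⟩⟩

section Ind

variable {ι : Type*} [Fintype ι] [DecidableEq ι]

omit [DecidableEq ι] in
lemma exists_notMem_of_card_lt {u : Finset ι} (h : u.card < Fintype.card ι) : ∃ k, k ∉ u := by
  by_contra! hcon
  exact h.ne (by rw [Finset.eq_univ_of_forall hcon, Finset.card_univ])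

/-- Functions that are constant on `v` and on its complement. -/
def BiConst (Y : ι → ι → ℤ) (u v : Finset ι) : Prop :=
  ∃ l m : ℤ, ∀ i, ∑ j ∈ u, Y i j = l * (if i ∈ v then 1 else 0) + m

lemma ind_eq (hc : 7 ≤ Fintype.card ι) {u u' : Finset ι} (hu : u.Nonempty) (hu3 : u.card ≤ 3)
    (hu3' : u'.card ≤ 3) {l l' m m' : ℤ} (hl : l ≠ 0) (h : ∀ k, l * (if k ∈ u then 1 else 0) + m =
      l' * (if k ∈ u' then 1 else 0) + m') : u = u' ∧ l = l' ∧ m = m' := by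
  obtain ⟨k, hk⟩ := exists_notMem_of_card_lt (u := u ∪ u') (by
    have := Finset.card_union_le u u'; omega)
  rw [Finset.mem_union, not_or] at hk
  have hm : m = m' := by simpa [hk.1, hk.2] using h k
  subst hm
  have h1 : ∀ k ∈ u, k ∈ u' ∧ l = l' := fun k hk => by
    by_cases hk' : k ∈ u'
    · exact ⟨hk', by simpa [hk, hk'] using h k⟩
    · exact absurd (by simpa [hk, hk'] using h k) hl
  obtain ⟨x, hx⟩ := hu
  refine ⟨Finset.Subset.antisymm (fun k hk => (h1 k hk).1) fun k hk => ?_, (h1 x hx).2, rfl⟩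
  by_contra hk'
  have := h k
  rw [if_pos hk, if_neg hk', ← (h1 x hx).2] at this
  exact hl (by linarith)

variable {Y Y' : ι → ι → ℤ} (hc : 7 ≤ Fintype.card ι)
  (hY : ∀ i k, ∑ j, Y' i j * Y j k = if i = k then 1 else 0) (hs : ∀ i, ∑ j, Y' i j = 1)

include hY hs in
lemma BiConst.inv {u v : Finset ι} {l m : ℤ}
    (h : ∀ i, ∑ j ∈ u, Y i j = l * (if i ∈ v then 1 else 0) + m) (k : ι) :
    (if k ∈ u then 1 else 0) = l * ∑ i ∈ v, Y' k i + m := by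
  have e : ∑ i, Y' k i * ∑ j ∈ u, Y i j = if k ∈ u then 1 else 0 := by
    simp only [Finset.mul_sum]
    rw [Finset.sum_comm]
    simp [hY]
  rw [← e]
  simp only [h, mul_add, Finset.sum_add_distrib, ← Finset.sum_mul, hs, mul_ite, mul_one, mul_zero,
    one_mul]
  rw [Finset.sum_ite_mem, Finset.univ_inter, ← Finset.sum_mul, mul_comm]

include hY hs in
/-- Linear relations between indicators are transported up to constants. -/
lemma BiConst.exists_sum_eq {α : Type*} [Fintype α] {u v : α → Finset ι} {l m c : α → ℤ} {κ : ℤ}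
    (h : ∀ a i, ∑ j ∈ u a, Y i j = l a * (if i ∈ v a then 1 else 0) + m a)
    (hl : ∀ a, l a * l a = 1) (hκ : ∀ i, ∑ a, c a * (if i ∈ v a then 1 else 0) = κ) :
    ∃ κ', ∀ k, ∑ a, c a * l a * (if k ∈ u a then 1 else 0) = κ' := by
  refine ⟨κ + ∑ a, c a * l a * m a, fun k => ?_⟩
  have e : ∀ a, c a * l a * (if k ∈ u a then 1 else 0) =
      ∑ i, c a * (if i ∈ v a then 1 else 0) * Y' k i + c a * l a * m a := fun a => by
    rw [BiConst.inv hY hs (h a) k]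
    simp only [mul_ite, mul_one, mul_zero, ite_mul, zero_mul, Finset.sum_ite_mem, Finset.univ_inter,
      ← Finset.mul_sum]
    linear_combination (c a * ∑ i ∈ v a, Y' k i) * hl a
  rw [Finset.sum_congr rfl fun a _ => e a, Finset.sum_add_distrib, Finset.sum_comm]
  simp only [← Finset.sum_mul, hκ, ← Finset.mul_sum, hs, mul_one]

include hc hY hs

lemma BiConst.ne_zero {u v : Finset ι} (hu : u.Nonempty) (hu3 : u.card ≤ 3) {l m : ℤ}
    (h : ∀ i, ∑ j ∈ u, Y i j = l * (if i ∈ v then 1 else 0) + m) : l ≠ 0 := by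
  rintro rfl
  have := BiConst.inv hY hs h
  have := (ind_eq hc hu hu3 (u' := ∅) (l := 1) (l' := 0) (m := 0) (m' := m) (by simp) one_ne_zero
    fun k => by rw [one_mul, add_zero, this k]; simp).2.1
  omega

lemma BiConst.isUnit {u v : Finset ι} (hu : u.Nonempty) (hu3 : u.card ≤ 3) {l m : ℤ}
    (h : ∀ i, ∑ j ∈ u, Y i j = l * (if i ∈ v then 1 else 0) + m) : IsUnit l := by
  have h1 := BiConst.inv hY hs h
  obtain ⟨x, hx⟩ := hu
  obtain ⟨y, hy⟩ := exists_notMem_of_card_lt (u := u) (by omega)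
  have hx := (if_pos hx).symm.trans (h1 x)
  have hy := (if_neg hy).symm.trans (h1 y)
  exact IsUnit.of_mul_eq_one (∑ i ∈ v, Y' x i - ∑ i ∈ v, Y' y i) (by linarith)

lemma BiConst.left_unique {u u' v : Finset ι} (hu : u.Nonempty) (hu3 : u.card ≤ 3) (hu' : u'.Nonempty)
    (hu3' : u'.card ≤ 3) (h : BiConst Y u v) (h' : BiConst Y u' v) : u = u' := by
  obtain ⟨l, m, h⟩ := h
  obtain ⟨l', m', h'⟩ := h'
  have e := BiConst.inv hY hs h
  have e' := BiConst.inv hY hs h'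
  refine (ind_eq hc hu hu3 hu3' (l := l') (l' := l) (m := -l' * m) (m' := -l * m')
    (BiConst.ne_zero hc hY hs hu' hu3' h') fun k => ?_).1
  rw [e k, e' k]
  ring

lemma BiConst.right_unique {u v v' : Finset ι} (hu : u.Nonempty) (hu3 : u.card ≤ 3) (hv : v.Nonempty)
    (hv3 : v.card ≤ 3) (hv3' : v'.card ≤ 3) (h : BiConst Y u v) (h' : BiConst Y u v') : v = v' := by
  obtain ⟨l, m, h⟩ := h
  obtain ⟨l', m', h'⟩ := h'
  exact (ind_eq hc hv hv3 hv3' (BiConst.ne_zero hc hY hs hu hu3 h) fun k => (h k).symm.trans (h' k)).1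

end Ind

section Weights

variable {ι : Type*} [Fintype ι] [DecidableEq ι]

/-- Weights with total zero on everything and on `v`. -/
def wt (v : Finset ι) : Submodule ℝ (ι → ℝ) where
  carrier := {t | ∑ i, t i = 0 ∧ ∑ i ∈ v, t i = 0}
  add_mem' h h' := by simp [Finset.sum_add_distrib, h.1, h.2, h'.1, h'.2]
  zero_mem' := by simp
  smul_mem' c t h := by simp [← Finset.mul_sum, h.1, h.2]

/-- The pairing with a vector. -/
def pair (y : ι → ℝ) : Module.Dual ℝ (ι → ℝ) := ∑ i, y i • LinearMap.proj i

omit [DecidableEq ι] in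
lemma pair_apply (y t : ι → ℝ) : pair y t = ∑ i, y i * t i := by simp [pair]

lemma pair_ind (w : Finset ι) (t : ι → ℝ) : pair (fun i => if i ∈ w then 1 else 0) t = ∑ i ∈ w, t i := by
  simp [pair_apply]

lemma single_sub_mem {v : Finset ι} {i j : ι} (h : i ∈ v ↔ j ∈ v) :
    Pi.single i (1 : ℝ) - Pi.single j 1 ∈ wt v := by
  constructor
  · simp
  · simp [Finset.sum_sub_distrib, Pi.single_apply, Finset.sum_ite_eq', h]

lemma pair_single_sub (y : ι → ℝ) (i j : ι) :
    pair y (Pi.single i (1 : ℝ) - Pi.single j 1) = y i - y j := by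
  rw [map_sub]; simp [pair_apply, Pi.single_apply]

lemma exists_wt_pair_ne {v : Finset ι} {y : ι → ℝ} {i j : ι} (h : i ∈ v ↔ j ∈ v) (hy : y i ≠ y j) :
    ∃ s ∈ wt v, pair y s ≠ 0 :=
  ⟨_, single_sub_mem h, by rw [pair_single_sub]; exact sub_ne_zero.2 hy⟩

/-- Weights near `t₀` that vanish only where they have to. -/
lemma exists_weights (hc : 7 ≤ Fintype.card ι) (Y : ι → ι → ℤ) {v : Finset ι} (hv3 : v.card ≤ 3)
    {t₀ : ι → ℝ} (h₀ : t₀ ∈ wt v) {O : Set (ι → ℝ)} (hO : O ∈ 𝓝 t₀) :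
    ∃ t ∈ O, ∑ i, t i = 0 ∧ ∑ i ∈ v, t i = 0 ∧
      (∀ w : Finset ι, w.Nonempty → w.card ≤ 3 → w ≠ v → ∑ i ∈ w, t i ≠ 0) ∧
      ∀ u : Finset ι, ∑ j ∈ u, ∑ i, t i * Y i j = 0 → BiConst Y u v := by
  obtain ⟨t, ht, htO, hg⟩ := exists_generic (wt v) (κ := Finset ι ⊕ Finset ι)
    (Sum.elim (fun w => pair fun i => if i ∈ w then 1 else 0)
      fun u => pair fun i => ((∑ j ∈ u, Y i j : ℤ) : ℝ)) h₀ hO (fun k => by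
        cases k <;> simp only [Sum.elim_inl, Sum.elim_inr] <;> fun_prop)
  refine ⟨t, htO, ht.1, ht.2, fun w hw hw3 hwv => ?_, fun u hu => ?_⟩
  · have := hg (Sum.inl w)
    simp only [Sum.elim_inl, pair_ind w t] at this
    refine this ?_
    by_contra hcon
    push Not at hcon
    have hcst : ∀ i j, (i ∈ v ↔ j ∈ v) → (i ∈ w ↔ j ∈ w) := fun i j hij => by
      by_contra hne
      obtain ⟨s, hs, h⟩ := exists_wt_pair_ne (y := fun i => if i ∈ w then (1 : ℝ) else 0) hij (by
        by_cases h1 : i ∈ w <;> by_cases h2 : j ∈ w <;> simp_all)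
      exact h (hcon s hs)
    obtain ⟨x, hx⟩ := hw
    obtain ⟨k, hk⟩ := exists_notMem_of_card_lt (u := w ∪ v) (by
      have := Finset.card_union_le w v; omega)
    rw [Finset.mem_union, not_or] at hk
    have hxv : x ∈ v := by
      by_contra hxv
      exact hk.1 ((hcst x k (by simp [hxv, hk.2])).1 hx)
    refine hwv (Finset.Subset.antisymm (fun y hy => ?_) fun y hy => ?_)
    · by_contra hyv
      exact hk.1 ((hcst y k (by simp [hyv, hk.2])).1 hy)
    · exact (hcst x y (by simp [hxv, hy])).1 hx
  · have h0 : ¬ ∃ s ∈ wt v, pair (fun i => ((∑ j ∈ u, Y i j : ℤ) : ℝ)) s ≠ 0 := fun hs => by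
      refine hg (Sum.inr u) hs ?_
      rw [Sum.elim_inr, pair_apply, ← hu, Finset.sum_comm]
      refine Finset.sum_congr rfl fun i _ => ?_
      push_cast
      rw [Finset.sum_mul]
      exact Finset.sum_congr rfl fun _ _ => mul_comm _ _
    have hcst : ∀ i j, (i ∈ v ↔ j ∈ v) → ∑ k ∈ u, Y i k = ∑ k ∈ u, Y j k := fun i j hij => by
      by_contra hne
      exact h0 (exists_wt_pair_ne hij (by exact_mod_cast hne))
    obtain ⟨k, hk⟩ := exists_notMem_of_card_lt (u := v) (by omega)
    obtain rfl | ⟨x, hx⟩ := v.eq_empty_or_nonempty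
    · exact ⟨0, ∑ j ∈ u, Y k j, fun i => by simpa using hcst i k (by simp)⟩
    refine ⟨∑ j ∈ u, Y x j - ∑ j ∈ u, Y k j, ∑ j ∈ u, Y k j, fun i => ?_⟩
    by_cases hi : i ∈ v
    · rw [if_pos hi, hcst i x (by simp [hi, hx])]; ring
    · rw [if_neg hi, hcst i k (by simp [hi, hk])]; ring

end Weights

namespace Arr

variable {ι : Type*} [Fintype ι] [DecidableEq ι] {A B : Arr ι}

/-- Sets of indices of lines and of triple points. -/
def IsMain (A : Arr ι) (u : Finset ι) : Prop := (∃ i, u = {i}) ∨ u ∈ A.T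

lemma IsMain.flat {u : Finset ι} (h : A.IsMain u) : A.IsFlat u :=
  h.elim Or.inl fun h => Or.inr (Or.inl h)

lemma good_of_sum_ne {χ : ι → ℤ} {t : ι → ℝ} {ε : ℝ} (hε : ε ≠ 0) {v : Finset ι}
    (h : ∀ w, A.IsMain w → w ≠ v → ∑ i ∈ w, t i ≠ 0) {u : Finset ι} (hu : A.IsFlat u) (huv : u ≠ v) :
    A.Good χ t ε u := by
  have key : ∀ w : Finset ι, ∑ i ∈ w, t i ≠ 0 → uu χ t w ε ≠ 1 := fun w hw h1 => by
    have h2 := congrArg norm h1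
    rw [uu_apply, Complex.norm_exp, norm_one, Real.exp_eq_one_iff] at h2
    simp only [Complex.add_re, Complex.mul_re, Complex.I_re, Complex.ofReal_re, Complex.I_im,
      Complex.ofReal_im, Complex.intCast_re, Complex.intCast_im, Complex.mul_im] at h2
    have : ε * ∑ i ∈ w, t i = 0 := by linarith
    exact (mul_ne_zero hε hw) this
  by_cases hm : A.IsMain u
  · obtain ⟨P, hP⟩ := hu.exists_piece
    exact ⟨u, P, hP, key u (h u hm huv)⟩
  rcases hu with h1 | h1 | ⟨i, j, hij, rfl, hp⟩
  · exact absurd (Or.inl h1) hm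
  · exact absurd (Or.inr h1) hm
  have hu : A.IsFlat {i, j} := Or.inr (Or.inr ⟨i, j, hij, rfl, hp⟩)
  obtain ⟨k, hk, -⟩ := hu.exists_notMem ∅ (by simp)
  have hd : ∀ i' j', i' ∈ ({i, j} : Finset ι) → j' ∈ ({i, j} : Finset ι) → i' ≠ j' →
      A.d i' j' k ≠ 0 := fun i' j' hi hj hne h => hk ((hu.d_eq_zero_iff hi hj hne k).1 h)
  by_cases hi : ({i} : Finset ι) = v
  · exact ⟨{j}, _, isPiece_half hij.symm (Finset.pair_comm i j) (hd j i (by simp) (by simp) hij.symm),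
      key _ (h _ (Or.inl ⟨j, rfl⟩) fun hj => hij (Finset.singleton_inj.1 (hi.trans hj.symm)))⟩
  · exact ⟨{i}, _, isPiece_half hij rfl (hd i j (by simp) (by simp) hij),
      key _ (h _ (Or.inl ⟨i, rfl⟩) hi)⟩

lemma exists_tri {p : Finset ι} (hp : p ∈ A.T) : ∃ a b c k, A.Tri p a b c k := by
  obtain ⟨a, b, c, hab, hac, hbc, e⟩ := Finset.card_eq_three.1 (A.card_T p hp)
  obtain ⟨k, hk, -⟩ := (show A.IsFlat p from Or.inr (Or.inl hp)).exists_notMem ∅ (by simp)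
  exact ⟨a, b, c, k, hp, e, hab, hac, hbc, hk⟩

lemma IsMain.card_inter_le {u v : Finset ι} (hu : A.IsMain u) (hv : A.IsMain v) (h : u ≠ v) :
    (u ∩ v).card ≤ 1 := by
  rcases hu with ⟨i, rfl⟩ | hu
  · exact (Finset.card_le_card Finset.inter_subset_left).trans (by simp)
  rcases hv with ⟨i, rfl⟩ | hv
  · exact (Finset.card_le_card Finset.inter_subset_right).trans (by simp)
  · exact A.inter u hu v hv h

/-- A linear relation between four indicators expresses a triple point by its lines. -/
lemma eq_single_of_sum_eq_zero {u : Fin 4 → Finset ι} (hu : ∀ n, A.IsMain (u n))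
    (hinj : Function.Injective u) {s : Fin 4 → ℤ} (hs : ∀ n, s n * s n = 1)
    (h0 : ∀ k, ∑ n, s n * (if k ∈ u n then 1 else 0) = 0) {n m : Fin 4} (hn : u n ∈ A.T)
    (hm : m ≠ n) : ∃ x ∈ u n, u m = {x} := by
  have key : ∀ n, u n ∈ A.T → ∀ m, m ≠ n → s n * s m * (u n ∩ u m).card = -1 := by
    intro n hn m hm
    have e : ∑ m, s n * s m * (u n ∩ u m).card = 0 := by
      have : ∀ m, s n * s m * (u n ∩ u m).card =
          ∑ k ∈ u n, s n * (s m * (if k ∈ u m then 1 else 0)) := fun m => by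
        rw [← Finset.mul_sum, ← Finset.mul_sum, Finset.sum_ite_mem]
        simp [mul_assoc]
      simp only [this]
      rw [Finset.sum_comm]
      simp only [← Finset.mul_sum, h0, mul_zero, Finset.sum_const_zero]
    rw [← Finset.add_sum_erase _ _ (Finset.mem_univ n), Finset.inter_self, A.card_T _ hn, hs] at e
    have h1 : ∑ m ∈ Finset.univ.erase n, (1 + s n * s m * (u n ∩ u m).card) = 0 := by
      rw [Finset.sum_add_distrib, Finset.sum_const, Finset.card_erase_of_mem (Finset.mem_univ n)]
      simpa using e
    have h2 := (Finset.sum_eq_zero_iff_of_nonneg fun m hm => ?_).1 h1 m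
      (Finset.mem_erase.2 ⟨hm, Finset.mem_univ m⟩)
    · linarith
    · have h3 := (hu n).card_inter_le (hu m) fun e => Finset.ne_of_mem_erase hm (hinj e).symm
      rcases Int.isUnit_iff.1 (IsUnit.of_mul_eq_one _ (hs n)) with e1 | e1 <;>
        rcases Int.isUnit_iff.1 (IsUnit.of_mul_eq_one _ (hs m)) with e2 | e2 <;>
        rw [e1, e2] <;> omega
  have h1 := key n hn m hm
  rcases hu m with ⟨x, hx⟩ | hmT
  · refine ⟨x, ?_, hx⟩
    by_contra hxn
    rw [hx, Finset.inter_singleton_of_notMem hxn] at h1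
    simp at h1
  exfalso
  obtain ⟨r, hrn, hrm⟩ := (by decide : ∀ n m : Fin 4, ∃ r, r ≠ n ∧ r ≠ m) n m
  have h2 := key n hn r hrn
  have h3 := key m hmT r hrm
  have h4 : 0 < s n * s m * (s n * s r * (s m * s r)) := by
    rw [show s n * s m * (s n * s r * (s m * s r)) = (s n * s n) * (s m * s m) * (s r * s r) by ring,
      hs, hs, hs]
    norm_num
  have h5 : ∀ {a b : ℤ}, a * b = -1 → 0 ≤ b → a < 0 := fun {a b} h hb => by
    by_contra! ha
    have := mul_nonneg ha hb
    omega
  have := h5 h1 (by positivity)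
  have := mul_pos_of_neg_of_neg (h5 h2 (by positivity)) (h5 h3 (by positivity))
  nlinarith

section Theorem

variable {h : ConeIso A B} {Y Y' : ι → ι → ℤ} {c c' : ι → E3 → ℝ}

lemma exists_rel (H : IsAngleMap h Y c) {t : ι → ℝ} {v : Finset ι}
    (ht : ∀ u : Finset ι, ∑ j ∈ u, ∑ i, t i * Y i j = 0 → BiConst Y u v) {η : ℝ} (h0 : 0 < η)
    {δ : C(I, E3) → ℂ} (hδ : IsCrossed (A.N η) (fun γ => A.psi (fun _ => 0) t γ 1) δ)
    (hn : ∀ η' > 0, ¬ ∃ m : E3 → ℂ, ∀ γ : C(I, E3), (∀ s, γ s ∈ A.N η') →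
      δ γ = principal (fun γ => A.psi (fun _ => 0) t γ 1) m γ) : ∃ u, B.IsMain u ∧ BiConst Y u v := by
  by_contra hcon
  push Not at hcon
  obtain ⟨η', h0', hN⟩ := h.exists_N h0
  have hK := B.one_le_K
  set e := min (1 / (128 * B.K)) (η' / 16) with he
  have e0 : 0 < e := by positivity
  have he1 : 128 * B.K * e ≤ 1 := by
    calc 128 * B.K * e ≤ 128 * B.K * (1 / (128 * B.K)) := by gcongr; exact min_le_left _ _
      _ = 1 := mul_div_cancel₀ _ (by positivity)
  have heη : 16 * e ≤ η' := by linarith [min_le_right (1 / (128 * B.K)) (η' / 16)]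
  have hp := H.isCrossed_pull_eval hδ (hN η' le_rfl)
  obtain ⟨m, hm⟩ := exists_principal (F := {u | B.IsFlat u}) (fun u hu => good_of_sum_ne one_ne_zero
    (v := ∅) (fun w hw _ hs => hcon w hw (ht w hs)) hu (Finset.nonempty_iff_ne_empty.1 hu.nonempty))
    e0.le he1 (hp.mono (N_mono heη))
  obtain ⟨η'', h0'', hN'⟩ := h.symm.exists_N e0
  exact hn η'' h0'' (H.principal_of_pull (hN' η'' le_rfl) hm)

lemma exists_two_flats (hc : 7 ≤ Fintype.card ι) (i : ι) : ∃ w0 w1 : Finset ι,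
    A.IsFlat w0 ∧ A.IsFlat w1 ∧ i ∈ w0 ∧ i ∈ w1 ∧ w0 ≠ {i} ∧ w1 ≠ {i} ∧ w0 ≠ w1 ∧
    ∃ t ∈ wt {i}, 0 < ∑ j ∈ w0.erase i, t j ∧ 0 < ∑ j ∈ w1.erase i, t j := by
  have hex : ∀ w, A.IsFlat w → i ∈ w → ∃ j ∉ w, ∃ s, A.IsFlat s ∧ i ∈ s ∧ j ∈ s.erase i :=
    fun w hw hi => by
      obtain ⟨j, hj, -⟩ := hw.exists_notMem ∅ (by simp)
      have hji : j ≠ i := fun e => hj (e ▸ hi)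
      obtain ⟨s, hs, h1, h2⟩ := A.exists_flat hji
      exact ⟨j, hj, s, hs, h2, Finset.mem_erase.2 ⟨hji, h1⟩⟩
  obtain ⟨a, -, w0, hw0, hi0, ha⟩ := hex _ (isFlat_single i) (by simp)
  obtain ⟨b, hb0, w1, hw1, hi1, hb⟩ := hex _ hw0 hi0
  obtain ⟨x, hx⟩ := exists_notMem_of_card_lt (u := w0 ∪ w1) (by
    have := Finset.card_union_le w0 w1
    have := hw0.card_le
    have := hw1.card_le
    omega)
  let U := (w0 ∪ w1).erase i
  have hxU : ∀ j ∈ U, j ≠ x := fun j hj e => hx (e ▸ Finset.mem_of_mem_erase hj)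
  have hxi : i ≠ x := fun e => hx (e ▸ Finset.mem_union_left _ hi0)
  have hpos : ∀ w : Finset ι, w.erase i ⊆ U → (w.erase i).Nonempty →
      0 < ∑ j ∈ w.erase i, ((if j ∈ U then (1 : ℝ) else 0) - if j = x then (U.card : ℝ) else 0) :=
    fun w hw hn => Finset.sum_pos (fun j hj => by simp [hw hj, hxU j (hw hj)]) hn
  refine ⟨w0, w1, hw0, hw1, hi0, hi1, fun e => ?_, fun e => ?_, fun e => hb0 (e ▸ Finset.mem_of_mem_erase hb),
    fun j => (if j ∈ U then 1 else 0) - if j = x then (U.card : ℝ) else 0, ⟨?_, ?_⟩,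
    hpos w0 (Finset.erase_subset_erase _ Finset.subset_union_left) ⟨a, ha⟩,
    hpos w1 (Finset.erase_subset_erase _ Finset.subset_union_right) ⟨b, hb⟩⟩
  · simp [e] at ha
  · simp [e] at hb
  · simp [Finset.sum_sub_distrib]
  · rw [Finset.sum_singleton]; simp [U, hxi]

/-- Every line and triple point of `A` corresponds to one of `B`. -/
lemma exists_main (hc : 7 ≤ Fintype.card ι) (H : IsAngleMap h Y c) {v : Finset ι} (hv : A.IsMain v) :
    ∃ u, B.IsMain u ∧ BiConst Y u v := by
  have hgood : ∀ {t : ι → ℝ}, (∀ w : Finset ι, w.Nonempty → w.card ≤ 3 → w ≠ v → ∑ i ∈ w, t i ≠ 0) →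
      ∀ u, A.IsFlat u → u ≠ v → A.Good (fun _ => 0) t 1 u := fun ht u hu huv =>
    good_of_sum_ne one_ne_zero (fun w hw hwi => ht w hw.flat.nonempty hw.flat.card_le hwi) hu huv
  have hv3 := hv.flat.card_le
  rcases hv with ⟨i, rfl⟩ | hp
  · obtain ⟨w0, w1, hw0, hw1, hi0, hi1, h0i, h1i, h01, t₀, ht₀, hpos⟩ := A.exists_two_flats hc i
    have hop : ∀ w : Finset ι, IsOpen {t : ι → ℝ | 0 < ∑ j ∈ w.erase i, t j} := fun w =>
      isOpen_lt continuous_const (by fun_prop)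
    obtain ⟨t, htO, hts, hti, htA, htB⟩ := exists_weights hc Y hv3 ht₀
      (O := {t | 0 < ∑ j ∈ w0.erase i, t j ∧ 0 < ∑ j ∈ w1.erase i, t j})
      (((hop w0).inter (hop w1)).mem_nhds hpos)
    obtain ⟨η, h0, δ, hδ, hn⟩ := exists_class_line hw0 hw1 hi0 hi1 h0i h1i h01 (by simpa using hti)
      hts htO.1 htO.2 (hgood htA)
    exact exists_rel H htB h0 hδ hn
  · obtain ⟨a, b, d, k, hT⟩ := A.exists_tri hp
    obtain ⟨t, htO, hts, htp, htA, htB⟩ := exists_weights hc Y hv3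
      (t₀ := Pi.single a 1 + Pi.single b 1 - 2 • Pi.single d 1) (by
        constructor
        · simp [Finset.sum_add_distrib, Finset.sum_sub_distrib, ← Finset.mul_sum]; norm_num
        · simp [Finset.sum_add_distrib, Finset.sum_sub_distrib, ← Finset.mul_sum,
            hT.ma, hT.mb, hT.mc]; norm_num)
      (O := {t | 0 < t a ∧ 0 < t b}) (((isOpen_lt continuous_const (continuous_apply a)).inter
        (isOpen_lt continuous_const (continuous_apply b))).mem_nhds (by
          simp [hT.ab, hT.ac, hT.bc, hT.ab.symm]))
    obtain ⟨η, h0, δ, hδ, hn⟩ := exists_class_point hT htp hts htO.1 htO.2 (hgood htA)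
    exact exists_rel H htB h0 hδ hn

/-- A homeomorphism of the complements induces a permutation of the lines preserving the triple
points. -/
theorem exists_perm (hc : 13 ≤ Fintype.card ι) (hd : ∃ p₀ ∈ A.T, ∀ i ∉ p₀, ∃ p ∈ A.T, ∃ p' ∈ A.T,
    p ≠ p' ∧ i ∈ p ∧ i ∈ p') (H : IsAngleMap h Y c)
    (H' : IsAngleMap h.symm Y' c') : ∃ (π : Equiv.Perm ι) (l : ℤ) (m : ι → ℤ), IsUnit l ∧
      (∀ i k, Y k (π i) = l * (if k = i then 1 else 0) + m i) ∧
      ∀ p ∈ A.T, p.image π ∈ B.T := by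
  have hc7 : 7 ≤ Fintype.card ι := by omega
  have hY : ∀ i k, ∑ j, Y' i j * Y j k = if i = k then 1 else 0 := H'.mul_Y H
  have hs := H'.sum_Y
  have hmain : ∀ {A : Arr ι} {u}, A.IsMain u → u.Nonempty ∧ u.card ≤ 3 := fun hu =>
    ⟨hu.flat.nonempty, hu.flat.card_le⟩
  choose! τ hτ hbi using fun v (hv : A.IsMain v) => exists_main hc7 H hv
  have hinj : ∀ {v v'}, A.IsMain v → A.IsMain v' → τ v = τ v' → v = v' := fun hv hv' e =>
    BiConst.right_unique hc7 hY hs (hmain (hτ _ hv)).1 (hmain (hτ _ hv)).2 (hmain hv).1 (hmain hv).2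
      (hmain hv').2 (hbi _ hv) (e ▸ hbi _ hv')
  choose! l m hlm using hbi
  have hl : ∀ v, A.IsMain v → IsUnit (l v) := fun v hv =>
    BiConst.isUnit hc7 hY hs (hmain (hτ v hv)).1 (hmain (hτ v hv)).2 (hlm v hv)
  have hll : ∀ v, A.IsMain v → l v * l v = 1 := fun v hv => Int.isUnit_mul_self (hl v hv)
  have hone : ∀ i, A.IsMain {i} := fun i => Or.inl ⟨i, rfl⟩
  have hsT : ∀ i, ({i} : Finset ι) ∉ A.T := fun i hi => by simpa using A.card_T _ hi
  have hsT' : ∀ i, ({i} : Finset ι) ∉ B.T := fun i hi => by simpa using B.card_T _ hi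
  have hbad : ∀ p ∈ A.T, ∀ i ∈ p, τ {i} ∈ B.T → ∃ j k x y z, p = {i, j, k} ∧ i ≠ j ∧ i ≠ k ∧
      j ≠ k ∧ τ p = {x} ∧ τ {j} = {y} ∧ τ {k} = {z} ∧ x ∈ τ {i} ∧ y ∈ τ {i} ∧ z ∈ τ {i} := by
    intro p hp i hi hT
    obtain ⟨j, k, hjk, e⟩ := Finset.card_eq_two.1
      (show (p.erase i).card = 2 by rw [Finset.card_erase_of_mem hi, A.card_T p hp])
    have hpe : p = {i, j, k} := by rw [← e, Finset.insert_erase hi]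
    have hij : i ≠ j := fun h => Finset.notMem_erase i p (by rw [e, h]; simp)
    have hik : i ≠ k := fun h => Finset.notMem_erase i p (by rw [e, h]; simp)
    let v : Fin 4 → Finset ι := ![p, {i}, {j}, {k}]
    have hv : ∀ n, A.IsMain (v n) := fun n => by
      fin_cases n
      exacts [Or.inr hp, hone i, hone j, hone k]
    have hne : ∀ i, p ≠ {i} := fun i e => hsT i (e ▸ hp)
    have hvi : Function.Injective (τ ∘ v) := fun n n' e => by
      have := hinj (hv n) (hv n') e
      fin_cases n <;> fin_cases n' <;>
        simp [v, hne, (hne _).symm, hij, hik, hjk, hij.symm, hik.symm, hjk.symm] at this ⊢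
    obtain ⟨κ, hκ⟩ := BiConst.exists_sum_eq hY hs (u := τ ∘ v) (v := v) (l := l ∘ v) (m := m ∘ v)
      (c := ![1, -1, -1, -1]) (κ := 0) (fun n => hlm _ (hv n)) (fun n => hll _ (hv n)) fun x => by
        simp only [v, hpe, Fin.sum_univ_four, Matrix.cons_val, Finset.mem_insert,
          Finset.mem_singleton]
        by_cases h1 : x = i
        · simp [h1, hij, hik]
        by_cases h2 : x = j
        · simp [h2, hij.symm, hjk]
        · simp [h1, h2]; split_ifs <;> rfl
    obtain ⟨x₀, hx₀⟩ := exists_notMem_of_card_lt (u := Finset.univ.biUnion (τ ∘ v)) (by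
      have := Finset.card_biUnion_le_card_mul Finset.univ (τ ∘ v) 3 fun n _ => (hmain (hτ _ (hv n))).2
      simp only [Finset.card_univ, Fintype.card_fin] at this
      omega)
    simp only [Finset.mem_biUnion, Finset.mem_univ, true_and, not_exists] at hx₀
    obtain rfl : κ = 0 := by rw [← hκ x₀]; simp [-Function.comp_apply, hx₀]
    have key := fun n hn => eq_single_of_sum_eq_zero (A := B) (u := τ ∘ v) (fun n => hτ _ (hv n)) hvi
      (fun n => by
        have := hll _ (hv n)
        fin_cases n <;> simpa using this) hκ (n := 1) (m := n) hT hn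
    obtain ⟨x, hx, ex⟩ := key 0 (by decide)
    obtain ⟨y, hy, ey⟩ := key 2 (by decide)
    obtain ⟨z, hz, ez⟩ := key 3 (by decide)
    exact ⟨j, k, x, y, z, hpe, hij, hik, hjk, ex, ey, ez, hx, hy, hz⟩
  obtain ⟨p₀, hp₀, hdeg⟩ := hd
  have hmem : ∀ i, τ {i} ∈ B.T → i ∈ p₀ := fun i hT => by
    by_contra hi
    obtain ⟨p, hp, p', hp', hpp, hip, hip'⟩ := hdeg i hi
    obtain ⟨j, k, x, y, z, hpe, hij, hik, hjk, ex, ey, ez, hx, hy, hz⟩ := hbad p hp i hip hT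
    obtain ⟨-, -, x', -, -, -, -, -, -, ex', -, -, hx', -, -⟩ := hbad p' hp' i hip' hT
    have hn : ∀ {v v' a b}, A.IsMain v → A.IsMain v' → τ v = {a} → τ v' = {b} → v ≠ v' → a ≠ b :=
      fun hv hv' e e' hne h => hne (hinj hv hv' (by rw [e, e', h]))
    have hpm : A.IsMain p := Or.inr hp
    have hpm' : A.IsMain p' := Or.inr hp'
    have h4 : ({x', x, y, z} : Finset ι).card ≤ (τ {i}).card := Finset.card_le_card (by
      simp [Finset.insert_subset_iff, hx, hy, hz, hx'])
    rw [B.card_T _ hT, Finset.card_insert_of_notMem, Finset.card_eq_three.2 ⟨x, y, z,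
      hn hpm (hone j) ex ey fun e => hsT j (e ▸ hp), hn hpm (hone k) ex ez fun e => hsT k (e ▸ hp),
      hn (hone j) (hone k) ey ez (by simpa using hjk), rfl⟩] at h4
    · omega
    · simp only [Finset.mem_insert, Finset.mem_singleton, not_or]
      exact ⟨hn hpm' hpm ex' ex hpp.symm, hn hpm' (hone j) ex' ey fun e => hsT j (e ▸ hp'),
        hn hpm' (hone k) ex' ez fun e => hsT k (e ▸ hp')⟩
  have hline : ∀ i, ∃ k, τ {i} = {k} := fun i => by
    refine (hτ _ (hone i)).resolve_right fun hT => ?_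
    obtain ⟨j, k, x, y, z, hpe, hij, hik, hjk, ex, ey, ez, hx, hy, hz⟩ := hbad p₀ hp₀ i (hmem i hT) hT
    obtain ⟨κ, hκ⟩ := BiConst.exists_sum_eq hY hs (u := fun i => τ {i}) (v := fun i => {i})
      (l := fun i => l {i}) (c := fun _ => 1) (κ := 1) (fun i => hlm _ (hone i))
      (fun i => hll _ (hone i)) fun i => by simp
    have e := (hκ y).trans (hκ x).symm
    rw [← sub_eq_zero, ← Finset.sum_sub_distrib, Finset.sum_eq_single j] at e
    · have hxy : x ≠ y := fun h => hsT j (hinj (Or.inr hp₀) (hone j) (by rw [ex, ey, h]) ▸ hp₀)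
      simp [ey, hxy] at e
      exact (hl _ (hone j)).ne_zero e
    · intro a _ haj
      by_cases hai : a = i
      · simp [hai, hx, hy]
      have haT : τ {a} ∉ B.T := fun h => by
        have := hmem a h
        rw [hpe] at this
        simp only [Finset.mem_insert, Finset.mem_singleton, hai, haj, false_or] at this
        exact hsT' z (by rwa [← ez, ← this])
      obtain ⟨w, hw⟩ := (hτ _ (hone a)).resolve_right haT
      have h1 : y ≠ w := fun h => haj (Finset.singleton_inj.1 (hinj (hone a) (hone j) (by
        rw [hw, ey, h])))
      have h2 : x ≠ w := fun h => hsT a (hinj (hone a) (Or.inr hp₀) (by rw [hw, ex, h]) ▸ hp₀)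
      simp [hw, h1, h2]
    · simp
  choose π₀ hπ₀ using hline
  have hinj₀ : Function.Injective π₀ := fun i j hij => Finset.singleton_inj.1
    (hinj (hone i) (hone j) (by rw [hπ₀, hπ₀, hij]))
  let π : Equiv.Perm ι := Equiv.ofBijective π₀ (Finite.injective_iff_bijective.1 hinj₀)
  have hlm₀ : ∀ i k, Y k (π i) = l {i} * (if k = i then 1 else 0) + m {i} := fun i k => by
    have := hlm _ (hone i) k
    simpa [hπ₀, π] using this
  have hsum : ∀ k, l {k} = 1 - ∑ i, m {i} := fun k => by
    have h1 := H.sum_Y k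
    rw [← Equiv.sum_comp π] at h1
    simp only [hlm₀, Finset.sum_add_distrib, mul_ite, mul_one, mul_zero, Finset.sum_ite_eq,
      Finset.mem_univ, if_true] at h1
    linarith
  have : Nonempty ι := Fintype.card_pos_iff.1 (by omega)
  set L := 1 - ∑ i, m {i}
  have hLu : IsUnit L := by
    have i := Classical.arbitrary ι
    exact hsum i ▸ hl _ (hone i)
  refine ⟨π, L, fun i => m {i}, hLu, fun i k => by rw [hlm₀, hsum], fun p hp => ?_⟩
  have hpm : A.IsMain p := Or.inr hp
  have hcard : (p.image π).card = 3 := by rw [Finset.card_image_of_injective _ π.injective, A.card_T p hp]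
  have e : τ p = p.image π := BiConst.left_unique hc7 hY hs (hmain (hτ p hpm)).1 (hmain (hτ p hpm)).2
    ((hmain hpm).1.image π) hcard.le ⟨_, _, hlm p hpm⟩ ⟨L, ∑ i ∈ p, m {i}, fun k => by
      rw [Finset.sum_image π.injective.injOn, Finset.sum_congr rfl fun i _ => hlm₀ i k,
        Finset.sum_add_distrib]
      simp [hsum]⟩
  rcases hτ p hpm with ⟨k, hk⟩ | h
  · rw [← e, hk] at hcard
    simp at hcard
  · rwa [← e]

end Theorem
end Arr

end

section

open unitInterval Topology
open Filter (Tendsto Eventually eventually_all)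

/-! ### Square roots near a triangle -/

/-- Three lines `a r` such that the lines with `χ = 1` meet each of them in pairs. -/
structure BlockData {ι : Type*} [Fintype ι] [DecidableEq ι] (T : Finset (Finset ι)) where
  χ : ι → ℤ
  a : Fin 3 → ι
  pr : Fin 3 → ι → ι
  Rp : Fin 3 → Finset ι
  inj : Function.Injective a
  χ01 : ∀ i, χ i = 0 ∨ χ i = 1
  χa : ∀ r, χ (a r) = 0
  sum : ∀ r (X : ι → ℝ), ∑ j, χ j * X j = ∑ k ∈ Rp r, (X k + X (pr r k))
  tri : ∀ r, ∀ k ∈ Rp r, χ k = 1 ∧ χ (pr r k) = 1 ∧ k ≠ pr r k ∧ {a r, k, pr r k} ∈ T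
  cover : ∀ r j, χ j = 1 → ∃ k, χ k = 1 ∧ k ≠ j ∧ {a r, j, k} ∈ T
  even : Even (∑ j, χ j)
  card : 5 ≤ (Finset.univ.filter (χ · = 1)).card
  line : ∀ k, χ k = 0 → (∀ r, k ≠ a r) → (∀ r, ∀ p ∈ T, ¬ {k, a r} ⊆ p) ∧
    ∃ j, χ j = 1 ∧ ∀ p ∈ T, ¬ {k, j} ⊆ p
  corner : ∀ r s, r ≠ s → ∀ p ∈ T, ¬ {a r, a s} ⊆ p

namespace Arr

variable {ι : Type*} [Fintype ι] [DecidableEq ι] {A : Arr ι}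

/-- Flat functions on the neighbourhood of a flat are proportional. -/
lemma flat_ratio {u : Finset ι} (hu : A.IsFlat u) {e : ℝ} (h0 : 0 < e) (he : 8 * A.K * e ≤ 1)
    {ψ : C(I, E3) → ℂ} {m m' : E3 → ℂ}
    (hm : ∀ γ : C(I, E3), (∀ s, γ s ∈ A.V u (4 * e)) → m (γ 0) = ψ γ * m (γ 1))
    (hm' : ∀ γ : C(I, E3), (∀ s, γ s ∈ A.V u (4 * e)) → m' (γ 0) = ψ γ * m' (γ 1)) {x y : E3}
    (hx : x ∈ A.V u e) (hy : y ∈ A.V u e) : m x * m' y = m y * m' x := by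
  obtain ⟨γ, hγ⟩ := hu.joinedIn h0 he hx hy
  have e1 := hm γ.toContinuousMap hγ
  have e2 := hm' γ.toContinuousMap hγ
  have g0 : γ.toContinuousMap 0 = x := γ.source
  have g1 : γ.toContinuousMap 1 = y := γ.target
  rw [g0, g1] at e1 e2
  rw [e1, e2]; ring

/-- Real points in a flag. -/
lemma exists_flag {w : Finset ι} (hw : A.IsFlat w) {i m n : ι} (hi : i ∈ w) (hm : m ∈ w)
    (him : i ≠ m) (hn : n ∉ w) {η : ℝ} (h0 : 0 < η) : ∃ x ∈ A.V {i} η, x ∈ A.V w η ∧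
      ∀ j ∉ w, ∃ r : ℝ, A.f j x = r ∧ 0 < r * (A.d i m j / A.d i m n) := by
  have hK := A.one_le_K
  obtain ⟨e, e0, he, heη⟩ : ∃ e : ℝ, 0 < e ∧ 8 * A.K ^ 2 * e ≤ 1 ∧ 8 * A.K ^ 2 * e ≤ η := by
    refine ⟨min 1 η / (8 * A.K ^ 2), by positivity, ?_, ?_⟩ <;>
      rw [mul_div_cancel₀ _ (by positivity)]
    · exact min_le_left _ _
    · exact min_le_right _ _
  have hd : A.d i m n ≠ 0 := fun h => hn ((hw.d_eq_zero_iff hi hm him n).1 h)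
  have key := flag_mem hw hi hm him hn he (x := A.pt i m n ((e * e : ℝ) : ℂ) ((e : ℝ) : ℂ) 1)
    (by rw [f_pt_fst hd]; exact_mod_cast (mul_pos e0 e0).ne')
    (by rw [f_pt_fst hd, f_pt_snd hd, Complex.norm_real, Complex.norm_real, Real.norm_of_nonneg e0.le,
      Real.norm_of_nonneg (mul_pos e0 e0).le])
    (by rw [f_pt_snd hd, f_pt_trd hd, Complex.norm_real, Real.norm_of_nonneg e0.le]; simp)
  refine ⟨_, V_mono heη key.1, V_mono heη key.2, fun j hj => ?_⟩
  set q := A.d i m j / A.d i m n with hq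
  have hdj : A.d i m j ≠ 0 := fun h => hj ((hw.d_eq_zero_iff hi hm him j).1 h)
  refine ⟨A.d j m n / A.d i m n * (e * e) + A.d i j n / A.d i m n * e + q, ?_, ?_⟩
  · rw [f_pt, hq]; push_cast; ring
  have h1 := abs_le.1 (A.ratio_le j m n i m n)
  have h2 := abs_le.1 (A.ratio_le i j n i m n)
  have h3 := A.ratio_ge hdj hd
  rw [← hq] at h3
  have h4 : |A.d j m n / A.d i m n * (e * e) + A.d i j n / A.d i m n * e| < |q| := by
    have e1 : e ≤ 1 := by nlinarith
    have := A.ratio_le j m n i m n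
    have := A.ratio_le i j n i m n
    calc _ ≤ |A.d j m n / A.d i m n| * (e * e) + |A.d i j n / A.d i m n| * e := by
          refine (abs_add_le _ _).trans_eq ?_
          rw [abs_mul _ (e * e), abs_of_pos (mul_pos e0 e0), abs_mul _ e, abs_of_pos e0]
      _ ≤ A.K * (e * 1) + A.K * e := by gcongr
      _ < A.K⁻¹ := by
        rw [lt_inv_comm₀ (by positivity) (by positivity), ← one_div, lt_div_iff₀ (by positivity)]
        nlinarith
      _ ≤ _ := h3
  nlinarith [abs_lt.1 h4, abs_mul_abs_self q, abs_nonneg q, neg_abs_le q, le_abs_self q,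
    abs_mul (A.d j m n / A.d i m n * (e * e) + A.d i j n / A.d i m n * e) q,
    neg_abs_le ((A.d j m n / A.d i m n * (e * e) + A.d i j n / A.d i m n * e) * q)]

/-- The inverse of the phase of a square root of `f_k f_j`. -/
def sqrtPhase (A : Arr ι) (k j : ι) (c : ℝ) (x : E3) : ℂ :=
  Complex.exp (-((Complex.arg (A.f k x) + Complex.arg (A.f j x / (c * A.f k x)) / 2 : ℝ) *
    Complex.I))

lemma sqrtPhase_flat {k j : ι} {c : ℝ} (hc : c ≠ 0) {γ : C(I, E3)} (hγ : ∀ s, γ s ∈ A.M)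
    (h : ∀ s, A.f j (γ s) / (c * A.f k (γ s)) ∈ Complex.slitPlane) :
    A.sqrtPhase k j c (γ 0) = Complex.exp (((Theta (A.f k) γ + Theta (A.f j) γ) / 2 : ℝ) *
      Complex.I) * A.sqrtPhase k j c (γ 1) := by
  have hc' : (c : ℂ) ≠ 0 := by exact_mod_cast hc
  have hcont : Continuous fun s => A.f j (γ s) / (c * A.f k (γ s)) :=
    Continuous.div (by fun_prop) (by fun_prop) fun s => mul_ne_zero hc' (hγ s k)
  have h1 := Theta_f_eq γ hγ j k (k := (c : ℂ)⁻¹) (inv_ne_zero hc')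
  have e : (fun s => (c : ℂ)⁻¹ * A.f j (γ s) / A.f k (γ s)) =
      fun s => A.f j (γ s) / (c * A.f k (γ s)) := by
    funext s; have := hγ s k; field_simp
  rw [e] at h1
  have h2 := ang_eq_of_arg ⟨_, hcont⟩ (fun s => Complex.slitPlane_ne_zero (h s))
    (fun s => Complex.arg (A.f j (γ s) / (c * A.f k (γ s))))
    (continuous_iff_continuousAt.2 fun s => (Complex.continuousAt_arg (h s)).comp
      (f := fun s => A.f j (γ s) / (c * A.f k (γ s))) hcont.continuousAt)
    fun s => (Complex.norm_mul_exp_arg_mul_I _).symm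
  simp only [ContinuousMap.coe_mk] at h2
  obtain ⟨n, hn⟩ := exists_int_ang ⟨fun s => A.f k (γ s), by fun_prop⟩ fun s => hγ s k
  change Theta (A.f k) γ - _ = _ at hn
  simp only [ContinuousMap.coe_mk] at hn
  rw [sqrtPhase, sqrtPhase, ← Complex.exp_add, Complex.exp_eq_exp_iff_exists_int]
  refine ⟨-n, ?_⟩
  have h3 : (Theta (A.f k) γ + Theta (A.f j) γ) / 2 = Complex.arg (A.f k (γ 1)) -
      Complex.arg (A.f k (γ 0)) + 2 * Real.pi * n + (Complex.arg (A.f j (γ 1) / (c * A.f k (γ 1))) -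
        Complex.arg (A.f j (γ 0) / (c * A.f k (γ 0)))) / 2 := by
    rw [h1, h2]; linarith
  rw [h3]
  push_cast
  ring

/-- At real points the phase is a sign. -/
lemma sqrtPhase_real {k j : ι} {c r r' : ℝ} {x : E3} (hk : A.f k x = r) (hj : A.f j x = r')
    (h0 : r ≠ 0) (h : 0 < r' / (c * r)) : A.sqrtPhase k j c x = (r / |r| : ℝ) := by
  have h1 : Complex.arg (A.f j x / (c * A.f k x)) = 0 := by
    rw [hk, hj, ← Complex.ofReal_mul, ← Complex.ofReal_div]
    exact Complex.arg_ofReal_of_nonneg h.le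
  rw [sqrtPhase, h1, hk]
  rcases lt_or_gt_of_ne h0 with hr | hr
  · rw [Complex.arg_ofReal_of_neg hr, abs_of_neg hr, div_neg, div_self h0]
    simp [Complex.exp_neg]
  · rw [Complex.arg_ofReal_of_nonneg hr.le, abs_of_pos hr, div_self h0]
    simp

end Arr

namespace BlockData

open Arr

variable {ι : Type*} [Fintype ι] [DecidableEq ι] {A : Arr ι} {T : Finset (Finset ι)}
  (β : BlockData T)

/-- Flats meeting the triangle but none of the lines with `χ = 1`. -/
def IsTri (A : Arr ι) (r : Fin 3) (u : Finset ι) : Prop :=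
  A.IsFlat u ∧ β.a r ∈ u ∧ ∀ i ∈ u, β.χ i = 0

def cc (A : Arr ι) (r : Fin 3) (k : ι) : ℝ :=
  A.d (β.a r) (β.pr r k) (β.a (r + 1)) / A.d (β.a r) k (β.a (r + 1))

/-- The flat section near the line `a r`. -/
def nn (A : Arr ι) (r : Fin 3) (x : E3) : ℂ :=
  ∏ k ∈ β.Rp r, A.sqrtPhase k (β.pr r k) (β.cc A r k) x

variable {β}

lemma nn_ne_zero (r : Fin 3) (x : E3) : β.nn A r x ≠ 0 :=
  Finset.prod_ne_zero_iff.2 fun _ _ => Complex.exp_ne_zero _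

variable (hA : A.T = T)
include hA

lemma d_ne {r : Fin 3} {k : ι} (hk : k ∈ β.Rp r) (s : Fin 3) (hs : r ≠ s) :
    A.d (β.a r) k (β.a s) ≠ 0 ∧ A.d (β.a r) (β.pr r k) (β.a s) ≠ 0 := by
  obtain ⟨h1, h2, h3, h4⟩ := β.tri r k hk
  have hf : A.IsFlat {β.a r, k, β.pr r k} := Or.inr (Or.inl (by rw [hA]; exact h4))
  have hn : β.a s ∉ ({β.a r, k, β.pr r k} : Finset ι) := by
    simp only [Finset.mem_insert, Finset.mem_singleton, not_or]
    refine ⟨fun h => hs (β.inj h).symm, fun h => ?_, fun h => ?_⟩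
    · rw [← h, β.χa] at h1; omega
    · rw [← h, β.χa] at h2; omega
  have hak : β.a r ≠ k := fun h => by rw [← h, β.χa] at h1; omega
  have hap : β.a r ≠ β.pr r k := fun h => by rw [← h, β.χa] at h2; omega
  exact ⟨fun h => hn ((hf.d_eq_zero_iff (by simp) (by simp) hak _).1 h),
    fun h => hn ((hf.d_eq_zero_iff (by simp) (by simp) hap _).1 h)⟩

lemma f_pr {r : Fin 3} {k : ι} (hk : k ∈ β.Rp r) (x : E3) : A.f (β.pr r k) x =
    (A.d (β.pr r k) k (β.a (r + 1)) / A.d (β.a r) k (β.a (r + 1)) : ℝ) * A.f (β.a r) x +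
      β.cc A r k * A.f k x := by
  have hs : r ≠ r + 1 := by simp
  obtain ⟨h1, h2, h3, h4⟩ := β.tri r k hk
  have hf : A.IsFlat {β.a r, k, β.pr r k} := Or.inr (Or.inl (by rw [hA]; exact h4))
  have hak : β.a r ≠ k := fun h => by rw [← h, β.χa] at h1; omega
  rw [A.f_cramer (d_ne hA hk _ hs).1 (β.pr r k) x,
    (hf.d_eq_zero_iff (by simp) (by simp) hak (β.pr r k)).2 (by simp), cc]
  simp

lemma cc_ne {r : Fin 3} {k : ι} (hk : k ∈ β.Rp r) : β.cc A r k ≠ 0 :=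
  div_ne_zero (d_ne hA hk _ (by simp)).2 (d_ne hA hk _ (by simp)).1

lemma norm_ratio_sub_one_lt {r : Fin 3} {k : ι} (hk : k ∈ β.Rp r) {u : Finset ι}
    (hu : β.IsTri A r u) {η : ℝ} (hη : A.K * η ≤ 1) {x : E3} (hx : x ∈ A.V u η) :
    ‖A.f (β.pr r k) x / (β.cc A r k * A.f k x) - 1‖ < 1 := by
  obtain ⟨h1, h2, h3, h4⟩ := β.tri r k hk
  have hs : r ≠ r + 1 := by simp
  have hd := d_ne hA hk _ hs
  have hku : k ∉ u := fun h => by rw [hu.2.2 k h] at h1; omega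
  have hc := cc_ne hA hk
  have hc' : (β.cc A r k : ℂ) ≠ 0 := by exact_mod_cast hc
  have hfk := hx.1 k
  have e : A.f (β.pr r k) x / (β.cc A r k * A.f k x) - 1 =
      ((A.d (β.pr r k) k (β.a (r + 1)) / A.d (β.a r) (β.pr r k) (β.a (r + 1)) : ℝ) : ℂ) *
        (A.f (β.a r) x / A.f k x) := by
    rw [f_pr hA hk x, div_sub_one (mul_ne_zero hc' hfk), add_sub_cancel_right, cc]
    have := hd.1
    have := hd.2
    have g1 : ((A.d (β.a r) k (β.a (r + 1)) : ℝ) : ℂ) ≠ 0 := by exact_mod_cast hd.1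
    have g2 : ((A.d (β.a r) (β.pr r k) (β.a (r + 1)) : ℝ) : ℂ) ≠ 0 := by exact_mod_cast hd.2
    push_cast
    field_simp
  rw [e, norm_mul, Complex.norm_real, norm_div (A.f _ x)]
  have h5 := A.ratio_le (β.pr r k) k (β.a (r + 1)) (β.a r) (β.pr r k) (β.a (r + 1))
  have h6 := hx.2 _ hu.2.1 k hku
  have h7 : 0 < ‖A.f k x‖ := norm_pos_iff.2 hfk
  have hK := A.one_le_K
  calc _ ≤ A.K * (‖A.f (β.a r) x‖ / ‖A.f k x‖) := by gcongr; exact h5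
    _ < A.K * η := by gcongr; rwa [div_lt_iff₀ h7]
    _ ≤ 1 := hη

lemma nn_flat {r : Fin 3} {u : Finset ι} (hu : β.IsTri A r u) {η : ℝ} (hη : A.K * η ≤ 1)
    (t : ι → ℝ) (γ : C(I, E3)) (hγ : ∀ s, γ s ∈ A.V u η) :
    β.nn A r (γ 0) = A.psi β.χ t γ 0 * β.nn A r (γ 1) := by
  have e : A.psi β.χ t γ 0 = ∏ k ∈ β.Rp r,
      Complex.exp (((Theta (A.f k) γ + Theta (A.f (β.pr r k)) γ) / 2 : ℝ) * Complex.I) := by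
    rw [psi, ex_apply, ← Complex.exp_sum]
    congr 1
    have := congrArg (fun x : ℝ => (x : ℂ) * Complex.I / 2) (β.sum r fun j => Theta (A.f j) γ)
    push_cast at this
    rw [Finset.sum_mul, Finset.sum_div, Finset.sum_mul, Finset.sum_div] at this
    calc _ = ∑ j, (β.χ j : ℂ) * (Theta (A.f j) γ : ℂ) * Complex.I / 2 := by
          refine Finset.sum_congr rfl fun j _ => ?_
          have : (Real.pi : ℂ) ≠ 0 := by exact_mod_cast Real.pi_ne_zero
          push_cast
          field_simp
          ring
      _ = _ := this
      _ = _ := Finset.sum_congr rfl fun k _ => by push_cast; ring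
  rw [e, nn, nn, ← Finset.prod_mul_distrib]
  refine Finset.prod_congr rfl fun k hk => sqrtPhase_flat (cc_ne hA hk) (fun s => (hγ s).1) fun s => ?_
  have := Complex.mem_slitPlane_of_norm_lt_one (norm_ratio_sub_one_lt hA hk hu hη (hγ s))
  rwa [add_sub_cancel] at this

omit hA in
lemma card_Rp (r : Fin 3) : (2 * (β.Rp r).card : ℝ) = ∑ j, (β.χ j : ℝ) := by
  have := β.sum r fun _ => 1
  simp only [mul_one] at this
  rw [this, Finset.sum_const]
  simp; ring

/-- The sign comparing the sections at a corner. -/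
def kap (A : Arr ι) (β : BlockData T) (r s : Fin 3) : ℝ :=
  (∏ k ∈ β.Rp r, A.d (β.a r) (β.a s) k) * ∏ k ∈ β.Rp s, A.d (β.a r) (β.a s) k

omit hA in
lemma isTri_single (r : Fin 3) : β.IsTri A r {β.a r} :=
  ⟨isFlat_single _, by simp, fun i hi => by rw [Finset.mem_singleton.1 hi, β.χa]⟩

lemma isTri_corner {r s : Fin 3} (hrs : r ≠ s) : β.IsTri A r {β.a r, β.a s} := by
  refine ⟨Or.inr (Or.inr ⟨_, _, fun h => hrs (β.inj h), rfl, hA ▸ β.corner r s hrs⟩), by simp, ?_⟩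
  intro i hi
  rcases Finset.mem_insert.1 hi with rfl | hi
  · exact β.χa r
  · rw [Finset.mem_singleton.1 hi, β.χa]

lemma exists_corner {r s : Fin 3} (hrs : r ≠ s) {η : ℝ} (h0 : 0 < η) (hη : A.K * η ≤ 1) :
    ∃ x ∈ A.V {β.a r, β.a s} η, (0 < kap A β r s → β.nn A r x = β.nn A s x) ∧
      (kap A β r s < 0 → β.nn A r x = -β.nn A s x) := by
  have hc := isTri_corner (β := β) hA hrs
  have hc' : β.IsTri A s {β.a r, β.a s} := ⟨hc.1, by simp, hc.2.2⟩
  obtain ⟨n, hn, -⟩ := hc.1.exists_notMem ∅ (by simp)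
  obtain ⟨x, -, hx, hr⟩ := exists_flag hc.1 (i := β.a r) (m := β.a s) (by simp) (by simp)
    (fun h => hrs (β.inj h)) hn h0
  have hnot : ∀ k, β.χ k = 1 → k ∉ ({β.a r, β.a s} : Finset ι) := fun k hk h => by
    rw [hc.2.2 k h] at hk; omega
  choose! R hR hRp using hr
  set dn := A.d (β.a r) (β.a s) n
  have key : ∀ r', β.IsTri A r' {β.a r, β.a s} → β.nn A r' x =
      ((∏ k ∈ β.Rp r', R k) / |∏ k ∈ β.Rp r', R k| : ℝ) := fun r' hr' => by
    rw [nn, Finset.abs_prod, ← Finset.prod_div_distrib, Complex.ofReal_prod]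
    refine Finset.prod_congr rfl fun k hk => ?_
    obtain ⟨h1, h2, -, -⟩ := β.tri r' k hk
    refine sqrtPhase_real (hR k (hnot k h1)) (hR _ (hnot _ h2)) (fun h => ?_) ?_
    · have := hx.1 k
      rw [hR k (hnot k h1), h] at this
      simp at this
    · have h3 := norm_ratio_sub_one_lt hA hk hr' hη hx
      rw [hR k (hnot k h1), hR _ (hnot _ h2), ← Complex.ofReal_mul, ← Complex.ofReal_div,
        ← Complex.ofReal_one, ← Complex.ofReal_sub, Complex.norm_real, Real.norm_eq_abs] at h3
      linarith [abs_lt.1 h3]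
  have hpos : ∀ r', 0 < (∏ k ∈ β.Rp r', R k) *
      ((∏ k ∈ β.Rp r', A.d (β.a r) (β.a s) k) * (dn⁻¹) ^ (β.Rp r').card) := fun r' => by
    rw [← Finset.prod_const, ← Finset.prod_mul_distrib, ← Finset.prod_mul_distrib]
    refine Finset.prod_pos fun k hk => ?_
    have := hRp k (hnot k (β.tri r' k hk).1)
    rwa [div_eq_mul_inv] at this
  have hcard : (β.Rp r).card = (β.Rp s).card := by
    have := (card_Rp (β := β) r).trans (card_Rp s).symm
    exact_mod_cast mul_left_cancel₀ two_ne_zero this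
  have h1 := hpos r
  have h2 := hpos s
  rw [hcard] at h1
  set P := ∏ k ∈ β.Rp r, R k
  set Q := ∏ k ∈ β.Rp s, R k
  set z := (dn⁻¹) ^ (β.Rp s).card
  have h3 : 0 < P * Q * kap A β r s := by
    have h4 := mul_pos h1 h2
    have e : P * ((∏ k ∈ β.Rp r, A.d (β.a r) (β.a s) k) * z) *
        (Q * ((∏ k ∈ β.Rp s, A.d (β.a r) (β.a s) k) * z)) = P * Q * kap A β r s * (z * z) := by
      rw [kap]; ring
    rw [e] at h4
    exact pos_of_mul_pos_left h4 (mul_self_nonneg z)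
  have hP : P ≠ 0 := fun h => by simp [h] at h1
  have hQ : Q ≠ 0 := fun h => by simp [h] at h2
  refine ⟨x, hx, fun hk => ?_, fun hk => ?_⟩ <;> rw [key r hc, key s hc']
  · have h5 : 0 < P * Q := pos_of_mul_pos_left h3 hk.le
    rw [Complex.ofReal_inj, div_eq_div_iff (abs_ne_zero.2 hP) (abs_ne_zero.2 hQ)]
    rcases pos_and_pos_or_neg_and_neg_of_mul_pos h5 with ⟨p, q⟩ | ⟨p, q⟩
    · rw [abs_of_pos p, abs_of_pos q]; ring
    · rw [abs_of_neg p, abs_of_neg q]; ring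
  · have h5 : P * Q < 0 := by nlinarith
    rw [← Complex.ofReal_neg, Complex.ofReal_inj, ← neg_div,
      div_eq_div_iff (abs_ne_zero.2 hP) (abs_ne_zero.2 hQ)]
    rcases mul_neg_iff.1 h5 with ⟨p, q⟩ | ⟨p, q⟩
    · rw [abs_of_pos p, abs_of_neg q]; ring
    · rw [abs_of_neg p, abs_of_pos q]; ring

lemma nn_corner {r s : Fin 3} (hrs : r ≠ s) {e : ℝ} (h0 : 0 < e) (he : 8 * A.K * e ≤ 1) {x : E3}
    (hx : x ∈ A.V {β.a r, β.a s} e) : (0 < kap A β r s → β.nn A r x = β.nn A s x) ∧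
      (kap A β r s < 0 → β.nn A r x = -β.nn A s x) := by
  have hK := A.one_le_K
  have hc := isTri_corner (β := β) hA hrs
  have hc' : β.IsTri A s {β.a r, β.a s} := ⟨hc.1, by simp, hc.2.2⟩
  obtain ⟨y, hy, h1, h2⟩ := exists_corner (β := β) hA hrs h0 (by nlinarith)
  have := flat_ratio hc.1 h0 he (nn_flat hA hc (by linarith) 0) (nn_flat hA hc' (by linarith) 0) hx hy
  have hn := nn_ne_zero (A := A) (β := β) s y
  exact ⟨fun h => mul_right_cancel₀ hn (by rw [this, h1 h]; ring),
    fun h => mul_right_cancel₀ hn (by rw [this, h2 h]; ring)⟩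

/-- With negative holonomy there are no flat functions near the triangle. -/
theorem eq_zero_of_flat (hk : kap A β 0 1 * kap A β 1 2 * kap A β 0 2 < 0) {e : ℝ} (h0 : 0 < e)
    (he : 8 * A.K * e ≤ 1) {μ : E3 → ℂ} (hμ : ∀ r u, β.IsTri A r u → ∀ γ : C(I, E3),
      (∀ s, γ s ∈ A.V u (4 * e)) → μ (γ 0) = A.psi β.χ 0 γ 0 * μ (γ 1)) (r : Fin 3) {x : E3}
    (hx : x ∈ A.V {β.a r} e) : μ x = 0 := by
  have hK := A.one_le_K
  have key : ∀ r, ∃ ρ : ℂ, ∀ u, β.IsTri A r u → (u = {β.a r} ∨ ∃ s ≠ r, u = {β.a r, β.a s}) →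
      ∀ x ∈ A.V u e, μ x = ρ * β.nn A r x := by
    intro r
    obtain ⟨x₀, hx₀⟩ := A.exists_mem_V_single (β.a r) h0
    have h1 : ∀ u, β.IsTri A r u → ∀ x ∈ A.V u e, ∀ y ∈ A.V u e,
        μ x * β.nn A r y = μ y * β.nn A r x := fun u hu x hx y hy =>
      flat_ratio hu.1 h0 he (hμ r u hu) (nn_flat hA hu (by linarith) 0) hx hy
    have hs : ∀ x ∈ A.V {β.a r} e, μ x = μ x₀ / β.nn A r x₀ * β.nn A r x := fun x hx => by
      have := h1 _ (isTri_single r) x hx x₀ hx₀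
      have hn := nn_ne_zero (A := A) (β := β) r x₀
      field_simp
      linear_combination this
    refine ⟨μ x₀ / β.nn A r x₀, fun u hu hu' x hx => ?_⟩
    rcases hu' with rfl | ⟨s, hsr, rfl⟩
    · exact hs x hx
    obtain ⟨n, hn, -⟩ := hu.1.exists_notMem ∅ (by simp)
    obtain ⟨y, hy, hy', -⟩ := exists_flag hu.1 (i := β.a r) (m := β.a s) (by simp) (by simp)
      (fun h => hsr (β.inj h).symm) hn h0
    have h2 := h1 _ hu x hx y hy'
    rw [hs y hy] at h2
    exact mul_right_cancel₀ (nn_ne_zero (A := A) (β := β) r y) (by linear_combination h2)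
  choose ρ hρ using key
  have h2 : ∀ r s, r ≠ s → (0 < kap A β r s → ρ r = ρ s) ∧ (kap A β r s < 0 → ρ r = -ρ s) := by
    intro r s hrs
    obtain ⟨y, hy, -⟩ := exists_corner (β := β) hA hrs h0 (by nlinarith)
    have hc := isTri_corner (β := β) hA hrs
    have e1 := hρ r _ hc (Or.inr ⟨s, hrs.symm, rfl⟩) y hy
    have e2 := hρ s _ ⟨hc.1, by simp, hc.2.2⟩ (Or.inr ⟨r, hrs, Finset.pair_comm _ _⟩) y hy
    have hn := nn_ne_zero (A := A) (β := β) s y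
    obtain ⟨h3, h4⟩ := nn_corner (β := β) hA hrs h0 he hy
    constructor <;> intro h <;> refine mul_right_cancel₀ hn ?_
    · rw [← e2, e1, h3 h]
    · rw [neg_mul, ← e2, e1, h4 h]; ring
  have hν : ∀ r s, r ≠ s → kap A β r s ≠ 0 → ∃ ν : ℝ, 0 < ν * kap A β r s ∧ ρ r = ν * ρ s ∧
      ρ s = ν * ρ r := by
    intro r s hrs h0
    rcases lt_or_gt_of_ne h0 with h | h
    · exact ⟨-1, by linarith, by simp [(h2 r s hrs).2 h], by simp [(h2 r s hrs).2 h]⟩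
    · exact ⟨1, by linarith, by simp [(h2 r s hrs).1 h], by simp [(h2 r s hrs).1 h]⟩
  obtain ⟨ν, p1, q1, q1'⟩ := hν 0 1 (by decide) fun h => by simp [h] at hk
  obtain ⟨τ, p2, q2, q2'⟩ := hν 1 2 (by decide) fun h => by simp [h] at hk
  obtain ⟨υ, p3, q3, q3'⟩ := hν 0 2 (by decide) fun h => by simp [h] at hk
  have hneg : ν * τ * υ < 0 := by
    have := mul_pos (mul_pos p1 p2) p3
    by_contra h
    push Not at h
    nlinarith
  have h00 : ((1 - ν * τ * υ : ℝ) : ℂ) * ρ 0 = 0 := by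
    push_cast
    linear_combination q1 + (ν : ℂ) * q2 + (ν * τ : ℂ) * q3'
  have hρ0 : ρ 0 = 0 := (mul_eq_zero.1 h00).resolve_left fun h => by
    have := Complex.ofReal_eq_zero.1 h
    linarith
  have hfin : ρ 1 = 0 ∧ ρ 2 = 0 := by rw [q1', q3', hρ0]; simp
  have hr0 : ρ r = 0 := by fin_cases r <;> simp [hfin, hρ0]
  rw [hρ r _ (isTri_single r) (Or.inl rfl) x hx, hr0, zero_mul]

end BlockData

end

section

open unitInterval Topology
open Filter (Tendsto Eventually eventually_all)

/-! ### Walls with prescribed sections -/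

namespace Arr

variable {ι : Type*} [Fintype ι] [DecidableEq ι] {A : Arr ι} {χ : ι → ℤ} {t : ι → ℝ}

lemma psi_zero (γ : C(I, E3)) : A.psi χ t γ 0 = A.psi χ 0 γ 0 := by
  simp [psi, ex_apply]

lemma uu_zero_of_even {G : Finset ι} (h : Even (∑ j ∈ G, χ j)) : uu χ t G 0 = 1 := by
  obtain ⟨n, hn⟩ := h
  rw [uu_apply, Complex.exp_eq_one_iff]
  exact ⟨n, by rw [hn]; push_cast; ring⟩

lemma uu_zero_ne_of_odd {G : Finset ι} (h : Odd (∑ j ∈ G, χ j)) : uu χ t G 0 ≠ 1 := by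
  obtain ⟨n, hn⟩ := h
  rw [uu_apply, hn]
  have : ((2 * n + 1 : ℤ) : ℂ) * (Real.pi * Complex.I) + ((0 : ℝ) : ℂ) * ((∑ j ∈ G, t j : ℝ) : ℂ) =
      Real.pi * Complex.I + n * (2 * Real.pi * Complex.I) := by push_cast; ring
  rw [this, Complex.exp_add, Complex.exp_pi_mul_I, Complex.exp_int_mul_two_pi_mul_I]
  norm_num

namespace WallData

variable {η η₁ : ℝ} {v w0 w1 : Finset ι}

/-- Restriction of a wall to a smaller neighbourhood. -/
def mono (W : WallData A η₁ v w0 w1) (h : η ≤ η₁) : WallData A η v w0 w1 where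
  J := W.J
  G0 := W.G0
  G1 := W.G1
  a := W.a
  b := W.b
  k := W.k
  c := W.c
  sg := W.sg
  c_ne := W.c_ne
  sg_ne := W.sg_ne
  up x hx := W.up x (V_mono h hx)
  out x hx := W.out x (V_mono h hx)
  re0 x hx hx' := W.re0 x (V_mono h hx) (V_mono h hx')
  up0 x hx hx' := W.up0 x (V_mono h hx) (V_mono h hx')
  re1 x hx hx' := W.re1 x (V_mono h hx) (V_mono h hx')
  up1 x hx hx' := W.up1 x (V_mono h hx) (V_mono h hx')
  sub0 := W.sub0
  sub1 := W.sub1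
  off u hu h1 h2 h3 x hx hx' := W.off u hu h1 h2 h3 x (V_mono h hx) (V_mono h hx')

lemma F_apply (W : WallData A η₁ v w0 w1) (h0 : uu χ t W.G0 0 = 1) (x : E3) : W.F χ t x 0 =
    open Classical in
    if x ∈ A.V w0 η₁ then (1 - uu χ t (W.J \ W.G1) 0) * W.s0 χ t x 0 else 0 := by
  rw [F]
  split_ifs <;> simp [h0]

/-- A flat function near `w0` is the jump of a crossed homomorphism. -/
theorem exists_class_of_section (W : WallData A η₁ v w0 w1) (hη : η₁ ≤ 1) (hle : η ≤ η₁)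
    (hv : A.IsFlat v) (hw0 : A.IsFlat w0) (hw1 : A.IsFlat w1) (h0v : w0 ≠ v) (h1v : w1 ≠ v)
    (h01 : w0 ≠ w1) (hJ : Balanced χ t W.J) (h0 : uu χ t W.G0 0 = 1)
    (h1 : uu χ t (W.J \ W.G1) 0 ≠ 1)
    (hconn : ∀ x y, x ∈ A.V v η → x ∈ A.V w0 η → y ∈ A.V v η → y ∈ A.V w0 η → ∃ γ : C(I, E3),
      γ 0 = x ∧ γ 1 = y ∧ ∀ r, γ r ∈ A.V v η₁ ∧ γ r ∈ A.V w0 η₁) {s : E3 → ℂ}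
    (hs : ∀ γ : C(I, E3), (∀ r, γ r ∈ A.V w0 η₁) → s (γ 0) = A.psi χ t γ 0 * s (γ 1)) :
    ∃ E : C(I, E3) → C(ℝ, ℂ), IsCrossed (A.N η) (A.psi χ t) E ∧
      (∀ u, A.IsFlat u → u ≠ v → ∀ γ : C(I, E3), (∀ r, γ r ∈ A.V u η) → E γ = 0) ∧
      ∀ γ : C(I, E3), (∀ r, γ r ∈ A.V v η) → E γ 0 = -principal (fun γ => A.psi χ t γ 0)
        (open Classical in fun x => if x ∈ A.V w0 η then s x else 0) γ := by
  classical
  obtain ⟨E₁, -, hz, -, hF⟩ := W.exists_class hη hv hw0 hw1 h0v h1v h01 hJ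
  obtain ⟨E, hE, hEz, -, hEF⟩ := (W.mono hle).exists_class (hle.trans hη) hv hw0 hw1 h0v h1v h01 hJ
  have hu : 1 - uu χ t (W.J \ W.G1) 0 ≠ 0 := sub_ne_zero.2 h1.symm
  have hs0 : ∀ γ : C(I, E3), (∀ r, γ r ∈ A.V v η₁) → (∀ r, γ r ∈ A.V w0 η₁) →
      W.s0 χ t (γ 0) 0 = A.psi χ t γ 0 * W.s0 χ t (γ 1) 0 := fun γ hγ hγ' => by
    have e := hF γ hγ 0 h0
    simp only [hz w0 hw0 h0v γ hγ', principal, ContinuousMap.sub_apply, ContinuousMap.mul_apply,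
      F_apply W h0, if_pos (hγ' _), ContinuousMap.zero_apply] at e
    refine mul_left_cancel₀ hu ?_
    linear_combination e
  by_cases hex : ∃ x₀, x₀ ∈ A.V v η ∧ x₀ ∈ A.V w0 η
  swap
  · refine ⟨fun _ => 0, IsCrossed.zero, fun _ _ _ _ _ => rfl, fun γ hγ => ?_⟩
    have : ∀ r, γ r ∉ A.V w0 η := fun r h => hex ⟨_, hγ r, h⟩
    simp [principal, this]
  obtain ⟨x₀, hx₀, hx₀'⟩ := hex
  have hne : ∀ x, W.s0 χ t x 0 ≠ 0 := fun x => ex_ne_zero _ _ _ _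
  have key : ∀ x ∈ A.V v η, x ∈ A.V w0 η → s x = s x₀ / W.s0 χ t x₀ 0 * W.s0 χ t x 0 := by
    intro x hx hx'
    obtain ⟨γ, g0, g1, hγ⟩ := hconn x x₀ hx hx' hx₀ hx₀'
    have e1 := hs γ fun r => (hγ r).2
    have e2 := hs0 γ (fun r => (hγ r).1) fun r => (hγ r).2
    rw [g0, g1] at e1 e2
    rw [e1, e2]
    have := hne x₀
    field_simp
  set c := s x₀ / W.s0 χ t x₀ 0
  refine ⟨fun γ => ContinuousMap.const ℝ (c / (1 - uu χ t (W.J \ W.G1) 0)) * E γ, hE.smul _,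
    fun u hu huv γ hγ => by simp only [hEz u hu huv γ hγ, mul_zero], fun γ hγ => ?_⟩
  have hi : ∀ r, (if γ r ∈ A.V w0 η then s (γ r) else 0) =
      c / (1 - uu χ t (W.J \ W.G1) 0) * (W.mono hle).F χ t (γ r) 0 := fun r => by
    rw [F_apply (W.mono hle) h0]
    split_ifs with h
    · rw [key _ (hγ r) h]
      change _ = c / (1 - uu χ t (W.J \ W.G1) 0) * ((1 - uu χ t (W.J \ W.G1) 0) * W.s0 χ t (γ r) 0)
      field_simp
    · rw [mul_zero]
  simp only [ContinuousMap.mul_apply, ContinuousMap.const_apply, principal, hi, hEF γ hγ 0 h0,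
    ContinuousMap.sub_apply]
  ring

end WallData
end Arr

/-! ### The special crossed homomorphisms -/

namespace BlockData

open Arr

variable {ι : Type*} [Fintype ι] [DecidableEq ι] {A : Arr ι} {T : Finset (Finset ι)}
  (β : BlockData T)

/-- The flats at which the section near the triangle has a jump. -/
def IsSpecial (v : Finset ι) : Prop :=
  (v ∈ T ∧ (∃ r, β.a r ∈ v) ∧ ∃ j ∈ v, β.χ j = 1) ∨ ∃ k, v = {k} ∧ β.χ k = 0 ∧ ∀ r, k ≠ β.a r

/-- The neighbourhood of the side `r` of the triangle. -/
def side (A : Arr ι) (η : ℝ) (r : Fin 3) : Set E3 := {x | ∃ u, β.IsTri A r u ∧ x ∈ A.V u η}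

open Classical in
/-- The flat section near the triangle. -/
def nT (A : Arr ι) (η : ℝ) (x : E3) : ℂ :=
  if x ∈ β.side A η 0 then β.nn A 0 x else if x ∈ β.side A η 1 then β.nn A 1 x else
    if x ∈ β.side A η 2 then β.nn A 2 x else 0

variable {β} {η : ℝ}

lemma nT_eq_zero {x : E3} (h : ∀ r, x ∉ β.side A η r) : β.nT A η x = 0 := by
  simp [nT, h]

lemma a_ne {r : Fin 3} {j : ι} (h : β.χ j = 1) : j ≠ β.a r := fun e => by
  rw [e, β.χa] at h; omega

/-- The side is disjoint from the neighbourhoods of the other unspecial flats. -/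
lemma notMem_side (hη : η ≤ 1) {u : Finset ι} (hu : A.IsFlat u) (hs : ¬ β.IsSpecial u)
    (hr : ∀ r, β.a r ∉ u) {x : E3} (hx : x ∈ A.V u η) (r : Fin 3) : x ∉ β.side A η r := by
  rintro ⟨u', hu', hx'⟩
  rcases V_comparable hη hx hx' with h | h
  · rcases hu.eq_or_single hu'.1 h with e | ⟨k, e⟩
    · exact hr r (e ▸ hu'.2.1)
    · refine hs (Or.inr ⟨k, e, hu'.2.2 k (h (by simp [e])), fun r hk => hr r (by simp [e, hk])⟩)
  · exact hr r (h hu'.2.1)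

lemma nT_zero (hη : η ≤ 1) {u : Finset ι} (hu : A.IsFlat u) (hs : ¬ β.IsSpecial u)
    (hr : ∀ r, β.a r ∉ u) {x : E3} (hx : x ∈ A.V u η) : β.nT A η x = 0 :=
  nT_eq_zero (notMem_side hη hu hs hr hx)

variable (hA : A.T = T)
include hA

lemma eq_corner {r s : Fin 3} (hrs : r ≠ s) {u : Finset ι} (hu : A.IsFlat u) (h : β.a r ∈ u)
    (h' : β.a s ∈ u) : u = {β.a r, β.a s} :=
  hu.eq_of_two (isTri_corner (β := β) hA hrs).1 (fun e => hrs (β.inj e)) h h' (by simp) (by simp)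

lemma mem_corner (hη : η ≤ 1) {r s : Fin 3} (hrs : r ≠ s) {x : E3} (h : x ∈ β.side A η r)
    (h' : x ∈ β.side A η s) : x ∈ A.V {β.a r, β.a s} η := by
  obtain ⟨u, hu, hx⟩ := h
  obtain ⟨u', hu', hx'⟩ := h'
  rcases V_comparable hη hx hx' with h | h
  · rwa [← eq_corner hA hrs hu'.1 (h hu.2.1) hu'.2.1]
  · rwa [← eq_corner hA hrs hu.1 hu.2.1 (h hu'.2.1)]

lemma nT_eq (hk : ∀ r s, r < s → 0 < kap A β r s) (h0 : 0 < η) (hη : η ≤ 1) (he : 8 * A.K * η ≤ 1)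
    {r : Fin 3} {x : E3} (h : x ∈ β.side A η r) : β.nT A η x = β.nn A r x := by
  have key : ∀ s, x ∈ β.side A η s → β.nn A s x = β.nn A r x := fun s h' => by
    rcases lt_trichotomy s r with hs | rfl | hs
    · exact (nn_corner hA hs.ne h0 he (mem_corner hA hη hs.ne h' h)).1 (hk s r hs)
    · rfl
    · exact ((nn_corner hA hs.ne h0 he (mem_corner hA hη hs.ne h h')).1 (hk r s hs)).symm
  have : x ∈ β.side A η 0 ∨ x ∈ β.side A η 1 ∨ x ∈ β.side A η 2 := by
    fin_cases r
    · exact Or.inl h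
    · exact Or.inr (Or.inl h)
    · exact Or.inr (Or.inr h)
  rw [nT]
  split_ifs with h0 h1 h2
  · exact key 0 h0
  · exact key 1 h1
  · exact key 2 h2
  · tauto

lemma isSpecial_of_mem {u : Finset ι} (hu : A.IsFlat u) {r : Fin 3} (hr : β.a r ∈ u) {j : ι}
    (hj : j ∈ u) (h1 : β.χ j = 1) : u ∈ T ∧ ∃ k, β.χ k = 1 ∧ k ≠ j ∧ u = {β.a r, j, k} := by
  obtain ⟨k, hk, hkj, hT⟩ := β.cover r j h1
  have : u = {β.a r, j, k} := hu.eq_of_two (Or.inr (Or.inl (by rw [hA]; exact hT)))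
    (a_ne h1).symm hr hj (by simp) (by simp)
  exact ⟨by rw [this]; exact hT, k, hk, hkj, this⟩

lemma nT_flat (hk : ∀ r s, r < s → 0 < kap A β r s) (h0 : 0 < η) (hη : η ≤ 1)
    (he : 8 * A.K * η ≤ 1) {u : Finset ι} (hu : A.IsFlat u) (hs : ¬ β.IsSpecial u) (t : ι → ℝ)
    (γ : C(I, E3)) (hγ : ∀ s, γ s ∈ A.V u η) :
    β.nT A η (γ 0) = A.psi β.χ t γ 0 * β.nT A η (γ 1) := by
  by_cases hr : ∀ r, β.a r ∉ u
  · rw [nT_zero hη hu hs hr (hγ 0), nT_zero hη hu hs hr (hγ 1), mul_zero]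
  push Not at hr
  obtain ⟨r, hr⟩ := hr
  have hT : β.IsTri A r u := ⟨hu, hr, fun i hi => (β.χ01 i).resolve_right fun h =>
    hs (Or.inl ⟨(isSpecial_of_mem hA hu hr hi h).1, ⟨r, hr⟩, i, hi, h⟩)⟩
  rw [nT_eq hA hk h0 hη he ⟨u, hT, hγ 0⟩, nT_eq hA hk h0 hη he ⟨u, hT, hγ 1⟩]
  have hK := A.one_le_K
  exact nn_flat hA hT (by nlinarith) t γ hγ

open Classical in
lemma nT_point (hk : ∀ r s, r < s → 0 < kap A β r s) (h0 : 0 < η) (hη : η ≤ 1)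
    (he : 8 * A.K * η ≤ 1) {v : Finset ι} (hv : A.IsFlat v) {r : Fin 3} (hr : β.a r ∈ v) {j : ι}
    (hj : j ∈ v) (h1 : β.χ j = 1) {x : E3} (hx : x ∈ A.V v η) :
    β.nT A η x = if x ∈ A.V {β.a r} η then β.nn A r x else 0 := by
  split_ifs with h
  · exact nT_eq hA hk h0 hη he ⟨_, isTri_single r, h⟩
  refine nT_eq_zero fun s ⟨u, hu, hxu⟩ => ?_
  have hns : ∀ u', j ∈ u' → ¬ β.IsTri A s u' := fun u' h h' => by
    have := h'.2.2 j h
    omega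
  rcases V_comparable hη hx hxu with h' | h'
  · exact hns u (h' hj) hu
  · rcases hu.1.eq_or_single hv h' with e | ⟨i, e⟩
    · exact hns u (e ▸ hj) hu
    · have hi : i = β.a s := by
        have := hu.2.1
        rw [e, Finset.mem_singleton] at this
        exact this.symm
      have hrs : s = r := by
        by_contra hne
        have := eq_corner hA hne hv (h' hu.2.1) hr
        rw [this] at hj
        simp only [Finset.mem_insert, Finset.mem_singleton] at hj
        rcases hj with hj | hj <;> exact a_ne h1 hj
      rw [e, hi, hrs] at hxu
      exact h hxu

lemma isFlat_pair {k : ι} (h0 : β.χ k = 0) (hk : ∀ r, k ≠ β.a r) (r : Fin 3) :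
    A.IsFlat {k, β.a r} :=
  Or.inr (Or.inr ⟨k, β.a r, hk r, rfl, hA ▸ (β.line k h0 hk).1 r⟩)

open Classical in
lemma nT_line (hkap : ∀ r s, r < s → 0 < kap A β r s) (h0 : 0 < η) (hη : η ≤ 1)
    (he : 8 * A.K * η ≤ 1) {k : ι} (hk0 : β.χ k = 0) (hk : ∀ r, k ≠ β.a r) {x : E3}
    (hx : x ∈ A.V {k} η) :
    β.nT A η x = ∑ r, if x ∈ A.V {k, β.a r} η then β.nn A r x else 0 := by
  have hpf := isFlat_pair hA hk0 hk
  have hT : ∀ r, β.IsTri A r {k, β.a r} := fun r => ⟨hpf r, by simp, fun i hi => by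
    rcases Finset.mem_insert.1 hi with rfl | hi
    · exact hk0
    · rw [Finset.mem_singleton.1 hi, β.χa]⟩
  have hmem : ∀ r, x ∈ β.side A η r → x ∈ A.V {k, β.a r} η := by
    rintro r ⟨u, hu, hxu⟩
    have hku : k ∈ u := by
      rcases V_comparable hη hx hxu with h | h
      · exact h (by simp)
      · exact absurd (Finset.mem_singleton.1 (h hu.2.1)) (hk r).symm
    rwa [hu.1.eq_of_two (hpf r) (hk r) hku hu.2.1 (by simp) (by simp)] at hxu
  by_cases hr : ∃ r, x ∈ A.V {k, β.a r} η
  · obtain ⟨r, hr⟩ := hr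
    rw [Finset.sum_eq_single_of_mem r (Finset.mem_univ r), if_pos hr,
      nT_eq hA hkap h0 hη he ⟨_, hT r, hr⟩]
    intro s _ hsr
    refine if_neg fun hs => ?_
    have h3 : ∀ {r}, ({k} : Finset ι) ≠ {k, β.a r} := fun {r} e => by
      have : β.a r ∈ ({k} : Finset ι) := by rw [e]; simp
      exact hk r (Finset.mem_singleton.1 this).symm
    rcases eq_of_three (isFlat_single k) (hpf r) (hpf s) hη hx hr hs with e | e | e
    · exact h3 e
    · exact h3 e
    · have : β.a r ∈ ({k, β.a s} : Finset ι) := by rw [← e]; simp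
      rcases Finset.mem_insert.1 this with h | h
      · exact hk r h.symm
      · exact hsr (β.inj (Finset.mem_singleton.1 h)).symm
  · push Not at hr
    rw [Finset.sum_eq_zero fun r _ => if_neg (hr r)]
    exact nT_eq_zero fun r h => hr r (hmem r h)

lemma exists_special (hk : ∀ r s, r < s → 0 < kap A β r s) {η₁ : ℝ} (h0 : 0 < η) (h1 : η₁ ≤ 1)
    (h8 : 8 * A.K ^ 2 * η₁ ≤ 1) (hle : 8 * A.K ^ 2 * η ≤ η₁) {v : Finset ι} (hv : β.IsSpecial v)
    {t : ι → ℝ} (ht : ∑ i, t i = 0) (htv : ∑ i ∈ v, t i = 0) :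
    ∃ E : C(I, E3) → C(ℝ, ℂ), IsCrossed (A.N η) (A.psi β.χ t) E ∧
      (∀ u, A.IsFlat u → u ≠ v → ∀ γ : C(I, E3), (∀ r, γ r ∈ A.V u η) → E γ = 0) ∧
      ∀ γ : C(I, E3), (∀ r, γ r ∈ A.V v η) →
        E γ 0 = -principal (fun γ => A.psi β.χ t γ 0) (β.nT A η) γ := by
  classical
  have hK := A.one_le_K
  have hη₁ : 0 < η₁ := lt_of_lt_of_le (by positivity) hle
  have hηle : η ≤ η₁ := (le_mul_of_one_le_left h0.le (by nlinarith)).trans hle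
  have hK1 := (eight_K_sq hη₁.le h8).1
  have h8K : 8 * A.K * η ≤ 1 := by nlinarith
  have hη1 := hηle.trans h1
  have hsumc : ∀ J : Finset ι, Even (∑ j ∈ J, β.χ j) → ∑ j ∈ J, t j = 0 → Balanced β.χ t J := by
    intro J he hJ
    have e1 := Finset.sum_add_sum_compl J β.χ
    have e2 := Finset.sum_add_sum_compl J t
    refine ⟨he, ?_, hJ, by linarith⟩
    have := β.even
    rw [← e1] at this
    exact (Int.even_add.1 this).1 he
  rcases hv with ⟨hvT, ⟨r, hr⟩, j, hj, hj1⟩ | ⟨k, rfl, hk0, hka⟩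
  · have hvf : A.IsFlat v := Or.inr (Or.inl (by rw [hA]; exact hvT))
    obtain ⟨-, k, hk1, hkj, hveq⟩ := isSpecial_of_mem hA hvf hr hj hj1
    obtain ⟨n, hn, -⟩ := hvf.exists_notMem ∅ (by simp)
    obtain ⟨W, WJ, W0, W1, -, -, -⟩ := exists_wall_point hη₁.le h8 (by rw [hA]; exact hvT) hr hj
      (a_ne hj1).symm hn (c := 1) (by simp)
    have hsv : ∑ i ∈ v, β.χ i = 2 := by
      rw [hveq, Finset.sum_insert (by simp [(a_ne hj1).symm, (a_ne hk1).symm]),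
        Finset.sum_insert (by simp [hkj.symm]), Finset.sum_singleton, β.χa, hj1, hk1]
      norm_num
    have hne : ∀ i, ({i} : Finset ι) ≠ v := fun i h => by
      have := A.card_T v (by rw [hA]; exact hvT)
      rw [← h] at this; simp at this
    obtain ⟨E, hE, hz, hF⟩ := W.exists_class_of_section (χ := β.χ) (t := t) h1 hηle hvf
      (isFlat_single _) (isFlat_single _) (hne _) (hne _)
      (fun h => a_ne hj1 (Finset.singleton_inj.1 h).symm)
      (hsumc _ (by rw [WJ, hsv]; exact even_two) (by rw [WJ, htv]))
      (uu_zero_of_even (by rw [W0, Finset.sum_singleton, β.χa]; exact Even.zero))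
      (uu_zero_ne_of_odd (by
        have := Finset.sum_sdiff (f := β.χ) W.sub1
        rw [W1, WJ, hsv, Finset.sum_singleton, hj1] at this
        rw [W1, WJ]
        exact ⟨0, by linarith⟩))
      (fun x y hx hx' hy hy' => by
        obtain ⟨γ, g0, g1, hγ⟩ := flag_joined hvf hr (hne _).symm (by linarith) hx' hx hy' hy
        exact ⟨γ, g0, g1, fun s => ⟨V_mono hle (hγ s).2, V_mono hle (hγ s).1⟩⟩)
      (nn_flat hA (isTri_single r) (by linarith) t)
    refine ⟨E, hE, hz, fun γ hγ => ?_⟩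
    rw [hF γ hγ, principal, principal, nT_point hA hk h0 hη1 h8K hvf hr hj hj1 (hγ 0),
      nT_point hA hk h0 hη1 h8K hvf hr hj hj1 (hγ 1)]
  · obtain ⟨-, j, hj1, hjT⟩ := β.line k hk0 hka
    have hkj : j ≠ k := fun h => by rw [h] at hj1; omega
    have hpf := isFlat_pair hA hk0 hka
    have hpj : A.IsFlat {k, j} := Or.inr (Or.inr ⟨k, j, hkj.symm, rfl, hA ▸ hjT⟩)
    have hne : ∀ i, i ≠ k → ({k, i} : Finset ι) ≠ {k} := fun i hi h => by
      have : i ∈ ({k} : Finset ι) := by rw [← h]; simp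
      exact hi (Finset.mem_singleton.1 this)
    have herase : ∀ i, i ≠ k → ({k, i} : Finset ι).erase k = {i} := fun i hi => by
      rw [Finset.erase_insert (by simpa using hi.symm)]
    have h01 : ∀ r, ({k, β.a r} : Finset ι) ≠ {k, j} := fun r h => by
      have : j ∈ ({k, β.a r} : Finset ι) := by rw [h]; simp
      rcases Finset.mem_insert.1 this with h | h
      · exact hkj h
      · exact a_ne hj1 (Finset.mem_singleton.1 h)
    have hJs : Even (∑ i ∈ ({k}ᶜ : Finset ι), β.χ i) := by
      have e1 := Finset.sum_add_sum_compl {k} β.χ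
      rw [Finset.sum_singleton, hk0, zero_add] at e1
      rw [e1]; exact β.even
    have key : ∀ r, ∃ E : C(I, E3) → C(ℝ, ℂ), IsCrossed (A.N η) (A.psi β.χ t) E ∧
        (∀ u, A.IsFlat u → u ≠ {k} → ∀ γ : C(I, E3), (∀ r, γ r ∈ A.V u η) → E γ = 0) ∧
        ∀ γ : C(I, E3), (∀ r, γ r ∈ A.V {k} η) → E γ 0 = -principal (fun γ => A.psi β.χ t γ 0)
          (fun x => if x ∈ A.V {k, β.a r} η then β.nn A r x else 0) γ := by
      intro r
      have hTr : β.IsTri A r {k, β.a r} := ⟨hpf r, by simp, fun i hi => by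
        rcases Finset.mem_insert.1 hi with rfl | hi
        · exact hk0
        · rw [Finset.mem_singleton.1 hi, β.χa]⟩
      obtain ⟨W, WJ, W0, W1, -, -, -⟩ := exists_wall_line hη₁.le h8 (hpf r) hpj (h01 r)
        (i := k) (a := β.a r) (b := j) (by simp) (by simp) (by simp) (hka r).symm (by simp) hkj
        (c := 1) (by simp)
      rw [herase _ (hka r).symm] at W0
      rw [herase _ hkj] at W1
      refine W.exists_class_of_section h1 hηle (isFlat_single k) (hpf r) hpj
        (hne _ (hka r).symm) (hne _ hkj) (h01 r) (hsumc _ (by rw [WJ]; exact hJs) (by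
          have e1 := Finset.sum_add_sum_compl {k} t
          rw [htv, ht, zero_add] at e1
          rw [WJ, e1]))
        (uu_zero_of_even (by rw [W0, Finset.sum_singleton, β.χa]; exact Even.zero))
        (uu_zero_ne_of_odd (by
          have := Finset.sum_sdiff (f := β.χ) W.sub1
          have hs := hJs
          rw [← WJ, ← this, W1, Finset.sum_singleton, hj1] at hs
          rw [W1]
          exact (Int.even_add_one.1 hs |> Int.not_even_iff_odd.1)))
        (fun x y hx hx' hy hy' => by
          obtain ⟨γ, g0, g1, hγ⟩ := flag_joined (hpf r) (by simp) (hne _ (hka r).symm)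
            (by linarith) hx hx' hy hy'
          exact ⟨γ, g0, g1, fun s => ⟨V_mono hle (hγ s).1, V_mono hle (hγ s).2⟩⟩)
        (nn_flat hA hTr (by linarith) t)
    choose E hE hz hF using key
    refine ⟨fun γ => ∑ r, E r γ, IsCrossed.sum fun r _ => hE r, fun u hu huk γ hγ =>
      Finset.sum_eq_zero fun r _ => hz r u hu huk γ hγ, fun γ hγ => ?_⟩
    rw [ContinuousMap.sum_apply, Finset.sum_congr rfl fun r _ => hF r γ hγ, principal,
      nT_line hA hk h0 hη1 h8K hk0 hka (hγ 0), nT_line hA hk h0 hη1 h8K hk0 hka (hγ 1),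
      Finset.sum_neg_distrib, Finset.mul_sum, ← Finset.sum_sub_distrib]
    rfl

end BlockData

end

section

open unitInterval Topology
open Filter (Tendsto Eventually eventually_all)

/-! ### Limits of principal crossed homomorphisms -/

namespace Arr

variable {ι : Type*} [Fintype ι] [DecidableEq ι] {A : Arr ι} {χ χ' : ι → ℤ} {t : ι → ℝ}

lemma exists_mem_flag {w : Finset ι} (hw : A.IsFlat w) {i : ι} (hi : i ∈ w) {e : ℝ} (h0 : 0 < e) :
    ∃ x ∈ A.V {i} e, x ∈ A.V w e := by
  by_cases h : ∃ m ∈ w, m ≠ i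
  · obtain ⟨m, hm, hmi⟩ := h
    obtain ⟨n, hn, -⟩ := hw.exists_notMem ∅ (by simp)
    obtain ⟨x, hx, hx', -⟩ := exists_flag hw hi hm hmi.symm hn h0
    exact ⟨x, hx, hx'⟩
  · push Not at h
    rw [Finset.eq_singleton_iff_unique_mem.2 ⟨hi, h⟩]
    obtain ⟨x, hx⟩ := A.exists_mem_V_single i h0
    exact ⟨x, hx, hx⟩

/-- Away from a flat everything can be joined to a line. -/
lemma joinedIn_line {v : Finset ι} {j : ι} (hj : j ∉ v) {e : ℝ} (h0 : 0 < e)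
    (he : 8 * A.K * e ≤ 1) {u : Finset ι} (hu : A.IsFlat u) (huv : u ≠ v) {x : E3}
    (hx : x ∈ A.V u e) : ∃ y ∈ A.V {j} e,
      JoinedIn (⋃ s ∈ {s | A.IsFlat s ∧ s ≠ v}, A.V s (4 * e)) x y := by
  have hsub : ∀ w, A.IsFlat w → w ≠ v → A.V w (4 * e) ⊆
      ⋃ s ∈ {s | A.IsFlat s ∧ s ≠ v}, A.V s (4 * e) := fun w hw hwv => by
    intro y hy
    simp only [Set.mem_iUnion]
    exact ⟨w, ⟨hw, hwv⟩, hy⟩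
  have hJ : ∀ w, A.IsFlat w → w ≠ v → ∀ y ∈ A.V w e, ∀ z ∈ A.V w e,
      JoinedIn (⋃ s ∈ {s | A.IsFlat s ∧ s ≠ v}, A.V s (4 * e)) y z := fun w hw hwv y hy z hz =>
    (hw.joinedIn h0 he hy hz).mono (hsub w hw hwv)
  obtain ⟨i, hi, hiv⟩ : ∃ i ∈ u, {i} ≠ v := by
    by_contra hcon
    push Not at hcon
    obtain ⟨i, hi⟩ := hu.nonempty
    refine huv ?_
    rw [← hcon i hi]
    exact Finset.eq_singleton_iff_unique_mem.2 ⟨hi, fun k hk => by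
      have := (hcon k hk).trans (hcon i hi).symm
      exact Finset.singleton_inj.1 this⟩
  obtain ⟨x₁, hx₁, hx₁'⟩ := exists_mem_flag hu hi h0
  have j1 := hJ u hu huv x hx x₁ hx₁'
  by_cases hij : i = j
  · exact ⟨x₁, hij ▸ hx₁, j1⟩
  obtain ⟨w, hw, hiw, hjw⟩ := exists_flat (A := A) hij
  have hwv : w ≠ v := fun h => hj (h ▸ hjw)
  obtain ⟨x₂, hx₂, hx₂'⟩ := exists_mem_flag hw hiw h0
  obtain ⟨x₃, hx₃, hx₃'⟩ := exists_mem_flag hw hjw h0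
  exact ⟨x₃, hx₃, (j1.trans (hJ _ (isFlat_single i) hiv _ hx₁ _ hx₂)).trans
    (hJ w hw hwv _ hx₂' _ hx₃')⟩

variable (A) in
lemma exists_d_ne (j : ι) : ∃ a b, A.d j a b ≠ 0 := by
  obtain ⟨a, ha, -⟩ := (isFlat_single (A := A) j).exists_notMem ∅ (by simp)
  have haj : j ≠ a := fun h => ha (by simp [h])
  obtain ⟨w, hw, hjw, haw⟩ := exists_flat (A := A) haj
  obtain ⟨b, hb, -⟩ := hw.exists_notMem ∅ (by simp)
  exact ⟨a, b, fun h => hb ((hw.d_eq_zero_iff hjw haw haj b).1 h)⟩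

/-- Principality persists in the limit `ε → 0`. -/
theorem exists_principal_zero {v : Finset ι}
    (hgood : ∀ ε ≠ 0, ∀ u, A.IsFlat u → u ≠ v → A.Good χ t ε u) {j : ι} (hj : Odd (χ j))
    (hjv : j ∉ v) {e : ℝ} (h0 : 0 < e) (he : 512 * A.K * e ≤ 1) {L : C(I, E3) → C(ℝ, ℂ)}
    (hL : IsCrossed (A.N (64 * e)) (A.psi χ t) L) :
    ∃ m : E3 → ℂ, ∀ u, A.IsFlat u → u ≠ v → ∀ γ : C(I, E3), (∀ s, γ s ∈ A.V u e) →
      L γ 0 = principal (fun γ => A.psi χ t γ 0) m γ := by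
  set F : Set (Finset ι) := {s | A.IsFlat s ∧ s ≠ v}
  have hm : ∀ ε : ℝ, ε ≠ 0 → ∃ m : E3 → ℂ, ∀ γ : C(I, E3), (∀ r, γ r ∈ ⋃ s ∈ F, A.V s (4 * e)) →
      L γ ε = principal (fun γ => A.psi χ t γ ε) m γ := fun ε hε =>
    exists_principal (F := F) (fun s hs => hgood ε hε s hs.1 hs.2) (by positivity) (by linarith)
      ((isCrossed_eval hL ε).mono (by
        intro x hx
        simp only [Set.mem_iUnion] at hx
        obtain ⟨s, hs, hx⟩ := hx
        exact V_subset_N hs.1 (V_mono (by linarith) hx)))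
  choose! m hm using hm
  have hjoin : ∀ x, (∃ u, A.IsFlat u ∧ u ≠ v ∧ x ∈ A.V u e) → ∃ γ : C(I, E3), γ 0 = x ∧
      γ 1 ∈ A.V {j} e ∧ ∀ r, γ r ∈ ⋃ s ∈ F, A.V s (4 * e) := by
    rintro x ⟨u, hu, huv, hx⟩
    obtain ⟨y, hy, γ, hγ⟩ := joinedIn_line hjv h0 (by linarith [A.one_le_K]) hu huv hx
    exact ⟨γ.toContinuousMap, γ.source, by rw [show γ.toContinuousMap 1 = y from γ.target]; exact hy,
      hγ⟩
  choose! p hp0 hp1 hp using hjoin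
  obtain ⟨a, b, hab⟩ := A.exists_d_ne j
  have hP := isPiece_line hab
  have h8 : 8 * A.K * e ≤ 1 := by linarith [A.one_le_K]
  have hjF : ({j} : Finset ι) ∈ F := ⟨isFlat_single j, fun h => hjv (h ▸ by simp)⟩
  set lo : E3 → C(I, E3) := fun x => loop (A.rk j a b) (p x 1)
  let M : E3 → ℝ → ℂ := fun x ε =>
    L (p x) ε + A.psi χ t (p x) ε * (L (lo x) ε / (1 - uu χ t {j} ε))
  have hu0 : 1 - uu χ t {j} 0 ≠ 0 :=
    sub_ne_zero.2 (uu_zero_ne_of_odd (by rwa [Finset.sum_singleton])).symm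
  have hM : ∀ x, ContinuousAt (M x) 0 := fun x => by
    refine (L (p x)).continuous.continuousAt.add ((A.psi χ t (p x)).continuous.continuousAt.mul
      ((L (lo x)).continuous.continuousAt.div ?_ hu0))
    exact continuousAt_const.sub (uu χ t {j}).continuous.continuousAt
  have hev : ∀ᶠ ε in 𝓝[≠] (0 : ℝ), 1 - uu χ t {j} ε ≠ 0 := Filter.Eventually.filter_mono
    nhdsWithin_le_nhds ((continuousAt_const.sub (uu χ t {j}).continuous.continuousAt).eventually_ne hu0)
  have key : ∀ ε ≠ 0, 1 - uu χ t {j} ε ≠ 0 → ∀ x, (∃ u, A.IsFlat u ∧ u ≠ v ∧ x ∈ A.V u e) →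
      m ε x = M x ε := by
    intro ε hε hu x hx
    have e1 := hm ε hε (p x) (hp x hx)
    have e2 := hm ε hε (lo x) fun r => by
      simp only [Set.mem_iUnion]
      exact ⟨_, hjF, loop_mem hP h0.le h8 (hp1 x hx) (hp1 x hx) r⟩
    rw [principal, hp0 x hx] at e1
    simp only [principal, lo, loop_zero, loop_one, hP.psi_loop h8 (hp1 x hx), ← uu_apply] at e2
    simp only [M, lo, e1, e2]
    field_simp
    ring
  refine ⟨fun x => M x 0, fun u hu huv γ hγ => ?_⟩
  have hx : ∀ r, ∃ u, A.IsFlat u ∧ u ≠ v ∧ γ r ∈ A.V u e := fun r => ⟨u, hu, huv, hγ r⟩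
  have c1 : Tendsto (fun ε => L γ ε) (𝓝[≠] 0) (𝓝 (L γ 0)) :=
    (L γ).continuous.continuousAt.tendsto.mono_left nhdsWithin_le_nhds
  have c2 : Tendsto (fun ε => M (γ 0) ε - A.psi χ t γ ε * M (γ 1) ε) (𝓝[≠] 0)
      (𝓝 (M (γ 0) 0 - A.psi χ t γ 0 * M (γ 1) 0)) :=
    ((hM _).sub ((A.psi χ t γ).continuous.continuousAt.mul (hM _))).tendsto.mono_left
      nhdsWithin_le_nhds
  refine tendsto_nhds_unique c1 (c2.congr' ?_)
  filter_upwards [hev, self_mem_nhdsWithin] with ε h1 h2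
  rw [← key ε h2 h1 _ (hx 0), ← key ε h2 h1 _ (hx 1), hm ε h2 γ fun r => ?_, principal]
  simp only [Set.mem_iUnion]
  exact ⟨u, ⟨hu, huv⟩, V_mono (by linarith) (hγ r)⟩

/-- Characters with the same parity are gauge equivalent. -/
lemma exists_gauge (h : ∀ j, 2 ∣ χ' j - χ j) : ∃ G : E3 → ℂ, (∀ x, G x ≠ 0) ∧
    ∀ γ : C(I, E3), (∀ s, γ s ∈ A.M) → G (γ 0) * A.psi χ' 0 γ 0 = A.psi χ 0 γ 0 * G (γ 1) := by
  choose z hz using h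
  refine ⟨fun x => Complex.exp (∑ j, z j * Complex.arg (A.f j x) * Complex.I),
    fun x => Complex.exp_ne_zero _, fun γ hγ => ?_⟩
  have hn : ∀ j, ∃ n : ℤ, Theta (A.f j) γ =
      Complex.arg (A.f j (γ 1)) - Complex.arg (A.f j (γ 0)) + 2 * Real.pi * n := fun j => by
    obtain ⟨n, hn⟩ := exists_int_ang ⟨fun s => A.f j (γ s), by fun_prop⟩ fun s => hγ s j
    change Theta (A.f j) γ - _ = _ at hn
    simp only [ContinuousMap.coe_mk] at hn
    exact ⟨n, by linarith⟩
  choose n hn using hn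
  rw [psi, psi, ex_apply, ex_apply, ← Complex.exp_add, ← Complex.exp_add,
    Complex.exp_eq_exp_iff_exists_int]
  refine ⟨∑ j, z j * n j, ?_⟩
  push_cast
  rw [Finset.sum_mul, ← Finset.sum_add_distrib, ← Finset.sum_add_distrib, ← Finset.sum_add_distrib]
  refine Finset.sum_congr rfl fun j _ => ?_
  have hc : (χ' j : ℂ) = χ j + 2 * z j := by
    have := hz j
    have h2 : χ' j = χ j + 2 * z j := by linarith
    rw [h2]; push_cast; ring
  have hpi : (Real.pi : ℂ) ≠ 0 := by exact_mod_cast Real.pi_ne_zero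
  rw [hc, hn j]
  push_cast
  field_simp
  simp
  ring

/-- Flat functions on the connected neighbourhood of a flat. -/
lemma eq_zero_of_joined {u : Finset ι} (hu : A.IsFlat u) {e : ℝ} (h0 : 0 < e)
    (he : 8 * A.K * e ≤ 1) {ψ : C(I, E3) → ℂ} {m : E3 → ℂ}
    (hm : ∀ γ : C(I, E3), (∀ s, γ s ∈ A.V u (4 * e)) → m (γ 0) = ψ γ * m (γ 1)) {x y : E3}
    (hx : x ∈ A.V u e) (hy : y ∈ A.V u e) (h : m y = 0) : m x = 0 := by
  obtain ⟨γ, hγ⟩ := hu.joinedIn h0 he hx hy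
  have e1 := hm γ.toContinuousMap hγ
  have g0 : γ.toContinuousMap 0 = x := γ.source
  have g1 : γ.toContinuousMap 1 = y := γ.target
  rw [g0, g1, h, mul_zero] at e1
  exact e1

lemma good_zero_of_odd {j : ι} (hj : Odd (χ j)) : A.Good χ t 0 {j} := by
  obtain ⟨a, b, hab⟩ := A.exists_d_ne j
  exact ⟨_, _, isPiece_line hab, uu_zero_ne_of_odd (by rwa [Finset.sum_singleton])⟩

/-- Near a line with odd `χ` flat functions vanish. -/
lemma eq_zero_of_odd {j : ι} (hj : Odd (χ j)) {e : ℝ} (h0 : 0 < e) (he : 8 * A.K * e ≤ 1)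
    {m : E3 → ℂ} (hm : ∀ γ : C(I, E3), (∀ s, γ s ∈ A.V {j} (4 * e)) →
      m (γ 0) = A.psi χ t γ 0 * m (γ 1)) {x : E3} (hx : x ∈ A.V {j} e) : m x = 0 :=
  (good_zero_of_odd hj).eq_zero (χ := χ) (t := t) h0.le he hx hx fun γ hγ _ =>
    sub_eq_zero.2 (hm γ hγ)

end Arr

/-! ### The obstruction -/

namespace BlockData

open Arr

variable {ι : Type*} [Fintype ι] [DecidableEq ι] {A B : Arr ι} {T : Finset (Finset ι)}
  {β : BlockData T}

lemma not_isSpecial_single {j : ι} (hj : β.χ j = 1) : ¬ β.IsSpecial {j} := by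
  rintro (⟨-, ⟨r, hr⟩, -⟩ | ⟨k, hk, h0, -⟩)
  · exact a_ne hj (Finset.mem_singleton.1 hr).symm
  · rw [← Finset.singleton_inj.1 hk] at h0; omega

lemma IsTri.not_isSpecial {r : Fin 3} {u : Finset ι} (h : β.IsTri A r u) : ¬ β.IsSpecial u := by
  rintro (⟨-, -, j, hj, h1⟩ | ⟨k, hk, -, h1⟩)
  · have := h.2.2 j hj; omega
  · have := h.2.1
    rw [hk, Finset.mem_singleton] at this
    exact h1 r this.symm

lemma IsSpecial.isMain (hA : A.T = T) {v : Finset ι} (h : β.IsSpecial v) : A.IsMain v := by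
  rcases h with h | ⟨k, hk, -⟩
  · exact Or.inr (by rw [hA]; exact h.1)
  · exact Or.inl ⟨k, hk⟩

lemma IsSpecial.image {v : Finset ι} (h : β.IsSpecial v) {π : Equiv.Perm ι}
    (hT : ∀ p ∈ T, p.image π ∈ T) (hχ : ∀ i, β.χ (π i) = β.χ i)
    (ha : ∀ r, ∃ s, π (β.a r) = β.a s) : β.IsSpecial (v.image π) := by
  rcases h with ⟨hv, ⟨r, hr⟩, j, hj, h1⟩ | ⟨k, rfl, h0, hk⟩
  · obtain ⟨s, hs⟩ := ha r
    exact Or.inl ⟨hT v hv, ⟨s, hs ▸ Finset.mem_image_of_mem π hr⟩, π j,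
      Finset.mem_image_of_mem π hj, by rw [hχ, h1]⟩
  · refine Or.inr ⟨π k, by simp, by rw [hχ, h0], fun r hr => ?_⟩
    choose f hf using ha
    have hinj : Function.Injective f := fun r s h => β.inj (π.injective (by rw [hf, hf, h]))
    obtain ⟨s, rfl⟩ := (Finite.injective_iff_surjective.1 hinj) r
    rw [← hf] at hr
    exact hk s (π.injective hr)

/-- The special crossed homomorphisms add up to a principal one, and are not principal. -/
lemma exists_family (hA : A.T = T) (hc : 10 ≤ Fintype.card ι)
    (hk : ∀ r s, r < s → 0 < kap A β r s) : ∃ (η : ℝ) (n : E3 → ℂ) (t : Finset ι → ι → ℝ)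
      (E : Finset ι → C(I, E3) → C(ℝ, ℂ)), 0 < η ∧
      (∀ v, β.IsSpecial v → ∑ i, t v i = 0 ∧ ∀ w, A.IsMain w → w ≠ v → ∑ i ∈ w, t v i ≠ 0) ∧
      (∀ v, β.IsSpecial v → IsCrossed (A.N η) (A.psi β.χ (t v)) (E v)) ∧
      (∀ γ : C(I, E3), (∀ s, γ s ∈ A.N η) → (open Classical in
        ∑ v ∈ Finset.univ.filter β.IsSpecial, E v γ 0) =
          -principal (fun γ => A.psi β.χ 0 γ 0) n γ) ∧
      ∃ p, β.IsSpecial p ∧ p ∈ T ∧ (∀ i ∈ p, β.χ i = 1 ∨ ∃ r, i = β.a r) ∧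
        ∀ η' > 0, ¬ ∃ q : E3 → ℂ, ∀ γ : C(I, E3), (∀ s, γ s ∈ A.N η') →
          E p γ 0 = principal (fun γ => A.psi β.χ 0 γ 0) q γ := by
  classical
  have hK := A.one_le_K
  obtain ⟨η₁, h0₁, h1, h8, -⟩ := A.exists_radius
  obtain ⟨η, h0, hle⟩ : ∃ η : ℝ, 0 < η ∧ 8 * A.K ^ 2 * η ≤ η₁ :=
    ⟨η₁ / (8 * A.K ^ 2), by positivity, (mul_div_cancel₀ _ (by positivity)).le⟩
  have hηle : η ≤ η₁ := (le_mul_of_one_le_left h0.le (by nlinarith)).trans hle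
  have hη1 := hηle.trans h1
  have h8K : 8 * A.K * η ≤ 1 := by nlinarith
  have key : ∀ v, β.IsSpecial v → ∃ (t : ι → ℝ) (E : C(I, E3) → C(ℝ, ℂ)), (∑ i, t i = 0 ∧
      ∀ w, A.IsMain w → w ≠ v → ∑ i ∈ w, t i ≠ 0) ∧ IsCrossed (A.N η) (A.psi β.χ t) E ∧
      (∀ u, A.IsFlat u → u ≠ v → ∀ γ : C(I, E3), (∀ r, γ r ∈ A.V u η) → E γ = 0) ∧
      ∀ γ : C(I, E3), (∀ r, γ r ∈ A.V v η) →
        E γ 0 = -principal (fun γ => A.psi β.χ 0 γ 0) (β.nT A η) γ := by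
    intro v hv
    obtain ⟨t, -, ht, htv, hw, -⟩ := exists_weights (by omega) (fun _ _ => 0)
      (hv.isMain hA).flat.card_le (Submodule.zero_mem (wt v)) Filter.univ_mem
    obtain ⟨E, hE, hz, hF⟩ := exists_special hA hk h0 h1 h8 hle hv ht htv
    refine ⟨t, E, ⟨ht, fun w hw' => hw w hw'.flat.nonempty hw'.flat.card_le⟩, hE, hz, fun γ hγ => ?_⟩
    rw [hF γ hγ, principal, principal, psi_zero]
  choose! t E ht hE hz hF using key
  refine ⟨η, β.nT A η, t, E, h0, ht, hE, ?_, ?_⟩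
  · have hcoc := isCocycle_psi_eval (A := A) β.χ 0 0
    rw [← iUnion_flat]
    have h1 : IsCrossed (⋃ s : {s : Finset ι // A.IsFlat s}, A.V s.1 η)
        (fun γ => A.psi β.χ 0 γ 0) fun γ => ∑ v ∈ Finset.univ.filter β.IsSpecial, E v γ 0 := by
      rw [iUnion_flat]
      refine IsCrossed.sum fun v hv => ?_
      have := isCrossed_eval (hE v (Finset.mem_filter.1 hv).2) 0
      simpa only [psi_zero (t := t v)] using this
    have h2 : IsCrossed (⋃ s : {s : Finset ι // A.IsFlat s}, A.V s.1 η)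
        (fun γ => A.psi β.χ 0 γ 0) fun γ => 0 - principal (fun γ => A.psi β.χ 0 γ 0) (β.nT A η) γ := by
      rw [iUnion_flat]
      exact IsCrossed.zero.sub (isCrossed_principal (hcoc.mono N_subset_M) _)
    intro γ hγ
    refine (IsCrossed.eq_of_cover (U := fun s : {s : Finset ι // A.IsFlat s} => A.V s.1 η)
      (fun s => isOpen_V s.1 η) h1 h2 ?_ γ hγ).trans (zero_sub _)
    intro u γ hγ
    by_cases hu : β.IsSpecial u.1
    · rw [Finset.sum_eq_single_of_mem u.1 (by simp [hu]), hF u.1 hu γ hγ, zero_sub]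
      intro v hv hvu
      rw [hz v (Finset.mem_filter.1 hv).2 u.1 u.2 hvu.symm γ hγ]; rfl
    · rw [Finset.sum_eq_zero fun v hv => ?_, principal,
        ← nT_flat hA hk h0 hη1 h8K u.2 hu 0 γ hγ, sub_self, sub_zero]
      have hv := (Finset.mem_filter.1 hv).2
      rw [hz v hv u.1 u.2 (fun h => hu (h ▸ hv)) γ hγ]; rfl
  obtain ⟨j₁, hj₁⟩ : ∃ j, β.χ j = 1 := by
    obtain ⟨j, hj⟩ := Finset.card_pos.1 (lt_of_lt_of_le (by norm_num) β.card)
    exact ⟨j, (Finset.mem_filter.1 hj).2⟩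
  obtain ⟨k₁, hk₁, hkj₁, hp⟩ := β.cover 0 j₁ hj₁
  obtain ⟨j₂, hj₂, hj₂'⟩ : ∃ j, β.χ j = 1 ∧ j ∉ ({j₁, k₁} : Finset ι) := by
    by_contra hcon
    push Not at hcon
    have := Finset.card_le_card (s := Finset.univ.filter (β.χ · = 1)) (t := {j₁, k₁})
      fun j hj => hcon j (Finset.mem_filter.1 hj).2
    have := this.trans Finset.card_le_two
    have := β.card
    omega
  obtain ⟨k₂, hk₂, -, hp₂⟩ := β.cover 0 j₂ hj₂
  set p : Finset ι := {β.a 0, j₁, k₁} with hpdef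
  set p₂ : Finset ι := {β.a 0, j₂, k₂} with hp2def
  have hpp : p₂ ≠ p := fun h => by
    have : j₂ ∈ p := by rw [← h]; simp [hp2def]
    rw [hpdef, Finset.mem_insert] at this
    exact this.elim (a_ne hj₂) hj₂'
  have hpf : A.IsFlat p := Or.inr (Or.inl (by rw [hA]; exact hp))
  have hpf₂ : A.IsFlat p₂ := Or.inr (Or.inl (by rw [hA]; exact hp₂))
  have hsp : β.IsSpecial p := Or.inl ⟨hp, ⟨0, by simp [hpdef]⟩, j₁, by simp [hpdef], hj₁⟩
  refine ⟨p, hsp, hp, fun i hi => ?_, ?_⟩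
  · simp only [hpdef, Finset.mem_insert, Finset.mem_singleton] at hi
    rcases hi with rfl | rfl | rfl
    · exact Or.inr ⟨0, rfl⟩
    · exact Or.inl hj₁
    · exact Or.inl hk₁
  rintro η' h0' ⟨q, hq⟩
  obtain ⟨e, he0, he, he'⟩ : ∃ e : ℝ, 0 < e ∧ 4 * e ≤ η ∧ 4 * e ≤ η' :=
    ⟨min η η' / 4, by positivity, by linarith [min_le_left η η'], by linarith [min_le_right η η']⟩
  have h8e : 8 * A.K * e ≤ 1 := by nlinarith
  have hflat : ∀ u, A.IsFlat u → u ≠ p → ∀ γ : C(I, E3), (∀ s, γ s ∈ A.V u (4 * e)) →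
      q (γ 0) = A.psi β.χ 0 γ 0 * q (γ 1) := fun u hu hup γ hγ => by
    have e1 := hq γ fun s => V_subset_N hu (V_mono he' (hγ s))
    rw [hz p hsp u hu hup γ fun s => V_mono he (hγ s), principal, ContinuousMap.zero_apply] at e1
    linear_combination -e1
  have hne : ∀ i, ({i} : Finset ι) ≠ p := fun i h => by
    have := A.card_T p (by rw [hA]; exact hp)
    rw [← h] at this; simp at this
  have hqj : ∀ j, β.χ j = 1 → ∀ x ∈ A.V {j} e, q x = 0 := fun j hj x hx =>
    eq_zero_of_odd (χ := β.χ) (t := 0) (by rw [hj]; exact odd_one) he0 h8e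
      (hflat _ (isFlat_single j) (hne j)) hx
  obtain ⟨x, hx, hx'⟩ := exists_mem_flag hpf₂ (i := j₂) (by simp [hp2def]) he0
  obtain ⟨y, hy, hy'⟩ := exists_mem_flag hpf₂ (i := β.a 0) (by simp [hp2def]) he0
  have hy0 := eq_zero_of_joined hpf₂ he0 h8e (hflat _ hpf₂ hpp) hy' hx' (hqj j₂ hj₂ x hx)
  obtain ⟨z, hz', hzp⟩ := exists_mem_flag hpf (i := j₁) (by simp [hpdef]) he0
  obtain ⟨w, hw, hwp⟩ := exists_mem_flag hpf (i := β.a 0) (by simp [hpdef]) he0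
  have hw0 := eq_zero_of_joined (isFlat_single _) he0 h8e
    (hflat _ (isFlat_single (β.a 0)) (hne _)) hw hy hy0
  have hqn : q w + β.nT A η w = 0 := by
    refine eq_zero_of_joined (m := fun x => q x + β.nT A η x) hpf he0 h8e
      (ψ := fun γ => A.psi β.χ 0 γ 0) (fun γ hγ => ?_) hwp hzp ?_
    · have e1 := hq γ fun s => V_subset_N hpf (V_mono he' (hγ s))
      rw [hF p hsp γ fun s => V_mono he (hγ s), principal, principal] at e1
      linear_combination -e1
    · rw [hqj j₁ hj₁ z hz', nT_zero hη1 (isFlat_single j₁) (not_isSpecial_single hj₁)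
        (fun r h => a_ne hj₁ (Finset.mem_singleton.1 h).symm) (V_mono (by linarith) hz'), add_zero]
  rw [hw0, zero_add, nT_eq hA hk h0 hη1 h8K ⟨_, isTri_single 0, V_mono (by linarith) hw⟩] at hqn
  exact nn_ne_zero _ _ hqn

/-- Cones over the complements of arrangements with positive and negative holonomy around the
triangle are not homeomorphic. -/
theorem isEmpty_coneIso (hA : A.T = T) (hB : B.T = T) (hc : 13 ≤ Fintype.card ι)
    (hd : ∃ p₀ ∈ T, ∀ i ∉ p₀, ∃ p ∈ T, ∃ p' ∈ T, p ≠ p' ∧ i ∈ p ∧ i ∈ p')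
    (hkA : ∀ r s, r < s → 0 < kap A β r s) (hkB : kap B β 0 1 * kap B β 1 2 * kap B β 0 2 < 0)
    (hπ : ∀ π : Equiv.Perm ι, (∀ p ∈ T, p.image π ∈ T) →
      (∀ i, β.χ (π i) = β.χ i) ∧ ∀ r, ∃ s, π (β.a r) = β.a s) : IsEmpty (ConeIso A B) := by
  classical
  refine ⟨fun h => ?_⟩
  obtain ⟨Y, c, hY⟩ := h.exists_Y
  obtain ⟨Y', c', hY'⟩ := h.symm.exists_Y
  have H : IsAngleMap h Y c := ⟨hY⟩
  obtain ⟨π, l, m, hl, hYπ, hT⟩ := exists_perm hc (hA.symm ▸ hd) H ⟨hY'⟩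
  rw [hA, hB] at hT
  obtain ⟨hχ, ha⟩ := hπ π hT
  obtain ⟨η, n, t, E, h0, ht, hE, hsum, p, hp, hpT, hpi, hnot⟩ := exists_family hA (by omega) hkA
  have hKB := B.one_le_K
  set χ' : ι → ℤ := fun j => ∑ i, β.χ i * Y i j with hχ'
  have hl2 : Odd l := by
    rcases Int.isUnit_iff.1 hl with rfl | rfl
    · exact odd_one
    · exact odd_neg_one
  have hpar : ∀ j, 2 ∣ χ' j - β.χ j := fun j => by
    obtain ⟨i, rfl⟩ := π.surjective j
    have e1 : χ' (π i) = l * β.χ i + m i * ∑ k, β.χ k := by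
      simp only [hχ', hYπ, mul_add, Finset.sum_add_distrib, Finset.mul_sum]
      congr 1
      · simp [mul_comm]
      · exact Finset.sum_congr rfl fun k _ => mul_comm _ _
    obtain ⟨z, hz⟩ := β.even
    obtain ⟨y, hy⟩ := hl2
    rw [e1, hχ, hz, hy]
    exact ⟨y * β.χ i + m i * z, by ring⟩
  have hodd : ∀ j, β.χ j = 1 → Odd (χ' j) := fun j hj => by
    obtain ⟨z, hz⟩ := hpar j
    exact ⟨z, by linarith⟩
  set t' : Finset ι → ι → ℝ := fun v j => ∑ i, t v i * Y i j with ht'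
  have htπ : ∀ v, β.IsSpecial v → ∀ i, t' v (π i) = l * t v i := fun v hv i => by
    have e1 : t' v (π i) = l * t v i + m i * ∑ k, t v k := by
      simp only [ht', hYπ, Int.cast_add, Int.cast_mul, mul_add, Finset.sum_add_distrib,
        Finset.mul_sum]
      congr 1
      · simp [mul_comm]
      · exact Finset.sum_congr rfl fun k _ => mul_comm _ _
    rw [e1, (ht v hv).1, mul_zero, add_zero]
  have hTinv : ∀ w, B.IsMain w → ∃ w', A.IsMain w' ∧ w = w'.image π := by
    rintro w (⟨i, rfl⟩ | hw)
    · exact ⟨{π.symm i}, Or.inl ⟨_, rfl⟩, by simp⟩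
    · rw [hB] at hw
      have hinj : Function.Injective fun q : T => (⟨q.1.image π, hT _ q.2⟩ : T) := fun q q' e => by
        have := congrArg Subtype.val e
        exact Subtype.ext (Finset.image_injective π.injective this)
      obtain ⟨q, hq⟩ := (Finite.injective_iff_surjective.1 hinj) ⟨w, hw⟩
      exact ⟨q.1, Or.inr (by rw [hA]; exact q.2), (congrArg Subtype.val hq).symm⟩
  have hgood : ∀ v, β.IsSpecial v → ∀ ε ≠ 0, ∀ u, B.IsFlat u → u ≠ v.image π →
      B.Good χ' (t' v) ε u := fun v hv ε hε u hu huv => by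
    refine good_of_sum_ne hε (fun w hw hwv => ?_) hu huv
    obtain ⟨w', hw', rfl⟩ := hTinv w hw
    rw [Finset.sum_image fun _ _ _ _ e => π.injective e, Finset.sum_congr rfl fun i _ => htπ v hv i,
      ← Finset.mul_sum]
    refine mul_ne_zero (by exact_mod_cast hl.ne_zero) ((ht v hv).2 w' hw' fun e => hwv (by rw [e]))
  obtain ⟨η₂, h0₂, hη₂⟩ := h.exists_N h0
  obtain ⟨e, he0, he1, he8, heη⟩ : ∃ e : ℝ, 0 < e ∧ e ≤ 1 ∧ 512 * B.K * e ≤ 1 ∧ 64 * e ≤ η₂ := by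
    refine ⟨min 1 η₂ / (512 * B.K), by positivity, ?_, ?_, ?_⟩
    · rw [div_le_one (by positivity)]
      linarith [min_le_left 1 η₂]
    · rw [mul_div_cancel₀ _ (by positivity)]
      exact min_le_left _ _
    · rw [mul_div_assoc', div_le_iff₀ (by positivity)]
      nlinarith [min_le_right 1 η₂]
  have hgN : ∀ x ∈ B.N (64 * e), h.g x ∈ A.N η := hη₂ _ heη
  set G : E3 → ℂ := fun x => ex β.χ 0 (fun i => -c i x) 0 with hG
  have hG0 : ∀ x, G x ≠ 0 := fun x => ex_ne_zero _ _ _ _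
  have hexz : ∀ v x, ex β.χ (t v) (fun i => -c i x) 0 = G x := fun v x => by simp [hG, ex_apply]
  have hGψ : ∀ γ : C(I, E3), (∀ s, γ s ∈ B.M) →
      G (γ 0) * A.psi β.χ 0 (push h.g γ) 0 = B.psi χ' 0 γ 0 * G (γ 1) := fun γ hγ => by
    have := congrArg (fun f : C(ℝ, ℂ) => f 0) (H.psi_push β.χ 0 hγ)
    simp only [ContinuousMap.mul_apply] at this
    rw [psi_zero (χ := fun j => ∑ i, β.χ i * Y i j)] at this
    exact this
  set L : Finset ι → C(I, E3) → C(ℝ, ℂ) := fun v γ =>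
    ex β.χ (t v) (fun i => -c i (γ 0)) * E v (push h.g γ) with hL
  have hLc : ∀ v, β.IsSpecial v → IsCrossed (B.N (64 * e)) (B.psi χ' (t' v)) (L v) := fun v hv =>
    ((hE v hv).pull (h.cont.mono N_subset_M) hgN).gauge
      (G := fun x => ex β.χ (t v) fun i => -c i x) fun γ hγ =>
        H.psi_push β.χ (t v) fun s => N_subset_M (hγ s)
  have hm : ∀ v, β.IsSpecial v → ∃ m : E3 → ℂ, ∀ u, B.IsFlat u → u ≠ v.image π → ∀ γ : C(I, E3),
      (∀ s, γ s ∈ B.V u e) → L v γ 0 = principal (fun γ => B.psi χ' 0 γ 0) m γ := fun v hv => by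
    obtain ⟨j, hj, hjv⟩ : ∃ j, β.χ j = 1 ∧ j ∉ v.image π := by
      by_contra hcon
      push Not at hcon
      have := Finset.card_le_card (s := Finset.univ.filter (β.χ · = 1)) (t := v.image π)
        fun j hj => hcon j (Finset.mem_filter.1 hj).2
      have := this.trans Finset.card_image_le
      have := (hv.isMain hA).flat.card_le
      have := β.card
      omega
    obtain ⟨m, hm⟩ := exists_principal_zero (hgood v hv) (hodd j hj) hjv he0 he8 (hLc v hv)
    exact ⟨m, fun u hu huv γ hγ => by rw [hm u hu huv γ hγ, principal, principal, psi_zero]⟩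
  choose! mb hmb using hm
  set S := Finset.univ.filter β.IsSpecial with hS
  have hSm : ∀ {v}, v ∈ S → β.IsSpecial v := fun hv => (Finset.mem_filter.1 hv).2
  set n' : E3 → ℂ := fun x => G x * n (h.g x) with hn'
  have hLsum : ∀ γ : C(I, E3), (∀ s, γ s ∈ B.N (64 * e)) → ∑ v ∈ S, L v γ 0 =
      -principal (fun γ => B.psi χ' 0 γ 0) n' γ := fun γ hγ => by
    have hγM : ∀ s, γ s ∈ B.M := fun s => N_subset_M (hγ s)
    have hpu := push_apply h.cont hγM
    have e1 := hsum (push h.g γ) fun s => by rw [hpu]; exact hgN _ (hγ s)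
    simp only [hL, ContinuousMap.mul_apply, hexz, ← Finset.mul_sum]
    rw [e1, principal, principal, hpu, hpu, hn']
    linear_combination n (h.g (γ 1)) * hGψ γ hγM
  set μ : E3 → ℂ := fun x => ∑ v ∈ S, mb v x + n' x with hμ
  have hμflat : ∀ u, B.IsFlat u → ¬ β.IsSpecial u → ∀ γ : C(I, E3), (∀ s, γ s ∈ B.V u e) →
      μ (γ 0) = B.psi χ' 0 γ 0 * μ (γ 1) := fun u hu hus γ hγ => by
    have e1 := hLsum γ fun s => V_subset_N hu (V_mono (by linarith) (hγ s))
    rw [Finset.sum_congr rfl fun v hv => hmb v (hSm hv) u hu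
      (fun e => hus (e ▸ (hSm hv).image hT hχ ha)) γ hγ] at e1
    simp only [principal, Finset.sum_sub_distrib, ← Finset.mul_sum] at e1
    simp only [hμ]
    linear_combination e1
  have h8 : 8 * B.K * (e / 4) ≤ 1 := by nlinarith
  have h4 : 4 * (e / 4) = e := by ring
  have he4 : 0 < e / 4 := by positivity
  have hμj : ∀ j, β.χ j = 1 → ∀ x ∈ B.V {j} (e / 4), μ x = 0 := fun j hj x hx =>
    eq_zero_of_odd (hodd j hj) he4 h8
      (by rw [h4]; exact hμflat _ (isFlat_single j) (not_isSpecial_single hj)) hx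
  obtain ⟨Q, hQ0, hQ⟩ := exists_gauge (A := B) hpar
  have hμa : ∀ r, ∀ x ∈ B.V {β.a r} (e / 4), μ x = 0 := fun r x hx => by
    have := eq_zero_of_flat hB hkB he4 h8 (μ := fun x => Q x * μ x) (fun r u hu γ hγ => by
      rw [h4] at hγ
      rw [hμflat u hu.1 hu.not_isSpecial γ hγ]
      linear_combination μ (γ 1) * hQ γ fun s => (hγ s).1) r hx
    exact (mul_eq_zero.1 this).resolve_left (hQ0 x)
  set πp := p.image π with hπp
  have hπpT : πp ∈ B.T := by rw [hB]; exact hT p hpT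
  have hπpf : B.IsFlat πp := Or.inr (Or.inl hπpT)
  have hpS : p ∈ S := by simp [hS, hp]
  set q : E3 → ℂ := fun x => if x ∈ B.V πp (e / 4) then mb p x - μ x else mb p x with hq
  have hLp : ∀ u, B.IsFlat u → ∀ γ : C(I, E3), (∀ s, γ s ∈ B.V u (e / 4)) →
      L p γ 0 = principal (fun γ => B.psi χ' 0 γ 0) q γ := by
    intro u hu γ hγ
    by_cases hup : u = πp
    · subst hup
      have e1 := hLsum γ fun s => V_subset_N hu (V_mono (by linarith) (hγ s))
      rw [← Finset.add_sum_erase S _ hpS, Finset.sum_congr rfl fun v hv =>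
        hmb v (hSm (Finset.mem_of_mem_erase hv)) πp hu
          (fun e => (Finset.ne_of_mem_erase hv) (Finset.image_injective π.injective e).symm) γ
          fun s => V_mono (by linarith) (hγ s)] at e1
      simp only [principal, Finset.sum_sub_distrib, ← Finset.mul_sum] at e1
      simp only [principal, hq, if_pos (hγ _), hμ, ← Finset.add_sum_erase S _ hpS]
      linear_combination e1
    · have hqm : ∀ s, q (γ s) = mb p (γ s) := fun s => by
        simp only [hq]
        split_ifs with hs
        · have hsub : u ⊆ πp := by
            rcases V_comparable (by linarith) (hγ s) hs with h | h
            · exact h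
            · rcases hπpf.eq_or_single hu h with h | ⟨i, h⟩
              · exact absurd h.symm hup
              · have := B.card_T _ hπpT
                rw [h] at this; simp at this
          obtain ⟨i, rfl⟩ := (hu.eq_or_single hπpf hsub).resolve_left hup
          obtain ⟨i₀, hi₀, rfl⟩ := Finset.mem_image.1 (hsub (Finset.mem_singleton_self i))
          have : μ (γ s) = 0 := by
            rcases hpi i₀ hi₀ with h1 | ⟨r, rfl⟩
            · exact hμj _ (by rw [hχ, h1]) _ (hγ s)
            · obtain ⟨r', hr'⟩ := ha r
              have := hγ s
              rw [hr'] at this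
              exact hμa r' _ this
          rw [this, sub_zero]
        · rfl
      rw [hmb p hp u hu hup γ fun s => V_mono (by linarith) (hγ s), principal, principal, hqm, hqm]
  obtain ⟨η', h0', hη'⟩ := h.symm.exists_N he4
  refine hnot η' h0' (h.principal_of_pull (G := G) (ψ' := fun γ => B.psi χ' 0 γ 0) hG0 hGψ
    (δ := fun γ => E p γ 0) (η := e / 4) (hη' η' le_rfl) (m := q) fun γ hγ => ?_)
  have hcr := isCrossed_eval (hLc p hp) 0
  simp only [psi_zero (t := t' p)] at hcr
  have h1 : IsCrossed (⋃ s : {s : Finset ι // B.IsFlat s}, B.V s.1 (e / 4))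
      (fun γ => B.psi χ' 0 γ 0) fun γ => L p γ 0 := by
    rw [iUnion_flat]; exact hcr.mono (N_mono (by linarith))
  have h2 : IsCrossed (⋃ s : {s : Finset ι // B.IsFlat s}, B.V s.1 (e / 4))
      (fun γ => B.psi χ' 0 γ 0) (principal (fun γ => B.psi χ' 0 γ 0) q) := by
    rw [iUnion_flat]
    exact isCrossed_principal ((isCocycle_psi_eval χ' 0 0).mono N_subset_M) _
  rw [← iUnion_flat] at hγ
  have := IsCrossed.eq_of_cover (U := fun s : {s : Finset ι // B.IsFlat s} => B.V s.1 (e / 4))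
    (fun s => isOpen_V s.1 (e / 4)) h1 h2 (fun u => hLp u.1 u.2) γ hγ
  rw [← this]
  simp only [hL, ContinuousMap.mul_apply, hexz]

end BlockData

end

section

open unitInterval Topology
open Filter (Tendsto Eventually eventually_all)

/-! ### Two arrangements of 28 lines -/

namespace Example

def blockP : List (ℤ × ℤ × ℤ) :=
  [(1, 0, 0), (0, 1, 0), (0, 0, 1), (1, 4, -2), (1, 4, -1), (1, -2, -2), (1, -2, 1), (2, -3, 1),
    (2, -3, 2), (1, -1, -1), (4, -4, 1), (4, -3, 2), (4, -3, 1)]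

def blockN : List (ℤ × ℤ × ℤ) :=
  [(9, 8, 7), (6, 4, 7), (-5, -6, 6), (-20, -14, -15), (-25, -20, -9), (5, 3, 10), (65, 54, 50),
    (32, 24, 47), (47, 42, 29), (11, 4, 33), (26, 22, 15), (7, 6, 13), (22, 24, -5)]

/-- The two orders of the blocks, completed by two lines near a further line. -/
def row (b : Bool) (i : ℕ) : ℤ × ℤ × ℤ :=
  (bif b then blockP ++ blockN ++ [(17999, -12004, -1998), (18001, -11996, -2002)]
    else blockN ++ blockP ++ [(18020, -11986, -1985), (17980, -12014, -2015)]).getD i 0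

def trip : List (ℕ × ℕ × ℕ) :=
  let t := [(0, 3, 6), (0, 4, 10), (0, 5, 9), (0, 7, 12), (0, 8, 11), (1, 3, 5), (1, 4, 9),
    (1, 6, 8), (1, 7, 11), (1, 10, 12), (2, 3, 4), (2, 5, 6), (2, 7, 8), (2, 9, 10), (2, 11, 12)]
  t ++ t.map (fun p => (p.1 + 13, p.2.1 + 13, p.2.2 + 13)) ++ [(3, 26, 27)]

def dz (x y z : ℤ × ℤ × ℤ) : ℤ :=
  x.1 * (y.2.1 * z.2.2 - y.2.2 * z.2.1) - x.2.1 * (y.1 * z.2.2 - y.2.2 * z.1) +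
    x.2.2 * (y.1 * z.2.1 - y.2.1 * z.1)

def lr (x : ℤ × ℤ × ℤ) : Fin 3 → ℝ := ![x.1, x.2.1, x.2.2]

lemma det3_lr (x y z : ℤ × ℤ × ℤ) : det3 (lr x) (lr y) (lr z) = dz x y z := by
  simp [det3, lr, dz]

def On (n : ℕ) (x : ℕ × ℕ × ℕ) : Prop := n = x.1 ∨ n = x.2.1 ∨ n = x.2.2

instance (n : ℕ) (x : ℕ × ℕ × ℕ) : Decidable (On n x) := inferInstanceAs (Decidable (_ ∨ _))

def lines (x : ℕ × ℕ × ℕ) : Finset (Fin 28) := Finset.univ.filter (On · x)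

/-- The triple points. -/
def T : Finset (Finset (Fin 28)) := trip.toFinset.image lines

lemma exists_trip {p : Finset (Fin 28)} : p ∈ T ↔ ∃ x ∈ trip, ∀ i : Fin 28, i ∈ p ↔ On i x := by
  simp only [T, Finset.mem_image, List.mem_toFinset]
  refine exists_congr fun x => and_congr_right fun _ => ?_
  rw [eq_comm, Finset.ext_iff]
  simp [lines]

lemma det_lt (b : Bool) : ((List.range 28).all fun k => (List.range k).all fun j =>
    (List.range j).all fun i => dz (row b i) (row b j) (row b k) != 0 ||
      trip.contains (i, j, k)) = true := by
  cases b <;> decide +kernel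

lemma dz_trip (b : Bool) : ∀ x ∈ trip, dz (row b x.1) (row b x.2.1) (row b x.2.2) = 0 := by
  cases b <;> decide +kernel

lemma trip_lt : ∀ x ∈ trip, x.1 < x.2.1 ∧ x.2.1 < x.2.2 ∧ x.2.2 < 28 := by decide +kernel

lemma trip_inter : ∀ x ∈ trip, ∀ y ∈ trip, x = y ∨ ∀ a ∈ [x.1, x.2.1, x.2.2],
    ∀ b ∈ [x.1, x.2.1, x.2.2], On a y → On b y → a = b := by decide +kernel

lemma mem_T_iff {i j k : Fin 28} (h : i < j) (h' : j < k) :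
    {i, j, k} ∈ T ↔ ((i : ℕ), (j : ℕ), (k : ℕ)) ∈ trip := by
  rw [exists_trip]
  constructor
  · rintro ⟨x, hx, hp⟩
    have h1 := trip_lt x hx
    have hi := (hp i).1 (by simp)
    have hj := (hp j).1 (by simp)
    have hk := (hp k).1 (by simp)
    rw [On] at hi hj hk
    obtain ⟨a, b, c⟩ := x
    simp only at h1 hi hj hk
    have : a = i ∧ b = j ∧ c = k := by omega
    rwa [← this.1, ← this.2.1, ← this.2.2]
  · exact fun hx => ⟨_, hx, fun m => by simp [On, Fin.ext_iff]⟩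

lemma det_of_lt {ι : Type*} [LinearOrder ι] {l : ι → Fin 3 → ℝ} {T : Finset (Finset ι)}
    (key : ∀ i j k, i < j → j < k → (det3 (l i) (l j) (l k) = 0 ↔ {i, j, k} ∈ T)) (i j k : ι)
    (hij : i ≠ j) (hjk : j ≠ k) (hik : i ≠ k) : det3 (l i) (l j) (l k) = 0 ↔ {i, j, k} ∈ T := by
  have rot : ∀ {i j k}, (det3 (l i) (l j) (l k) = 0 ↔ {i, j, k} ∈ T) →
      (det3 (l j) (l k) (l i) = 0 ↔ {j, k, i} ∈ T) := fun {i j k} h => by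
    rwa [det3_rot, show ({j, k, i} : Finset ι) = {i, j, k} by ext; simp; tauto]
  have sw : ∀ {i j k}, (det3 (l i) (l j) (l k) = 0 ↔ {i, j, k} ∈ T) →
      (det3 (l j) (l i) (l k) = 0 ↔ {j, i, k} ∈ T) := fun {i j k} h => by
    rwa [det3_swap, neg_eq_zero, Finset.insert_comm]
  rcases lt_or_gt_of_ne hij with h1 | h1 <;> rcases lt_or_gt_of_ne hjk with h2 | h2 <;>
    rcases lt_or_gt_of_ne hik with h3 | h3
  · exact key i j k h1 h2
  · exact absurd (h1.trans h2) h3.not_gt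
  · exact rot (sw (key i k j h3 h2))
  · exact rot (key k i j h3 h1)
  · exact sw (key j i k h1 h3)
  · exact rot (rot (key j k i h2 h3))
  · exact absurd (h2.trans h1) h3.not_gt
  · exact rot (rot (sw (key k j i h2 h1)))

def arr (b : Bool) : Arr (Fin 28) where
  l i := lr (row b i)
  T := T
  card_T p hp := by
    obtain ⟨x, hx, h⟩ := exists_trip.1 hp
    obtain ⟨h1, h2, h3⟩ := trip_lt x hx
    have : p = {⟨x.1, by omega⟩, ⟨x.2.1, by omega⟩, ⟨x.2.2, h3⟩} := by
      ext i
      simp [h, On, Fin.ext_iff]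
    rw [this, Finset.card_eq_three]
    exact ⟨_, _, _, by simpa [Fin.ext_iff] using h1.ne, by simpa [Fin.ext_iff] using (h1.trans h2).ne,
      by simpa [Fin.ext_iff] using h2.ne, rfl⟩
  inter p hp q hq hpq := by
    obtain ⟨x, hx, h⟩ := exists_trip.1 hp
    obtain ⟨y, hy, h'⟩ := exists_trip.1 hq
    rcases trip_inter x hx y hy with rfl | hxy
    · exact absurd (Finset.ext fun i => (h i).trans (h' i).symm) hpq
    · refine Finset.card_le_one.2 fun a ha b hb => Fin.ext ?_
      rw [Finset.mem_inter, h, h'] at ha hb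
      exact hxy a (by simpa [On] using ha.1) b (by simpa [On] using hb.1) ha.2 hb.2
  det := by
    have key : ∀ i j k : Fin 28, i < j → j < k →
        (det3 (lr (row b i)) (lr (row b j)) (lr (row b k)) = 0 ↔ {i, j, k} ∈ T) := by
      intro i j k hij hjk
      have h := det_lt b
      simp only [List.all_eq_true, List.mem_range] at h
      have h := h k k.2 j hjk i hij
      rw [mem_T_iff hij hjk, det3_lr, Int.cast_eq_zero]
      refine ⟨fun h0 => ?_, fun hx => dz_trip b _ hx⟩
      rw [h0] at h
      exact List.contains_iff_mem.1 h
    exact det_of_lt key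
  card := by simp

def pr (r : Fin 3) (k : Fin 28) : Fin 28 :=
  ((![[6, 10, 9, 3, 12, 11, 5, 4, 8, 7], [5, 9, 3, 8, 11, 6, 4, 12, 7, 10],
    [4, 3, 6, 5, 8, 7, 10, 9, 12, 11]] : Fin 3 → List (Fin 28)) r).getD (k - 3 : ℕ) 0

def Rp : Fin 3 → Finset (Fin 28) := ![{3, 10, 5, 7, 8}, {3, 4, 6, 7, 10}, {3, 5, 7, 9, 11}]

def chi (i : Fin 28) : ℤ := if 3 ≤ (i : ℕ) ∧ (i : ℕ) ≤ 12 then 1 else 0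

def side (r : Fin 3) : Fin 28 := ⟨r, by omega⟩

/-- Membership of a triple in any order. -/
def inT (i j k : Fin 28) : Prop :=
  ∃ x ∈ trip, i ≠ j ∧ j ≠ k ∧ i ≠ k ∧ On i x ∧ On j x ∧ On k x

instance (i j k : Fin 28) : Decidable (inT i j k) :=
  inferInstanceAs (Decidable (∃ x ∈ trip, _))

lemma inT.mem {i j k : Fin 28} (h : inT i j k) : {i, j, k} ∈ T := by
  obtain ⟨x, hx, h1, h2, h3, h4, h5, h6⟩ := h
  refine exists_trip.2 ⟨x, hx, fun m => ?_⟩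
  have := trip_lt x hx
  simp only [On, ne_eq, Fin.ext_iff, Finset.mem_insert, Finset.mem_singleton] at *
  omega

lemma notMem_T {i j : Fin 28} (h : ∀ x ∈ trip, ¬ (On i x ∧ On j x)) :
    ∀ p ∈ T, ¬ {i, j} ⊆ p := fun p hp hs => by
  obtain ⟨x, hx, h'⟩ := exists_trip.1 hp
  exact h x hx ⟨(h' i).1 (hs (by simp)), (h' j).1 (hs (by simp))⟩

def block : BlockData T where
  χ := chi
  a := side
  pr := pr
  Rp := Rp
  inj := by decide
  χ01 i := by rw [chi]; split_ifs <;> simp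
  χa := by decide
  sum r X := by
    have h1 : ∀ r, Finset.univ.filter (chi · = 1) = Rp r ∪ (Rp r).image (pr r) := by decide +kernel
    have h2 : ∀ r, Disjoint (Rp r) ((Rp r).image (pr r)) := by decide +kernel
    have h3 : ∀ r, ∀ k ∈ Rp r, ∀ k' ∈ Rp r, pr r k = pr r k' → k = k' := by decide +kernel
    rw [Finset.sum_add_distrib, ← Finset.sum_image (f := X) (h3 r), ← Finset.sum_union (h2 r), ← h1,
      Finset.sum_filter]
    refine Finset.sum_congr rfl fun j _ => ?_
    rw [chi]; split_ifs <;> simp_all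
  tri := by
    have h : ∀ r, ∀ k ∈ Rp r, chi k = 1 ∧ chi (pr r k) = 1 ∧ k ≠ pr r k ∧
      inT (side r) k (pr r k) := by decide +kernel
    exact fun r k hk => ⟨(h r k hk).1, (h r k hk).2.1, (h r k hk).2.2.1, (h r k hk).2.2.2.mem⟩
  cover := by
    have h : ∀ r j, chi j = 1 → chi (pr r j) = 1 ∧ pr r j ≠ j ∧ inT (side r) j (pr r j) := by
      decide +kernel
    exact fun r j hj => ⟨pr r j, (h r j hj).1, (h r j hj).2.1, (h r j hj).2.2.mem⟩
  even := by decide +kernel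
  card := by decide +kernel
  line := by
    have h : ∀ k, chi k = 0 → (∀ r, k ≠ side r) → (∀ r, ∀ x ∈ trip, ¬ (On k x ∧ On (side r) x)) ∧
      ∀ x ∈ trip, ¬ (On k x ∧ On ((4 : Fin 28) : ℕ) x) := by decide +kernel
    exact fun k h0 h1 => ⟨fun r => notMem_T ((h k h0 h1).1 r), 4, by decide, notMem_T (h k h0 h1).2⟩
  corner := by
    have h : ∀ r s, r ≠ s → ∀ x ∈ trip, ¬ (On (side r) x ∧ On (side s) x) := by decide +kernel
    exact fun r s hrs => notMem_T (h r s hrs)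

lemma kap_eq (b : Bool) (r s : Fin 3) : BlockData.kap (arr b) block r s =
    (((∏ k ∈ Rp r, dz (row b r) (row b s) (row b k)) *
      ∏ k ∈ Rp s, dz (row b r) (row b s) (row b k) : ℤ) : ℝ) := by
  push_cast
  simp only [BlockData.kap, Arr.d, arr, det3_lr]
  rfl

lemma card_deg (i : Fin 28) :
    (T.filter (i ∈ ·)).card = (trip.toFinset.filter (On i ·)).card := by
  rw [T, Finset.filter_image, Finset.card_image_of_injOn]
  · congr 1
    exact Finset.filter_congr fun x _ => by simp [lines]
  intro x hx y hy hxy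
  have hx := List.mem_toFinset.1 (Finset.mem_filter.1 hx).1
  have hy := List.mem_toFinset.1 (Finset.mem_filter.1 hy).1
  obtain ⟨h1, h2, h3⟩ := trip_lt x hx
  have h : ∀ i : Fin 28, On i x → On i y := fun i hi => by
    have : i ∈ lines x := by simpa [lines] using hi
    rw [hxy] at this
    simpa [lines] using this
  refine (trip_inter x hx y hy).resolve_right fun hc => h1.ne ?_
  exact hc _ (by simp) _ (by simp) (h ⟨x.1, by omega⟩ (Or.inl rfl))
    (h ⟨x.2.1, by omega⟩ (Or.inr (Or.inl rfl)))

/-- A permutation increasing a function preserves it. -/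
lemma perm_eq {ι M : Type*} [Fintype ι] [AddCommMonoid M] [PartialOrder M]
    [IsOrderedCancelAddMonoid M] (π : Equiv.Perm ι) {f : ι → M} (h : ∀ i, f i ≤ f (π i)) (i : ι) :
    f (π i) = f i :=
  ((Finset.sum_eq_sum_iff_of_le fun i _ => h i).1 (Equiv.sum_comp π f).symm i
    (Finset.mem_univ i)).symm

/-- Automorphisms of the incidence structure preserve the triangle and its block. -/
lemma perm {π : Equiv.Perm (Fin 28)} (h : ∀ p ∈ T, p.image π ∈ T) :
    (∀ i, chi (π i) = chi i) ∧ ∀ r, ∃ s, π (side r) = side s := by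
  have hdeg : ∀ i, (trip.toFinset.filter (On (π i : Fin 28) ·)).card =
      (trip.toFinset.filter (On i ·)).card := by
    refine perm_eq π (f := fun i : Fin 28 => (trip.toFinset.filter (On i ·)).card) fun i => ?_
    simp only [← card_deg]
    rw [← Finset.card_image_of_injective _ (Finset.image_injective π.injective)]
    refine Finset.card_le_card fun q hq => ?_
    obtain ⟨p, hp, rfl⟩ := Finset.mem_image.1 hq
    rw [Finset.mem_filter] at hp ⊢
    exact ⟨h p hp.1, Finset.mem_image_of_mem π hp.2⟩
  have hco : ∀ i j : Fin 28, (∃ x ∈ trip, On i x ∧ On j x) →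
      ∃ x ∈ trip, On (π i : Fin 28) x ∧ On (π j : Fin 28) x := by
    rintro i j ⟨x, hx, hi, hj⟩
    obtain ⟨y, hy, hy'⟩ := exists_trip.1 (h _ (exists_trip.2 ⟨x, hx, fun i =>
      show i ∈ lines x ↔ _ by simp [lines]⟩))
    exact ⟨y, hy, (hy' _).1 (Finset.mem_image_of_mem π (by simpa [lines] using hi)),
      (hy' _).1 (Finset.mem_image_of_mem π (by simpa [lines] using hj))⟩
  have h3 : ∀ i : Fin 28, (trip.toFinset.filter (On i ·)).card = 4 ↔ i = 3 := by decide +kernel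
  have hs : ∀ i : Fin 28, ((trip.toFinset.filter (On i ·)).card = 5 ∧
      ∃ x ∈ trip, On i x ∧ On (3 : Fin 28) x) ↔ ∃ r, i = side r := by decide +kernel
  have hc : ∀ i : Fin 28, chi i = 1 ↔ (∃ r, ∃ x ∈ trip, On i x ∧ On (side r) x) ∧
      ∀ r, i ≠ side r := by decide +kernel
  have hπ3 : π 3 = 3 := (h3 _).1 ((hdeg 3).trans ((h3 3).2 rfl))
  have hside : ∀ r, ∃ s, π (side r) = side s := fun r => by
    obtain ⟨h1, h2⟩ := (hs (side r)).2 ⟨r, rfl⟩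
    have := hco _ _ h2
    rw [hπ3] at this
    exact (hs _).1 ⟨(hdeg _).trans h1, this⟩
  refine ⟨perm_eq π fun i => ?_, hside⟩
  rcases block.χ01 i with h0 | h1
  · change chi i = 0 at h0
    rw [h0, chi]; split_ifs <;> simp
  · change chi i = 1 at h1
    obtain ⟨⟨r, hr⟩, hn⟩ := (hc i).1 h1
    rw [h1, (hc (π i)).2 ⟨?_, fun s hs => ?_⟩]
    · obtain ⟨s, hs⟩ := hside r
      exact ⟨s, hs ▸ hco _ _ hr⟩
    · choose f hf using hside
      have hinj : Function.Injective f := fun r s e => block.inj (π.injective (by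
        change π (side r) = π (side s); rw [hf, hf, e]))
      obtain ⟨r, rfl⟩ := (Finite.injective_iff_surjective.1 hinj) s
      rw [← hf] at hs
      exact hn r (π.injective hs)

theorem isEmpty_coneIso : IsEmpty (Arr.ConeIso (arr true) (arr false)) := by
  refine BlockData.isEmpty_coneIso (β := block) rfl rfl (by simp) ?_ ?_ ?_ fun π h => perm h
  · have h : ∀ i : Fin 28, i < 26 → ∃ x ∈ trip, ∃ y ∈ trip, ¬ (On y.1 x ∧ On y.2.1 x) ∧ On i x ∧ On i y := by
      decide +kernel
    have hl : ∀ x ∈ trip, lines x ∈ T := fun x hx =>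
      Finset.mem_image_of_mem _ (List.mem_toFinset.2 hx)
    have hm : ∀ (i : Fin 28) x, i ∈ lines x ↔ On i x := fun i x => by simp [lines]
    refine ⟨lines (3, 26, 27), hl _ (by decide), fun i hi => ?_⟩
    obtain ⟨x, hx, y, hy, hne, h1, h2⟩ := h i (by
      rw [hm, On] at hi
      push Not at hi
      have := i.2
      exact Fin.lt_def.2 (by change (i : ℕ) < 26; simp only at hi; omega))
    refine ⟨_, hl x hx, _, hl y hy, fun e => hne ?_, (hm i x).2 h1, (hm i y).2 h2⟩
    have hlt := trip_lt y hy
    have h3 : ∀ n (hn : n < 28), On n y → On n x := fun n hn h => by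
      rw [← hm ⟨n, hn⟩] at h ⊢
      rwa [e]
    exact ⟨h3 _ (by omega) (Or.inl rfl), h3 _ (by omega) (Or.inr (Or.inl rfl))⟩
  · have h : ∀ r s : Fin 3, r < s → 0 < (∏ k ∈ Rp r, dz (row true r) (row true s) (row true k)) *
      ∏ k ∈ Rp s, dz (row true r) (row true s) (row true k) := by decide +kernel
    intro r s hrs
    rw [kap_eq]
    exact_mod_cast h r s hrs
  · simp only [kap_eq]
    norm_cast

end Example

end

section

open unitInterval Topology
open Filter (Tendsto Eventually eventually_all)

/-! ### Transport along a pencil of graphs -/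

namespace Pencil

/-- Slopes depending slowly on the position. -/
structure Slope where
  g : ℝ → ℝ
  lip : ∀ x y, |g x - g y| ≤ |x - y| / 6

variable (S : Slope)

def cl (s : ℝ) : ℝ := max (-5) (min 5 s)

lemma abs_cl (s : ℝ) : |cl s| ≤ 5 :=
  abs_le.2 ⟨le_max_left _ _, max_le (by norm_num) (min_le_left _ _)⟩

lemma cl_eq {s : ℝ} (h : |s| ≤ 5) : cl s = s := by
  rw [cl, min_eq_right (abs_le.1 h).2, max_eq_right (abs_le.1 h).1]

namespace Slope

lemma sub_le (s s' : ℝ) {x x' u u' : ℝ} (h : x + cl s * S.g x = u)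
    (h' : x' + cl s' * S.g x' = u') : |x - x'| ≤ 6 * (|u - u'| + |cl s - cl s'| * |S.g x'|) := by
  have e : x - x' = (u - u') - cl s * (S.g x - S.g x') - (cl s - cl s') * S.g x' := by
    rw [← h, ← h']; ring
  have h1 : |cl s * (S.g x - S.g x')| ≤ 5 * (|x - x'| / 6) := by
    rw [abs_mul]
    exact mul_le_mul (abs_cl s) (S.lip x x') (abs_nonneg _) (by norm_num)
  have h2 := abs_sub (u - u' - cl s * (S.g x - S.g x')) ((cl s - cl s') * S.g x')
  have h3 := abs_sub (u - u') (cl s * (S.g x - S.g x'))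
  rw [← e, abs_mul (cl s - cl s')] at h2
  linarith

lemma exists_foot (s u : ℝ) : ∃ x, x + cl s * S.g x = u := by
  have hc : ContractingWith (5 / 6) fun x => u - cl s * S.g x := by
    refine ⟨by rw [div_lt_one (by norm_num)]; norm_num, LipschitzWith.of_dist_le_mul fun x y => ?_⟩
    rw [Real.dist_eq, Real.dist_eq, sub_sub_sub_cancel_left, ← mul_sub, abs_mul, abs_sub_comm x y]
    calc _ ≤ 5 * (|y - x| / 6) := mul_le_mul (abs_cl s) (S.lip y x) (abs_nonneg _) (by norm_num)
      _ = _ := by push_cast; ring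
  refine ⟨hc.fixedPoint, ?_⟩
  have := hc.fixedPoint_isFixedPt
  rw [Function.IsFixedPt] at this
  linarith

def foot (s u : ℝ) : ℝ := (S.exists_foot s u).choose

lemma foot_spec (s u : ℝ) : S.foot s u + cl s * S.g (S.foot s u) = u :=
  (S.exists_foot s u).choose_spec

lemma foot_eq {s u x : ℝ} (h : x + cl s * S.g x = u) : S.foot s u = x := by
  have := S.sub_le s s (S.foot_spec s u) h
  simp only [sub_self, abs_zero, zero_mul, add_zero, mul_zero] at this
  exact sub_eq_zero.1 (abs_nonpos_iff.1 this)

lemma continuous_g : Continuous S.g :=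
  (LipschitzWith.of_dist_le_mul (K := 1 / 6) fun x y => by
    rw [Real.dist_eq, Real.dist_eq]; push_cast; linarith [S.lip x y]).continuous

lemma continuous_foot : Continuous fun p : ℝ × ℝ => S.foot p.1 p.2 := by
  refine continuous_iff_continuousAt.2 fun q => tendsto_iff_dist_tendsto_zero.2 ?_
  have hc : Continuous fun p : ℝ × ℝ =>
      6 * (|p.2 - q.2| + |cl p.1 - cl q.1| * |S.g (S.foot q.1 q.2)|) := by unfold cl; fun_prop
  have := hc.tendsto q
  simp only [sub_self, abs_zero, zero_mul, add_zero, mul_zero] at this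
  exact squeeze_zero (fun _ => dist_nonneg)
    (fun p => S.sub_le p.1 q.1 (S.foot_spec _ _) (S.foot_spec _ _)) this

/-- Parallel transport from the fibre over `t` to the fibre over `t'`. -/
def tr (t t' y : ℂ) : ℂ := y + (t' - t) * (S.g (S.foot t.re y.re) : ℝ)

lemma continuous_tr : Continuous fun p : ℂ × ℂ × ℂ => S.tr p.1 p.2.1 p.2.2 := by
  have h := S.continuous_foot.comp (f := fun p : ℂ × ℂ × ℂ => (p.1.re, p.2.2.re)) (by fun_prop)
  have hg := Complex.continuous_ofReal.comp (S.continuous_g.comp h)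
  exact (continuous_snd.comp continuous_snd).add
    (((continuous_fst.comp continuous_snd).sub continuous_fst).mul hg)

lemma tr_self (t y : ℂ) : S.tr t t y = y := by simp [tr]

lemma foot_tr {t t' : ℂ} (h : |t.re| ≤ 5) (h' : |t'.re| ≤ 5) (y : ℂ) :
    S.foot t'.re (S.tr t t' y).re = S.foot t.re y.re := by
  apply S.foot_eq
  have := S.foot_spec t.re y.re
  rw [cl_eq h] at this
  rw [cl_eq h', tr, Complex.add_re, Complex.re_mul_ofReal, Complex.sub_re]
  linarith

end Slope

/-- Fibres between which transport is defined. -/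
def Ok (t t' : ℂ) : Prop := t' = t ∨ |t.re| ≤ 5 ∧ |t'.re| ≤ 5

variable {S}

lemma tr_tr {t t' t'' : ℂ} (h : Ok t t') (y : ℂ) :
    S.tr t' t'' (S.tr t t' y) = S.tr t t'' y := by
  rcases h with rfl | ⟨h1, h2⟩
  · rw [S.tr_self]
  · rw [Slope.tr, S.foot_tr h1 h2, Slope.tr, Slope.tr]; ring

variable {J : Type*} {b m : J → ℝ}

lemma tr_ne (hb : ∀ j, S.g (b j) = m j) {t t' : ℂ} (h : Ok t t') {y : ℂ} {j : J}
    (hy : y ≠ b j + m j * t) : S.tr t t' y ≠ b j + m j * t' := by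
  rcases h with rfl | ⟨h1, h2⟩
  · rwa [S.tr_self]
  intro e
  have h3 := S.foot_tr h1 h2 y
  rw [e, S.foot_eq (x := b j) (by simp [cl_eq h2, hb]; ring)] at h3
  rw [Slope.tr, ← h3, hb] at e
  exact hy (by linear_combination e)

/-- The total space over a set of base points. -/
def Tot (b m : J → ℝ) (Q : Set (ℂ × ℂ)) : Set ((ℂ × ℂ) × ℂ) :=
  {p | p.1 ∈ Q ∧ ∀ j, p.2 ≠ b j + m j * p.1.1}

def lift (hb : ∀ j, S.g (b j) = m j) {Q Q' : Set (ℂ × ℂ)} {k : ℂ × ℂ → ℂ × ℂ}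
    (hk : Continuous k) (h : ∀ p ∈ Q, k p ∈ Q' ∧ Ok p.1 (k p).1) : C(Tot b m Q, Tot b m Q') where
  toFun p := ⟨(k p.1.1, S.tr p.1.1.1 (k p.1.1).1 p.1.2), (h _ p.2.1).1,
    fun j => tr_ne hb (h _ p.2.1).2 (p.2.2 j)⟩
  continuous_toFun := by
    refine Continuous.subtype_mk ((hk.comp (by fun_prop)).prodMk ?_) _
    exact S.continuous_tr.comp (f := fun p : Tot b m Q => (p.1.1.1, (k p.1.1).1, p.1.2)) (by fun_prop)

lemma lift_comp (hb : ∀ j, S.g (b j) = m j) {Q Q' Q'' : Set (ℂ × ℂ)} {k k' : ℂ × ℂ → ℂ × ℂ}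
    (hk : Continuous k) (h : ∀ p ∈ Q, k p ∈ Q' ∧ Ok p.1 (k p).1) (hk' : Continuous k')
    (h' : ∀ p ∈ Q', k' p ∈ Q'' ∧ Ok p.1 (k' p).1)
    (h'' : ∀ p ∈ Q, k' (k p) ∈ Q'' ∧ Ok p.1 (k' (k p)).1) :
    (lift hb hk' h').comp (lift hb hk h) = lift hb (hk'.comp hk) h'' := by
  ext1 p
  refine Subtype.ext (Prod.ext rfl ?_)
  exact tr_tr (h _ p.2.1).2 _

lemma homotopic_lift (hb : ∀ j, S.g (b j) = m j) {Q Q' : Set (ℂ × ℂ)} {H : ℝ → ℂ × ℂ → ℂ × ℂ}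
    (hH : Continuous fun p : ℝ × ℂ × ℂ => H p.1 p.2)
    (h : ∀ s : I, ∀ p ∈ Q, H s p ∈ Q' ∧ Ok p.1 (H s p).1) {k k' : ℂ × ℂ → ℂ × ℂ}
    (hk : Continuous k) (h0 : ∀ p ∈ Q, k p ∈ Q' ∧ Ok p.1 (k p).1)
    (hk' : Continuous k') (h1 : ∀ p ∈ Q, k' p ∈ Q' ∧ Ok p.1 (k' p).1)
    (e0 : ∀ p ∈ Q, H 0 p = k p) (e1 : ∀ p ∈ Q, H 1 p = k' p) :
    (lift hb hk h0).Homotopic (lift hb hk' h1) := by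
  refine ⟨⟨⟨fun q => ⟨(H q.1 q.2.1.1, S.tr q.2.1.1.1 (H q.1 q.2.1.1).1 q.2.1.2),
    (h q.1 _ q.2.2.1).1, fun j => tr_ne hb (h q.1 _ q.2.2.1).2 (q.2.2.2 j)⟩, ?_⟩, fun p => ?_,
    fun p => ?_⟩⟩
  · have hc : Continuous fun q : I × Tot b m Q => H q.1 q.2.1.1 :=
      hH.comp (f := fun q : I × Tot b m Q => ((q.1 : ℝ), q.2.1.1)) (by fun_prop)
    refine Continuous.subtype_mk (hc.prodMk ?_) _
    exact S.continuous_tr.comp (f := fun q : I × Tot b m Q => (q.2.1.1.1, (H q.1 q.2.1.1).1, q.2.1.2))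
      (by fun_prop)
  · refine Subtype.ext ?_
    simp [lift, e0 _ p.2.1]
  · refine Subtype.ext ?_
    simp [lift, e1 _ p.2.1]

/-! ### Homotopies in the base -/

def phi (x : ℝ) : ℝ := max 0 (min 1 (4 - |x|))
def rho (x : ℝ) : ℝ := max 0 (min 1 (3 - |x|))
def pos (y : ℝ) : ℝ := max 0 (y + 1)

/-- Push the strip `|Re t| ≤ 3` below `Im t = -1`. -/
def bet (t : ℂ) : ℂ := t - (phi t.re * pos t.im : ℝ) * Complex.I
def ee (t : ℂ) : ℝ := rho t.re * pos t.im
def mm (t : ℂ) : ℝ := min 1 (2 * ee t)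
def om (t : ℂ) : ℂ := (t.re * mm t : ℝ) + (ee t - 1 : ℝ) * Complex.I
def th (t : ℂ) : ℝ := min 1 (max 0 (max (|t.re| - 3) (-1 - t.im)))
def D1 (s : ℝ) (t : ℂ) : ℂ := t - (s * ((phi t.re - rho t.re) * pos t.im) : ℝ) * Complex.I
def D2 (c : ℝ) (t : ℂ) : ℂ := bet (c * t) + (ee t : ℝ) * Complex.I

/-- Not a puncture. -/
def Np (t : ℂ) : Prop := t.im = 0 → |t.re| ≠ 1

def Q0 : Set (ℂ × ℂ) := {p | Np p.1 ∧ p.2 = 0}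
def Q1 : Set (ℂ × ℂ) := {p | (p.1 = 0 ∨ p.2 = -Complex.I) ∧ |p.2.re| < 4 ∧ Np p.2}

lemma phi_one {x : ℝ} (h : |x| ≤ 3) : phi x = 1 := by
  rw [phi, min_eq_left (by linarith), max_eq_right zero_le_one]
lemma phi_zero {x : ℝ} (h : 4 ≤ |x|) : phi x = 0 :=
  max_eq_left ((min_le_right _ _).trans (by linarith))
lemma rho_one {x : ℝ} (h : |x| ≤ 2) : rho x = 1 := by
  rw [rho, min_eq_left (by linarith), max_eq_right zero_le_one]
lemma rho_zero {x : ℝ} (h : 3 ≤ |x|) : rho x = 0 :=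
  max_eq_left ((min_le_right _ _).trans (by linarith))
lemma rho_nonneg (x : ℝ) : 0 ≤ rho x := le_max_left _ _
lemma pos_nonneg (y : ℝ) : 0 ≤ pos y := le_max_left _ _
lemma le_pos (y : ℝ) : y + 1 ≤ pos y := le_max_right _ _
lemma pos_eq {y : ℝ} (h : -1 ≤ y) : pos y = y + 1 := max_eq_right (by linarith)
lemma pos_zero {y : ℝ} (h : y ≤ -1) : pos y = 0 := max_eq_left (by linarith)
lemma ee_nonneg (t : ℂ) : 0 ≤ ee t := mul_nonneg (rho_nonneg _) (pos_nonneg _)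
lemma mm_nonneg (t : ℂ) : 0 ≤ mm t := le_min zero_le_one (by linarith [ee_nonneg t])
lemma mm_le (t : ℂ) : mm t ≤ 1 := min_le_left _ _
lemma mm_one {t : ℂ} (h : 1 ≤ ee t) : mm t = 1 := min_eq_left (by linarith)
lemma mm_zero {t : ℂ} (h : ee t = 0) : mm t = 0 := by simp [mm, h]
lemma th_nonneg (t : ℂ) : 0 ≤ th t := le_min zero_le_one (le_max_left _ _)
lemma th_le (t : ℂ) : th t ≤ 1 := min_le_left _ _
lemma th_one {t : ℂ} (h : 4 ≤ |t.re|) : th t = 1 :=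
  min_eq_left (le_max_of_le_right (le_max_of_le_left (by linarith)))

lemma ee_cases (t : ℂ) : ee t = 0 ∨ th t = 0 ∧ |t.re| < 3 ∧ -1 < t.im := by
  by_cases h : |t.re| < 3
  · by_cases h' : -1 < t.im
    · exact Or.inr ⟨by rw [th, max_eq_left (max_le (by linarith) (by linarith))]; simp, h, h'⟩
    · exact Or.inl (by rw [ee, pos_zero (by linarith), mul_zero])
  · exact Or.inl (by rw [ee, rho_zero (by linarith), zero_mul])

lemma ee_zero_of_le {t : ℂ} (h : 4 ≤ |t.re|) : ee t = 0 := by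
  rw [ee, rho_zero (by linarith), zero_mul]

lemma bet_re (t : ℂ) : (bet t).re = t.re := by simp [bet]
lemma bet_im (t : ℂ) : (bet t).im = t.im - phi t.re * pos t.im := by simp [bet]
lemma om_re (t : ℂ) : (om t).re = t.re * mm t := by simp [om]
lemma om_im (t : ℂ) : (om t).im = ee t - 1 := by simp [om]

lemma bet_eq {t : ℂ} (h : |t.re| ≤ 3) (h' : -1 ≤ t.im) : bet t = t.re - Complex.I := by
  apply Complex.ext
  · simp [bet_re]
  · rw [bet_im, phi_one h, pos_eq h']; simp

lemma bet_zero : bet 0 = -Complex.I := by rw [bet_eq] <;> simp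

lemma bet_self {t : ℂ} (h : 4 ≤ |t.re|) : bet t = t := by simp [bet, phi_zero h]

lemma om_of_ee {t : ℂ} (h : ee t = 0) : om t = -Complex.I := by
  simp [om, h, mm_zero h]

lemma ee_neg_I : ee (-Complex.I) = 0 := by simp [ee, pos]

lemma bet_mm {t : ℂ} (h : |t.re| < 3) (h' : -1 < t.im) :
    bet (mm t * t) = (t.re * mm t : ℝ) - Complex.I := by
  have h0 := mm_nonneg t
  have h1 := mm_le t
  rw [bet_eq]
  · rw [Complex.re_ofReal_mul, mul_comm]
  · rw [Complex.re_ofReal_mul, abs_mul, abs_of_nonneg h0]; nlinarith [abs_nonneg t.re]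
  · rw [Complex.im_ofReal_mul]; nlinarith

lemma om_re_lt (t : ℂ) : |(om t).re| < 4 := by
  rcases ee_cases t with h | ⟨-, h, -⟩
  · simp [om_of_ee h]
  · rw [om_re, abs_mul, abs_of_nonneg (mm_nonneg t)]
    nlinarith [mm_nonneg t, mm_le t, abs_nonneg t.re]

lemma Np.om {t : ℂ} (h : Np t) : Np (om t) := by
  intro h1 h2
  rw [om_im, sub_eq_zero] at h1
  rw [om_re, mm_one h1.ge, mul_one] at h2
  rw [ee, rho_one (by linarith), one_mul, pos] at h1
  refine h ?_ h2
  rcases max_choice 0 (t.im + 1) with e | e <;> rw [e] at h1 <;> linarith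

lemma Np.D1 {t : ℂ} (h : Np t) (s : ℝ) : Np (D1 s t) := by
  intro h1 h2
  have e : (Pencil.D1 s t).re = t.re := by simp [Pencil.D1]
  rw [e] at h2
  refine h ?_ h2
  simpa [Pencil.D1, phi_one (show |t.re| ≤ 3 by linarith), rho_one (show |t.re| ≤ 2 by linarith)]
    using h1

lemma D2_re (c : ℝ) (t : ℂ) : (D2 c t).re = c * t.re := by simp [D2, bet_re]

lemma Np.D2 {t : ℂ} (h : Np t) {c : ℝ} (hc : 1 ≤ ee t → c = 1) : Np (D2 c t) := by
  intro h1 h2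
  rw [D2_re] at h2
  have h3 : (Pencil.D2 c t).im = c * t.im - phi (c * t.re) * pos (c * t.im) + ee t := by
    simp [Pencil.D2, bet_im]
  rw [h3, phi_one (by linarith), one_mul] at h1
  obtain rfl := hc (by linarith [le_pos (c * t.im)])
  rw [one_mul] at h1 h2
  refine h ?_ h2
  rw [ee, rho_one (by linarith)] at h1
  linarith

lemma D2_mm (t : ℂ) : D2 (mm t) t = om t := by
  rcases ee_cases t with h | ⟨-, h, h'⟩
  · rw [D2, mm_zero h, h, om_of_ee h]; simp [bet_zero]
  · rw [D2, bet_mm h h', om]; push_cast; ring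

lemma D2_one (t : ℂ) : D2 1 t = D1 1 t := by
  simp only [D2, D1, bet, ee]; push_cast; simp; ring

lemma D2_add (t : ℂ) : D2 (th t + mm t) t = om t + Complex.I + bet (th t * t) := by
  rcases ee_cases t with h | ⟨h0, h, h'⟩
  · rw [D2, mm_zero h, h, om_of_ee h, add_zero]; simp
  · rw [h0, zero_add, D2_mm]; simp [bet_zero]

/-- A combination of weights in the unit interval. -/
lemma wt_le {s c : ℝ} (hs : 0 ≤ s ∧ s ≤ 1) (hc : 0 ≤ c) (hc' : c ≤ 1) :
    0 ≤ 1 - s + s * c ∧ 1 - s + s * c ≤ 1 := by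
  constructor <;> nlinarith

lemma abs_mul_le {c x d : ℝ} (h : 0 ≤ c ∧ c ≤ 1) (hx : |x| ≤ d) : |c * x| ≤ d := by
  rw [abs_mul, abs_of_nonneg h.1]; nlinarith [abs_nonneg x]

lemma th_add_mm (t : ℂ) : 0 ≤ th t + mm t ∧ th t + mm t ≤ 1 := by
  refine ⟨add_nonneg (th_nonneg t) (mm_nonneg t), ?_⟩
  rcases ee_cases t with h | ⟨h, -, -⟩
  · rw [mm_zero h, add_zero]; exact th_le t
  · rw [h, zero_add]; exact mm_le t

lemma continuous_bet : Continuous bet := by unfold bet phi pos; fun_prop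
lemma continuous_ee : Continuous ee := by unfold ee rho pos; fun_prop
lemma continuous_mm : Continuous mm := by unfold mm; have := continuous_ee; fun_prop
lemma continuous_om : Continuous om := by
  unfold om; have := continuous_ee; have := continuous_mm; fun_prop
lemma continuous_th : Continuous th := by unfold th; fun_prop

def ka (p : ℂ × ℂ) : ℂ × ℂ := (th p.1 * p.1, om p.1)
def kb (p : ℂ × ℂ) : ℂ × ℂ := (p.2 + Complex.I + bet p.1, 0)

lemma continuous_ka : Continuous ka := by
  unfold ka; have := continuous_th; have := continuous_om; fun_prop

lemma continuous_kb : Continuous kb := by unfold kb; have := continuous_bet; fun_prop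

lemma om_or (t : ℂ) : th t = 0 ∨ om t = -Complex.I := by
  rcases ee_cases t with h | h
  · exact Or.inr (om_of_ee h)
  · exact Or.inl h.1

lemma ok_of {t t' : ℂ} (h : 4 ≤ |t.re| → t' = t) (h' : |t.re| ≤ 4 → |t'.re| ≤ 5) : Ok t t' := by
  rcases le_total 4 |t.re| with h4 | h4
  · exact Or.inl (h h4)
  · exact Or.inr ⟨h4.trans (by norm_num), h' h4⟩

lemma ka_mem (p : ℂ × ℂ) (hp : p ∈ Q0) : ka p ∈ Q1 ∧ Ok p.1 (ka p).1 := by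
  refine ⟨⟨?_, om_re_lt _, hp.1.om⟩, ok_of (fun h => by simp [ka, th_one h]) fun h => ?_⟩
  · exact (om_or p.1).imp (fun h => by simp [ka, h]) id
  · rw [ka, Complex.re_ofReal_mul]
    exact abs_mul_le ⟨th_nonneg _, th_le _⟩ (by linarith)

lemma kb_mem (p : ℂ × ℂ) (hp : p ∈ Q1) : kb p ∈ Q0 ∧ Ok p.1 (kb p).1 := by
  obtain ⟨h | h, h4, hN⟩ := hp
  · have e : (kb p).1 = p.2 := by simp [kb, h, bet_zero]
    refine ⟨⟨by rwa [e], rfl⟩, ?_⟩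
    rw [e, h]
    exact Or.inr ⟨by simp, by linarith⟩
  · have e : (kb p).1 = bet p.1 := by simp [kb, h]
    refine ⟨⟨?_, rfl⟩, ?_⟩
    · rw [e]
      intro h1 h2
      rw [bet_re] at h2
      rw [bet_im, phi_one (by linarith)] at h1
      linarith [le_pos p.1.im]
    · rw [e]
      exact ok_of bet_self fun h => by rw [bet_re]; linarith

variable (hb : ∀ j, S.g (b j) = m j)
include hb

lemma homotopic_kb_ka : (((lift hb continuous_kb kb_mem).comp (lift hb continuous_ka ka_mem)).Homotopic
    (ContinuousMap.id (Tot b m Q0))) := by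
  have hid : ∀ p ∈ Q0, (id p : ℂ × ℂ) ∈ Q0 ∧ Ok p.1 (id p).1 := fun p hp => ⟨hp, Or.inl rfl⟩
  have h1 : ∀ s : ℝ, ∀ p ∈ Q0, ((D1 s p.1, 0) : ℂ × ℂ) ∈ Q0 ∧ Ok p.1 (D1 s p.1) := fun s p hp =>
    ⟨⟨hp.1.D1 s, rfl⟩, ok_of (fun h => by simp [D1, phi_zero h, rho_zero (by linarith)]) fun h => by
      simp only [D1, Complex.sub_re, Complex.re_ofReal_mul, Complex.I_re, mul_zero, sub_zero]
      linarith⟩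
  have h2 : ∀ s : I, ∀ p ∈ Q0, ((D2 (1 - s + s * (th p.1 + mm p.1)) p.1, 0) : ℂ × ℂ) ∈ Q0 ∧
      Ok p.1 (D2 (1 - s + s * (th p.1 + mm p.1)) p.1) := fun s p hp => by
    refine ⟨⟨hp.1.D2 fun h => ?_, rfl⟩, ok_of (fun h => ?_) fun h => ?_⟩
    · rcases ee_cases p.1 with h' | h'
      · linarith
      · rw [h'.1, mm_one h]; ring
    · have e : 1 - (s : ℝ) + s * (th p.1 + mm p.1) = 1 := by
        rw [th_one h, mm_zero (ee_zero_of_le h)]; ring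
      simp [e, D2, ee_zero_of_le h, bet_self h]
    · rw [D2_re]
      exact abs_mul_le (wt_le s.2 (th_add_mm _).1 (th_add_mm _).2) (by linarith)
  have hba : ∀ p ∈ Q0, kb (ka p) ∈ Q0 ∧ Ok p.1 (kb (ka p)).1 := fun p hp => by
    have := h2 1 p hp
    simp only [Set.Icc.coe_one, sub_self, zero_add, one_mul, D2_add] at this
    exact this
  have c1 : Continuous fun p : ℝ × ℂ × ℂ => ((D1 p.1 p.2.1, 0) : ℂ × ℂ) := by
    unfold D1 phi rho pos; fun_prop
  have c2 : Continuous fun p : ℝ × ℂ × ℂ =>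
      ((D2 (1 - p.1 + p.1 * (th p.2.1 + mm p.2.1)) p.2.1, 0) : ℂ × ℂ) := by
    have := continuous_th; have := continuous_mm; have := continuous_ee; have := continuous_bet
    unfold D2; fun_prop
  have c11 : Continuous fun p : ℂ × ℂ => ((D1 1 p.1, 0) : ℂ × ℂ) :=
    c1.comp (f := fun p : ℂ × ℂ => ((1 : ℝ), p)) (by fun_prop)
  have e0 : ContinuousMap.id (Tot b m Q0) = lift hb continuous_id hid := by
    ext1 p; exact Subtype.ext (Prod.ext rfl (S.tr_self _ _).symm)
  rw [lift_comp hb _ _ _ _ hba, e0]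
  refine .symm (.trans (homotopic_lift hb (H := fun s p => (D1 s p.1, 0)) c1 (fun s => h1 s)
    continuous_id hid c11 (h1 1) (fun p hp => ?_) fun _ _ => rfl)
    (homotopic_lift hb (H := fun s p => (D2 (1 - s + s * (th p.1 + mm p.1)) p.1, 0)) c2 h2
      c11 (h1 1) _ hba (fun p hp => ?_) fun p hp => ?_))
  · exact Prod.ext (by simp [D1]) hp.2.symm
  · simp [D2_one]
  · simp only [sub_self, zero_add, one_mul, D2_add]; rfl

lemma homotopic_ka_kb : (((lift hb continuous_ka ka_mem).comp (lift hb continuous_kb kb_mem)).Homotopic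
    (ContinuousMap.id (Tot b m Q1))) := by
  have hid : ∀ p ∈ Q1, (id p : ℂ × ℂ) ∈ Q1 ∧ Ok p.1 (id p).1 := fun p hp => ⟨hp, Or.inl rfl⟩
  have hb0 : ∀ p ∈ Q1, p.1 = 0 → p.2 + Complex.I + bet p.1 = p.2 := fun p _ h => by
    simp [h, bet_zero]
  have hb1 : ∀ p ∈ Q1, p.2 = -Complex.I → p.2 + Complex.I + bet p.1 = bet p.1 := fun p _ h => by
    simp [h]
  have h1 : ∀ s : ℝ, ∀ p ∈ Q1, ((p.1, D1 s p.2) : ℂ × ℂ) ∈ Q1 ∧ Ok p.1 p.1 := fun s p hp =>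
    ⟨⟨hp.1.imp_right fun h => by simp [h, D1, pos], by
      simpa [D1] using hp.2.1, hp.2.2.D1 s⟩, Or.inl rfl⟩
  have h2 : ∀ s : I, ∀ p ∈ Q1, ((p.1, D2 (1 - s + s * mm p.2) p.2) : ℂ × ℂ) ∈ Q1 ∧ Ok p.1 p.1 :=
    fun s p hp => by
      have hw := wt_le s.2 (mm_nonneg p.2) (mm_le p.2)
      refine ⟨⟨hp.1.imp_right fun h => ?_, ?_, hp.2.2.D2 fun h => by rw [mm_one h]; ring⟩, Or.inl rfl⟩
      · rw [h] at hw ⊢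
        simp only [D2, ee_neg_I]
        rw [mm_zero ee_neg_I, mul_zero, add_zero]
        rw [bet_eq] <;> simp [s.2.1]
      · simp only [D2_re]
        rw [abs_mul, abs_of_nonneg hw.1]
        nlinarith [hp.2.1, abs_nonneg p.2.re]
  have h3 : ∀ s : I, ∀ p ∈ Q1, (((1 - (s : ℝ) : ℝ) * p.1 + ((s : ℝ) * th (p.2 + Complex.I + bet p.1) : ℝ) *
      (p.2 + Complex.I + bet p.1), om p.2) : ℂ × ℂ) ∈ Q1 ∧ Ok p.1 ((1 - (s : ℝ) : ℝ) * p.1 +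
        ((s : ℝ) * th (p.2 + Complex.I + bet p.1) : ℝ) * (p.2 + Complex.I + bet p.1)) := fun s p hp => by
    rcases hp.1 with h | h
    · rw [hb0 p hp h, h, mul_zero, zero_add]
      refine ⟨⟨(om_or p.2).imp_left fun h => by simp [h], om_re_lt _, hp.2.2.om⟩, Or.inr ⟨by simp, ?_⟩⟩
      rw [Complex.re_ofReal_mul]
      exact abs_mul_le ⟨mul_nonneg s.2.1 (th_nonneg _),
        mul_le_one₀ s.2.2 (th_nonneg _) (th_le _)⟩ (by linarith [hp.2.1])
    · rw [hb1 p hp h, h]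
      refine ⟨⟨Or.inr (om_of_ee ee_neg_I), om_re_lt _, (h ▸ hp.2.2).om⟩, ok_of (fun h => ?_) fun h => ?_⟩
      · rw [bet_self h, th_one h]; push_cast; ring
      · rw [Complex.add_re, Complex.re_ofReal_mul, Complex.re_ofReal_mul, bet_re, ← add_mul]
        exact abs_mul_le (wt_le s.2 (th_nonneg _) (th_le _)) (by linarith)
  have hom : ∀ p ∈ Q1, om (p.2 + Complex.I + bet p.1) = om p.2 := fun p hp => by
    rcases hp.1 with h | h
    · rw [hb0 p hp h]
    · rw [hb1 p hp h, h, om_of_ee ee_neg_I, om_of_ee]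
      rw [ee, bet_re, bet_im]
      rcases le_total 3 |p.1.re| with h3 | h3
      · rw [rho_zero h3, zero_mul]
      · rw [phi_one h3, pos_zero (y := p.1.im - 1 * pos p.1.im), mul_zero]
        linarith [le_pos p.1.im]
  have hab : ∀ p ∈ Q1, ka (kb p) ∈ Q1 ∧ Ok p.1 (ka (kb p)).1 := fun p hp => by
    have := h3 1 p hp
    simp only [Set.Icc.coe_one, sub_self, Complex.ofReal_zero, zero_mul, zero_add, one_mul] at this
    rw [← hom p hp] at this
    exact this
  have c1 : Continuous fun p : ℝ × ℂ × ℂ => ((p.2.1, D1 p.1 p.2.2) : ℂ × ℂ) := by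
    unfold D1 phi rho pos; fun_prop
  have := continuous_th
  have := continuous_mm
  have := continuous_ee
  have := continuous_bet
  have := continuous_om
  have c2 : Continuous fun p : ℝ × ℂ × ℂ =>
      ((p.2.1, D2 (1 - p.1 + p.1 * mm p.2.2) p.2.2) : ℂ × ℂ) := by unfold D2; fun_prop
  have c11 : Continuous fun p : ℂ × ℂ => ((p.1, D1 1 p.2) : ℂ × ℂ) :=
    c1.comp (f := fun p : ℂ × ℂ => ((1 : ℝ), p)) (by fun_prop)
  have c22 : Continuous fun p : ℂ × ℂ => ((p.1, om p.2) : ℂ × ℂ) := by fun_prop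
  have hom' : ∀ p ∈ Q1, ((p.1, om p.2) : ℂ × ℂ) ∈ Q1 ∧ Ok p.1 p.1 := fun p hp => by
    simpa [D2_mm] using h2 1 p hp
  have e0 : ContinuousMap.id (Tot b m Q1) = lift hb continuous_id hid := by
    ext1 p; exact Subtype.ext (Prod.ext rfl (S.tr_self _ _).symm)
  rw [lift_comp hb _ _ _ _ hab, e0]
  refine .symm (.trans (homotopic_lift hb (H := fun s p => (p.1, D1 s p.2)) c1 (fun s => h1 s)
    continuous_id hid c11 (h1 1) (fun p hp => by simp [D1]) fun _ _ => rfl)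
    (.trans (homotopic_lift hb (H := fun s p => (p.1, D2 (1 - s + s * mm p.2) p.2)) c2 h2
      c11 (h1 1) c22 hom' (fun p hp => by simp [D2_one]) fun p hp => by simp [D2_mm])
    (homotopic_lift hb (H := fun s p => ((1 - s : ℝ) * p.1 + (s * th (p.2 + Complex.I + bet p.1) : ℝ) *
      (p.2 + Complex.I + bet p.1), om p.2)) (by fun_prop) h3 c22 hom' _ hab (fun p hp => by simp)
      fun p hp => ?_)))
  simp only [sub_self, Complex.ofReal_zero, zero_mul, zero_add, one_mul, ← hom p hp]
  rfl

/-- Removing two fibres amounts to attaching a factor along the central fibre. -/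
theorem nonempty_homotopyEquiv : Nonempty (ContinuousMap.HomotopyEquiv (Tot b m Q0) (Tot b m Q1)) :=
  ⟨⟨lift hb continuous_ka ka_mem, lift hb continuous_kb kb_mem, homotopic_kb_ka hb,
    homotopic_ka_kb hb⟩⟩

end Pencil

end

section

open unitInterval Topology
open Filter (Tendsto Eventually eventually_all)

/-! ### Homogeneous coordinates -/

lemma exists_rep {x : E3} (hx : x ≠ 0) : ∃ c : ℂ, c ≠ 0 ∧ (mk ℂ x hx).rep = c • x := by
  obtain ⟨a, ha⟩ := exists_smul_eq_mk_rep ℂ x hx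
  exact ⟨a, a.ne_zero, ha.symm⟩

lemma isQuotientMap_mk : IsQuotientMap fun v : {v : E3 // v ≠ 0} => mk ℂ v.1 v.2 :=
  isQuotientMap_quotient_mk'

/-- Functions homogeneous of degree zero are continuous on the projective plane. -/
lemma continuousOn_rep {Z : Type*} [TopologicalSpace Z] (f : E3 →L[ℂ] ℂ) {c : E3 → Z}
    (hc : ContinuousOn c {x | f x ≠ 0}) (hs : ∀ a : ℂ, a ≠ 0 → ∀ x, c (a • x) = c x) :
    ContinuousOn (fun p : CP2 => c p.rep) {p | f p.rep ≠ 0} := by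
  have hpre : ∀ v : {v : E3 // v ≠ 0}, f (mk ℂ v.1 v.2).rep ≠ 0 ↔ f v.1 ≠ 0 := fun v => by
    obtain ⟨a, ha, e⟩ := exists_rep v.2
    simp [e, ha]
  have ho : IsOpen {p : CP2 | f p.rep ≠ 0} := by
    rw [← isQuotientMap_mk.isOpen_preimage]
    have : (fun v : {v : E3 // v ≠ 0} => mk ℂ v.1 v.2) ⁻¹' {p : CP2 | f p.rep ≠ 0} =
        {v | f v.1 ≠ 0} := Set.ext hpre
    rw [this]
    exact isOpen_ne_fun (by fun_prop) continuous_const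
  refine (isQuotientMap_mk.continuousOn_isOpen_iff ho).2 ?_
  refine (hc.comp continuous_subtype_val.continuousOn fun v hv => (hpre v).1 hv).congr fun v _ => ?_
  obtain ⟨a, ha, e⟩ := exists_rep v.2
  simp [e, hs a ha]

namespace Arr

variable {ι : Type*} [Fintype ι] [DecidableEq ι] (A : Arr ι)

/-- The complement in the projective plane. -/
def Mc : Set CP2 := {p | ∀ i, A.f i p.rep ≠ 0}

variable {A}

lemma mk_mem {x : E3} (hx : x ∈ A.M) (h0 : x ≠ 0) : Projectivization.mk ℂ x h0 ∈ A.Mc := fun i => by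
  obtain ⟨c, hc, e⟩ := exists_rep h0
  rw [e, map_smul]
  exact mul_ne_zero hc (hx i)

lemma ne_zero (x : A.M) : x.1 ≠ 0 := ne_zero_of_mem_M x.2

/-- The projection of the cone. -/
def toMc : C(A.M, A.Mc) where
  toFun x := ⟨Projectivization.mk ℂ x.1 (ne_zero x), mk_mem x.2 _⟩
  continuous_toFun := Continuous.subtype_mk (isQuotientMap_mk.continuous.comp
    (Continuous.subtype_mk continuous_subtype_val ne_zero)) _

variable (k : ι)

/-- The affine chart in which `f k = 1`. -/
def chart : C(A.Mc, A.M) where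
  toFun p := ⟨(A.f k p.1.rep)⁻¹ • p.1.rep, fun i => by
    rw [map_smul]; exact mul_ne_zero (inv_ne_zero (p.2 k)) (p.2 i)⟩
  continuous_toFun := by
    have h := continuousOn_rep (A.f k) (c := fun x => (A.f k x)⁻¹ • x)
      (ContinuousOn.smul (ContinuousOn.inv₀ (by fun_prop) fun x hx => hx) (by fun_prop))
      fun a ha x => by
        rw [map_smul, smul_smul, smul_eq_mul, mul_inv, mul_right_comm, inv_mul_cancel₀ ha, one_mul]
    exact Continuous.subtype_mk (h.comp_continuous continuous_subtype_val fun p : A.Mc => p.2 k) _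

lemma f_chart (p : A.Mc) : A.f k (chart k p).1 = 1 := by
  simp [chart, inv_mul_cancel₀ (p.2 k)]

lemma toMc_smul {c : ℂ} {x : A.M} {y : A.M} (h : y.1 = c • x.1) : toMc y = toMc x :=
  Subtype.ext ((mk_eq_mk_iff' ℂ _ _ (ne_zero y) (ne_zero x)).2 ⟨c, h.symm⟩)

lemma toMc_chart (p : A.Mc) : toMc (chart k p) = p := by
  refine Subtype.ext (Eq.trans ?_ (mk_rep p.1))
  exact (mk_eq_mk_iff' ℂ _ _ (ne_zero _) p.1.rep_nonzero).2 ⟨_, rfl⟩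

lemma smul_chart (x : A.M) : A.f k x.1 • (chart k (toMc x)).1 = x.1 := by
  obtain ⟨c, hc, e⟩ := exists_rep (ne_zero x)
  have h : ((toMc x).1 : CP2).rep = c • x.1 := e
  have := x.2 k
  simp only [chart, ContinuousMap.coe_mk, h, map_smul, smul_smul, smul_eq_mul]
  rw [show A.f k x.1 * ((c * A.f k x.1)⁻¹ * c) = 1 by field_simp, one_smul]

variable {B : Arr ι}

open Classical in
/-- The homogeneous lift of a map of complements. -/
def cone (φ : C(B.Mc, A.Mc)) (x : E3) : E3 :=
  if h : x ∈ B.M then B.f k x • (chart k (φ (toMc ⟨x, h⟩))).1 else 0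

lemma cone_eq (φ : C(B.Mc, A.Mc)) (x : B.M) : cone k φ x = B.f k x • (chart k (φ (toMc x))).1 := by
  rw [cone, dif_pos x.2]

lemma cone_mem (φ : C(B.Mc, A.Mc)) (x : B.M) : cone k φ x ∈ A.M := fun i => by
  rw [cone_eq, map_smul]
  exact mul_ne_zero (x.2 k) ((chart k _).2 i)

lemma cone_cone {φ : C(B.Mc, A.Mc)} {φ' : C(A.Mc, B.Mc)} (h : ∀ p, φ' (φ p) = p) (x : B.M) :
    cone k φ' (cone k φ x) = x := by
  have e := toMc_smul (x := chart k (φ (toMc x))) (y := ⟨_, cone_mem k φ x⟩) (cone_eq k φ x)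
  rw [toMc_chart] at e
  have e' : A.f k (cone k φ x) = B.f k x := by
    rw [cone_eq, map_smul, f_chart, smul_eq_mul, mul_one]
  rw [cone_eq k φ' ⟨_, cone_mem k φ x⟩, e, h, e', smul_chart]

lemma continuousOn_cone (φ : C(B.Mc, A.Mc)) : ContinuousOn (cone k φ) B.M := by
  rw [continuousOn_iff_continuous_domRestrict]
  have : B.M.domRestrict (cone k φ) = fun x : B.M => B.f k x • (chart k (φ (toMc x))).1 :=
    funext (cone_eq k φ)
  rw [this]
  exact ((B.f k).continuous.comp continuous_subtype_val).smul
    (continuous_subtype_val.comp ((chart k).comp (φ.comp toMc)).continuous)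

lemma cone_smul (φ : C(B.Mc, A.Mc)) {x : E3} (hx : x ∈ B.M) {c : ℂ} (hc : c ≠ 0) :
    cone k φ (c • x) = c • cone k φ x := by
  have hcx := smul_mem_M hx hc
  rw [cone_eq k φ ⟨x, hx⟩, cone_eq k φ ⟨_, hcx⟩, toMc_smul (x := ⟨x, hx⟩) (y := ⟨_, hcx⟩) rfl,
    map_smul, smul_eq_mul, mul_smul]

/-- Homeomorphisms of complements lift to the cones. -/
def ConeIso.ofHomeomorph (H : A.Mc ≃ₜ B.Mc) : ConeIso A B where
  g := cone k (H.symm : C(B.Mc, A.Mc))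
  g' := cone k (H : C(A.Mc, B.Mc))
  mem x hx := cone_mem k _ ⟨x, hx⟩
  mem' x hx := cone_mem k _ ⟨x, hx⟩
  left x hx := cone_cone k (by simp) ⟨x, hx⟩
  right x hx := cone_cone k (by simp) ⟨x, hx⟩
  cont := continuousOn_cone k _
  cont' := continuousOn_cone k _
  smul x hx c hc := cone_smul k _ hx hc
  smul' x hx c hc := cone_smul k _ hx hc

end Arr

end

section

open unitInterval Topology
open Filter (Tendsto Eventually eventually_all)

namespace Arr

variable {ι : Type*} [Fintype ι] [DecidableEq ι] {A : Arr ι}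

lemma exists_d_ne_zero {i j : ι} (h : i ≠ j) : ∃ k, A.d k i j ≠ 0 := by
  obtain ⟨s, hs, hi, hj⟩ := A.exists_flat h
  obtain ⟨k, hk, -⟩ := hs.exists_notMem ∅ (by simp)
  exact ⟨k, fun h0 => hk ((hs.d_eq_zero_iff hi hj h k).1 ((d_rot A k i j).trans h0))⟩

/-- The intersection lattice is determined by the triple points. -/
lemma exists_common_iff {s : Set ι} : (∃ p : CP2, ∀ i ∈ s, A.f i p.rep = 0) ↔
    ∀ i ∈ s, ∀ j ∈ s, ∀ k ∈ s, i ≠ j → j ≠ k → i ≠ k → {i, j, k} ∈ A.T := by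
  constructor
  · rintro ⟨p, hp⟩ i hi j hj k hk h1 h2 h3
    rw [← A.det i j k h1 h2 h3]
    by_contra hd
    apply p.rep_nonzero
    rw [A.eq_sum_D hd p.rep, hp i hi, hp j hj, hp k hk]
    simp
  · intro h
    have key : ∀ i j, i ≠ j → (∀ m ∈ s, A.d m i j = 0) → ∃ p : CP2, ∀ i ∈ s, A.f i p.rep = 0 := by
      intro i j hij hm
      obtain ⟨k, hk⟩ := A.exists_d_ne_zero hij
      have h0 : A.D k i j ≠ 0 := fun h0 => by
        have := A.f_D k i j k
        rw [h0, map_zero, div_self hk] at this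
        simp at this
      obtain ⟨c, -, hc⟩ := exists_rep h0
      refine ⟨Projectivization.mk ℂ _ h0, fun m hms => ?_⟩
      rw [hc, map_smul, f_D, hm m hms]
      simp
    have hne : ∀ i : ι, ∃ j, i ≠ j := fun i => by
      obtain ⟨j, hj, -⟩ := (A.isFlat_single i).exists_notMem ∅ (by simp)
      exact ⟨j, fun e => hj (by simp [e])⟩
    by_cases hs : s.Subsingleton
    · obtain ⟨i, hi⟩ : ∃ i, s ⊆ {i} := by
        rcases hs.eq_empty_or_singleton with rfl | ⟨i, rfl⟩
        · exact ⟨(Fintype.card_pos_iff.1 (by linarith [A.card])).some, by simp⟩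
        · exact ⟨i, le_rfl⟩
      obtain ⟨j, hj⟩ := hne i
      exact key i j hj fun m hm => by rw [hi hm, d_self]
    · obtain ⟨i, hi, j, hj, hij⟩ := Set.not_subsingleton_iff.1 hs
      refine key i j hij fun m hm => ?_
      by_cases h1 : m = i
      · rw [h1, d_self]
      by_cases h2 : m = j
      · rw [h2, d_self_out]
      exact (A.det m i j h1 hij h2).2 (h m hm i hi j hj h1 hij h2)

lemma f_injective {i j : ι} (h : ∀ p : CP2, A.f i p.rep = 0 → A.f j p.rep = 0) : i = j := by
  by_contra hij
  obtain ⟨k, hk⟩ := A.exists_d_ne_zero hij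
  have hd : A.d j k i ≠ 0 := by rwa [d_rot A i j k, d_rot A k i j]
  have h0 : A.D j k i ≠ 0 := fun h0 => by
    have := A.f_D j k i j
    rw [h0, map_zero, div_self hd] at this
    simp at this
  obtain ⟨c, hc, e⟩ := exists_rep h0
  have := h _ (by rw [e, map_smul, f_D, d_self_out]; simp)
  rw [e, map_smul, f_D, div_self hd] at this
  simp [hc] at this

end Arr

namespace Example

/-! ### The homotopy equivalence -/

/-- A form transverse to the lines of the arrangement. -/
def lam (b : Bool) : ℤ × ℤ × ℤ := bif b then (-2, -1, 0) else (-3, -2, -2)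

def axis : ℤ × ℤ × ℤ := (9, -6, -1)

lemma dz_frame (b : Bool) : dz (lam b) axis (row b 3) ≠ 0 := by cases b <;> decide

lemma det_frame (b : Bool) : det3 (lr (lam b)) (lr axis) (lr (row b 3)) ≠ 0 := by
  rw [det3_lr]; exact_mod_cast dz_frame b

/-- Affine coordinates off the line of index `3`. -/
def co (b : Bool) (x : E3) : ℂ × ℂ :=
  (2000 * lf (lr axis) x / lf (lr (row b 3)) x, lf (lr (lam b)) x / lf (lr (row b 3)) x)

/-- The point with given affine coordinates. -/
def pt (b : Bool) (q : ℂ × ℂ) : E3 :=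
  q.2 • dv (lr (lam b)) (lr axis) (lr (row b 3)) +
    (q.1 / 2000) • dv (lr axis) (lr (row b 3)) (lr (lam b)) +
      dv (lr (row b 3)) (lr (lam b)) (lr axis)

lemma lf_pt (b : Bool) (q : ℂ × ℂ) : lf (lr (lam b)) (pt b q) = q.2 ∧
    lf (lr axis) (pt b q) = q.1 / 2000 ∧ lf (lr (row b 3)) (pt b q) = 1 := by
  have h := det_frame b
  have h1 := det3_rot (lr (lam b)) (lr axis) (lr (row b 3))
  have h2 := det3_rot (lr axis) (lr (row b 3)) (lr (lam b))
  have s1 : ∀ a c : Fin 3 → ℝ, det3 a c a = 0 := fun a c => by rw [det3_rot, det3_self]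
  simp only [pt, map_add, map_smul, lf_dv, smul_eq_mul, det3_self, s1, zero_div,
    Complex.ofReal_zero, mul_zero, add_zero, zero_add, div_self h, div_self (h1 ▸ h),
    div_self (h2 ▸ h1 ▸ h), Complex.ofReal_one, mul_one, and_self]

lemma co_pt (b : Bool) (q : ℂ × ℂ) : co b (pt b q) = q := by
  obtain ⟨h1, h2, h3⟩ := lf_pt b q
  rw [co, h1, h2, h3]
  ext <;> simp
  field_simp

lemma pt_co {b : Bool} {x : E3} (h : lf (lr (row b 3)) x ≠ 0) :
    pt b (co b x) = (lf (lr (row b 3)) x)⁻¹ • x := by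
  have e := congrArg ((lf (lr (row b 3)) x)⁻¹ • ·) (eq_sum_dv (det_frame b) x)
  refine Eq.trans ?_ e.symm
  simp only [pt, co, smul_add, smul_smul]
  congr 1
  · congr 2
    · ring
    · field_simp
  · rw [inv_mul_cancel₀ h, one_smul]

lemma co_smul (b : Bool) {a : ℂ} (ha : a ≠ 0) (x : E3) : co b (a • x) = co b x := by
  simp only [co, map_smul, smul_eq_mul]
  rw [mul_left_comm, mul_div_mul_left _ _ ha, mul_div_mul_left _ _ ha]

lemma continuousOn_co (b : Bool) : ContinuousOn (co b) {x | lf (lr (row b 3)) x ≠ 0} := by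
  unfold co
  exact (ContinuousOn.div (by fun_prop) (by fun_prop) fun x hx => hx).prodMk
    (ContinuousOn.div (by fun_prop) (by fun_prop) fun x hx => hx)

lemma continuous_pt (b : Bool) : Continuous (pt b) := by unfold pt; fun_prop

def J : Type := {j : Fin 28 // j ≠ 3 ∧ j < 26}

variable (b : Bool)

def pz (j : J) : ℤ := dz (row b j.1) axis (row b 3)
def qz (j : J) : ℤ := dz (lam b) (row b j.1) (row b 3)
def rz (j : J) : ℤ := dz (lam b) axis (row b j.1)

/-- Intercepts and slopes of the lines in affine coordinates. -/
def icpt (j : J) : ℝ := -(rz b j / pz b j)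
def slp (j : J) : ℝ := -(qz b j / (2000 * pz b j))

lemma pz_ne_zero (j : J) : pz b j ≠ 0 := by
  have h : ∀ b : Bool, ∀ j : Fin 28, j ≠ 3 → j < 26 →
      dz (row b j) axis (row b 3) ≠ 0 := by decide +kernel
  exact h b j.1 j.2.1 j.2.2

lemma slp_sub_le (j k : J) : |slp b j - slp b k| ≤ 1 / 6 * |icpt b j - icpt b k| := by
  have h : ∀ b : Bool, ∀ j k : Fin 28, j ≠ 3 → k ≠ 3 → j < 26 → k < 26 →
      6 * |dz (lam b) (row b j) (row b 3) * dz (row b k) axis (row b 3) -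
        dz (lam b) (row b k) (row b 3) * dz (row b j) axis (row b 3)| ≤
      2000 * |dz (lam b) axis (row b j) * dz (row b k) axis (row b 3) -
        dz (lam b) axis (row b k) * dz (row b j) axis (row b 3)| := by decide +kernel
  have h : 6 * |(qz b j * pz b k - qz b k * pz b j : ℝ)| ≤
      2000 * |(rz b j * pz b k - rz b k * pz b j : ℝ)| := by
    exact_mod_cast h b j.1 k.1 j.2.1 k.2.1 j.2.2 k.2.2
  have hj : (pz b j : ℝ) ≠ 0 := by exact_mod_cast pz_ne_zero b j
  have hk : (pz b k : ℝ) ≠ 0 := by exact_mod_cast pz_ne_zero b k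
  have e1 : slp b j - slp b k =
      -((qz b j * pz b k - qz b k * pz b j) / (2000 * (pz b j * pz b k))) := by
    simp only [slp]; field_simp; ring
  have e2 : icpt b j - icpt b k = -((rz b j * pz b k - rz b k * pz b j) / (pz b j * pz b k)) := by
    simp only [icpt]; field_simp; ring
  have hp : 0 < |(pz b j * pz b k : ℝ)| := abs_pos.2 (mul_ne_zero hj hk)
  rw [e1, e2, abs_neg, abs_neg, abs_div, abs_div, abs_mul (2000 : ℝ), abs_of_pos (by norm_num : (0 : ℝ) < 2000),
    div_le_iff₀ (by positivity)]
  rw [show ∀ x y : ℝ, 1 / 6 * (x / y) * (2000 * y) = 2000 * x / 6 * (y / y) from fun x y => by ring,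
    div_self hp.ne']
  linarith

lemma exists_slope : ∃ S : Pencil.Slope, ∀ j, S.g (icpt b j) = slp b j := by
  have hf : (slp b).FactorsThrough (icpt b) := fun j k e => by
    have := slp_sub_le b j k
    rw [e, sub_self, abs_zero, mul_zero] at this
    exact sub_eq_zero.1 (abs_nonpos_iff.1 this)
  have hl : LipschitzOnWith (1 / 6) (Function.extend (icpt b) (slp b) 0) (Set.range (icpt b)) := by
    refine LipschitzOnWith.of_dist_le_mul ?_
    rintro _ ⟨j, rfl⟩ _ ⟨k, rfl⟩
    rw [hf.extend_apply, hf.extend_apply, Real.dist_eq, Real.dist_eq]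
    exact_mod_cast slp_sub_le b j k
  obtain ⟨g, hg, he⟩ := hl.extend_real
  refine ⟨⟨g, fun x y => ?_⟩, fun j => ?_⟩
  · have := hg.dist_le_mul x y
    rw [Real.dist_eq, Real.dist_eq] at this
    refine this.trans (le_of_eq ?_)
    push_cast; ring
  · exact (he ⟨j, rfl⟩).symm.trans (hf.extend_apply _ _)

variable {b}

lemma forall_ne_iff {x : E3} (hx : lf (lr (row b 3)) x ≠ 0) :
    (∀ j : Fin 28, j < 26 → lf (lr (row b j)) x ≠ 0) ↔
      ∀ j : J, (co b x).2 ≠ icpt b j + slp b j * (co b x).1 := by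
  have key : ∀ j : J, lf (lr (row b j.1)) x = (pz b j / dz (lam b) axis (row b 3) : ℂ) *
      lf (lr (row b 3)) x * ((co b x).2 - (icpt b j + slp b j * (co b x).1)) := fun j => by
    have hp : (pz b j : ℂ) ≠ 0 := by exact_mod_cast pz_ne_zero b j
    have hd : (dz (lam b) axis (row b 3) : ℂ) ≠ 0 := by exact_mod_cast dz_frame b
    rw [lf_cramer (det_frame b)]
    simp only [det3_lr, co, icpt, slp]
    rw [show dz (row b j.1) axis (row b 3) = pz b j from rfl,
      show dz (lam b) (row b j.1) (row b 3) = qz b j from rfl,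
      show dz (lam b) axis (row b j.1) = rz b j from rfl]
    push_cast
    field_simp
    ring
  have hj : ∀ j : J, lf (lr (row b j.1)) x ≠ 0 ↔
      (co b x).2 ≠ icpt b j + slp b j * (co b x).1 := fun j => by
    rw [key, ← sub_ne_zero (a := (co b x).2)]
    refine ⟨right_ne_zero_of_mul, mul_ne_zero (mul_ne_zero (div_ne_zero ?_ ?_) hx)⟩
    · exact_mod_cast pz_ne_zero b j
    · exact_mod_cast dz_frame b
  refine ⟨fun h j => (hj j).1 (h j.1 j.2.2), fun h j hj26 => ?_⟩
  by_cases h3 : j = 3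
  · rw [h3]; exact hx
  · exact (hj ⟨j, h3, hj26⟩).2 (h _)

lemma lf_last (x : E3) : lf (lr (row b 26)) x = 2000 * lf (lr axis) x - lf (lr (row b 3)) x ∧
    lf (lr (row b 27)) x = 2000 * lf (lr axis) x + lf (lr (row b 3)) x := by
  cases b <;> simp [lf_apply, lr, row, axis, blockP, blockN] <;> constructor <;> ring

lemma np_iff {x : E3} (hx : lf (lr (row b 3)) x ≠ 0) : Pencil.Np (co b x).1 ↔
    lf (lr (row b 26)) x ≠ 0 ∧ lf (lr (row b 27)) x ≠ 0 := by
  have h1 : Pencil.Np (co b x).1 ↔ (co b x).1 ≠ 1 ∧ (co b x).1 ≠ -1 := by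
    rw [Pencil.Np, Ne, Ne, Ne, Complex.ext_iff, Complex.ext_iff, abs_eq zero_le_one]
    simp only [Complex.one_re, Complex.one_im, Complex.neg_re, Complex.neg_im, neg_zero]
    tauto
  rw [h1, (lf_last x).1, (lf_last x).2]
  simp only [co, Ne, div_eq_iff hx, one_mul, neg_one_mul, sub_eq_zero, add_eq_zero_iff_eq_neg]

lemma mem_M_iff {x : E3} (hx : lf (lr (row b 3)) x ≠ 0) : x ∈ (arr b).M ↔
    Pencil.Np (co b x).1 ∧ ∀ j : J, (co b x).2 ≠ icpt b j + slp b j * (co b x).1 := by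
  rw [np_iff hx, ← forall_ne_iff hx]
  constructor
  · exact fun h => ⟨⟨h 26, h 27⟩, fun j _ => h j⟩
  · rintro ⟨⟨h, h'⟩, h0⟩ j
    rcases (by omega : j < 26 ∨ j = 26 ∨ j = 27) with h1 | rfl | rfl
    exacts [h0 j h1, h, h']

variable (b)

lemma mem_M_pt {q : (ℂ × ℂ) × ℂ} (hq : q ∈ Pencil.Tot (icpt b) (slp b) Pencil.Q0) :
    pt b (q.1.1, q.2) ∈ (arr b).M := by
  rw [mem_M_iff (by rw [(lf_pt b _).2.2]; exact one_ne_zero), co_pt]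
  exact ⟨hq.1.1, hq.2⟩

/-- The complement in affine coordinates. -/
def affine : (arr b).Mc ≃ₜ Pencil.Tot (icpt b) (slp b) Pencil.Q0 where
  toFun p := ⟨(((co b p.1.rep).1, 0), (co b p.1.rep).2),
    ⟨((mem_M_iff (p.2 3)).1 p.2).1, rfl⟩, ((mem_M_iff (p.2 3)).1 p.2).2⟩
  invFun q := Arr.toMc ⟨pt b (q.1.1.1, q.1.2), mem_M_pt b q.2⟩
  left_inv p := by
    refine Eq.trans (congrArg Arr.toMc (Subtype.ext ?_)) (Arr.toMc_chart 3 p)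
    exact pt_co (p.2 3)
  right_inv := by
    rintro ⟨⟨⟨t, w⟩, y⟩, hq⟩
    obtain ⟨a, ha, e⟩ := exists_rep (Arr.ne_zero_of_mem_M (mem_M_pt b hq))
    have hw : w = 0 := hq.1.2
    refine Subtype.ext ?_
    change (((co b (Projectivization.mk ℂ (pt b (t, y)) _).rep).1, (0 : ℂ)),
      (co b (Projectivization.mk ℂ (pt b (t, y)) _).rep).2) = ((t, w), y)
    rw [e, co_smul b ha, co_pt, hw]
  continuous_toFun := by
    have h := (continuousOn_rep (lf (lr (row b 3))) (continuousOn_co b)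
      fun a ha x => co_smul b ha x).comp_continuous continuous_subtype_val
      fun p : (arr b).Mc => p.2 3
    exact Continuous.subtype_mk ((h.fst.prodMk continuous_const).prodMk h.snd) _
  continuous_invFun := Arr.toMc.continuous.comp
    (Continuous.subtype_mk ((continuous_pt b).comp (by fun_prop)) _)

lemma row_mem (b b' : Bool) {x : E3} (h : ∀ j : Fin 28, j < 26 → lf (lr (row b j)) x ≠ 0)
    (j : Fin 28) (hj : j < 26) : lf (lr (row b' j)) x ≠ 0 := by
  have hr : ∀ b b' : Bool, ∀ j : Fin 28, j < 26 → ∃ k : Fin 28, k < 26 ∧ row b' j = row b k := by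
    decide +kernel
  obtain ⟨k, hk, e⟩ := hr b b' j hj
  rw [e]
  exact h k hk

variable {b}

lemma mem_Tot_co (b' : Bool) {q : (ℂ × ℂ) × ℂ}
    (hq : q ∈ Pencil.Tot (icpt b) (slp b) Pencil.Q1) : lf (lr (row b' 3)) (pt b (q.1.1, q.2)) ≠ 0 ∧
    (((co b' (pt b (q.1.1, q.2))).1, q.1.2), (co b' (pt b (q.1.1, q.2))).2) ∈
      Pencil.Tot (icpt b') (slp b') Pencil.Q1 := by
  obtain ⟨-, h2, h3⟩ := lf_pt b (q.1.1, q.2)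
  have h := (forall_ne_iff (b := b) (x := pt b (q.1.1, q.2)) (by rw [h3]; exact one_ne_zero)).2
    (by rw [co_pt]; exact hq.2)
  have h' := row_mem b b' h
  have h0 : lf (lr (row b' 3)) (pt b (q.1.1, q.2)) ≠ 0 := h' 3 (by decide)
  refine ⟨h0, ⟨hq.1.1.imp (fun e => ?_) id, hq.1.2⟩, (forall_ne_iff h0).1 h'⟩
  change 2000 * lf (lr axis) _ / _ = 0
  rw [h2, e]
  simp

/-- The change of affine coordinates. -/
def coChange (b b' : Bool) : C(Pencil.Tot (icpt b) (slp b) Pencil.Q1,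
    Pencil.Tot (icpt b') (slp b') Pencil.Q1) where
  toFun q := ⟨_, (mem_Tot_co b' q.2).2⟩
  continuous_toFun := by
    have h := (continuousOn_co b').comp_continuous
      (f := fun q : Pencil.Tot (icpt b) (slp b) Pencil.Q1 => pt b (q.1.1.1, q.1.2))
      ((continuous_pt b).comp (by fun_prop)) fun q => (mem_Tot_co b' q.2).1
    exact Continuous.subtype_mk ((h.fst.prodMk (by fun_prop)).prodMk h.snd) _

lemma coChange_coChange (b b' : Bool) (q : Pencil.Tot (icpt b) (slp b) Pencil.Q1) :
    coChange b' b (coChange b b' q) = q := by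
  have h := (mem_Tot_co b' q.2).1
  have e : co b (pt b' (co b' (pt b (q.1.1.1, q.1.2)))) = (q.1.1.1, q.1.2) := by
    rw [pt_co h, co_smul b (inv_ne_zero h), co_pt]
  refine Subtype.ext ?_
  simp only [coChange, ContinuousMap.coe_mk, Prod.mk.eta, e]

theorem nonempty_homotopyEquiv :
    Nonempty (ContinuousMap.HomotopyEquiv (arr true).Mc (arr false).Mc) := by
  have h : ∀ b, Nonempty (ContinuousMap.HomotopyEquiv (arr b).Mc
      (Pencil.Tot (icpt b) (slp b) Pencil.Q1)) := fun b => by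
    obtain ⟨S, hS⟩ := exists_slope b
    obtain ⟨e⟩ := Pencil.nonempty_homotopyEquiv hS
    exact ⟨(affine b).toHomotopyEquiv.trans e⟩
  obtain ⟨e⟩ := h true
  obtain ⟨e'⟩ := h false
  let m : Pencil.Tot (icpt true) (slp true) Pencil.Q1 ≃ₜ
      Pencil.Tot (icpt false) (slp false) Pencil.Q1 :=
    ⟨⟨coChange true false, coChange false true, coChange_coChange _ _, coChange_coChange _ _⟩,
      (coChange _ _).continuous, (coChange _ _).continuous⟩
  exact ⟨(e.trans m.toHomotopyEquiv).trans e'.symm⟩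

/-! ### The two sets of lines -/

def line (b : Bool) (i : Fin 28) : Set CP2 :=
  projLine (row b i).1 (row b i).2.1 (row b i).2.2

lemma mem_line {b : Bool} {i : Fin 28} {p : CP2} : p ∈ line b i ↔ (arr b).f i p.rep = 0 := by
  change _ ↔ lf (lr (row b i)) p.rep = 0
  rw [lf_apply, line, projLine, Set.mem_ofPred_eq]
  simp [lr]

lemma line_injective (b : Bool) : Function.Injective (line b) := fun _ _ e =>
  (arr b).f_injective fun _ hp => mem_line.1 (e ▸ mem_line.2 hp)

lemma isProjLine (b : Bool) (i : Fin 28) : IsProjLine (line b i) := by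
  refine ⟨_, _, _, ?_, rfl⟩
  have h : ∀ b : Bool, ∀ i : Fin 28, row b i ≠ 0 := by decide +kernel
  rintro ⟨h1, h2, h3⟩
  exact h b i (Prod.ext (by exact_mod_cast h1) (Prod.ext (by exact_mod_cast h2) (by exact_mod_cast h3)))

lemma compl_eq (b : Bool) : (⋃ L ∈ Set.range (line b), L)ᶜ = (arr b).Mc := by
  ext p
  simp [mem_line, Arr.Mc]

end Example

end

/-- There exist lattice-isomorphic line arrangements `𝔄₁`, `𝔄₂` in `ℂℙ²` whose
complements are homotopy equivalent but not homeomorphic. -/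
theorem statement13 :
    ∃ (A₁ A₂ : Set (Set CP2)) (φ : A₁ ≃ A₂),
      A₁.Finite ∧ A₂.Finite ∧
      (∀ L ∈ A₁, IsProjLine L) ∧ (∀ L ∈ A₂, IsProjLine L) ∧
      -- (1): `φ` is a lattice isomorphism: a family of lines in `𝔄₁` has a common
      -- point iff its image under `φ` has a common point
      (∀ S : Set A₁, (∃ p : CP2, ∀ L ∈ S, p ∈ (L : Set CP2)) ↔
        (∃ p : CP2, ∀ L ∈ S, p ∈ (φ L : Set CP2))) ∧
      -- (2): the complements are homotopy equivalent
      Nonempty (ContinuousMap.HomotopyEquiv (↥((⋃ L ∈ A₁, L)ᶜ)) (↥((⋃ L ∈ A₂, L)ᶜ))) ∧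
      -- (3): the complements are not homeomorphic
      ¬ Nonempty ((↥((⋃ L ∈ A₁, L)ᶜ)) ≃ₜ (↥((⋃ L ∈ A₂, L)ᶜ))) := by
  refine ⟨Set.range (Example.line true), Set.range (Example.line false),
    (Equiv.ofInjective _ (Example.line_injective true)).symm.trans
      (Equiv.ofInjective _ (Example.line_injective false)), Set.finite_range _, Set.finite_range _,
    ?_, ?_, fun S => ?_, ?_, ?_⟩
  · rintro _ ⟨i, rfl⟩; exact Example.isProjLine true i
  · rintro _ ⟨i, rfl⟩; exact Example.isProjLine false i
  · set e := Equiv.ofInjective _ (Example.line_injective true)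
    have h : ∀ P : Set.range (Example.line true) → Prop, (∀ L ∈ S, P L) ↔ ∀ i ∈ e ⁻¹' S, P (e i) :=
      fun P => ⟨fun h i hi => h _ hi, fun h L hL => by
        have := h (e.symm L) (by rwa [Set.mem_preimage, e.apply_symm_apply])
        rwa [e.apply_symm_apply] at this⟩
    simp only [h, Equiv.trans_apply, e.symm_apply_apply]
    refine Iff.trans (Iff.trans ?_ ((Example.arr true).exists_common_iff (s := e ⁻¹' S)))
      (Iff.trans ((Example.arr false).exists_common_iff (s := e ⁻¹' S)).symm ?_)
    · exact exists_congr fun p => forall₂_congr fun i _ => Example.mem_line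
    · exact exists_congr fun p => forall₂_congr fun i _ => Example.mem_line.symm
  · rw [Example.compl_eq, Example.compl_eq]
    exact Example.nonempty_homotopyEquiv
  · rw [Example.compl_eq, Example.compl_eq]
    rintro ⟨H⟩
    exact Example.isEmpty_coneIso.false (Arr.ConeIso.ofHomeomorph 3 H)
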